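/- There is no 2-reflective even lattice of signature (2,14). -/

import Mathlib

open Matrix

namespace Refl

noncomputable section

variable {n : ℕ}

/-- ℂ-bilinear extension of the Gram pairing. -/
def cpair (B : Matrix (Fin n) (Fin n) ℤ) (Z W : Fin n → ℂ) : ℂ :=
  ∑ i, ∑ j, (B i j : ℂ) * Z i * W j

/-- ℚ-bilinear extension of the Gram pairing. -/
def qpair (B : Matrix (Fin n) (Fin n) ℤ) (x y : Fin n → ℚ) : ℚ :=
  ∑ i, ∑ j, (B i j : ℚ) * x i * y j

/-- ℝ-bilinear extension of the Gram pairing. -/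
def rpair (B : Matrix (Fin n) (Fin n) ℤ) (x y : Fin n → ℝ) : ℝ :=
  ∑ i, ∑ j, (B i j : ℝ) * x i * y j

def intQ (v : Fin n → ℤ) : Fin n → ℚ := fun i => (v i : ℚ)

def intR (v : Fin n → ℤ) : Fin n → ℝ := fun i => (v i : ℝ)

def intC (v : Fin n → ℤ) : Fin n → ℂ := fun i => (v i : ℂ)

def ratR (v : Fin n → ℚ) : Fin n → ℝ := fun i => (v i : ℝ)

def ratC (v : Fin n → ℚ) : Fin n → ℂ := fun i => (v i : ℂ)

/-- (v, v) for an integral vector. -/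
def qnorm (B : Matrix (Fin n) (Fin n) ℤ) (v : Fin n → ℤ) : ℤ := v ⬝ᵥ B.mulVec v

/-- Membership in the dual lattice (a vector of ℚ^n pairing integrally with the lattice). -/
def InDual (B : Matrix (Fin n) (Fin n) ℤ) (x : Fin n → ℚ) : Prop :=
  ∀ y : Fin n → ℤ, ∃ m : ℤ, qpair B x (intQ y) = (m : ℚ)

/-- A rational vector lies in the lattice ℤ^n itself. -/
def InLat (x : Fin n → ℚ) : Prop := ∃ w : Fin n → ℤ, x = intQ w

/-- `B` is the Gram matrix of an even nondegenerate lattice of signature (p,q). -/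
def IsEvenLatticeOfSignature (B : Matrix (Fin n) (Fin n) ℤ) (p q : ℕ) : Prop :=
  n = p + q ∧ B.IsSymm ∧ (∀ x : Fin n → ℤ, 2 ∣ qnorm B x) ∧ B.det ≠ 0 ∧
    ∃ P : Matrix (Fin n) (Fin n) ℝ, IsUnit P.det ∧
      Pᵀ * B.map (Int.cast : ℤ → ℝ) * P =
        Matrix.diagonal (fun i : Fin n => if (i : ℕ) < p then (1 : ℝ) else -1)

/-- `B` is the Gram matrix of an even positive-definite lattice. -/
def IsEvenPosDef (B : Matrix (Fin n) (Fin n) ℤ) : Prop :=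
  B.IsSymm ∧ (∀ x : Fin n → ℤ, 2 ∣ qnorm B x) ∧ (B.map (Int.cast : ℤ → ℝ)).PosDef

/-- The cone {Z | (Z,Z) = 0, (Z,conj Z) > 0}. -/
def Cone (B : Matrix (Fin n) (Fin n) ℤ) : Set (Fin n → ℂ) :=
  {Z | cpair B Z Z = 0 ∧ 0 < (cpair B Z (fun i => (starRingEnd ℂ) (Z i))).re}

/-- `D` is one of the connected components of the cone (the affine cone `D•(M)`). -/
def IsComponent (B : Matrix (Fin n) (Fin n) ℤ) (D : Set (Fin n → ℂ)) : Prop :=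
  ∃ Z ∈ Cone B, D = connectedComponentIn (Cone B) Z

/-- The action of an integral matrix on ℂ^n. -/
def actC (g : Matrix (Fin n) (Fin n) ℤ) (Z : Fin n → ℂ) : Fin n → ℂ :=
  (g.map (Int.cast : ℤ → ℂ)).mulVec Z

/-- The group O⁺(M): integral isometries preserving the chosen component. -/
def OPlus (B : Matrix (Fin n) (Fin n) ℤ) (D : Set (Fin n → ℂ)) :
    Set (Matrix (Fin n) (Fin n) ℤ) :=
  {g | gᵀ * B * g = B ∧ actC g '' D = D}

/-- The stable orthogonal group Õ⁺(M): elements of O⁺(M) acting trivially on M^∨/M. -/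
def StableOPlus (B : Matrix (Fin n) (Fin n) ℤ) (D : Set (Fin n → ℂ)) :
    Set (Matrix (Fin n) (Fin n) ℤ) :=
  {g | g ∈ OPlus B D ∧ ∀ x : Fin n → ℚ, InDual B x →
        ∃ w : Fin n → ℤ, (g.map (Int.cast : ℤ → ℚ)).mulVec x - x = intQ w}

/-- `Γ` is a finite-index subgroup of O⁺(M). -/
structure IsFiniteIndexSubgroup (B : Matrix (Fin n) (Fin n) ℤ) (D : Set (Fin n → ℂ))
    (Γ : Set (Matrix (Fin n) (Fin n) ℤ)) : Prop where
  subset : Γ ⊆ OPlus B D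
  one_mem : (1 : Matrix (Fin n) (Fin n) ℤ) ∈ Γ
  mul_mem : ∀ g ∈ Γ, ∀ h ∈ Γ, g * h ∈ Γ
  inv_mem : ∀ g ∈ Γ, ∃ h ∈ Γ, g * h = 1 ∧ h * g = 1
  finite_index : ∃ S : Finset (Matrix (Fin n) (Fin n) ℤ),
    ∀ g ∈ OPlus B D, ∃ s ∈ S, ∃ γ ∈ Γ, g = s * γ

/-- `χ` is a character Γ → ℂ× with finite image (equivalently, of finite order). -/
structure IsCharacter (Γ : Set (Matrix (Fin n) (Fin n) ℤ))
    (χ : Matrix (Fin n) (Fin n) ℤ → ℂ) : Prop where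
  ne_zero : ∀ g ∈ Γ, χ g ≠ 0
  map_mul : ∀ g ∈ Γ, ∀ h ∈ Γ, χ (g * h) = χ g * χ h
  finite_image : (χ '' Γ).Finite

/-- `F` is a modular form of weight `k` and character `χ` for `Γ` on the component `D`. -/
structure IsModularForm (B : Matrix (Fin n) (Fin n) ℤ) (D : Set (Fin n → ℂ))
    (Γ : Set (Matrix (Fin n) (Fin n) ℤ)) (χ : Matrix (Fin n) (Fin n) ℤ → ℂ)
    (k : ℤ) (F : (Fin n → ℂ) → ℂ) : Prop where
  holo : DifferentiableOn ℂ F D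
  homogeneous : ∀ t : ℂ, t ≠ 0 → ∀ Z ∈ D, F (t • Z) = t ^ (-k) * F Z
  equivariant : ∀ g ∈ Γ, ∀ Z ∈ D, F (actC g Z) = χ g * F Z

def NonConstantOn (D : Set (Fin n → ℂ)) (F : (Fin n → ℂ) → ℂ) : Prop :=
  ¬ ∃ c : ℂ, ∀ Z ∈ D, F Z = c

/-- `Z` lies on the rational quadratic divisor of the integral vector `v`. -/
def OrthZ (B : Matrix (Fin n) (Fin n) ℤ) (Z : Fin n → ℂ) (v : Fin n → ℤ) : Prop :=
  cpair B Z (intC v) = 0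

/-- `F` is nonconstant and its zero set is contained in hyperplanes of (-2)-vectors. -/
def Is2ReflectiveForm (B : Matrix (Fin n) (Fin n) ℤ) (D : Set (Fin n → ℂ))
    (F : (Fin n → ℂ) → ℂ) : Prop :=
  NonConstantOn D F ∧
    ∀ Z ∈ D, F Z = 0 → ∃ v : Fin n → ℤ, qnorm B v = -2 ∧ OrthZ B Z v

/-- The lattice is 2-reflective. -/
def Is2Reflective (B : Matrix (Fin n) (Fin n) ℤ) : Prop :=
  ∃ D : Set (Fin n → ℂ), IsComponent B D ∧
    ∃ (Γ : Set (Matrix (Fin n) (Fin n) ℤ)) (χ : Matrix (Fin n) (Fin n) ℤ → ℂ)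
      (k : ℤ) (F : (Fin n → ℂ) → ℂ),
      IsFiniteIndexSubgroup B D Γ ∧ IsCharacter Γ χ ∧
      IsModularForm B D Γ χ k F ∧ Is2ReflectiveForm B D F

/-- Primitivity of an integral vector : ℚv ∩ ℤ^n = ℤv. -/
def IsPrimitive (v : Fin n → ℤ) : Prop :=
  v ≠ 0 ∧ ∀ (a : ℚ) (w : Fin n → ℤ), (∀ i, a * (v i : ℚ) = (w i : ℚ)) →
    ∃ m : ℤ, w = m • v

/-- The reflection σ_v maps the lattice into itself. -/
def ReflPreservesLat (B : Matrix (Fin n) (Fin n) ℤ) (v : Fin n → ℤ) : Prop :=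
  ∀ x : Fin n → ℤ, ∃ y : Fin n → ℤ, ∀ i,
    (x i : ℚ) - (2 * ((x ⬝ᵥ B.mulVec v : ℤ) : ℚ) / (qnorm B v : ℚ)) * (v i : ℚ) = (y i : ℚ)

/-- The ℂ-linear extension of the reflection σ_v. -/
def reflC (B : Matrix (Fin n) (Fin n) ℤ) (v : Fin n → ℤ) (Z : Fin n → ℂ) : Fin n → ℂ :=
  fun i => Z i - (2 * cpair B Z (intC v) / (qnorm B v : ℂ)) * (v i : ℂ)

/-- `v` is a reflective vector of the lattice `M` (w.r.t. the component `D`). -/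
def IsReflectiveVector (B : Matrix (Fin n) (Fin n) ℤ) (D : Set (Fin n → ℂ))
    (v : Fin n → ℤ) : Prop :=
  IsPrimitive v ∧ qnorm B v < 0 ∧ ReflPreservesLat B v ∧ reflC B v '' D = D

/-- `F` is nonconstant and its zero set is contained in hyperplanes of reflective vectors. -/
def IsReflectiveForm (B : Matrix (Fin n) (Fin n) ℤ) (D : Set (Fin n → ℂ))
    (F : (Fin n → ℂ) → ℂ) : Prop :=
  NonConstantOn D F ∧
    ∀ Z ∈ D, F Z = 0 → ∃ v : Fin n → ℤ, IsReflectiveVector B D v ∧ OrthZ B Z v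

/-- The lattice is reflective. -/
def IsReflective (B : Matrix (Fin n) (Fin n) ℤ) : Prop :=
  ∃ D : Set (Fin n → ℂ), IsComponent B D ∧
    ∃ (Γ : Set (Matrix (Fin n) (Fin n) ℤ)) (χ : Matrix (Fin n) (Fin n) ℤ → ℂ)
      (k : ℤ) (F : (Fin n → ℂ) → ℂ),
      IsFiniteIndexSubgroup B D Γ ∧ IsCharacter Γ χ ∧
      IsModularForm B D Γ χ k F ∧ IsReflectiveForm B D F

/-- Isomorphism of lattices given by Gram matrices. -/
def LatIso {m n : ℕ} (A : Matrix (Fin m) (Fin m) ℤ) (B : Matrix (Fin n) (Fin n) ℤ) : Prop :=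
  ∃ e : (Fin m → ℤ) ≃ₗ[ℤ] (Fin n → ℤ), ∀ x y : Fin m → ℤ,
    e x ⬝ᵥ B.mulVec (e y) = x ⬝ᵥ A.mulVec y

/-- Orthogonal direct sum of lattices. -/
def dsum {m n : ℕ} (A : Matrix (Fin m) (Fin m) ℤ) (B : Matrix (Fin n) (Fin n) ℤ) :
    Matrix (Fin (m + n)) (Fin (m + n)) ℤ :=
  Matrix.reindex finSumFinEquiv finSumFinEquiv (Matrix.fromBlocks A 0 0 B)

/-- The hyperbolic plane U. -/
def U : Matrix (Fin 2) (Fin 2) ℤ := !![0, 1; 1, 0]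

/-- Gram matrix of the root lattice A_m. -/
def gramA (m : ℕ) : Matrix (Fin m) (Fin m) ℤ :=
  Matrix.of fun i j =>
    if i = j then 2 else if i.val + 1 = j.val ∨ j.val + 1 = i.val then -1 else 0

/-- Gram matrix of the root lattice D_m. -/
def gramD (m : ℕ) : Matrix (Fin m) (Fin m) ℤ :=
  Matrix.of fun i j =>
    if i = j then 2
    else if (i.val + 1 = j.val ∧ j.val + 1 ≠ m) ∨ (j.val + 1 = i.val ∧ i.val + 1 ≠ m) then -1
    else if (i.val + 3 = m ∧ j.val + 1 = m) ∨ (j.val + 3 = m ∧ i.val + 1 = m) then -1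
    else 0

/-- Gram matrix of the root lattice E_6. -/
def gramE6 : Matrix (Fin 6) (Fin 6) ℤ :=
  !![2, -1, 0, 0, 0, 0;
     -1, 2, -1, 0, 0, 0;
     0, -1, 2, -1, 0, -1;
     0, 0, -1, 2, -1, 0;
     0, 0, 0, -1, 2, 0;
     0, 0, -1, 0, 0, 2]

/-- Gram matrix of the root lattice E_7. -/
def gramE7 : Matrix (Fin 7) (Fin 7) ℤ :=
  !![2, -1, 0, 0, 0, 0, 0;
     -1, 2, -1, 0, 0, 0, 0;
     0, -1, 2, -1, 0, 0, -1;
     0, 0, -1, 2, -1, 0, 0;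
     0, 0, 0, -1, 2, -1, 0;
     0, 0, 0, 0, -1, 2, 0;
     0, 0, -1, 0, 0, 0, 2]

/-- Gram matrix of the root lattice E_8. -/
def gramE8 : Matrix (Fin 8) (Fin 8) ℤ :=
  !![2, -1, 0, 0, 0, 0, 0, 0;
     -1, 2, -1, 0, 0, 0, 0, 0;
     0, -1, 2, -1, 0, 0, 0, -1;
     0, 0, -1, 2, -1, 0, 0, 0;
     0, 0, 0, -1, 2, -1, 0, 0;
     0, 0, 0, 0, -1, 2, -1, 0;
     0, 0, 0, 0, 0, -1, 2, 0;
     0, 0, -1, 0, 0, 0, 0, 2]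

/-- Gram matrix of the Nikulin lattice N_8 (basis a_1,…,a_7,h with h=(a_1+⋯+a_8)/2). -/
def gramN8 : Matrix (Fin 8) (Fin 8) ℤ :=
  Matrix.of fun i j =>
    if i = j then (if i.val = 7 then 4 else 2)
    else if i.val = 7 ∨ j.val = 7 then 1 else 0

/-- The lattice M = 2U ⊕ L(−1). -/
def M2U {r : ℕ} (L : Matrix (Fin r) (Fin r) ℤ) :
    Matrix (Fin (2 + (2 + r))) (Fin (2 + (2 + r))) ℤ :=
  dsum U (dsum U (-L))

/-- div(v) = d : the ideal (v, M) of ℤ is generated by d. -/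
def DivEq (B : Matrix (Fin n) (Fin n) ℤ) (v : Fin n → ℤ) (d : ℤ) : Prop :=
  Ideal.span {a : ℤ | ∃ x : Fin n → ℤ, a = v ⬝ᵥ B.mulVec x} = Ideal.span {d}

/-- Sum-of-divisors function σ₁ (on nonnegative integers). -/
def sigma1 (m : ℤ) : ℤ := ∑ d ∈ m.toNat.divisors, (d : ℤ)

end

end Refl

namespace Refl

lemma exists_small_solution {D m r s : ℤ} (hm : 0 < m) (hD : D ≠ 0) :
    ∃ x y z : ℤ, (x ≠ 0 ∨ y ≠ 0 ∨ z ≠ 0) ∧ x ^ 2 ≤ m * |D| ∧ y ^ 2 < m ∧ z ^ 2 < |D| ∧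
      m ∣ x - r * y ∧ D ∣ x - s * z := by
  obtain ⟨M, rfl⟩ := Int.eq_ofNat_of_zero_le hm.le
  set N := D.natAbs with hN
  have hDN : |D| = (N : ℤ) := by linarith
  set a := Nat.sqrt (M - 1) with ha
  set b := Nat.sqrt (N - 1) with hb
  set c := Nat.sqrt (M * N) with hc
  have ha1 : M ≤ (a + 1) ^ 2 := by have := Nat.lt_succ_sqrt' (M - 1); grind
  have hb1 : N ≤ (b + 1) ^ 2 := by have := Nat.lt_succ_sqrt' (N - 1); grind
  have hc1 : M * N < (c + 1) ^ 2 := Nat.lt_succ_sqrt' (M * N)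
  have ha2 : a ^ 2 < M := by have := Nat.sqrt_le' (M - 1); grind
  have hb2 : b ^ 2 < N := by have := Nat.sqrt_le' (N - 1); grind
  have hc2 : c ^ 2 ≤ M * N := Nat.sqrt_le' (M * N)
  have hcard : M * N < (c + 1) * ((a + 1) * (b + 1)) := by
    refine lt_of_pow_lt_pow_left₀ 2 (Nat.zero_le _) ?_
    calc (M * N) ^ 2 = (M * N) * (M * N) := by ring
      _ < (c + 1) ^ 2 * ((a + 1) ^ 2 * (b + 1) ^ 2) :=
        Nat.mul_lt_mul_of_lt_of_le hc1 (Nat.mul_le_mul ha1 hb1) (by simp)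
      _ = _ := by ring
  let S := Finset.range (c + 1) ×ˢ (Finset.range (a + 1) ×ˢ Finset.range (b + 1))
  let T := Finset.Ico (0 : ℤ) M ×ˢ Finset.Ico (0 : ℤ) N
  obtain ⟨u, hu, v, hv, hne, he⟩ := Finset.exists_ne_map_eq_of_card_lt_of_maps_to
    (s := S) (t := T)
    (f := fun p => (((p.1 : ℤ) - r * p.2.1) % M, ((p.1 : ℤ) - s * p.2.2) % N))
    (by simpa [S, T] using hcard) (fun p _ => by
      have h1 : (M : ℤ) ≠ 0 := by omega
      have h2 : (N : ℤ) ≠ 0 := by omega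
      simp only [T, Finset.coe_product, Finset.coe_Ico, Set.mem_prod, Set.mem_Ico]
      exact ⟨⟨Int.emod_nonneg _ h1, Int.emod_lt_of_pos _ hm⟩, Int.emod_nonneg _ h2,
        Int.emod_lt_of_pos _ (by omega)⟩)
  simp only [Prod.mk.injEq] at he
  obtain ⟨h1, h2⟩ := he
  have h1 := (Int.ModEq.dvd h1.symm)
  have h2 := (Int.ModEq.dvd h2.symm)
  have key : ∀ {p q t : ℕ}, p < t + 1 → q < t + 1 → ((p : ℤ) - q) ^ 2 ≤ (t : ℤ) ^ 2 :=
    fun hp hq => sq_le_sq.2 (by grind)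
  refine ⟨u.1 - v.1, u.2.1 - v.2.1, u.2.2 - v.2.2, ?_, ?_, ?_, ?_, ?_, ?_⟩
  · by_contra! h
    exact hne (by ext <;> grind)
  · grind
  · grind
  · grind
  · grind
  · rw [← hDN, abs_dvd] at h2
    grind

lemma legendre_solvable {D m r s : ℤ} (hD : Squarefree D) (hm : Squarefree m) (m0 : 0 < m)
    (hc : IsCoprime m D) (hr : m ∣ r ^ 2 - D) (hs : D ∣ s ^ 2 - m) :
    ∃ x y z : ℤ, (x ≠ 0 ∨ y ≠ 0 ∨ z ≠ 0) ∧ x ^ 2 - D * y ^ 2 = m * z ^ 2 := by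
  by_cases hm1 : m = 1
  · exact ⟨1, 0, 1, by simp, by omega⟩
  by_cases hD1 : D = 1
  · exact ⟨1, 1, 0, by simp, by rw [hD1]; ring⟩
  have D0 : D ≠ 0 := hD.ne_zero
  have hsq : ∀ {t z : ℤ}, Squarefree t → z ^ 2 = t → t = 1 := fun ht hz => by
    have := ht _ (dvd_of_eq (by rw [← hz]; ring : _ * _ = _))
    rw [← hz]; rcases Int.isUnit_iff.1 this with h | h <;> rw [h] <;> rfl
  obtain ⟨x, y, z, hne, hx, hy, hz, h1, h2⟩ := exists_small_solution (r := r) (s := s) m0 D0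
  obtain ⟨V, hV⟩ : m * D ∣ x ^ 2 - D * y ^ 2 - m * z ^ 2 := by
    refine hc.mul_dvd ?_ ?_
    · have := ((h1.mul_right (x + r * y)).add (hr.mul_right (y ^ 2))).sub
        (dvd_mul_right m (z ^ 2))
      grind
    · have := ((h2.mul_right (x + s * z)).add (hs.mul_right (z ^ 2))).sub
        (dvd_mul_right D (y ^ 2))
      grind
  have hV' : V = 0 ∨ V = -1 := by
    rcases lt_or_gt_of_ne D0 with hneg | hpos
    · rw [abs_of_neg hneg] at hx hz
      have hp : 0 < m * -D := by nlinarith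
      have u1 : -1 < -V := lt_of_mul_lt_mul_left (by nlinarith [sq_nonneg x, mul_nonneg (neg_pos.2 hneg).le (sq_nonneg y)]) hp.le
      have u2 : -V < 2 := lt_of_mul_lt_mul_left (by nlinarith [mul_nonneg m0.le (sq_nonneg z)]) hp.le
      omega
    · rw [abs_of_pos hpos] at hx hz
      have hp : 0 < m * D := by positivity
      have u1 : -2 < V := lt_of_mul_lt_mul_left (by nlinarith [sq_nonneg x]) hp.le
      have u2 : V ≤ 1 := le_of_mul_le_mul_left (by nlinarith [mul_nonneg m0.le (sq_nonneg z), mul_nonneg hpos.le (sq_nonneg y)]) hp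
      have u3 : V ≠ 1 := by
        rintro rfl
        have : x ^ 2 = m * D := le_antisymm hx (by nlinarith [mul_nonneg m0.le (sq_nonneg z), mul_nonneg hpos.le (sq_nonneg y)])
        have := hsq ((squarefree_mul_iff).2 ⟨hc.isRelPrime, hm, hD⟩) this
        have : m ∣ 1 := ⟨D, this.symm⟩
        exact hm1 (Int.eq_one_of_dvd_one m0.le this)
      omega
  rcases hV' with rfl | rfl
  · grind
  · exact ⟨x * z + D * y, x + y * z, z ^ 2 - D, Or.inr (Or.inr fun h =>
      hD1 (hsq hD (by omega : z ^ 2 = D))), by grind⟩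

lemma exists_sq_sub_of_primes {m : ℕ} {D : ℤ} (hm : Squarefree m)
    (h : ∀ q : ℕ, q.Prime → q ∣ m → ∃ r : ℤ, (q : ℤ) ∣ r ^ 2 - D) :
    ∃ r : ℤ, (m : ℤ) ∣ r ^ 2 - D := by
  choose! g hg using h
  obtain ⟨r, hr⟩ := Ideal.exists_forall_sub_mem_ideal
    (I := fun q : m.primeFactors => Ideal.span {((q : ℕ) : ℤ)}) (fun p q hpq => by
      change IsCoprime _ _
      rw [Ideal.isCoprime_span_singleton_iff, Nat.isCoprime_iff_coprime]
      exact (Nat.coprime_primes (Nat.prime_of_mem_primeFactors p.2)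
        (Nat.prime_of_mem_primeFactors q.2)).2 fun e => hpq (Subtype.ext e)) (fun q => g q)
  refine ⟨r, ?_⟩
  rw [← Nat.prod_primeFactors_of_squarefree hm, Nat.cast_prod]
  refine Finset.prod_dvd_of_coprime (fun p hp q hq hpq => Nat.isCoprime_iff_coprime.2
    ((Nat.coprime_primes (Nat.prime_of_mem_primeFactors hp)
      (Nat.prime_of_mem_primeFactors hq)).2 hpq)) fun q hq => ?_
  have h1 := Ideal.mem_span_singleton.1 (hr ⟨q, hq⟩)
  have := (h1.mul_right (r + g q)).add
    (hg q (Nat.prime_of_mem_primeFactors hq) (Nat.dvd_of_mem_primeFactors hq))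
  grind

lemma jacobiSym_natAbs_eq_one {D : ℤ} {q : ℕ} (hD : (8 : ℤ) ∣ D - 1) (hq : Odd q)
    (h : jacobiSym D q = 1) : jacobiSym q D.natAbs = 1 := by
  have ho : Odd D.natAbs := Int.natAbs_odd.2 (by grind)
  rcases lt_or_ge D 0 with hn | hp
  · have e : D = -(D.natAbs : ℤ) := by omega
    rw [e, jacobiSym.neg _ hq] at h
    rcases (show q % 4 = 1 ∨ q % 4 = 3 by grind) with h4 | h4
    · rw [jacobiSym.quadratic_reciprocity_one_mod_four h4 ho]
      rwa [ZMod.χ₄_nat_one_mod_four h4, one_mul] at h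
    · rw [jacobiSym.quadratic_reciprocity_three_mod_four h4 (by omega)]
      rwa [ZMod.χ₄_nat_three_mod_four h4, neg_one_mul] at h
  · rw [jacobiSym.quadratic_reciprocity_one_mod_four' hq (by omega)]
    grind

lemma jacobiSym_eq_one {D : ℤ} {m : ℕ} (hD : (8 : ℤ) ∣ D - 1) (hm : m ≠ 0)
    (h : ∀ q : ℕ, q.Prime → q ∣ m → q ≠ 2 → jacobiSym D q = 1) : jacobiSym m D.natAbs = 1 := by
  induction m using Nat.recOnMul with
  | zero => omega
  | one => simp
  | prime q hq =>
    by_cases h2 : q = 2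
    · subst h2
      have ho : Odd D.natAbs := Int.natAbs_odd.2 (by grind)
      rw [Nat.cast_ofNat, jacobiSym.at_two ho, ZMod.χ₈_nat_eq_if_mod_eight]
      omega
    · exact jacobiSym_natAbs_eq_one hD (hq.odd_of_ne_two h2) (h q hq dvd_rfl h2)
  | mul a b ha hb =>
    rw [Nat.cast_mul, jacobiSym.mul_left,
      ha (left_ne_zero_of_mul hm) fun q h1 h2 => h q h1 (h2.mul_right b),
      hb (right_ne_zero_of_mul hm) fun q h1 h2 => h q h1 (h2.mul_left a), one_mul]

lemma exists_sq_sub_of_modEq {D : ℤ} {m p : ℕ} (hD : (8 : ℤ) ∣ D - 1) (hm : m ≠ 0)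
    (h : ∀ q : ℕ, q.Prime → q ∣ m → q ≠ 2 → jacobiSym D q = 1) (hp : p.Prime)
    (h8 : (8 : ℤ) ∣ p - 1) (hpm : D ∣ p - m) : ∃ r : ℤ, (p : ℤ) ∣ r ^ 2 - D := by
  have : Fact p.Prime := ⟨hp⟩
  have hpo : Odd p := by grind
  have h1 : jacobiSym p D.natAbs = 1 := by
    rw [← jacobiSym_eq_one hD hm h]
    exact jacobiSym.mod_left' ((Int.modEq_iff_dvd.2 (Int.natAbs_dvd.2 hpm)).symm)
  have h4 : p % 4 = 1 := by omega
  have ho : Odd D.natAbs := Int.natAbs_odd.2 (by grind)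
  have h2 : jacobiSym D p = 1 := by
    have h3 : jacobiSym D.natAbs p = 1 := by
      rw [jacobiSym.quadratic_reciprocity_one_mod_four' ho h4, h1]
    rcases Int.natAbs_eq D with e | e <;> rw [e]
    · omega
    · rw [jacobiSym.neg _ hpo, ZMod.χ₄_nat_one_mod_four h4, h3, one_mul]
  obtain ⟨r, hr⟩ := ZMod.isSquare_of_jacobiSym_eq_one h2
  refine ⟨r.val, (ZMod.intCast_zmod_eq_zero_iff_dvd _ p).1 ?_⟩
  push_cast
  rw [ZMod.natCast_zmod_val, hr]; ring

lemma legendre_of_prime {D : ℤ} {m p : ℕ} (hD : (8 : ℤ) ∣ D - 1) (hDs : Squarefree D)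
    (hm : Squarefree m) (hc : IsCoprime (m : ℤ) D)
    (h : ∀ q : ℕ, q.Prime → q ∣ m → q ≠ 2 → ∃ r : ℤ, (q : ℤ) ∣ r ^ 2 - D) (hp : p.Prime)
    (h8 : (8 : ℤ) ∣ p - 1) (hpm : D ∣ p - m) (hlt : m < p) :
    ∃ x y z : ℤ, (x ≠ 0 ∨ y ≠ 0 ∨ z ≠ 0) ∧ x ^ 2 - D * y ^ 2 = p * m * z ^ 2 := by
  have hpc : p.Coprime m := (Nat.Prime.coprime_iff_not_dvd hp).2 fun hd =>
    absurd (Nat.le_of_dvd (Nat.pos_of_ne_zero hm.ne_zero) hd) (by omega)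
  have hJ : ∀ q : ℕ, q.Prime → q ∣ m → q ≠ 2 → jacobiSym D q = 1 := fun q hq hqm hq2 => by
    have : Fact q.Prime := ⟨hq⟩
    obtain ⟨r, hr⟩ := h q hq hqm hq2
    have hz := (ZMod.intCast_zmod_eq_zero_iff_dvd _ q).2 hr
    have hne : (D : ZMod q) ≠ 0 := fun h0 => by
      have hd := (ZMod.intCast_zmod_eq_zero_iff_dvd _ q).1 h0
      exact (Nat.prime_iff_prime_int.1 hq).not_isUnit
        (hc.isUnit_of_dvd' (Int.natCast_dvd_natCast.2 hqm) hd)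
    rw [← jacobiSym.legendreSym.to_jacobiSym, legendreSym.eq_one_iff q hne]
    exact ⟨r, by grind⟩
  have hpm' : IsCoprime (p : ℤ) D := by
    obtain ⟨t, ht⟩ := hpm
    rw [show (p : ℤ) = m + D * t by omega]
    simpa
  obtain ⟨r, hr⟩ := exists_sq_sub_of_primes (m := p * m) (D := D)
    ((Nat.squarefree_mul_iff).2 ⟨hpc, hp.squarefree, hm⟩) (fun q hq hqd => by
      by_cases hq2 : q = 2
      · exact ⟨1, by subst hq2; omega⟩
      rcases (Nat.Prime.dvd_mul hq).1 hqd with h1 | h1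
      · rw [(Nat.prime_dvd_prime_iff_eq hq hp).1 h1]
        exact exists_sq_sub_of_modEq hD hm.ne_zero hJ hp h8 hpm
      grind)
  refine legendre_solvable (m := p * m) (r := r) (s := m) hDs
    (Int.squarefree_natCast.2 ((Nat.squarefree_mul_iff).2 ⟨hpc, hp.squarefree, hm⟩) |> fun h => by
      simpa) (by
      have := hp.pos
      have := Nat.pos_of_ne_zero hm.ne_zero
      positivity) (hpm'.mul_left hc) hr ?_
  obtain ⟨t, ht⟩ := hpm
  exact ⟨-m * t, by grind⟩

/-- A unit congruent to a square modulo `sqMod p` is a square in `ℤ_p`. -/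
def sqMod (p : ℕ) : ℤ := if p = 2 then 8 else p

lemma exists_sum_two_sq_sub {p : ℕ} (hp : p.Prime) (h2 : p ≠ 2) {a b : ℤ} (ha : ¬(p : ℤ) ∣ a)
    (hb : ¬(p : ℤ) ∣ b) (T : ℤ) : ∃ x y : ℤ, (p : ℤ) ∣ a * x ^ 2 + b * y ^ 2 - T := by
  have : Fact p.Prime := ⟨hp⟩
  rw [← ZMod.intCast_zmod_eq_zero_iff_dvd] at ha hb
  obtain ⟨x, y, h⟩ := FiniteField.exists_root_sum_quadratic (R := ZMod p)
    (Polynomial.degree_quadratic (b := 0) (c := -(T : ZMod p)) ha)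
    (Polynomial.degree_quadratic (b := 0) (c := 0) hb)
    (by rw [ZMod.card]; exact hp.eq_two_or_odd.resolve_left h2)
  refine ⟨x.val, y.val, (ZMod.intCast_zmod_eq_zero_iff_dvd _ p).1 ?_⟩
  push_cast
  simp only [ZMod.natCast_zmod_val]
  simp at h
  grind

lemma exists_same {p : ℕ} (hp : p.Prime) {a b c d T : ℤ} (ha : ¬(p : ℤ) ∣ a) (hb : ¬(p : ℤ) ∣ b)
    (hc : ¬(p : ℤ) ∣ c) (hd : p = 2 → ¬4 ∣ d) (hT : ¬(p : ℤ) ∣ T) :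
    ∃ x y z w : ℤ, sqMod p ∣ a * x ^ 2 + b * y ^ 2 + c * z ^ 2 + d * w ^ 2 - T := by
  by_cases h2 : p = 2
  · subst h2
    simp only [sqMod, if_true]
    by_cases h1 : (4 : ℤ) ∣ a - T
    · by_cases h3 : (8 : ℤ) ∣ a - T
      · exact ⟨1, 0, 0, 0, by omega⟩
      · exact ⟨1, 2, 0, 0, by omega⟩
    by_cases h4 : (4 : ℤ) ∣ b - T
    · by_cases h3 : (8 : ℤ) ∣ b - T
      · exact ⟨0, 1, 0, 0, by omega⟩
      · exact ⟨2, 1, 0, 0, by omega⟩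
    by_cases h6 : (2 : ℤ) ∣ d
    · by_cases h3 : (8 : ℤ) ∣ a + d - T
      · exact ⟨1, 0, 0, 1, by omega⟩
      · exact ⟨1, 2, 0, 1, by omega⟩
    by_cases h5 : (4 : ℤ) ∣ c - T
    · by_cases h3 : (8 : ℤ) ∣ c - T
      · exact ⟨0, 0, 1, 0, by omega⟩
      · exact ⟨2, 0, 1, 0, by omega⟩
    by_cases h3 : (8 : ℤ) ∣ a + b + c - T
    · exact ⟨1, 1, 1, 0, by omega⟩
    · exact ⟨1, 1, 1, 2, by omega⟩
  · obtain ⟨x, y, h⟩ := exists_sum_two_sq_sub hp h2 ha hb T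
    exact ⟨x, y, 0, 0, by simpa [sqMod, h2] using h⟩

lemma exists_opp_two {a b c T : ℤ} (hb : ¬2 ∣ b) (hc : ¬2 ∣ c) (hT : ¬2 ∣ T)
    (h : 4 ∣ a - b) : ∃ x y z : ℤ, 16 ∣ a * x ^ 2 + b * y ^ 2 + c * z ^ 2 - 2 * T := by
  by_cases h1 : (16 : ℤ) ∣ a + b - 2 * T
  · exact ⟨1, 1, 0, by omega⟩
  by_cases h2 : (16 : ℤ) ∣ a * 9 + b - 2 * T
  · exact ⟨3, 1, 0, by omega⟩
  by_cases h3 : (16 : ℤ) ∣ a + b + c * 4 - 2 * T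
  · exact ⟨1, 1, 2, by omega⟩
  · exact ⟨3, 1, 2, by omega⟩

lemma exists_opp {p : ℕ} (hp : p.Prime) {a b c T : ℤ} (ha : ¬(p : ℤ) ∣ a) (hb : ¬(p : ℤ) ∣ b)
    (hc : ¬(p : ℤ) ∣ c) (hT : ¬(p : ℤ) ∣ T) :
    ∃ x y z : ℤ, p * sqMod p ∣ a * x ^ 2 + b * y ^ 2 + c * z ^ 2 - p * T := by
  by_cases h2 : p = 2
  · subst h2
    simp only [sqMod, if_true]
    by_cases h1 : (4 : ℤ) ∣ a - b
    · obtain ⟨x, y, z, h⟩ := exists_opp_two (c := c) (T := T) hb hc hT h1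
      grind
    by_cases h3 : (4 : ℤ) ∣ a - c
    · obtain ⟨x, y, z, h⟩ := exists_opp_two (c := b) (T := T) hc hb hT h3
      grind
    obtain ⟨x, y, z, h⟩ := exists_opp_two (a := b) (c := a) (T := T) hc ha hT (by omega)
    grind
  · obtain ⟨x, y, w, hw⟩ := exists_sum_two_sq_sub hp h2 ha hb (-c)
    have hpZ := Nat.prime_iff_prime_int.1 hp
    have hc2 : ¬(p : ℤ) ∣ 2 * c := fun h => (hpZ.dvd_mul.1 h).elim (fun h => h2 (by
      exact (Nat.prime_dvd_prime_iff_eq hp Nat.prime_two).1 (by exact_mod_cast h))) hc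
    obtain ⟨u, v, huv⟩ := (hpZ.coprime_iff_not_dvd).2 hc2
    refine ⟨x, y, 1 + p * (v * (T - w)), ?_⟩
    simp only [sqMod, h2, if_false]
    exact ⟨c * (v * (T - w)) ^ 2 - u * (T - w),
      by grind⟩

lemma exists_unit_part {p : ℕ} (hp : p.Prime) {a : ℤ} (ha : Squarefree a) :
    ∃ (β : ℕ) (u : ℤ), β < 2 ∧ ¬(p : ℤ) ∣ u ∧ a = p ^ β * u := by
  by_cases h : (p : ℤ) ∣ a
  · obtain ⟨u, rfl⟩ := h
    refine ⟨1, u, by simp, fun ⟨v, hv⟩ => ?_, by ring⟩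
    exact (Nat.prime_iff_prime_int.1 hp).not_isUnit (ha _ ⟨v, by grind⟩)
  · exact ⟨0, a, by simp, h, by ring⟩

lemma sum_single_sq {a : Fin 5 → ℤ} {i j k l : Fin 5} (h : [i, j, k, l].Nodup)
    (x y z w : ℤ) : ∑ t, a t * (Pi.single i x + Pi.single j y + Pi.single k z +
      Pi.single l w : Fin 5 → ℤ) t ^ 2 = a i * x ^ 2 + a j * y ^ 2 + a k * z ^ 2 + a l * w ^ 2 := by
  have h0 : ∀ t, a t * (Pi.single i x + Pi.single j y + Pi.single k z +
      Pi.single l w : Fin 5 → ℤ) t ^ 2 = (if t = i then a i * x ^ 2 else 0) +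
      (if t = j then a j * y ^ 2 else 0) + (if t = k then a k * z ^ 2 else 0) +
      (if t = l then a l * w ^ 2 else 0) := by
    simp only [Pi.add_apply, Pi.single_apply]
    grind
  rw [Finset.sum_congr rfl fun t _ => h0 t]
  simp [Finset.sum_add_distrib]

lemma exists_local {p : ℕ} (hp : p.Prime) {c0 : ℤ} {c : Fin 5 → ℤ} (h0 : Squarefree c0)
    (hc : ∀ i, Squarefree (c i)) : ∃ (x : Fin 5 → ℤ) (k : ℕ) (t : ℤ), k < 2 ∧ ¬(p : ℤ) ∣ t ∧
      (p : ℤ) ^ (2 * k) * sqMod p ∣ -(c0 * ∑ i, c i * x i ^ 2) - p ^ (2 * k) * t ^ 2 := by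
  obtain ⟨α, u0, hα, hu0, e0⟩ := exists_unit_part hp h0
  choose β u hβ hu e using fun i => exists_unit_part hp (hc i)
  have hcard : (Finset.univ.filter (fun i => β i = α)).card +
      (Finset.univ.filter (fun i => ¬β i = α)).card = 5 := by
    rw [Finset.card_filter_add_card_filter_not]; rfl
  have hu0' : ¬(p : ℤ) ∣ -u0 := by simpa
  have hl : ∀ i j k : Fin 5, ∃ l, l ∉ ({i, j, k} : Finset (Fin 5)) := fun i j k => by
    by_contra! h
    have := Finset.card_le_card (fun l _ => h l : Finset.univ ⊆ ({i, j, k} : Finset (Fin 5)))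
    exact absurd (this.trans Finset.card_le_three) (by simp)
  have hb : ∀ m, ¬β m = α → (p : ℤ) ^ α * p ^ β m = p := fun m hm => by
    have := hβ m
    rw [← pow_add, show α + β m = 1 by omega, pow_one]
  by_cases h3 : 2 < (Finset.univ.filter (fun i => β i = α)).card
  · obtain ⟨i, j, k, hi, hj, hk, hd⟩ := Finset.two_lt_card_iff.1 h3
    simp only [Finset.mem_filter, Finset.mem_univ, true_and] at hi hj hk
    obtain ⟨l, hl⟩ := hl i j k
    obtain ⟨d, g, hd2, hg⟩ : ∃ d g : ℤ, (p = 2 → ¬4 ∣ d) ∧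
        (p : ℤ) ^ α * (p ^ β l * u l) * g ^ 2 = p ^ (2 * α) * d := by
      by_cases hm : β l = α
      · exact ⟨u l, 1, by rintro rfl h; grind, by rw [hm]; ring⟩
      · refine ⟨p * u l, p ^ α, ?_, by linear_combination u l * ((p : ℤ) ^ α) ^ 2 * hb l hm⟩
        rintro rfl h
        grind
    obtain ⟨x, y, z, w, v, hv⟩ := exists_same hp (hu i) (hu j) (hu k) hd2 hu0'
    refine ⟨Pi.single i x + Pi.single j y + Pi.single k z + Pi.single l (g * w), α, u0, hα, hu0, ?_⟩
    rw [sum_single_sq (by grind), e i, e j, e k, e l, e0, hi, hj, hk]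
    exact ⟨-u0 * v, by linear_combination -(p : ℤ) ^ (2 * α) * u0 * hv - u0 * w ^ 2 * hg⟩
  · obtain ⟨i, j, k, hi, hj, hk, hd⟩ := Finset.two_lt_card_iff.1
      (show 2 < (Finset.univ.filter (fun i => ¬β i = α)).card by omega)
    obtain ⟨l, hl⟩ := hl i j k
    obtain ⟨x, y, z, v, hv⟩ := exists_opp hp (hu i) (hu j) (hu k) hu0'
    refine ⟨Pi.single i x + Pi.single j y + Pi.single k z + Pi.single l 0, 1, u0, by simp,
      hu0, -u0 * v, ?_⟩
    rw [sum_single_sq (by grind), e i, e j, e k, e0]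
    grind

lemma exists_squarefree_part {a : ℤ} (ha : a ≠ 0) :
    ∃ w b : ℤ, w ≠ 0 ∧ Squarefree b ∧ a = w ^ 2 * b := by
  obtain ⟨b, w, h, hb⟩ := Nat.sq_mul_squarefree a.natAbs
  have hw : (w : ℤ) ≠ 0 := by
    grind
  rcases Int.natAbs_eq a with e | e
  · exact ⟨w, b, hw, Int.squarefree_natCast.2 hb, by grind⟩
  · refine ⟨w, -b, hw, ?_, by rw [e, ← h]; simp⟩
    rw [← Int.squarefree_natAbs]; simpa

lemma local_squarefree {p : ℕ} (hp : p.Prime) {w D t : ℤ} {k : ℕ} (hD : Squarefree D)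
    (ht : ¬(p : ℤ) ∣ t) (hw : w ≠ 0)
    (h : (p : ℤ) ^ (2 * k) * sqMod p ∣ w ^ 2 * D - p ^ (2 * k) * t ^ 2) :
    ¬(p : ℤ) ∣ D ∧ ∃ r : ℤ, sqMod p ∣ r ^ 2 - D := by
  have hpZ := Nat.prime_iff_prime_int.1 hp
  have hp0 : (p : ℤ) ≠ 0 := hpZ.ne_zero
  obtain ⟨s, hs⟩ := h
  have hsq : (p : ℤ) ∣ sqMod p := by
    unfold sqMod; split_ifs with h
    · simp_all
    rfl
  obtain ⟨v, hwv, hv⟩ := (Int.finiteMultiplicity_iff.2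
    ⟨fun h => hp.one_lt.ne' (by omega), hw⟩ : FiniteMultiplicity (p : ℤ) w).exists_eq_pow_mul_and_not_dvd
  generalize multiplicity (p : ℤ) w = j at hwv
  subst hwv
  have hunit : ¬(p : ℤ) ∣ t ^ 2 + sqMod p * s := fun h =>
    ht (hpZ.dvd_of_dvd_pow ((dvd_add_left (hsq.mul_right s)).1 h))
  have hE : (p : ℤ) ^ (2 * j) * (v ^ 2 * D) = p ^ (2 * k) * (t ^ 2 + sqMod p * s) := by
    linear_combination hs
  have hjk : j = k := by
    rcases lt_trichotomy j k with h | h | h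
    · exfalso
      rw [show 2 * k = 2 * j + (2 + 2 * (k - j - 1)) by omega, pow_add, mul_assoc] at hE
      have h1 := mul_left_cancel₀ (pow_ne_zero _ hp0) hE
      rw [pow_add, mul_assoc] at h1
      have h2 : (p : ℤ) ^ 2 ∣ v ^ 2 * D := ⟨_, h1⟩
      have hcop : IsCoprime ((p : ℤ) ^ 2) (v ^ 2) :=
        ((hpZ.coprime_iff_not_dvd).2 hv).pow
      have h3 := hcop.dvd_of_dvd_mul_left h2
      rw [sq] at h3
      exact hpZ.not_isUnit (hD _ h3)
    · exact h
    · exfalso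
      rw [show 2 * j = 2 * k + (1 + (2 * (j - k) - 1)) by omega, pow_add, mul_assoc] at hE
      have h1 := mul_left_cancel₀ (pow_ne_zero _ hp0) hE
      rw [pow_add, pow_one, mul_assoc] at h1
      exact hunit ⟨_, h1.symm⟩
  subst hjk
  have h1 := mul_left_cancel₀ (pow_ne_zero _ hp0) hE
  refine ⟨fun h => hunit (h1 ▸ h.mul_left _), ?_⟩
  have hcop : IsCoprime v (sqMod p) := by
    unfold sqMod; split_ifs with h
    · rw [show (8 : ℤ) = (p : ℤ) ^ 3 by grind]
      exact ((hpZ.coprime_iff_not_dvd).2 hv).symm.pow_right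
    · exact ((hpZ.coprime_iff_not_dvd).2 hv).symm
  obtain ⟨a, b, hab⟩ := hcop
  refine ⟨a * t, -a ^ 2 * s - D * b * (a * v + 1), ?_⟩
  grind

lemma exists_crt (S : Finset ℕ) (hS : ∀ p ∈ S, p.Prime) (g : ℕ → ℤ) :
    ∃ r : ℤ, ∀ p ∈ S, (p : ℤ) ^ 6 ∣ r - g p := by
  obtain ⟨r, hr⟩ := Ideal.exists_forall_sub_mem_ideal
    (I := fun q : S => Ideal.span {((q : ℕ) : ℤ) ^ 6}) (fun p q hpq => by
      change IsCoprime _ _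
      rw [Ideal.isCoprime_span_singleton_iff]
      exact (Nat.isCoprime_iff_coprime.2 ((Nat.coprime_primes (hS p p.2) (hS q q.2)).2
        fun e => hpq (Subtype.ext e))).pow) (fun q => g q)
  exact ⟨r, fun p hp => Ideal.mem_span_singleton.1 (hr ⟨p, hp⟩)⟩

lemma exists_disc {c0 : ℤ} {c : Fin 5 → ℤ} (h0 : Squarefree c0) (hc : ∀ i, Squarefree (c i))
    {N : ℕ} (hN : N ≠ 0) : ∃ (x : Fin 5 → ℤ) (w D : ℤ), w ≠ 0 ∧ Squarefree D ∧
      -(c0 * ∑ i, c i * x i ^ 2) = w ^ 2 * D ∧ 8 ∣ D - 1 ∧ IsCoprime (N : ℤ) D ∧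
      ∀ q : ℕ, q.Prime → q ∣ N → q ≠ 2 → ∃ r : ℤ, (q : ℤ) ∣ r ^ 2 - D := by
  have hloc := fun (p : ℕ) (hp : p.Prime) => exists_local hp h0 hc
  choose! X k t hk ht hX using hloc
  have hS : ∀ p ∈ (2 * N).primeFactors, p.Prime := fun p hp => Nat.prime_of_mem_primeFactors hp
  choose x hx using fun i => exists_crt _ hS (fun p => X p i)
  have hd : ∀ p ∈ (2 * N).primeFactors, (p : ℤ) ^ (2 * k p) * sqMod p ∣
      -(c0 * ∑ i, c i * x i ^ 2) - p ^ (2 * k p) * t p ^ 2 := by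
    intro p hp
    have h6 : (p : ℤ) ^ (2 * k p) * sqMod p ∣ p ^ 6 := by
      have h1 : sqMod p ∣ (p : ℤ) ^ 4 := by
        unfold sqMod; split_ifs with h
        · grind
        simp
      rw [show (p : ℤ) ^ 6 = p ^ 2 * p ^ 4 by ring]
      exact mul_dvd_mul (pow_dvd_pow _ (by grind)) h1
    have h2 : (p : ℤ) ^ 6 ∣ ∑ i, c i * x i ^ 2 - ∑ i, c i * X p i ^ 2 := by
      rw [← Finset.sum_sub_distrib]
      refine Finset.dvd_sum fun i _ => ?_
      obtain ⟨v, hv⟩ := hx i p hp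
      exact ⟨c i * (x i + X p i) * v, by grind⟩
    obtain ⟨v, hv⟩ := h6.trans h2
    obtain ⟨u, hu⟩ := hX p (hS p hp)
    exact ⟨u - c0 * v, by grind⟩
  have h2 : 2 ∈ (2 * N).primeFactors := by simp [hN, Nat.prime_two]
  have hA : -(c0 * ∑ i, c i * x i ^ 2) ≠ 0 := by
    intro h
    obtain ⟨v, hv⟩ := hd 2 h2
    rw [h, zero_sub, mul_assoc, ← mul_neg] at hv
    have h3 := mul_left_cancel₀ (pow_ne_zero _ (by simp)) hv
    have h4 := ht 2 Nat.prime_two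
    refine h4 ((Nat.prime_iff_prime_int.1 Nat.prime_two).dvd_of_dvd_pow (n := 2) ?_)
    exact ⟨-4 * v, by simp only [sqMod, if_true] at h3; omega⟩
  obtain ⟨w, D, hw, hD, hwD⟩ := exists_squarefree_part hA
  have hall : ∀ p ∈ (2 * N).primeFactors, ¬(p : ℤ) ∣ D ∧ ∃ r : ℤ, sqMod p ∣ r ^ 2 - D :=
    fun p hp => local_squarefree (hS p hp) hD (ht p (hS p hp)) hw (hwD ▸ hd p hp)
  have hmem : ∀ q : ℕ, q.Prime → q ∣ N → q ∈ (2 * N).primeFactors := fun q hq h =>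
    Nat.mem_primeFactors.2 ⟨hq, h.mul_left 2, by omega⟩
  refine ⟨x, w, D, hw, hD, hwD, ?_, ?_, fun q hq hqN hq2 => ?_⟩
  · obtain ⟨h3, r, hr⟩ := hall 2 h2
    simp only [sqMod, if_true] at hr
    push_cast at h3
    have hr2 : ¬(2 : ℤ) ∣ r := fun h => by
      have h5 : (2 : ℤ) ∣ r ^ 2 - D := Dvd.dvd.trans (by simp) hr
      exact h3 ((dvd_sub_right (h.mul_left r |>.trans (by rw [sq]))).1 h5)
    obtain ⟨s, rfl | rfl⟩ : ∃ s, r = 4 * s + 1 ∨ r = 4 * s - 1 :=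
      ⟨(r + 1) / 4, by omega⟩
    · grind
    grind
  · rw [Int.isCoprime_iff_gcd_eq_one]
    by_contra h
    obtain ⟨q, hq, hqd⟩ := Nat.exists_prime_and_dvd h
    have h3 : q ∣ N := Int.natCast_dvd_natCast.1 ((Int.natCast_dvd_natCast.2 hqd).trans
      (Int.gcd_dvd_left ..))
    exact (hall q (hmem q hq h3)).1 ((Int.natCast_dvd_natCast.2 hqd).trans (Int.gcd_dvd_right ..))
  · obtain ⟨-, r, hr⟩ := hall q (hmem q hq hqN)
    exact ⟨r, by simpa [sqMod, hq2] using hr⟩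

lemma exists_rep {c0 : ℤ} {c : Fin 5 → ℤ} (h0 : c0 ≠ 0) (hc : ∀ i, c i ≠ 0) {N : ℕ}
    (hN : N ≠ 0) : ∃ (D : ℤ) (m : ℕ), D ≠ 0 ∧ IsCoprime (2 * N : ℤ) D ∧ IsCoprime (m : ℤ) D ∧
      ∀ p : ℕ, p.Prime → m < p → (8 : ℤ) ∣ p - 1 → D ∣ p - m →
      ∃ (u0 : ℤ) (u : Fin 5 → ℤ) (s : ℤ), (u0 ≠ 0 ∨ u ≠ 0) ∧
        c0 * u0 ^ 2 + ∑ i, c i * u i ^ 2 = c0.sign * p * s ^ 2 := by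
  obtain ⟨d0, s0, hd0, hs0, e0⟩ := exists_squarefree_part h0
  choose d s hd hs e using fun i => exists_squarefree_part (hc i)
  have hNm : N * s0.natAbs ≠ 0 := mul_ne_zero hN (Int.natAbs_pos.2 hs0.ne_zero).ne'
  obtain ⟨x, w, D, hw, hD, hwD, h8, hcop, hr⟩ := exists_disc hs0 hs hNm
  push_cast at hcop
  refine ⟨D, s0.natAbs, hD.ne_zero, ?_, by simpa using hcop.of_mul_left_right, fun p hp hlt hp8 hpm => ?_⟩
  · refine IsCoprime.mul_left ?_ hcop.of_mul_left_left
    obtain ⟨v, hv⟩ := h8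
    exact ⟨-4 * v, 1, by omega⟩
  obtain ⟨a, y, z, hne, h⟩ := legendre_of_prime h8 hD (Int.squarefree_natAbs.2 hs0)
    (by simpa using hcop.of_mul_left_right)
    (fun q hq hqm => hr q hq (hqm.mul_left N)) hp hp8 hpm hlt
  set M := ∏ i, d i with hM
  have hM0 : M ≠ 0 := Finset.prod_ne_zero_iff.2 fun i _ => hd i
  choose g hg using fun i => (Finset.dvd_prod_of_mem d (Finset.mem_univ i) : d i ∣ M)
  have hsgn : s0 * c0.sign = s0.natAbs := by
    rw [e0, Int.sign_mul, Int.sign_eq_one_of_pos (by positivity), one_mul, mul_comm,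
      Int.sign_mul_self_eq_natAbs]
  have hsum : ∑ i, c i * (d0 * s0 * y * (g i * x i)) ^ 2 =
      d0 ^ 2 * s0 ^ 2 * y ^ 2 * M ^ 2 * ∑ i, s i * x i ^ 2 := by
    rw [Finset.mul_sum]
    grind
  refine ⟨w * a * M, fun i => d0 * s0 * y * (g i * x i), d0 * M * w * z * s0, ?_, ?_⟩
  · by_cases ha : a = 0
    · right
      have hy : y ≠ 0 := by
        rintro rfl
        simp_all
      intro h1
      have hx : ∀ i, x i = 0 := fun i => by
        have h2 := congrFun h1 i
        have hgi : g i ≠ 0 := right_ne_zero_of_mul (hg i ▸ hM ▸ hM0)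
        simp_all
      simp_all
    simp_all
  grind

lemma meyer_diagonal {a0 b0 : ℤ} {a b : Fin 5 → ℤ} (ha0 : a0 < 0) (hb0 : 0 < b0)
    (ha : ∀ i, a i ≠ 0) (hb : ∀ i, b i ≠ 0) : ∃ (x0 y0 : ℤ) (x y : Fin 5 → ℤ),
      (x0 ≠ 0 ∨ y0 ≠ 0 ∨ x ≠ 0 ∨ y ≠ 0) ∧
      a0 * x0 ^ 2 + ∑ i, a i * x i ^ 2 + (b0 * y0 ^ 2 + ∑ i, b i * y i ^ 2) = 0 := by
  obtain ⟨D, m, hD, hcD, hmD, hf⟩ := exists_rep ha0.ne ha (N := 1) one_ne_zero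
  obtain ⟨D', m', hD', hcD', hmD', hg⟩ := exists_rep hb0.ne' hb (N := D.natAbs)
    (Int.natAbs_ne_zero.2 hD)
  have hDD : IsCoprime D D' := by
    have := hcD'.of_mul_left_right
    rw [Int.natCast_natAbs] at this
    rcases abs_choice D with h | h <;> rw [h] at this
    · omega
    · exact (IsCoprime.neg_left_iff _ _).1 this
  have h8D : IsCoprime (8 : ℤ) D := by
    simpa using (IsCoprime.pow_left (m := 3) hcD.of_mul_left_left)
  have h8D' : IsCoprime (8 : ℤ) D' := by
    simpa using (IsCoprime.pow_left (m := 3) hcD'.of_mul_left_left)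
  obtain ⟨r, hr1, hr2, hr3⟩ : ∃ r : ℤ, 8 ∣ r - 1 ∧ D ∣ r - m ∧ D' ∣ r - m' := by
    obtain ⟨a, b, h1⟩ := h8D
    obtain ⟨c, d, h2⟩ := h8D'.mul_left hDD
    refine ⟨c * (8 * D) * m' + d * D' * (a * 8 * m + b * D * 1), ?_, ?_, ?_⟩
    · exact ⟨c * D * m' + d * D' * a * m - d * D' * a - c * D, by
        grind⟩
    · exact ⟨c * 8 * m' + d * D' * b * (1 - m) - c * 8 * m, by
        grind⟩
    · exact ⟨d * (a * 8 * m + b * D * 1) - d * m', by grind⟩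
  have hcop : IsCoprime r ((8 * D * D').natAbs : ℕ) := by
    have key : ∀ {q s : ℤ}, q ∣ r - s → IsCoprime s q → IsCoprime r q := fun ⟨t, ht⟩ h => by
      rw [eq_add_of_sub_eq' ht]; simpa
    have := ((key hr1 isCoprime_one_left).mul_right (key hr2 hmD)).mul_right (key hr3 hmD')
    rw [Int.natCast_natAbs]
    rcases abs_choice (8 * D * D') with h | h <;> rw [h]
    · omega
    · exact this.neg_right
  obtain ⟨p, hp, hpp, hpr⟩ := Nat.forall_exists_prime_gt_and_zmodEq (m + m')
    (Int.natAbs_ne_zero.2 (by positivity)) hcop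
  have hpd : 8 * D * D' ∣ p - r := by
    have := hpr.symm.dvd
    rwa [Int.natAbs_dvd] at this
  have h8 : (8 : ℤ) ∣ p - 1 := by
    have := (Dvd.dvd.trans ⟨D * D', by ring⟩ hpd).add hr1; omega
  obtain ⟨u0, u, s, hu, hus⟩ := hf p hpp (by omega) h8 (by
    have := (Dvd.dvd.trans ⟨8 * D', by ring⟩ hpd).add hr2; simpa)
  obtain ⟨v0, v, t, hv, hvt⟩ := hg p hpp (by omega) h8 (by
    have := (Dvd.dvd.trans ⟨8 * D, by ring⟩ hpd).add hr3; simpa)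
  rw [Int.sign_eq_neg_one_of_neg ha0] at hus
  rw [Int.sign_eq_one_of_pos hb0] at hvt
  by_cases hs : s = 0
  · exact ⟨u0, 0, u, 0, by tauto, by rw [hus, hs]; simp⟩
  · refine ⟨t * u0, s * v0, t • u, s • v, ?_, ?_⟩
    · rcases hv with hv | hv
      · exact Or.inr (Or.inl (mul_ne_zero hs hv))
      · exact Or.inr (Or.inr (Or.inr (smul_ne_zero hs hv)))
    · have e1 : ∀ (q : ℤ) (c w : Fin 5 → ℤ), ∑ i, c i * (q • w) i ^ 2 =
          q ^ 2 * ∑ i, c i * w i ^ 2 := fun q c w => by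
        rw [Finset.mul_sum]
        exact Finset.sum_congr rfl fun i _ => by simp only [Pi.smul_apply, smul_eq_mul]; ring
      rw [e1, e1]
      linear_combination t ^ 2 * hus + s ^ 2 * hvt

open Metric Filter Topology Set
open Complex (I)

section

/-- A family of functions `f u` of `t`, holomorphic in each variable, continuous off `t = 0`. -/
structure Fam (Ω : Set (ℂ × ℂ)) (f : ℂ → ℂ → ℂ) : Prop where
  op : IsOpen Ω
  hc : ∀ p ∈ Ω, p.2 ≠ 0 → ContinuousAt (fun q : ℂ × ℂ => f q.1 q.2) p
  hu : ∀ p ∈ Ω, p.2 ≠ 0 → DifferentiableAt ℂ (fun u => f u p.2) p.1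
  ht : ∀ p ∈ Ω, DifferentiableAt ℂ (f p.1) p.2

/-- `f u t` does not vanish for `u` near `u₀` and `0 < |t| ≤ ρ`. -/
def Good (f : ℂ → ℂ → ℂ) (u₀ : ℂ) : Prop :=
  ∃ ρ > 0, ∃ δ > 0, ∀ u ∈ ball u₀ δ, ∀ t : ℂ, t ≠ 0 → ‖t‖ ≤ ρ → f u t ≠ 0

lemma exists_polydisc {Ω : Set (ℂ × ℂ)} (hΩ : IsOpen Ω) {u₀ t₀ : ℂ} (h : (u₀, t₀) ∈ Ω) :
    ∃ ρ > 0, closedBall u₀ ρ ×ˢ closedBall t₀ ρ ⊆ Ω := by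
  obtain ⟨ε, hε, h2⟩ := Metric.isOpen_iff.1 hΩ _ h
  refine ⟨ε / 2, by simpa, ?_⟩
  rintro ⟨u, t⟩ ⟨hu, ht⟩
  refine h2 ?_
  rw [mem_ball, Prod.dist_eq]
  simp only [mem_closedBall] at hu ht
  grind

lemma norm_le_of_sphere {g : ℂ → ℂ} {c : ℂ} {ρ M : ℝ} (hρ : 0 < ρ)
    (hg : ∀ t ∈ closedBall c ρ, DifferentiableAt ℂ g t) (hM : ∀ t ∈ sphere c ρ, ‖g t‖ ≤ M)
    {t : ℂ} (ht : t ∈ closedBall c ρ) : ‖g t‖ ≤ M := by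
  refine Complex.norm_le_of_forall_mem_frontier_norm_le (U := ball c ρ) isBounded_ball ?_ ?_ ?_
  · refine DifferentiableOn.diffContOnCl_ball (U := closedBall c ρ)
      (fun t ht => (hg t ht).differentiableWithinAt) subset_rfl
  · rw [frontier_ball c hρ.ne']; omega
  · rwa [closure_ball c hρ.ne']

lemma Fam.bound {Ω : Set (ℂ × ℂ)} {f : ℂ → ℂ → ℂ} (hf : Fam Ω f) {u₀ : ℂ} (h0 : (u₀, 0) ∈ Ω) :
    ∃ ρ > 0, ∃ C : ℝ, closedBall u₀ ρ ×ˢ closedBall (0 : ℂ) ρ ⊆ Ω ∧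
      ∀ u ∈ closedBall u₀ ρ, ∀ t ∈ ball (0 : ℂ) ρ, ‖f u t - f u 0‖ ≤ C * ‖t‖ := by
  obtain ⟨ρ, hρ, hs⟩ := exists_polydisc hf.op h0
  have hK : IsCompact (closedBall u₀ ρ ×ˢ sphere (0 : ℂ) ρ) :=
    (isCompact_closedBall _ _).prod (isCompact_sphere _ _)
  have hcon : ContinuousOn (fun q : ℂ × ℂ => f q.1 q.2) (closedBall u₀ ρ ×ˢ sphere (0 : ℂ) ρ) := by
    intro p hp
    refine (hf.hc p (hs ⟨hp.1, sphere_subset_closedBall hp.2⟩) ?_).continuousWithinAt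
    rintro h
    simp_all
  obtain ⟨M, hM⟩ := hK.exists_bound_of_continuousOn hcon
  refine ⟨ρ, hρ, (2 * M + 1) / ρ, hs, fun u hu t ht => ?_⟩
  have hb : ∀ t ∈ closedBall (0 : ℂ) ρ, ‖f u t‖ ≤ M := fun t ht =>
    norm_le_of_sphere hρ (fun t ht => hf.ht (u, t) (hs ⟨hu, ht⟩)) (fun t ht => hM (u, t) ⟨hu, ht⟩) ht
  have := Complex.dist_le_div_mul_dist_of_mapsTo_ball (f := f u) (c := 0) (z := t) (R₁ := ρ)
    (R₂ := 2 * M + 1) (fun t ht => (hf.ht (u, t)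
      (hs ⟨hu, ball_subset_closedBall ht⟩)).differentiableWithinAt) ?_ ht
  · simpa [dist_eq_norm] using this
  · intro t ht
    rw [mem_closedBall, dist_eq_norm]
    have h1 := hb t (ball_subset_closedBall ht)
    have h2 := hb 0 (mem_closedBall_self hρ.le)
    have := norm_sub_le (f u t) (f u 0)
    grind

lemma Fam.diff_zero {Ω : Set (ℂ × ℂ)} {f : ℂ → ℂ → ℂ} (hf : Fam Ω f) {u₀ : ℂ}
    (h0 : (u₀, 0) ∈ Ω) : DifferentiableAt ℂ (fun u => f u 0) u₀ := by
  obtain ⟨ρ, hρ, C, hs, hC⟩ := hf.bound h0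
  have hlim : TendstoLocallyUniformlyOn (fun (t : ℂ) u => f u t) (fun u => f u 0) (𝓝[≠] 0)
      (ball u₀ ρ) := by
    apply TendstoUniformlyOn.tendstoLocallyUniformlyOn
    rw [Metric.tendstoUniformlyOn_iff]
    intro ε hε
    have h1 : Tendsto (fun t : ℂ => C * ‖t‖) (𝓝[≠] 0) (𝓝 0) := by
      have : Tendsto (fun t : ℂ => C * ‖t‖) (𝓝 0) (𝓝 (C * ‖(0:ℂ)‖)) :=
        (continuous_const.mul continuous_norm).tendsto _
      simp only [norm_zero, mul_zero] at this
      exact this.mono_left nhdsWithin_le_nhds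
    filter_upwards [h1.eventually (gt_mem_nhds hε),
      nhdsWithin_le_nhds (ball_mem_nhds (0:ℂ) hρ)] with t ht1 ht2 u hu
    rw [dist_comm, dist_eq_norm]
    exact (hC u (ball_subset_closedBall hu) t ht2).trans_lt ht1
  have := hlim.differentiableOn ?_ isOpen_ball
  · exact (this u₀ (mem_ball_self hρ)).differentiableAt (ball_mem_nhds _ hρ)
  · filter_upwards [self_mem_nhdsWithin, nhdsWithin_le_nhds (ball_mem_nhds (0:ℂ) hρ)]
      with t ht1 ht2 u hu
    exact (hf.hu (u, t) (hs ⟨ball_subset_closedBall hu, ball_subset_closedBall ht2⟩)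
      ht1).differentiableWithinAt

lemma Fam.cont {Ω : Set (ℂ × ℂ)} {f : ℂ → ℂ → ℂ} (hf : Fam Ω f) {p : ℂ × ℂ}
    (hp : p ∈ Ω) : ContinuousAt (fun q : ℂ × ℂ => f q.1 q.2) p := by
  by_cases h : p.2 = 0
  · obtain ⟨u₀, t₀⟩ := p
    simp only at h
    subst h
    obtain ⟨ρ, hρ, C, hs, hC⟩ := hf.bound hp
    have h1 := (hf.diff_zero hp).continuousAt
    have h2 : Tendsto (fun q : ℂ × ℂ => f q.1 q.2 - f q.1 0) (𝓝 (u₀, 0)) (𝓝 0) := by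
      refine squeeze_zero_norm' (a := fun q : ℂ × ℂ => C * ‖q.2‖) ?_ ?_
      · filter_upwards [prod_mem_nhds (ball_mem_nhds u₀ hρ) (ball_mem_nhds (0:ℂ) hρ)] with q hq
        exact hC q.1 (ball_subset_closedBall hq.1) q.2 hq.2
      · have : Tendsto (fun q : ℂ × ℂ => C * ‖q.2‖) (𝓝 (u₀, 0)) (𝓝 (C * ‖(0:ℂ)‖)) :=
          (continuous_const.mul (continuous_norm.comp continuous_snd)).tendsto (u₀, (0:ℂ))
        simpa
    have h3 : Tendsto (fun q : ℂ × ℂ => f q.1 0) (𝓝 (u₀, 0)) (𝓝 (f u₀ 0)) :=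
      h1.tendsto.comp continuous_fst.continuousAt
    have := h2.add h3
    simpa
  · exact hf.hc p hp h

lemma Fam.hu' {Ω : Set (ℂ × ℂ)} {f : ℂ → ℂ → ℂ} (hf : Fam Ω f) {p : ℂ × ℂ}
    (hp : p ∈ Ω) : DifferentiableAt ℂ (fun u => f u p.2) p.1 := by
  by_cases h : p.2 = 0
  · rw [h]; exact hf.diff_zero (by grind)
  · exact hf.hu p hp h

lemma min_modulus {g : ℂ → ℂ} {c : ℂ} {ρ ε : ℝ} (hρ : 0 < ρ) (hε : 0 < ε)
    (hg : ∀ t ∈ closedBall c ρ, DifferentiableAt ℂ g t) (h0 : ∀ t ∈ closedBall c ρ, g t ≠ 0)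
    (hM : ∀ t ∈ sphere c ρ, ε ≤ ‖g t‖) : ε ≤ ‖g c‖ := by
  have := norm_le_of_sphere (g := fun t => (g t)⁻¹) (M := ε⁻¹) hρ
    (fun t ht => (hg t ht).inv (h0 t ht)) (fun t ht => by
      rw [norm_inv]; exact inv_anti₀ hε (hM t ht)) (mem_closedBall_self hρ.le)
  rw [norm_inv] at this
  exact (inv_le_inv₀ (norm_pos_iff.2 (h0 c (mem_closedBall_self hρ.le))) hε).1 this

lemma Fam.hurwitz {Ω : Set (ℂ × ℂ)} {f : ℂ → ℂ → ℂ} (hf : Fam Ω f) {U : Set ℂ} (hU : IsOpen U)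
    (hUc : IsPreconnected U) (hUΩ : ∀ u ∈ U, (u, 0) ∈ Ω) {u₀ u₁ : ℂ} (h0 : u₀ ∈ U) (h1 : u₁ ∈ U)
    (hg : Good f u₁) (hne : f u₀ 0 ≠ 0) : f u₁ 0 ≠ 0 := by
  have hdiff : DifferentiableOn ℂ (fun u => f u 0) U := fun u hu =>
    (hf.diff_zero (hUΩ u hu)).differentiableWithinAt
  have hfreq : ∃ᶠ u in 𝓝 u₁, f u 0 ≠ 0 := by
    by_contra hcon
    rw [not_frequently] at hcon
    have := (hdiff.analyticOnNhd hU).eqOn_zero_of_preconnected_of_eventuallyEq_zero hUc h1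
      (by filter_upwards [hcon] with u hu; simp_all)
    tauto
  obtain ⟨ρ, hρ, C, hs, -⟩ := hf.bound (hUΩ u₁ h1)
  obtain ⟨ρ', hρ', δ, hδ, hgood⟩ := hg
  set r := min (min ρ ρ') (δ / 2) with hr
  have hr0 : 0 < r := by grind
  have hK : IsCompact (closedBall u₁ r ×ˢ sphere (0 : ℂ) r) :=
    (isCompact_closedBall _ _).prod (isCompact_sphere _ _)
  have hrρ : r ≤ ρ := (min_le_left _ _).trans (min_le_left _ _)
  have hrρ' : r ≤ ρ' := (min_le_left _ _).trans (min_le_right _ _)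
  have hrδ : r < δ := (min_le_right _ _).trans_lt (by simpa)
  have hsub : ∀ u ∈ closedBall u₁ r, ∀ t ∈ closedBall (0:ℂ) r, (u, t) ∈ Ω := fun u hu t ht =>
    hs ⟨closedBall_subset_closedBall hrρ hu, closedBall_subset_closedBall hrρ ht⟩
  have hcon : ContinuousOn (fun q : ℂ × ℂ => ‖f q.1 q.2‖)
      (closedBall u₁ r ×ˢ sphere (0 : ℂ) r) := fun p hp =>
    (hf.cont (hsub p.1 hp.1 p.2 (sphere_subset_closedBall hp.2))).norm.continuousWithinAt
  obtain ⟨q, hq, hmin⟩ := hK.exists_isMinOn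
    ⟨(u₁, (r : ℂ)), mem_closedBall_self hr0.le, by simp [abs_of_pos hr0]⟩ hcon
  have hnz : ∀ u ∈ closedBall u₁ r, ∀ t : ℂ, t ≠ 0 → ‖t‖ ≤ r → f u t ≠ 0 := fun u hu t ht htr =>
    hgood u (closedBall_subset_ball hrδ hu) t ht (htr.trans hrρ')
  have hε : 0 < ‖f q.1 q.2‖ := by
    refine norm_pos_iff.2 (hnz q.1 hq.1 q.2 ?_ ?_)
    · rintro h
      have := hq.2; rw [h] at this; simp at this; linarith
    · have := hq.2; simp at this; linarith
  have hlow : ∃ᶠ u in 𝓝 u₁, ‖f q.1 q.2‖ ≤ ‖f u 0‖ := by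
    refine (hfreq.and_eventually (closedBall_mem_nhds u₁ hr0)).mono ?_
    rintro u ⟨hu, hur⟩
    refine min_modulus hr0 hε (fun t ht => hf.ht (u, t) (hsub u hur t ht)) ?_ ?_
    · intro t ht
      by_cases h : t = 0
      · grind
      · exact hnz u hur t h (by simpa using ht)
    · intro t ht
      exact hmin (show (u, t) ∈ closedBall u₁ r ×ˢ sphere (0 : ℂ) r from ⟨hur, ht⟩)
  have hcl : ‖f q.1 q.2‖ ≤ ‖f u₁ 0‖ := by
    by_contra hlt
    push Not at hlt
    have := (hf.diff_zero (hUΩ u₁ h1)).continuousAt.norm.eventually (gt_mem_nhds hlt)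
    obtain ⟨u, h1, h2⟩ := (hlow.and_eventually this).exists
    linarith
  exact norm_pos_iff.1 (hε.trans_le hcl)

/-- `f` vanishes to order exactly `m` at `0`. -/
def HasOrd (φ : ℂ → ℂ) (m : ℕ) : Prop :=
  ∃ l : ℂ, l ≠ 0 ∧ Tendsto (fun t => φ t / t ^ m) (𝓝[≠] 0) (𝓝 l)

lemma HasOrd.unique {φ : ℂ → ℂ} {m n : ℕ} (h1 : HasOrd φ m) (h2 : HasOrd φ n) : m = n := by
  wlog h : m < n generalizing m n
  · grind
  obtain ⟨l, hl, h1⟩ := h1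
  obtain ⟨l', hl', h2⟩ := h2
  exfalso
  have h3 : Tendsto (fun t : ℂ => φ t / t ^ n * t ^ (n - m)) (𝓝[≠] 0) (𝓝 (l' * 0)) := by
    refine h2.mul ?_
    have : Tendsto (fun t : ℂ => t ^ (n - m)) (𝓝 0) (𝓝 (0 ^ (n - m))) :=
      (continuous_pow _).tendsto _
    rw [zero_pow (by omega)] at this
    exact this.mono_left nhdsWithin_le_nhds
  rw [mul_zero] at h3
  refine hl (tendsto_nhds_unique (h1.congr' ?_) h3)
  filter_upwards [self_mem_nhdsWithin] with t ht
  have ht : t ≠ 0 := ht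
  obtain ⟨k, rfl⟩ := Nat.exists_eq_add_of_lt h
  have : m + k + 1 - m = k + 1 := by omega
  rw [this]; field_simp; ring

lemma exists_ord {φ : ℂ → ℂ} (ha : AnalyticAt ℂ φ 0) (h : ∃ᶠ t in 𝓝 0, φ t ≠ 0) :
    ∃ m, HasOrd φ m := by
  obtain ⟨m, g, hg, hg0, hev⟩ := (ha.exists_eventuallyEq_pow_smul_nonzero_iff).2
    (fun hc => h (by simpa))
  refine ⟨m, g 0, hg0, (hg.continuousAt.tendsto.mono_left nhdsWithin_le_nhds).congr' ?_⟩
  filter_upwards [self_mem_nhdsWithin, nhdsWithin_le_nhds hev] with t ht h2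
  simp_all

open Classical in
/-- Division of a family by `t`. -/
noncomputable def divT (f : ℂ → ℂ → ℂ) (u t : ℂ) : ℂ := if t = 0 then deriv (f u) 0 else f u t / t

lemma divT_eventually {f : ℂ → ℂ → ℂ} {p : ℂ × ℂ} (h : p.2 ≠ 0) :
    (fun q : ℂ × ℂ => divT f q.1 q.2) =ᶠ[𝓝 p] fun q => f q.1 q.2 / q.2 := by
  have : ∀ᶠ q : ℂ × ℂ in 𝓝 p, q.2 ≠ 0 := continuous_snd.continuousAt.eventually_ne h
  filter_upwards [this] with q hq
  simp [divT, hq]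

lemma Fam.div {Ω : Set (ℂ × ℂ)} {f : ℂ → ℂ → ℂ} (hf : Fam Ω f)
    (h : ∀ u, (u, (0:ℂ)) ∈ Ω → f u 0 = 0) : Fam Ω (divT f) := by
  refine ⟨hf.op, ?_, ?_, ?_⟩
  · intro p hp h0
    exact ((hf.hc p hp h0).div continuousAt_snd h0).congr (divT_eventually h0).symm
  · intro p hp h0
    have : (fun u => divT f u p.2) = fun u => f u p.2 / p.2 := by
      funext u; simp [divT, h0]
    rw [this]
    exact (hf.hu p hp h0).div_const _
  · rintro ⟨u, t⟩ hp
    by_cases h0 : t = 0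
    · subst h0
      have e : divT f u = dslope (f u) 0 := by
        funext t
        by_cases ht : t = 0
        · subst ht; simp [divT]
        · rw [dslope_of_ne _ ht, slope_def_field, h u hp]; simp [divT, ht]
      simp only [e]
      obtain ⟨ρ, hρ, hs⟩ := exists_polydisc hf.op hp
      have : DifferentiableOn ℂ (f u) (ball 0 ρ) := fun t ht =>
        (hf.ht (u, t) (hs ⟨mem_closedBall_self hρ.le,
          ball_subset_closedBall ht⟩)).differentiableWithinAt
      exact ((Complex.differentiableOn_dslope (ball_mem_nhds _ hρ)).2 this 0
        (mem_ball_self hρ)).differentiableAt (ball_mem_nhds _ hρ)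
    · have : divT f u =ᶠ[𝓝 t] fun t => f u t / t := by
        filter_upwards [isOpen_ne.mem_nhds h0] with s hs
        simp [divT, show s ≠ 0 from hs]
      exact ((hf.ht _ hp).div differentiableAt_id h0).congr_of_eventuallyEq this

lemma HasOrd.congr {φ ψ : ℂ → ℂ} {m : ℕ} (h : HasOrd φ m) (he : ∀ t ≠ 0, φ t = ψ t) :
    HasOrd ψ m := by
  obtain ⟨l, hl, h⟩ := h
  refine ⟨l, hl, h.congr' ?_⟩
  filter_upwards [self_mem_nhdsWithin] with t ht
  grind

theorem Fam.order {Ω : Set (ℂ × ℂ)} {U : Set ℂ} (hU : IsOpen U) (hUc : IsPreconnected U)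
    {u₀ : ℂ} (h0 : u₀ ∈ U) {m : ℕ} : ∀ {f : ℂ → ℂ → ℂ}, Fam Ω f →
    (∀ u, (u, (0:ℂ)) ∈ Ω ↔ u ∈ U) → Good f u₀ → HasOrd (f u₀) m →
    ∃ h, Fam Ω h ∧ (∀ u t, t ≠ 0 → f u t = t ^ m * h u t) ∧ ∀ u ∈ U, Good f u → h u 0 ≠ 0 := by
  induction m with
  | zero =>
    intro f hf hΩ hg ho
    refine ⟨f, hf, by simp, fun u hu hgu => ?_⟩
    refine hf.hurwitz hU hUc (fun u hu => (hΩ u).2 hu) h0 hu hgu ?_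
    obtain ⟨l, hl, ho⟩ := ho
    simp only [pow_zero, div_one] at ho
    have := ((hf.ht (u₀, 0) ((hΩ u₀).2 h0)).continuousAt.tendsto.mono_left
      (nhdsWithin_le_nhds (s := {0}ᶜ)))
    rw [tendsto_nhds_unique this ho]
    omega
  | succ m ih =>
    intro f hf hΩ hg ho
    have hz : f u₀ 0 = 0 := by
      obtain ⟨l, hl, ho⟩ := ho
      have h1 := ((hf.ht (u₀, 0) ((hΩ u₀).2 h0)).continuousAt.tendsto.mono_left
        (nhdsWithin_le_nhds (s := {0}ᶜ)))
      have h2 : Tendsto (fun t : ℂ => f u₀ t / t ^ (m + 1) * t ^ (m + 1)) (𝓝[≠] 0)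
          (𝓝 (l * 0)) := by
        refine ho.mul ?_
        have : Tendsto (fun t : ℂ => t ^ (m + 1)) (𝓝 0) (𝓝 (0 ^ (m + 1))) :=
          (continuous_pow _).tendsto _
        rw [zero_pow (by omega)] at this
        exact this.mono_left nhdsWithin_le_nhds
      rw [mul_zero] at h2
      refine tendsto_nhds_unique h1 (h2.congr' ?_)
      filter_upwards [self_mem_nhdsWithin] with t ht
      simp_all
    have hall : ∀ u, (u, (0:ℂ)) ∈ Ω → f u 0 = 0 := by
      intro u hu
      by_contra hne
      exact hf.hurwitz hU hUc (fun u hu => (hΩ u).2 hu) ((hΩ u).1 hu) h0 hg hne hz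
    have hgd : ∀ u, Good f u → Good (divT f) u := by
      rintro u ⟨ρ, hρ, δ, hδ, h⟩
      refine ⟨ρ, hρ, δ, hδ, fun v hv t ht htρ => ?_⟩
      simp only [divT, ht, if_false]
      grind
    have hod : HasOrd (divT f u₀) m := by
      obtain ⟨l, hl, ho⟩ := ho
      refine ⟨l, hl, ho.congr' ?_⟩
      filter_upwards [self_mem_nhdsWithin] with t ht
      have ht : t ≠ 0 := ht
      simp only [divT, ht, if_false]
      ring
    obtain ⟨h, hh1, hh2, hh3⟩ := ih (hf.div hall) hΩ (hgd _ hg) hod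
    refine ⟨h, hh1, fun u t ht => ?_, fun u hu hg => hh3 u hu (hgd u hg)⟩
    have := hh2 u t ht
    simp only [divT, ht, if_false] at this
    grind

lemma Fam.hasOrd {Ω : Set (ℂ × ℂ)} {f h : ℂ → ℂ → ℂ} (hh : Fam Ω h) {u : ℂ} (hu : (u, 0) ∈ Ω)
    {m : ℕ} (e : ∀ t, t ≠ 0 → f u t = t ^ m * h u t) (hne : h u 0 ≠ 0) : HasOrd (f u) m := by
  refine ⟨h u 0, hne, ((hh.ht (u, 0) hu).continuousAt.tendsto.mono_left
    nhdsWithin_le_nhds).congr' ?_⟩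
  filter_upwards [self_mem_nhdsWithin] with t ht
  simp_all

/-- `exp(2πiw)` -/
noncomputable def ee (w : ℂ) : ℂ := Complex.exp (2 * Real.pi * I * w)

lemma ee_add (z w : ℂ) : ee (z + w) = ee z * ee w := by
  simp [ee, mul_add, Complex.exp_add]

lemma ee_ne (z : ℂ) : ee z ≠ 0 := Complex.exp_ne_zero _

lemma ee_zero : ee 0 = 1 := by simp [ee]

lemma ee_neg (z : ℂ) : ee (-z) = (ee z)⁻¹ := by simp [ee, Complex.exp_neg]

lemma ee_int (n : ℤ) : ee n = 1 := by
  rw [ee, Complex.exp_eq_one_iff]; exact ⟨n, by ring⟩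

lemma ee_one : ee 1 = 1 := by simpa using ee_int 1

lemma ee_eq_iff {z w : ℂ} : ee z = ee w ↔ ∃ n : ℤ, z = w + n := by
  rw [ee, ee, Complex.exp_eq_exp_iff_exists_int]
  have h : (2 * Real.pi * I : ℂ) ≠ 0 := Complex.two_pi_I_ne_zero
  grind

lemma ee_nat_mul (n : ℕ) (z : ℂ) : ee (n * z) = ee z ^ n := by
  rw [ee, ee, ← Complex.exp_nat_mul]; ring_nf

lemma norm_ee (z : ℂ) : ‖ee z‖ = Real.exp (-2 * Real.pi * z.im) := by
  rw [ee, Complex.norm_exp]; simp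

lemma differentiable_ee : Differentiable ℂ ee := by
  unfold ee; fun_prop

lemma norm_ee_lt_one {τ : ℂ} (h : 0 < τ.im) : ‖ee τ‖ < 1 := by
  rw [norm_ee, Real.exp_lt_one_iff]; nlinarith [Real.pi_pos]

lemma exists_ee {s : ℂ} (hs : s ≠ 0) : ∃ z, ee z = s := by
  refine ⟨Complex.log s / (2 * Real.pi * I), ?_⟩
  rw [ee, mul_div_cancel₀ _ Complex.two_pi_I_ne_zero, Complex.exp_log hs]

/-- `∏_{n ≥ 1} (1 - qⁿ x)` -/
noncomputable def qprod (q x : ℂ) : ℂ := ∏' n : ℕ, (1 + -(q ^ (n + 1) * x))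

lemma qprod_summable {q : ℂ} (hq : ‖q‖ < 1) (x : ℂ) :
    Summable fun n : ℕ => ‖-(q ^ (n + 1) * x)‖ := by
  have := ((summable_geometric_of_lt_one (norm_nonneg q) hq).mul_left (‖q‖ * ‖x‖))
  refine this.congr fun n => ?_
  rw [norm_neg, norm_mul, norm_pow, pow_succ]; ring

lemma qprod_succ {q : ℂ} (hq : ‖q‖ < 1) (x : ℂ) : qprod q x = (1 - q * x) * qprod q (q * x) := by
  have h := (multipliable_one_add_of_summable (qprod_summable hq (q * x)))
  rw [qprod, qprod, tprod_eq_zero_mul']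
  · congr 1
    · ring
    · refine tprod_congr fun n => ?_
      ring
  grind

lemma qprod_ne_zero {q : ℂ} (hq : ‖q‖ < 1) {x : ℂ} (h : ∀ n : ℕ, q ^ (n + 1) * x ≠ 1) :
    qprod q x ≠ 0 := by
  refine tprod_one_add_ne_zero_of_summable (fun n hn => h n ?_) (qprod_summable hq x)
  grind

lemma differentiable_qprod {q : ℂ} (hq : ‖q‖ < 1) : Differentiable ℂ (qprod q) := by
  intro x
  have hs : Summable fun n : ℕ => ‖q‖ ^ (n + 1) * (‖x‖ + 1) := by
    have := ((summable_geometric_of_lt_one (norm_nonneg q) hq).mul_left (‖q‖ * (‖x‖ + 1)))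
    grind
  have := Summable.hasProdLocallyUniformlyOn_nat_one_add (K := ball (0:ℂ) (‖x‖ + 1))
    (f := fun n x => -(q ^ (n + 1) * x)) isOpen_ball hs
    (Eventually.of_forall fun n y hy => by
      rw [norm_neg, norm_mul, norm_pow]
      gcongr
      simpa using (mem_ball_zero_iff.1 hy).le) (fun n => by fun_prop)
  have h2 := this.differentiableOn
    (Eventually.of_forall fun s => by
      fun_prop) isOpen_ball
  exact (h2 x (by simp)).differentiableAt (isOpen_ball.mem_nhds (by simp))

/-- The Jacobi theta product, with simple zeros exactly at `ℤ + ℤτ`. -/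
noncomputable def theta (τ w : ℂ) : ℂ :=
  (1 - ee w) * qprod (ee τ) (ee w) * qprod (ee τ) (ee (-w))

lemma theta_add_one (τ w : ℂ) : theta τ (w + 1) = theta τ w := by
  simp [theta, ee_add, ee_neg, ee_one]

lemma theta_add_tau {τ : ℂ} (hτ : 0 < τ.im) (w : ℂ) :
    theta τ (w + τ) = -ee (-w) * theta τ w := by
  have hq := norm_ee_lt_one hτ
  have h1 := qprod_succ hq (ee w)
  have h2 := qprod_succ hq (ee (-(w + τ)))
  have e : ee τ * ee (-(w + τ)) = ee (-w) := by rw [← ee_add]; simp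
  rw [e] at h2
  rw [theta, theta, h1, h2, ee_add, ee_neg]
  have := ee_ne w
  grind

lemma differentiable_theta {τ : ℂ} (hτ : 0 < τ.im) : Differentiable ℂ (theta τ) := by
  have hq := differentiable_qprod (norm_ee_lt_one hτ)
  have h := differentiable_ee
  unfold theta
  fun_prop

lemma qprod_ee_ne_zero {τ : ℂ} (hτ : 0 < τ.im) {w : ℂ} (hw : ∀ a b : ℤ, w ≠ 0 → w ≠ a + b * τ) :
    qprod (ee τ) (ee w) ≠ 0 := by
  refine qprod_ne_zero (norm_ee_lt_one hτ) fun n hn => ?_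
  rw [← ee_nat_mul, ← ee_add, ← ee_zero, ee_eq_iff] at hn
  obtain ⟨m, hm⟩ := hn
  have h : w = m + (-(n + 1) : ℤ) * τ := by push_cast at hm ⊢; grind
  by_cases h0 : w = 0
  · rw [h0] at h
    have := congrArg Complex.im h
    have hn : (0:ℝ) ≤ n := n.cast_nonneg
    simp only [Complex.zero_im, Complex.add_im, Complex.intCast_im, Complex.mul_im,
      Complex.intCast_re, zero_add, zero_mul, add_zero] at this
    push_cast at this
    nlinarith
  tauto

lemma theta_ne_zero {τ : ℂ} (hτ : 0 < τ.im) {w : ℂ} (hw : ∀ a b : ℤ, w ≠ a + b * τ) :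
    theta τ w ≠ 0 := by
  refine mul_ne_zero (mul_ne_zero (fun h => ?_) (qprod_ee_ne_zero hτ fun a b _ => hw a b))
    (qprod_ee_ne_zero hτ fun a b _ h => hw (-a) (-b) ?_)
  · rw [sub_eq_zero, ← ee_zero, ee_eq_iff] at h
    obtain ⟨n, hn⟩ := h
    refine hw (-n) 0 ?_
    grind
  grind

lemma theta_ord_zero {τ : ℂ} (hτ : 0 < τ.im) : HasOrd (theta τ) 1 := by
  have hq := differentiable_qprod (norm_ee_lt_one hτ)
  have h := differentiable_ee
  have hd : HasDerivAt (fun w => 1 - ee w) (-(2 * Real.pi * I)) 0 := by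
    have : HasDerivAt (fun w : ℂ => 2 * Real.pi * I * w) (2 * Real.pi * I) 0 := by
      simpa using (hasDerivAt_id (0:ℂ)).const_mul (2 * Real.pi * I : ℂ)
    have := this.cexp.const_sub 1
    simpa
  have hs := hd.tendsto_slope_zero
  refine ⟨-(2 * Real.pi * I) * (qprod (ee τ) (ee 0) * qprod (ee τ) (ee (-0))), ?_, ?_⟩
  · refine mul_ne_zero (neg_ne_zero.2 Complex.two_pi_I_ne_zero) (mul_ne_zero ?_ ?_)
    · exact qprod_ee_ne_zero hτ (by simp)
    · exact qprod_ee_ne_zero hτ (by simp)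
  · have hc : Continuous fun w => qprod (ee τ) (ee w) * qprod (ee τ) (ee (-w)) := by
      have := hq.continuous
      have := h.continuous
      fun_prop
    refine (hs.mul (hc.tendsto 0 |>.mono_left nhdsWithin_le_nhds)).congr fun t => ?_
    simp [theta, ee_zero]
    ring

lemma HasOrd.mul {f g : ℂ → ℂ} {m n : ℕ} (h1 : HasOrd f m) (h2 : HasOrd g n) :
    HasOrd (fun t => f t * g t) (m + n) := by
  obtain ⟨l, hl, h1⟩ := h1
  obtain ⟨l', hl', h2⟩ := h2
  refine ⟨l * l', mul_ne_zero hl hl', (h1.mul h2).congr fun t => ?_⟩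
  ring

lemma hasOrd_const {c : ℂ} (h : c ≠ 0) : HasOrd (fun _ => c) 0 :=
  ⟨c, h, by simp⟩

lemma hasOrd_zero_of_ne {f : ℂ → ℂ} (hc : ContinuousAt f 0) (h : f 0 ≠ 0) : HasOrd f 0 :=
  ⟨f 0, h, by simpa using hc.tendsto.mono_left nhdsWithin_le_nhds⟩

lemma HasOrd.pow {f : ℂ → ℂ} {m : ℕ} (h : HasOrd f m) (k : ℕ) :
    HasOrd (fun t => f t ^ k) (m * k) := by
  obtain ⟨l, hl, h1⟩ := h
  refine ⟨l ^ k, pow_ne_zero _ hl, (h1.pow k).congr fun t => ?_⟩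
  ring

lemma HasOrd.prod {ι : Type*} (s : Finset ι) {f : ι → ℂ → ℂ} {m : ι → ℕ}
    (h : ∀ i ∈ s, HasOrd (f i) (m i)) : HasOrd (fun t => ∏ i ∈ s, f i t) (∑ i ∈ s, m i) := by
  classical
  induction s using Finset.induction_on with
  | empty => simpa using hasOrd_const one_ne_zero
  | insert a s ha ih =>
    simp only [Finset.prod_insert ha, Finset.sum_insert ha]
    exact (h a (by simp)).mul (ih fun i hi => h i (by grind))

lemma HasOrd.comp_mul {f : ℂ → ℂ} {m : ℕ} (h : HasOrd f m) {c : ℂ} (hc : c ≠ 0) :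
    HasOrd (fun t => f (c * t)) m := by
  obtain ⟨l, hl, h1⟩ := h
  refine ⟨c ^ m * l, mul_ne_zero (pow_ne_zero _ hc) hl, ?_⟩
  have h2 : Tendsto (fun t : ℂ => c * t) (𝓝[≠] 0) (𝓝[≠] 0) := by
    refine tendsto_nhdsWithin_iff.2 ⟨?_, ?_⟩
    · have : Tendsto (fun t : ℂ => c * t) (𝓝 0) (𝓝 (c * 0)) := (continuous_const_mul c).tendsto _
      rw [mul_zero] at this
      exact this.mono_left nhdsWithin_le_nhds
    · filter_upwards [self_mem_nhdsWithin] with t ht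
      grind
  refine ((h1.comp h2).const_mul (c ^ m)).congr fun t => ?_
  simp only [Function.comp_apply, mul_pow]
  field_simp

lemma theta_ord {τ : ℂ} (hτ : 0 < τ.im) {w : ℂ} (a b : ℤ) (hw : w = a + b * τ) :
    HasOrd (fun t => theta τ (w + t)) 1 := by
  subst hw
  have key : ∀ b : ℕ, HasOrd (fun t => theta τ ((b : ℂ) * τ + t)) 1 ∧
      HasOrd (fun t => theta τ (-(b : ℂ) * τ + t)) 1 := by
    intro b
    induction b with
    | zero => simpa using theta_ord_zero hτ
    | succ b ih =>
      constructor
      · have := (hasOrd_zero_of_ne (f := fun t => -ee (-(b * τ + t))) (by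
          have := differentiable_ee.continuous
          fun_prop) (by simpa using ee_ne _)).mul ih.1
        rw [zero_add] at this
        refine this.congr fun t _ => ?_
        rw [← theta_add_tau hτ]; grind
      · have := (hasOrd_zero_of_ne (f := fun t => -ee ((-(b + 1 : ℂ) * τ + t))) (by
          have := differentiable_ee.continuous
          fun_prop) (by simpa using ee_ne _)).mul ih.2
        rw [zero_add] at this
        refine this.congr fun t _ => ?_
        have h := theta_add_tau hτ (-(b + 1 : ℂ) * τ + t)
        rw [show (-(b + 1 : ℂ) * τ + t + τ) = -(b : ℂ) * τ + t by ring] at h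
        rw [h, ee_neg]
        have := ee_ne (-(b + 1 : ℂ) * τ + t)
        grind
  have hper : ∀ (n : ℤ) (w : ℂ), theta τ (w + n) = theta τ w := by
    intro n w
    have : Function.Periodic (theta τ) 1 := theta_add_one τ
    simpa using (this.int_mul n) w
  have h2 : HasOrd (fun t => theta τ ((b : ℂ) * τ + t)) 1 := by
    rcases Int.eq_nat_or_neg b with ⟨n, rfl | rfl⟩
    · simp_all
    simp_all
  refine h2.congr fun t _ => ?_
  rw [← hper a]; ring_nf

lemma HasOrd.factor {f : ℂ → ℂ} (hf : Differentiable ℂ f) {w : ℂ} {m : ℕ}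
    (h : HasOrd (fun t => f (w + t)) m) :
    ∃ F : ℂ → ℂ, AnalyticAt ℂ F w ∧ F w ≠ 0 ∧ ∀ᶠ z in 𝓝 w, f z = (z - w) ^ m * F z := by
  have ha : AnalyticAt ℂ f w := hf.analyticAt w
  have hne : ¬ ∀ᶠ z in 𝓝 w, f z = 0 := by
    intro h0
    obtain ⟨l, hl, h⟩ := h
    have h1 : ∀ᶠ t : ℂ in 𝓝 0, f (w + t) = 0 := by
      have : Tendsto (fun t : ℂ => w + t) (𝓝 0) (𝓝 w) := by
        simpa using ((continuous_const_add w).tendsto (0 : ℂ))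
      exact this.eventually h0
    have h2 : Tendsto (fun _ : ℂ => (0 : ℂ)) (𝓝[≠] 0) (𝓝 l) := by
      refine h.congr' ?_
      filter_upwards [h1.filter_mono nhdsWithin_le_nhds] with t ht
      grind
    simp_all
  obtain ⟨n, F, hF, hF0, he⟩ := ha.exists_eventuallyEq_pow_smul_nonzero_iff.2 hne
  have hn : HasOrd (fun t => f (w + t)) n := by
    have hw : Tendsto (fun t : ℂ => w + t) (𝓝 0) (𝓝 w) := by
      simpa using ((continuous_const_add w).tendsto (0 : ℂ))
    refine ⟨F w, hF0, ((hF.continuousAt.tendsto.comp hw).mono_left nhdsWithin_le_nhds).congr' ?_⟩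
    filter_upwards [(hw.eventually he).filter_mono nhdsWithin_le_nhds, self_mem_nhdsWithin]
      with t ht h0
    simp_all
  obtain rfl := h.unique hn
  tauto

lemma entire_quotient {f g : ℂ → ℂ} (hf : Differentiable ℂ f) (hg : Differentiable ℂ g)
    (m : ℂ → ℕ) (hfm : ∀ w, HasOrd (fun t => f (w + t)) (m w))
    (hgm : ∀ w, HasOrd (fun t => g (w + t)) (m w)) :
    ∃ k : ℂ → ℂ, Differentiable ℂ k ∧ (∀ w, k w ≠ 0) ∧ ∀ w, f w = k w * g w := by
  let k : ℂ → ℂ := fun w => limUnder (𝓝[≠] w) fun x => f x / g x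
  have key : ∀ w, ∃ F G : ℂ → ℂ, AnalyticAt ℂ F w ∧ F w ≠ 0 ∧ AnalyticAt ℂ G w ∧ G w ≠ 0 ∧
      (∀ᶠ z in 𝓝 w, f z = (z - w) ^ m w * F z) ∧ (∀ᶠ z in 𝓝 w, g z = (z - w) ^ m w * G z) ∧
      ∀ᶠ z in 𝓝 w, k z = F z / G z := by
    intro w
    obtain ⟨F, hF, hF0, heF⟩ := (hfm w).factor hf
    obtain ⟨G, hG, hG0, heG⟩ := (hgm w).factor hg
    refine ⟨F, G, hF, hF0, hG, hG0, heF, heG, ?_⟩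
    have hq : AnalyticAt ℂ (fun z => F z / G z) w := hF.div hG hG0
    have h1 : ∀ᶠ y in 𝓝 w, y ≠ w → f y / g y = F y / G y := by
      filter_upwards [heF, heG] with y h1 h2 hy
      rw [h1, h2, mul_div_mul_left _ _ (pow_ne_zero _ (sub_ne_zero.2 hy))]
    filter_upwards [h1.eventually_nhds, hq.eventually_continuousAt] with x hx hc
    refine Tendsto.limUnder_eq ((hc.tendsto.mono_left nhdsWithin_le_nhds).congr' ?_)
    have h2 : ∀ᶠ y in 𝓝[≠] x, y ≠ w := by
      by_cases hxw : x = w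
      · subst hxw; exact self_mem_nhdsWithin
      · exact (continuousAt_id.eventually_ne hxw).filter_mono nhdsWithin_le_nhds
    filter_upwards [hx.filter_mono nhdsWithin_le_nhds, h2] with y h3 h4
    grind
  refine ⟨k, fun w => ?_, fun w => ?_, fun w => ?_⟩
  · obtain ⟨F, G, hF, hF0, hG, hG0, -, -, h⟩ := key w
    exact (hF.div hG hG0).differentiableAt.congr_of_eventuallyEq h
  · obtain ⟨F, G, hF, hF0, hG, hG0, -, -, h⟩ := key w
    rw [h.self_of_nhds]
    positivity
  · obtain ⟨F, G, hF, hF0, hG, hG0, h1, h2, h⟩ := key w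
    rw [h.self_of_nhds, h1.self_of_nhds, h2.self_of_nhds]
    grind

lemma doubly_periodic_const {f : ℂ → ℂ} (hf : Differentiable ℂ f) {τ : ℂ} (hτ : 0 < τ.im)
    (h1 : ∀ w, f (w + 1) = f w) (h2 : ∀ w, f (w + τ) = f w) (z w : ℂ) : f z = f w := by
  refine hf.apply_eq_apply_of_bounded ?_ z w
  obtain ⟨M, hM⟩ := (isCompact_closedBall (0:ℂ) (1 + ‖τ‖)).exists_bound_of_continuousOn
    hf.continuous.continuousOn
  refine isBounded_iff_forall_norm_le.2 ⟨M, ?_⟩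
  rintro _ ⟨w, rfl⟩
  have p1 : Function.Periodic f 1 := h1
  have p2 : Function.Periodic f τ := h2
  set b := ⌊w.im / τ.im⌋ with hb
  set w1 := w - b * τ with hw1
  set a := ⌊w1.re⌋ with ha
  have e : f w = f (w1 - a) := by
    have := p1.sub_int_mul_eq (x := w1) a
    rw [mul_one] at this
    rw [this, hw1, p2.sub_int_mul_eq]
  rw [e]
  refine hM _ ?_
  rw [mem_closedBall_zero_iff]
  have hb0 : 0 ≤ Int.fract (w.im / τ.im) := Int.fract_nonneg _
  have hb1 : Int.fract (w.im / τ.im) < 1 := Int.fract_lt_one _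
  have him : w1.im = Int.fract (w.im / τ.im) * τ.im := by
    rw [hw1, Int.fract, sub_mul, div_mul_cancel₀ _ hτ.ne', ← hb]; simp
  have hre : (w1 - a).re = Int.fract w1.re := by rfl
  have h3 := Complex.norm_le_abs_re_add_abs_im (w1 - a)
  have h4 := Complex.abs_im_le_norm τ
  have h5 : (w1 - a).im = w1.im := by simp
  rw [hre, h5, him, abs_of_nonneg (Int.fract_nonneg _), abs_of_nonneg (by positivity)] at h3
  rw [abs_of_pos hτ] at h4
  have := Int.fract_lt_one w1.re
  nlinarith

lemma index_zero {k : ℂ → ℂ} (hk : Differentiable ℂ k) (h0 : ∀ w, k w ≠ 0) {τ : ℂ}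
    (hτ : 0 < τ.im) {M γ : ℂ} (h1 : ∀ w, k (w + 1) = k w)
    (h2 : ∀ w, k (w + τ) = ee (-M * w + γ) * k w) : M = 0 := by
  have hd : Differentiable ℂ (deriv k) := by
    fun_prop
  set l : ℂ → ℂ := fun w => deriv k w / k w with hl
  have hld : Differentiable ℂ l := fun w => (hd w).div (hk w) (h0 w)
  have hdd : Differentiable ℂ (deriv l) := by
    fun_prop
  have l1 : ∀ w, l (w + 1) = l w := by
    intro w
    have : deriv k (w + 1) = deriv k w := by
      rw [← deriv_comp_add_const]; simp_all
    grind
  have l2 : ∀ w, l (w + τ) = l w - 2 * Real.pi * I * M := by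
    intro w
    have : deriv k (w + τ) = -(2 * Real.pi * I * M) * ee (-M * w + γ) * k w +
        ee (-M * w + γ) * deriv k w := by
      rw [← deriv_comp_add_const]
      have : (fun x => k (x + τ)) = fun w => ee (-M * w + γ) * k w := funext h2
      rw [this]
      have hE : HasDerivAt (fun w => ee (-M * w + γ)) (-(2 * Real.pi * I * M) * ee (-M * w + γ))
          w := by
        have := (((hasDerivAt_id w).const_mul (-M)).add_const γ).const_mul (2 * Real.pi * I : ℂ)
        refine this.cexp.congr_deriv ?_
        simp only [ee, id]; ring
      exact (hE.mul (hk w).hasDerivAt).deriv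
    grind
  have hc : ∀ z w, deriv l z = deriv l w := by
    refine doubly_periodic_const hdd hτ (fun w => ?_) fun w => ?_
    · rw [← deriv_comp_add_const]; simp_all
    · rw [← deriv_comp_add_const]
      simp_all
  have haff : ∀ w, l w = l 0 + deriv l 0 * w := by
    intro w
    have hz : ∀ x, deriv (fun w => l w - deriv l 0 * w) x = 0 := by
      intro x
      have := ((hld x).hasDerivAt.sub ((hasDerivAt_id x).const_mul (deriv l 0))).deriv
      simp only [mul_one] at this
      rw [hc x 0, sub_self] at this
      simpa
    have := is_const_of_deriv_eq_zero (f := fun w => l w - deriv l 0 * w)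
      (hld.sub (differentiable_id.const_mul _)) hz w 0
    grind
  have hα : deriv l 0 = 0 := by
    have := l1 0
    grind
  have h3 := l2 0
  rw [zero_add, haff τ, hα] at h3
  have : 2 * Real.pi * I * M = 0 := by grind
  simpa

lemma theta_add_int_tau {τ : ℂ} (hτ : 0 < τ.im) (a : ℤ) :
    ∃ γ : ℂ, ∀ w, theta τ (w + a * τ) = ee (-a * w + γ) * theta τ w := by
  have hm : ee (1 / 2) = -1 := by
    rw [ee, show (2 * Real.pi * I * (1 / 2) : ℂ) = Real.pi * I by ring, Complex.exp_pi_mul_I]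
  have key : ∀ b : ℕ, ∃ γ : ℂ, ∀ w, theta τ (w + b * τ) = ee (-b * w + γ) * theta τ w := by
    intro b
    induction b with
    | zero => exact ⟨0, fun w => by simp [ee_zero]⟩
    | succ b ih =>
      obtain ⟨γ, ih⟩ := ih
      refine ⟨γ + 1 / 2 - b * τ, fun w => ?_⟩
      have : w + ((b + 1 : ℕ) : ℂ) * τ = (w + b * τ) + τ := by grind
      rw [this, theta_add_tau hτ, ih, neg_eq_neg_one_mul (ee _), ← hm, ← ee_add, ← mul_assoc,
        ← ee_add]
      grind
  rcases Int.eq_nat_or_neg a with ⟨b, rfl | rfl⟩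
  · simp_all
  · obtain ⟨γ, h⟩ := key b
    refine ⟨-γ - b * (b * τ), fun w => ?_⟩
    have := h (w + (-b : ℤ) * τ)
    rw [show w + ((-b : ℤ) : ℂ) * τ + b * τ = w by simp] at this
    rw [this, ← mul_assoc, ← ee_add, show (-((-b : ℤ) : ℂ) * w + (-γ - b * (b * τ)) +
      (-(b : ℂ) * (w + ((-b : ℤ) : ℂ) * τ) + γ)) = 0 by push_cast; ring, ee_zero, one_mul]

theorem theta_count {ι : Type*} (S : Finset ι) (a : ι → ℤ) (z : ι → ℂ) {g : ℂ → ℂ}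
    (hg : Differentiable ℂ g) {τ M γ : ℂ} (hτ : 0 < τ.im) (ha : ∀ i ∈ S, a i ≠ 0)
    (h1 : ∀ w, g (w + 1) = g w) (h2 : ∀ w, g (w + τ) = ee (-M * w + γ) * g w) (c : ℕ)
    [∀ w : ℂ, DecidablePred fun i => ∃ p q : ℤ, a i * w + z i = p + q * τ]
    (hord : ∀ w, HasOrd (fun t => g (w + t))
      (c * (S.filter fun i => ∃ p q : ℤ, a i * w + z i = p + q * τ).card)) :
    M = c * ∑ i ∈ S, (a i : ℂ) ^ 2 := by
  set G : ℂ → ℂ := fun w => ∏ i ∈ S, theta τ (a i * w + z i) ^ c with hG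
  have hth := differentiable_theta hτ
  have hGd : Differentiable ℂ G := by
    fun_prop
  have hGo : ∀ w, HasOrd (fun t => G (w + t))
      (c * (S.filter fun i => ∃ p q : ℤ, a i * w + z i = p + q * τ).card) := by
    intro w
    rw [Finset.card_filter, Finset.mul_sum]
    refine HasOrd.prod S fun i hi => ?_
    rw [mul_comm c]
    refine HasOrd.pow (f := fun t => theta τ (a i * (w + t) + z i)) ?_ c
    have hai : (a i : ℂ) ≠ 0 := by simp_all
    split_ifs with h
    · obtain ⟨p, q, h⟩ := h
      refine ((theta_ord hτ p q h).comp_mul hai).congr fun t _ => ?_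
      grind
    · refine hasOrd_zero_of_ne ?_ ?_
      · have := hth.continuous; fun_prop
      · rw [add_zero]
        refine theta_ne_zero hτ fun p q hpq => h ⟨p, q, hpq⟩
  obtain ⟨k, hk, hk0, he⟩ := entire_quotient hg hGd _ hord hGo
  have hG1 : ∀ w, G (w + 1) = G w := by
    intro w
    refine Finset.prod_congr rfl fun i _ => ?_
    have p : Function.Periodic (theta τ) 1 := theta_add_one τ
    have := (p.int_mul (a i)) (a i * w + z i)
    rw [← this]; ring_nf
  choose γ' hγ' using fun i => theta_add_int_tau hτ (a i)
  have hG2 : ∀ w, G (w + τ) = ee (-(c * ∑ i ∈ S, (a i : ℂ) ^ 2) * w +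
      c * ∑ i ∈ S, (-(a i : ℂ) * z i + γ' i)) * G w := by
    intro w
    have hprod : ∀ (f : ι → ℂ), ee (∑ i ∈ S, f i) = ∏ i ∈ S, ee (f i) := by
      intro f; simp only [ee, Finset.mul_sum, Complex.exp_sum]
    have : -(c * ∑ i ∈ S, (a i : ℂ) ^ 2) * w + c * ∑ i ∈ S, (-(a i : ℂ) * z i + γ' i) =
        ∑ i ∈ S, c * (-(a i : ℂ) * (a i * w + z i) + γ' i) := by
      simp only [mul_add, Finset.mul_sum, Finset.sum_add_distrib, Finset.sum_mul, neg_mul,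
        ← Finset.sum_neg_distrib]
      grind
    rw [this, hprod, hG, ← Finset.prod_mul_distrib]
    refine Finset.prod_congr rfl fun i _ => ?_
    rw [ee_nat_mul, ← mul_pow, ← hγ']
    grind
  have hfreq : ∀ w, ∃ᶠ x in 𝓝[≠] w, G x ≠ 0 := by
    intro w
    obtain ⟨F, hF, hF0, h⟩ := (hGo w).factor hGd
    refine Eventually.frequently ?_
    filter_upwards [h.filter_mono nhdsWithin_le_nhds,
      (hF.continuousAt.eventually_ne hF0).filter_mono nhdsWithin_le_nhds,
      self_mem_nhdsWithin] with x h1 h2 h3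
    rw [h1]
    exact mul_ne_zero (pow_ne_zero _ (sub_ne_zero.2 h3)) h2
  have ext : ∀ f1 f2 : ℂ → ℂ, Continuous f1 → Continuous f2 →
      (∀ w, f1 w * G w = f2 w * G w) → ∀ w, f1 w = f2 w := by
    intro f1 f2 c1 c2 h w
    by_contra hne
    have : ∀ᶠ x in 𝓝[≠] w, f1 x ≠ f2 x :=
      (c1.continuousAt.ne_iff_eventually_ne c2.continuousAt).1 hne |>.filter_mono
        nhdsWithin_le_nhds
    obtain ⟨x, hx1, hx2⟩ := ((hfreq w).and_eventually this).exists
    grind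
  have hkc := hk.continuous
  have hec := differentiable_ee.continuous
  have k1 : ∀ w, k (w + 1) = k w := by
    refine ext _ _ (by fun_prop) hkc fun w => ?_
    rw [← he, ← hG1, ← he, h1]
  have k2 : ∀ w, k (w + τ) = ee (-(M - c * ∑ i ∈ S, (a i : ℂ) ^ 2) * w +
      (γ - c * ∑ i ∈ S, (-(a i : ℂ) * z i + γ' i))) * k w := by
    refine ext _ _ (by fun_prop) (by fun_prop) fun w => ?_
    rw [mul_assoc, ← he]
    have e1 := he (w + τ)
    rw [h2, hG2] at e1
    have := ee_ne (-(c * ∑ i ∈ S, (a i : ℂ) ^ 2) * w + c * ∑ i ∈ S, (-(a i : ℂ) * z i + γ' i))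
    apply mul_left_cancel₀ this
    rw [mul_left_comm, ← e1, ← mul_assoc, ← ee_add]
    grind
  exact sub_eq_zero.1 (index_zero hk hk0 hτ k1 k2)

lemma qParam_one (z : ℂ) : Function.Periodic.qParam 1 z = ee z := by
  simp only [Function.Periodic.qParam, ee]
  simp

/-- The function of `s = exp(2πiω)` attached to a `1`-periodic function of `ω`. -/
noncomputable def cusp (F : ℂ → ℂ → ℂ) (u s : ℂ) : ℂ := Function.Periodic.cuspFunction 1 (F u) s

lemma cusp_ee {F : ℂ → ℂ → ℂ} {u : ℂ} (h : ∀ ω, F u (ω + 1) = F u ω) (ω : ℂ) :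
    cusp F u (ee ω) = F u ω := by
  rw [← qParam_one, cusp, Function.Periodic.eq_cuspFunction one_ne_zero]
  simpa

lemma ee_log {s0 ω0 : ℂ} (h : ee ω0 = s0) {s : ℂ} (hs : s ≠ 0) :
    ee (ω0 + Complex.log (s / s0) / (2 * Real.pi * I)) = s := by
  have h0 : s0 ≠ 0 := h ▸ ee_ne _
  rw [ee_add, h, ee, mul_div_cancel₀ _ Complex.two_pi_I_ne_zero,
    Complex.exp_log (div_ne_zero hs h0)]
  grind

theorem fam_cusp {F : ℂ → ℂ → ℂ} {W Ω : Set (ℂ × ℂ)} (hp : ∀ u ω, F u (ω + 1) = F u ω)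
    (hΩ : IsOpen Ω) (hW : IsOpen W) (hWΩ : ∀ u ω, (u, ee ω) ∈ Ω ↔ (u, ω) ∈ W)
    (hd : DifferentiableOn ℂ (fun p : ℂ × ℂ => F p.1 p.2) W)
    (hb : ∀ u, (u, (0:ℂ)) ∈ Ω → ∃ M H : ℝ, ∀ ω : ℂ, H ≤ ω.im → ‖F u ω‖ ≤ M) :
    Fam Ω (cusp F) := by
  have key : ∀ p ∈ Ω, p.2 ≠ 0 →
      DifferentiableAt ℂ (fun q : ℂ × ℂ => cusp F q.1 q.2) p := by
    rintro ⟨u, s⟩ hp0 hs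
    obtain ⟨ω, rfl⟩ := exists_ee hs
    have hw := (hWΩ u ω).1 hp0
    have hd1 := (hd _ hw).differentiableAt (hW.mem_nhds hw)
    set l : ℂ × ℂ → ℂ × ℂ := fun q => (q.1, ω + Complex.log (q.2 / ee ω) / (2 * Real.pi * I))
      with hl
    have hl0 : l (u, ee ω) = (u, ω) := by simp_all
    have hld : DifferentiableAt ℂ l (u, ee ω) := by
      have : DifferentiableAt ℂ (fun q : ℂ × ℂ => Complex.log (q.2 / ee ω)) (u, ee ω) :=
        DifferentiableAt.clog (by fun_prop) (by simp_all)
      fun_prop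
    rw [← hl0] at hd1
    refine (hd1.comp (u, ee ω) hld).congr_of_eventuallyEq ?_
    have : ∀ᶠ q : ℂ × ℂ in 𝓝 (u, ee ω), q.2 ≠ 0 :=
      continuous_snd.continuousAt.eventually_ne (ee_ne ω)
    filter_upwards [this] with q hq
    simp only [Function.comp_apply, hl]
    rw [← cusp_ee (hp _), ee_log rfl hq]
  refine ⟨hΩ, fun p hp h0 => (key p hp h0).continuousAt, fun p hp h0 => ?_, fun p hp0 => ?_⟩
  · fun_prop
  · by_cases h0 : p.2 = 0
    · have hp1 : (p.1, (0:ℂ)) ∈ Ω := by grind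
      obtain ⟨M, H, hM⟩ := hb p.1 hp1
      rw [h0]
      obtain ⟨ρ, hρ, hsub⟩ := exists_polydisc hΩ hp1
      refine Function.Periodic.differentiableAt_cuspFunction_zero zero_lt_one
        (fun z => by simp_all) ?_ ?_
      · have h1 : ∀ᶠ z in Filter.comap Complex.im atTop,
            Function.Periodic.qParam 1 z ∈ closedBall (0:ℂ) ρ :=
          ((Function.Periodic.qParam_tendsto zero_lt_one).mono_right
            nhdsWithin_le_nhds).eventually (closedBall_mem_nhds _ hρ)
        filter_upwards [h1] with z hz
        rw [qParam_one] at hz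
        have hw := (hWΩ p.1 z).1 (hsub ⟨mem_closedBall_self hρ.le, hz⟩)
        exact ((hd _ hw).differentiableAt (hW.mem_nhds hw)).comp (f := fun ω => (p.1, ω)) z
          (by fun_prop)
      · refine Asymptotics.IsBigO.of_bound M ?_
        have h1 : ∀ᶠ z in Filter.comap Complex.im atTop, H ≤ z.im :=
          tendsto_comap.eventually (eventually_ge_atTop H)
        filter_upwards [h1] with z hz
        simp_all
    fun_prop

/-- Functions with the transformation laws of a restriction of a modular form to a plane
through a one-dimensional cusp. -/
structure FJ (τ : ℂ) (A : ℝ) (β : ℂ) (f : ℂ → ℂ → ℂ) : Prop where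
  hτ : 0 < τ.im
  hA : 0 < A
  hβ : β.im = A * τ.im / 2
  p1 : ∀ w ω, f (w + 1) ω = f w ω
  p2 : ∀ w ω, f w (ω + 1) = f w ω
  p3 : ∀ w ω, f (w + τ) (ω + A * w + β) = f w ω
  hol : DifferentiableOn ℂ (fun p : ℂ × ℂ => f p.1 p.2)
    {p | A * p.1.im ^ 2 < 2 * τ.im * p.2.im}

/-- The height function invariant under the transformation laws. -/
noncomputable def ht (τ : ℂ) (A : ℝ) (w ω : ℂ) : ℝ := ω.im - A * w.im ^ 2 / (2 * τ.im)

lemma FJ.shift {τ : ℂ} {A : ℝ} {β : ℂ} {f : ℂ → ℂ → ℂ} (h : FJ τ A β f) (w ω : ℂ) (n : ℤ) :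
    ∃ ω', f (w + n * τ) ω' = f w ω ∧ ht τ A (w + n * τ) ω' = ht τ A w ω := by
  have hτ := h.hτ
  have up : ∀ w ω, ht τ A (w + τ) (ω + A * w + β) = ht τ A w ω := by
    intro w ω
    have := h.hβ
    simp only [ht, Complex.add_im, Complex.im_ofReal_mul, this]
    grind
  rcases Int.eq_nat_or_neg n with ⟨b, rfl | rfl⟩
  · induction b with
    | zero => exact ⟨ω, by simp⟩
    | succ b ih =>
      obtain ⟨ω', h1, h2⟩ := ih
      refine ⟨ω' + A * (w + (b : ℤ) * τ) + β, ?_⟩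
      rw [show w + ((b + 1 : ℕ) : ℤ) * τ = w + (b : ℤ) * τ + τ by grind, h.p3, up]
      grind
  · induction b with
    | zero => exact ⟨ω, by simp⟩
    | succ b ih =>
      obtain ⟨ω', h1, h2⟩ := ih
      set w' := w + (-((b + 1 : ℕ) : ℤ) : ℤ) * τ with hw'
      have e : w' + τ = w + (-(b : ℤ) : ℤ) * τ := by grind
      refine ⟨ω' - A * w' - β, ?_⟩
      rw [← h1, ← h2, ← e]
      have a := h.p3 w' (ω' - A * w' - β)
      have b := up w' (ω' - A * w' - β)
      rw [show ω' - A * w' - β + A * w' + β = ω' by ring] at a b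
      grind

theorem FJ.bound {τ : ℂ} {A : ℝ} {β : ℂ} {f : ℂ → ℂ → ℂ} (h : FJ τ A β f) :
    ∃ M, ∀ w ω, 1 ≤ ht τ A w ω → ‖f w ω‖ ≤ M := by
  have hτ := h.hτ
  have hA := h.hA
  have hdom : ∀ w ω, 0 < ht τ A w ω →
      (w, ω) ∈ {p : ℂ × ℂ | A * p.1.im ^ 2 < 2 * τ.im * p.2.im} := by
    intro w ω hp
    rw [ht, sub_pos, div_lt_iff₀ (by simpa)] at hp
    grind
  have hopen : IsOpen {p : ℂ × ℂ | A * p.1.im ^ 2 < 2 * τ.im * p.2.im} :=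
    isOpen_lt (by fun_prop) (by fun_prop)
  let Q : ℝ × ℝ × ℝ → ℂ × ℂ := fun p =>
    (p.1 + p.2.1 * τ, p.2.2 + (1 + A * (p.2.1 * τ.im) ^ 2 / (2 * τ.im) : ℝ) * I)
  have hQ : Continuous Q := by fun_prop
  have hQ1 : ∀ p, (Q p).1.im = p.2.1 * τ.im := by
    intro p
    simp [Q]
  have hQ2 : ∀ p, (Q p).2.im = 1 + A * (p.2.1 * τ.im) ^ 2 / (2 * τ.im) := by
    intro p
    simp only [Q, Complex.add_im, Complex.ofReal_im, Complex.im_ofReal_mul, Complex.I_im,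
      mul_one, zero_add]
  obtain ⟨M, hM⟩ := ((isCompact_Icc (a := (0:ℝ)) (b := 1)).prod
    ((isCompact_Icc (a := (0:ℝ)) (b := 1)).prod
      (isCompact_Icc (a := (0:ℝ)) (b := 1)))).exists_bound_of_continuousOn
    (f := fun p => f (Q p).1 (Q p).2) (by
      refine h.hol.continuousOn.comp hQ.continuousOn fun p _ => hdom _ _ ?_
      rw [ht, hQ1, hQ2]; simp)
  refine ⟨M, fun w ω hv => ?_⟩
  have bd : ∀ w ω, ht τ A w ω = 1 → ‖f w ω‖ ≤ M := by
    intro w ω hv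
    have P1 : ∀ ω, Function.Periodic (fun w => f w ω) 1 := fun ω w => h.p1 w ω
    have P2 : ∀ w, Function.Periodic (f w) 1 := fun w ω => h.p2 w ω
    obtain ⟨ω', e1, e2⟩ := h.shift w ω (-⌊w.im / τ.im⌋)
    set w1 := w + (-⌊w.im / τ.im⌋ : ℤ) * τ with hw1
    set b := Int.fract (w.im / τ.im) with hb
    have him : w1.im = b * τ.im := by
      rw [hw1, hb, Int.fract, sub_mul, div_mul_cancel₀ _ hτ.ne']; simp; ring
    set x := w1.re - b * τ.re with hx
    have hw1' : w1 = x + b * τ := by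
      apply Complex.ext
      · simp [hx]
      simpa
    have e3 : f w1 ω' = f (w1 - ⌊x⌋) (ω' - ⌊ω'.re⌋) := by
      have i1 := (P1 ω').sub_int_mul_eq (x := w1) ⌊x⌋
      have i2 := (P2 (w1 - ⌊x⌋)).sub_int_mul_eq (x := ω') ⌊ω'.re⌋
      grind
    rw [← e1, e3]
    have := hM (Int.fract x, b, Int.fract ω'.re)
      ⟨⟨Int.fract_nonneg _, (Int.fract_lt_one _).le⟩, ⟨Int.fract_nonneg _, (Int.fract_lt_one _).le⟩,
        ⟨Int.fract_nonneg _, (Int.fract_lt_one _).le⟩⟩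
    have q1 : (Q (Int.fract x, b, Int.fract ω'.re)).1 = w1 - ⌊x⌋ := by
      rw [hw1']
      simp only [Q, Int.fract]
      push_cast; ring
    have q2 : (Q (Int.fract x, b, Int.fract ω'.re)).2 = ω' - ⌊ω'.re⌋ := by
      rw [hv, ht, him] at e2
      apply Complex.ext
      · simp only [Q, Complex.add_re, Complex.ofReal_re, Complex.re_ofReal_mul, Complex.I_re,
          mul_zero, add_zero, Complex.sub_re, Complex.intCast_re, Int.fract]
      · rw [hQ2]
        simp only [Complex.sub_im, Complex.intCast_im]
        grind
    grind
  rcases hv.eq_or_lt with hv | hv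
  · grind
  set k : ℝ := A / (2 * τ.im) with hk
  have hk0 : 0 < k := by positivity
  set R := Real.sqrt ((ht τ A w ω - 1) * 2 / k) with hR
  have hR2 : R ^ 2 = (ht τ A w ω - 1) * 2 / k :=
    Real.sq_sqrt (div_nonneg (by simpa) hk0.le)
  have hR0 : 0 < R := Real.sqrt_pos.2 (div_pos (by simpa) hk0)
  let d : ℂ → ℂ × ℂ := fun u => (w + u, ω + k * (2 * w.im * u - I * u ^ 2 / 2))
  have hd : ∀ u, ht τ A (d u).1 (d u).2 = ht τ A w ω - k * ‖u‖ ^ 2 / 2 := by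
    intro u
    have h1 : ‖u‖ ^ 2 = u.re ^ 2 + u.im ^ 2 := by
      rw [← Complex.normSq_eq_norm_sq, Complex.normSq_apply]; ring
    have h2 : (d u).2.im = ω.im + k * (2 * w.im * u.im - (u.re ^ 2 - u.im ^ 2) / 2) := by
      have e : I * u ^ 2 / 2 = ((-(u.re * u.im) : ℝ) : ℂ) +
          (((u.re ^ 2 - u.im ^ 2) / 2 : ℝ) : ℂ) * I := by
        conv_lhs => rw [← Complex.re_add_im u]
        push_cast
        linear_combination (I * u.im ^ 2 / 2 + u.re * u.im) * Complex.I_sq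
      simp only [d]
      rw [e]
      simp only [Complex.add_im, Complex.mul_im, Complex.ofReal_re, Complex.ofReal_im, zero_mul,
        add_zero, Complex.sub_im, Complex.I_im, Complex.I_re, mul_one, mul_zero]
      simp
    have h3 : (d u).1.im = w.im + u.im := by rfl
    rw [ht, ht, h2, h3, h1, hk]; ring
  have hdd : Differentiable ℂ d := by fun_prop
  have hon : ∀ u ∈ closedBall (0:ℂ) R, DifferentiableAt ℂ (fun u => f (d u).1 (d u).2) u := by
    intro u hu
    rw [mem_closedBall_zero_iff] at hu
    have hu2 : ‖u‖ ^ 2 ≤ R ^ 2 := by gcongr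
    have hin : d u ∈ _ := hdom (d u).1 (d u).2 (by
      rw [hd]
      rw [hR2, le_div_iff₀ hk0] at hu2; grind)
    exact ((h.hol _ hin).differentiableAt (hopen.mem_nhds hin)).comp u (hdd u)
  simpa [d] using Complex.norm_le_of_forall_mem_frontier_norm_le (U := ball (0:ℂ) R)
    (f := fun u => f (d u).1 (d u).2) isBounded_ball
    ⟨fun u hu => (hon u (ball_subset_closedBall hu)).differentiableWithinAt, by
      rw [closure_ball _ hR0.ne']
      exact fun u hu => (hon u hu).continuousAt.continuousWithinAt⟩
    (fun u hu => by
      rw [frontier_ball _ hR0.ne', mem_sphere_zero_iff_norm] at hu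
      refine bd _ _ ?_
      rw [hd, hu, hR2]; grind) (subset_closure (mem_ball_self hR0))

lemma ee_norm_le {ω : ℂ} {H : ℝ} : ‖ee ω‖ ≤ Real.exp (-2 * Real.pi * H) ↔ H ≤ ω.im := by
  rw [norm_ee, Real.exp_le_exp]
  have := Real.pi_pos
  simp_all

/-- The domain of the expansion in `s = exp(2πiω)`. -/
def FJdom (τ : ℂ) (A : ℝ) : Set (ℂ × ℂ) :=
  {p | ‖p.2‖ < Real.exp (-Real.pi * A * p.1.im ^ 2 / τ.im)}

lemma FJdom_open (τ : ℂ) (A : ℝ) : IsOpen (FJdom τ A) :=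
  isOpen_lt (by fun_prop) (by fun_prop)

lemma FJdom_zero (τ : ℂ) (A : ℝ) (w : ℂ) : (w, (0:ℂ)) ∈ FJdom τ A := by
  simp [FJdom, Real.exp_pos]

lemma FJdom_ee {τ : ℂ} {A : ℝ} (hτ : 0 < τ.im) (w ω : ℂ) :
    (w, ee ω) ∈ FJdom τ A ↔ A * w.im ^ 2 < 2 * τ.im * ω.im := by
  change ‖ee ω‖ < _ ↔ _
  rw [norm_ee, Real.exp_lt_exp, lt_div_iff₀ hτ]
  have := Real.pi_pos
  constructor <;> intro h <;> nlinarith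

lemma FJ.fam {τ : ℂ} {A : ℝ} {β : ℂ} {f : ℂ → ℂ → ℂ} (h : FJ τ A β f) :
    Fam (FJdom τ A) (cusp f) := by
  obtain ⟨M, hM⟩ := h.bound
  refine fam_cusp h.p2 (FJdom_open τ A) (isOpen_lt (by fun_prop) (by fun_prop))
    (fun u ω => FJdom_ee h.hτ u ω) h.hol fun u _ => ⟨M, 1 + A * u.im ^ 2 / (2 * τ.im), ?_⟩
  intro ω hω
  exact hM u ω (by rw [ht]; grind)

theorem FJ.leading {τ : ℂ} {A : ℝ} {β : ℂ} {f : ℂ → ℂ → ℂ} (h : FJ τ A β f) (m : ℂ → ℕ)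
    (hord : ∀ w, ∃ H : ℝ, ∀ ω : ℂ, H ≤ ω.im → HasOrd (fun t => f (w + t) ω) (m w))
    (hnz : ∀ w, ∃ δ > 0, ∃ H : ℝ, ∀ w' ∈ ball w δ, w' ≠ w → ∀ ω : ℂ, H ≤ ω.im → f w' ω ≠ 0)
    {w₁ : ℂ} (h1 : m w₁ = 0) :
    ∃ (C : ℕ) (g : ℂ → ℂ), HasOrd (cusp f w₁) C ∧ Differentiable ℂ g ∧
      (∀ w, g (w + 1) = g w) ∧ (∀ w, g (w + τ) = ee (-(C * A) * w + -C * β) * g w) ∧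
      (∀ w, HasOrd (fun t => g (w + t)) (m w)) ∧ (C = 0 → ∀ w, g w = cusp f w 0) := by
  have hF := h.fam
  have hπ := Real.pi_pos
  have hτ := h.hτ
  have nz0 : ∀ w, m w = 0 → ∃ H : ℝ, ∀ ω : ℂ, H ≤ ω.im → f w ω ≠ 0 := by
    intro w hw
    obtain ⟨H, hH⟩ := hord w
    refine ⟨max H (1 + A * w.im ^ 2 / (2 * τ.im)), fun ω hω => ?_⟩
    obtain ⟨l, hl, hl2⟩ := hH ω (le_trans (le_max_left _ _) hω)
    rw [hw] at hl2
    simp only [pow_zero, div_one] at hl2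
    have hdom : (w, ω) ∈ {p : ℂ × ℂ | A * p.1.im ^ 2 < 2 * τ.im * p.2.im} := by
      have := le_trans (le_max_right _ _) hω
      have h2 : A * w.im ^ 2 / (2 * τ.im) < ω.im := by grind
      rw [div_lt_iff₀ (by simpa)] at h2
      grind
    have hop : IsOpen {p : ℂ × ℂ | A * p.1.im ^ 2 < 2 * τ.im * p.2.im} :=
      isOpen_lt (by fun_prop) (by fun_prop)
    have hc : ContinuousAt (fun t => f (w + t) ω) 0 := by
      have := ((h.hol _ hdom).differentiableAt (hop.mem_nhds hdom)).continuousAt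
      rw [← add_zero w] at this
      fun_prop
    have := tendsto_nhds_unique (hc.tendsto.mono_left (nhdsWithin_le_nhds (s := {0}ᶜ))) hl2
    simp_all
  have hgood : ∀ w, m w = 0 → Good (cusp f) w := by
    intro w hw
    obtain ⟨δ, hδ, H, hH⟩ := hnz w
    obtain ⟨H', hH'⟩ := nz0 w hw
    refine ⟨Real.exp (-2 * Real.pi * max H H'), Real.exp_pos _, δ, hδ, fun u hu t ht htρ => ?_⟩
    obtain ⟨ω, rfl⟩ := exists_ee ht
    rw [ee_norm_le] at htρ
    rw [cusp_ee (h.p2 u)]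
    grind
  have hcd : ∀ᶠ s in 𝓝 (0:ℂ), DifferentiableAt ℂ (cusp f w₁) s := by
    have : ∀ᶠ s in 𝓝 (0:ℂ), (w₁, s) ∈ FJdom τ A :=
      (Continuous.prodMk_right w₁).continuousAt.eventually
        ((FJdom_open τ A).mem_nhds (FJdom_zero τ A w₁))
    filter_upwards [this] with s hs
    exact hF.ht _ hs
  obtain ⟨C, hC⟩ := exists_ord (Complex.analyticAt_iff_eventually_differentiableAt.2 hcd) (by
    obtain ⟨ρ, hρ, δ, hδ, hg⟩ := hgood w₁ h1
    have : ∃ᶠ s in 𝓝[≠] (0:ℂ), cusp f w₁ s ≠ 0 := by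
      refine Eventually.frequently ?_
      filter_upwards [self_mem_nhdsWithin,
        nhdsWithin_le_nhds (closedBall_mem_nhds (0:ℂ) hρ)] with s hs hs2
      exact hg _ (mem_ball_self hδ) _ hs (by simpa using hs2)
    exact this.filter_mono nhdsWithin_le_nhds)
  obtain ⟨k, hk1, hk2, hk3⟩ := Fam.order isOpen_univ isPreconnected_univ (mem_univ w₁) hF
    (fun u => by simp [FJdom_zero]) (hgood w₁ h1) hC
  have kc : ∀ w, Tendsto (k w) (𝓝[≠] 0) (𝓝 (k w 0)) := fun w =>
    (hk1.ht (w, 0) (FJdom_zero _ _ _)).continuousAt.tendsto.mono_left nhdsWithin_le_nhds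
  refine ⟨C, fun w => k w 0, hC, fun w => hk1.diff_zero (FJdom_zero _ _ _), fun w => ?_,
    fun w => ?_, fun w => ?_, fun hC0 w => ?_⟩
  · refine tendsto_nhds_unique (kc (w + 1)) ((kc w).congr' ?_)
    filter_upwards [self_mem_nhdsWithin] with s hs
    have hs : s ≠ 0 := hs
    obtain ⟨ω, rfl⟩ := exists_ee hs
    apply mul_left_cancel₀ (pow_ne_zero C hs)
    rw [← hk2 _ _ hs, ← hk2 _ _ hs, cusp_ee (h.p2 _), cusp_ee (h.p2 _), h.p1]
  · set q := ee (A * w + β) with hq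
    have hq0 : q ≠ 0 := ee_ne _
    have t1 : Tendsto (fun s => k (w + τ) (q * s)) (𝓝[≠] 0) (𝓝 (k (w + τ) 0)) := by
      refine (kc (w + τ)).comp (tendsto_nhdsWithin_iff.2 ⟨?_, ?_⟩)
      · have : Tendsto (fun t : ℂ => q * t) (𝓝 0) (𝓝 (q * 0)) := (continuous_const_mul q).tendsto _
        rw [mul_zero] at this
        exact this.mono_left nhdsWithin_le_nhds
      · filter_upwards [self_mem_nhdsWithin] with t ht
        grind
    have e : ee (-(C * A) * w + -C * β) = (q ^ C)⁻¹ := by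
      rw [hq, ← ee_nat_mul, ← ee_neg]; congr 1; ring
    change k (w + τ) 0 = _ * k w 0
    rw [e]
    refine tendsto_nhds_unique t1 (((kc w).const_mul _).congr' ?_)
    filter_upwards [self_mem_nhdsWithin] with s hs
    have hs : s ≠ 0 := hs
    have hqs : q * s ≠ 0 := mul_ne_zero hq0 hs
    obtain ⟨ω, rfl⟩ := exists_ee hs
    have e1 := hk2 (w + τ) _ hqs
    have e2 := hk2 w _ hs
    rw [hq, ← ee_add, cusp_ee (h.p2 _), show A * w + β + ω = ω + A * w + β by ring, h.p3,
      ← cusp_ee (h.p2 _), e2] at e1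
    rw [show ω + A * w + β = (A * w + β) + ω by ring, ee_add, ← hq, mul_pow] at e1
    have := pow_ne_zero C hq0
    have := pow_ne_zero C hs
    grind
  · obtain ⟨δ, hδ, H, hH⟩ := hnz w
    obtain ⟨H', hH'⟩ := hord w
    obtain ⟨ρ, hρ, hsub⟩ := exists_polydisc (FJdom_open τ A) (FJdom_zero τ A w)
    set r := min ρ (Real.exp (-2 * Real.pi * max H H')) with hr
    have hr0 : 0 < r := lt_min hρ (Real.exp_pos _)
    set Ω' : Set (ℂ × ℂ) := {p | (w + p.2, p.1) ∈ FJdom τ A ∧ p.1 ∈ ball (0:ℂ) r} with hΩ'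
    have hfm : Fam Ω' (fun s t => k (w + t) s) := by
      refine ⟨?_, fun p hp _ => ?_, fun p hp _ => ?_, fun p hp => ?_⟩
      · exact ((FJdom_open τ A).preimage (f := fun p : ℂ × ℂ => (w + p.2, p.1))
          (by fun_prop)).inter (isOpen_ball.preimage continuous_fst)
      · exact (hk1.cont hp.1).comp (f := fun p : ℂ × ℂ => (w + p.2, p.1)) (by fun_prop)
      · exact hk1.ht _ hp.1
      · exact (hk1.hu' hp.1).comp (f := fun t => w + t) p.2 (by fun_prop)
    have hsmall : ∀ s, s ∈ ball (0:ℂ) r → s ≠ 0 →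
        ∃ ω, ee ω = s ∧ H ≤ ω.im ∧ H' ≤ ω.im := by
      intro s hs h0
      obtain ⟨ω, rfl⟩ := exists_ee h0
      rw [mem_ball_zero_iff] at hs
      have := ee_norm_le.1 (hs.le.trans (min_le_right _ _))
      grind
    have hm0 : ∀ t ∈ ball (0:ℂ) δ, t ≠ 0 → m (w + t) = 0 := by
      intro t ht ht0
      by_contra hm
      obtain ⟨H2, hH2⟩ := hord (w + t)
      have hdist : w + t ∈ ball w δ := by simpa using ht
      set ω : ℂ := ((max (max H H2) (1 + A * (w + t).im ^ 2 / (2 * τ.im)) : ℝ) : ℂ) * I with hω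
      have him : ω.im = max (max H H2) (1 + A * (w + t).im ^ 2 / (2 * τ.im)) := by
        rw [hω, Complex.im_ofReal_mul]; simp
      have hle : H ≤ ω.im := him ▸ (le_trans (le_max_left _ _) (le_max_left _ _))
      have hle2 : H2 ≤ ω.im := him ▸ (le_trans (le_max_right _ _) (le_max_left _ _))
      have hle3 : 1 + A * (w + t).im ^ 2 / (2 * τ.im) ≤ ω.im := him ▸ le_max_right _ _
      have hne := hH _ hdist (by simpa) ω hle
      have ho := hH2 ω hle2
      have hdom : (w + t, ω) ∈ {p : ℂ × ℂ | A * p.1.im ^ 2 < 2 * τ.im * p.2.im} := by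
        have h2 : A * (w + t).im ^ 2 / (2 * τ.im) < ω.im := by grind
        rw [div_lt_iff₀ (by simpa)] at h2
        grind
      have hop : IsOpen {p : ℂ × ℂ | A * p.1.im ^ 2 < 2 * τ.im * p.2.im} :=
        isOpen_lt (by fun_prop) (by fun_prop)
      have hc : ContinuousAt (fun u => f (w + t + u) ω) 0 := by
        have := ((h.hol _ hdom).differentiableAt (hop.mem_nhds hdom)).continuousAt
        rw [← add_zero (w + t)] at this
        fun_prop
      exact hm (ho.unique (hasOrd_zero_of_ne hc (by simpa)))
    have hgd : ∀ s ∈ ball (0:ℂ) r, Good (fun s t => k (w + t) s) s := by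
      intro s hs
      refine ⟨δ / 2, by simpa, r - ‖s‖, by simpa using hs, fun u hu t ht htρ => ?_⟩
      have htb : t ∈ ball (0:ℂ) δ := by rw [mem_ball_zero_iff]; grind
      have hub : u ∈ ball (0:ℂ) r := by
        rw [mem_ball_zero_iff]
        rw [mem_ball, dist_eq_norm] at hu
        linarith [norm_le_norm_add_norm_sub' u s]
      by_cases hu0 : u = 0
      · grind
      · obtain ⟨ω, rfl, hω1, hω2⟩ := hsmall u hub hu0
        have := hk2 (w + t) _ hu0
        rw [cusp_ee (h.p2 _)] at this
        intro hz
        have hz : k (w + t) (ee ω) = 0 := hz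
        rw [hz, mul_zero] at this
        exact hH _ (by simpa using htb) (by simpa) ω hω1 this
    have hmem : ∀ s, (s, (0:ℂ)) ∈ Ω' ↔ s ∈ ball (0:ℂ) r := by
      intro s
      refine ⟨fun hs => hs.2, fun hs => ⟨hsub ⟨?_, ?_⟩, hs⟩⟩
      · simp [hρ.le]
      · rw [mem_ball_zero_iff] at hs
        simpa using hs.le.trans (min_le_left _ _)
    set s0 : ℂ := ((r / 2 : ℝ) : ℂ) with hs0
    have hs0b : s0 ∈ ball (0:ℂ) r := by
      rw [mem_ball_zero_iff, hs0, Complex.norm_real, Real.norm_of_nonneg (by grind)]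
      simpa
    have hs0n : s0 ≠ 0 := by
      rw [hs0]; exact_mod_cast (by grind : (r / 2 : ℝ) ≠ 0)
    have ho0 : HasOrd (fun t => k (w + t) s0) (m w) := by
      obtain ⟨ω, hω, hω1, hω2⟩ := hsmall s0 hs0b hs0n
      obtain ⟨l, hl, hl2⟩ := hH' ω hω2
      refine ⟨(s0 ^ C)⁻¹ * l, mul_ne_zero (inv_ne_zero (pow_ne_zero _ hs0n)) hl,
        (hl2.const_mul (s0 ^ C)⁻¹).congr fun t => ?_⟩
      have := hk2 (w + t) _ hs0n
      rw [← hω, cusp_ee (h.p2 _), hω] at this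
      change _ * (f (w + t) ω / _) = k (w + t) s0 / _
      rw [this, mul_div_assoc, inv_mul_cancel_left₀ (pow_ne_zero _ hs0n)]
    obtain ⟨k2, hk21, hk22, hk23⟩ := Fam.order isOpen_ball (convex_ball (0:ℂ) r).isPreconnected
      hs0b hfm hmem (hgd s0 hs0b) ho0
    have h00 : (0:ℂ) ∈ ball (0:ℂ) r := mem_ball_self hr0
    exact hk21.hasOrd (f := fun s t => k (w + t) s) ((hmem 0).2 h00) (fun t ht => hk22 0 t ht) (hk23 0 h00 (hgd 0 h00))
  · have c1 := ((hF.ht (w, 0) (FJdom_zero _ _ _)).continuousAt.tendsto.mono_left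
      (nhdsWithin_le_nhds (s := {0}ᶜ)))
    refine tendsto_nhds_unique (kc w) (c1.congr' ?_)
    filter_upwards [self_mem_nhdsWithin] with s hs
    simp_all

theorem FJ.count {τ : ℂ} {A : ℝ} {β : ℂ} {f : ℂ → ℂ → ℂ} (h : FJ τ A β f)
    {ι : Type*} (S : Finset ι) (a : ι → ℤ) (z : ι → ℂ) (ha : ∀ i ∈ S, a i ≠ 0) (c : ℕ)
    [∀ w : ℂ, DecidablePred fun i => ∃ p q : ℤ, a i * w + z i = p + q * τ]
    (hord : ∀ w : ℂ, ∃ H : ℝ, ∀ ω : ℂ, H ≤ ω.im → HasOrd (fun t => f (w + t) ω)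
      (c * (S.filter fun i => ∃ p q : ℤ, a i * w + z i = p + q * τ).card))
    (hnz : ∀ w, ∃ δ > 0, ∃ H : ℝ, ∀ w' ∈ ball w δ, w' ≠ w → ∀ ω : ℂ, H ≤ ω.im → f w' ω ≠ 0)
    {w₁ : ℂ} (h1 : ∀ i ∈ S, ∀ p q : ℤ, a i * w₁ + z i ≠ p + q * τ) {C : ℕ}
    (hC : HasOrd (cusp f w₁) C) : C * A = c * ∑ i ∈ S, (a i : ℝ) ^ 2 := by
  obtain ⟨C', g, hC', hg, hg1, hg2, hg3, -⟩ := h.leading _ hord hnz (w₁ := w₁) (by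
    rw [Finset.filter_false_of_mem]; · simp
    simpa)
  obtain rfl := hC.unique hC'
  have := theta_count S a z hg h.hτ ha hg1 hg2 c hg3
  exact_mod_cast this

theorem FJ.const {τ : ℂ} {A : ℝ} {β : ℂ} {f : ℂ → ℂ → ℂ} (h : FJ τ A β f)
    (hord : ∀ w : ℂ, ∃ H : ℝ, ∀ ω : ℂ, H ≤ ω.im → HasOrd (fun t => f (w + t) ω) 0)
    (hnz : ∀ w, ∃ δ > 0, ∃ H : ℝ, ∀ w' ∈ ball w δ, w' ≠ w → ∀ ω : ℂ, H ≤ ω.im → f w' ω ≠ 0)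
    (w w' : ℂ) : cusp f w 0 = cusp f w' 0 ∧ cusp f w 0 ≠ 0 := by
  obtain ⟨C, g, hC, hg, hg1, hg2, hg3, hg4⟩ := h.leading (fun _ => 0) hord hnz (w₁ := 0) rfl
  have hC0 : C = 0 := by
    classical
    have := theta_count (∅ : Finset ℕ) (fun _ => 0) (fun _ => 0) hg h.hτ (by simp) hg1 hg2 0
      (by simpa)
    have hA : (A : ℂ) ≠ 0 := by exact_mod_cast h.hA.ne'
    simp_all
  rw [← hg4 hC0, ← hg4 hC0]
  refine ⟨doubly_periodic_const hg h.hτ hg1 (fun w => ?_) w w', fun h0 => ?_⟩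
  · rw [hg2, hC0]; simp [ee_zero]
  · obtain ⟨l, hl, hl2⟩ := hg3 w
    simp only [pow_zero, div_one] at hl2
    have hc : ContinuousAt (fun t => g (w + t)) 0 := by
      have := hg.continuous; fun_prop
    have := tendsto_nhds_unique (hc.tendsto.mono_left (nhdsWithin_le_nhds (s := {0}ᶜ))) hl2
    grind

theorem level_one {k : ℤ} {F : ℂ → ℂ} (hF : DifferentiableOn ℂ F {τ | 0 < τ.im})
    (hT : ∀ τ : ℂ, 0 < τ.im → F (τ + 1) = F τ)
    (hS : ∀ τ : ℂ, 0 < τ.im → F (-1 / τ) = τ ^ k * F τ)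
    (hb : ∃ M H : ℝ, ∀ τ : ℂ, H ≤ τ.im → ‖F τ‖ ≤ M) :
    (k < 0 → ∀ τ : ℂ, 0 < τ.im → F τ = 0) ∧
    (k = 0 → ∀ τ σ : ℂ, 0 < τ.im → 0 < σ.im → F τ = F σ) := by
  set f : UpperHalfPlane → ℂ := fun τ => F τ with hf
  have h1 : ∀ γ : Matrix.SpecialLinearGroup (Fin 2) ℤ, SlashAction.map k γ f = f := by
    apply SlashInvariantForm.slash_action_generators_SL2Z
    · ext τ
      rw [SlashInvariantForm.slash_S_apply]
      have := hS τ τ.im_pos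
      have e : (-(τ:ℂ))⁻¹ = -1 / (τ:ℂ) := by ring
      change F (-(τ:ℂ))⁻¹ * _ = F τ
      rw [e, this, mul_right_comm, ← zpow_add₀ τ.ne_zero, add_neg_cancel, zpow_zero, one_mul]
    · ext τ
      have hd : UpperHalfPlane.denom (Matrix.SpecialLinearGroup.toGL
          (Matrix.SpecialLinearGroup.map (Int.castRingHom ℝ) ModularGroup.T)) τ = 1 := by
        have a : ∀ M : Matrix.SpecialLinearGroup (Fin 2) ℤ,
          ∀ i j, ((Matrix.SpecialLinearGroup.toGL
          (Matrix.SpecialLinearGroup.map (Int.castRingHom ℝ) M)) : Matrix (Fin 2) (Fin 2) ℝ) i j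
            = ((M i j : ℤ) : ℝ) := fun M i j => rfl
        rw [UpperHalfPlane.denom, a, a, ModularGroup.coe_T]
        simp
      rw [ModularForm.SL_slash_apply]
      erw [hd]
      rw [_root_.one_zpow, mul_one, UpperHalfPlane.modular_T_smul]
      simp only [hf, UpperHalfPlane.coe_vadd]
      rw [add_comm]
      simpa using hT τ τ.im_pos
  have h2 : UpperHalfPlane.IsBoundedAtImInfty f := by
    obtain ⟨M, H, h⟩ := hb
    rw [UpperHalfPlane.isBoundedAtImInfty_iff]
    tauto
  let f' : ModularForm (Matrix.SpecialLinearGroup.mapGL (R := ℤ) (n := Fin 2) ℝ).range k :=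
    { toFun := f
      slash_action_eq' := by
        simpa
      holo' := by
        rw [UpperHalfPlane.mdifferentiable_iff]
        refine hF.congr fun τ hτ => ?_
        simp only [hf, Function.comp]
        rw [UpperHalfPlane.ofComplex_apply_of_im_pos hτ]
        rfl
      bdd_at_cusps' := by
        intro c hc
        rw [OnePoint.isBoundedAt_iff_forall_SL2Z hc]
        grind }
  constructor
  · intro hk τ hτ
    have := congrFun (ModularFormClass.levelOne_neg_weight_eq_zero hk f') ⟨τ, hτ⟩
    omega
  · rintro rfl τ σ hτ hσ
    obtain ⟨c, hc⟩ := ModularFormClass.levelOne_weight_zero_const f'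
    have a := congrFun hc ⟨τ, hτ⟩
    have b := congrFun hc ⟨σ, hσ⟩
    exact (a.trans b.symm : _)

variable {n : ℕ} {B B' : Matrix (Fin n) (Fin n) ℤ} {D : Set (Fin n → ℂ)} {E E' e f : Fin n → ℤ}
  {k : ℤ} {P : (Fin n → ℂ) → ℂ}

/-- The bilinear extension of the Gram pairing to an arbitrary commutative ring. -/
def bl {R : Type*} [CommRing R] (B : Matrix (Fin n) (Fin n) ℤ) (x y : Fin n → R) : R :=
  ∑ i, ∑ j, (B i j : R) * x i * y j

/-- The image of an integral vector. -/
def ic {R : Type*} [CommRing R] (v : Fin n → ℤ) : Fin n → R := fun i => (v i : R)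

section Ring

variable {R S : Type*} [CommRing R] [CommRing S] (B : Matrix (Fin n) (Fin n) ℤ)

lemma bl_eq_dot (x y : Fin n → R) : bl B x y = x ⬝ᵥ (B.map (Int.cast : ℤ → R)).mulVec y := by
  simp only [bl, dotProduct, mulVec, Matrix.map_apply, Finset.mul_sum]
  grind

@[simp] lemma bl_add_left (x y z : Fin n → R) : bl B (x + y) z = bl B x z + bl B y z := by
  simp [bl_eq_dot]

@[simp] lemma bl_add_right (x y z : Fin n → R) : bl B x (y + z) = bl B x y + bl B x z := by
  simp [bl_eq_dot, mulVec_add]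

@[simp] lemma bl_smul_left (a : R) (x y : Fin n → R) : bl B (a • x) y = a * bl B x y := by
  simp [bl_eq_dot]

@[simp] lemma bl_smul_right (a : R) (x y : Fin n → R) : bl B x (a • y) = a * bl B x y := by
  simp [bl_eq_dot, mulVec_smul]

@[simp] lemma bl_neg_left (x y : Fin n → R) : bl B (-x) y = -bl B x y := by
  simp [bl_eq_dot]

@[simp] lemma bl_neg_right (x y : Fin n → R) : bl B x (-y) = -bl B x y := by
  simp [bl_eq_dot, mulVec_neg]

@[simp] lemma bl_sub_left (x y z : Fin n → R) : bl B (x - y) z = bl B x z - bl B y z := by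
  simp [sub_eq_add_neg]

@[simp] lemma bl_sub_right (x y z : Fin n → R) : bl B x (y - z) = bl B x y - bl B x z := by
  simp [sub_eq_add_neg]

@[simp] lemma bl_zero_left (x : Fin n → R) : bl B 0 x = 0 := by
  simp [bl_eq_dot]

@[simp] lemma bl_zero_right (x : Fin n → R) : bl B x 0 = 0 := by
  simp [bl_eq_dot]

lemma bl_sum_left {ι : Type*} (s : Finset ι) (f : ι → Fin n → R) (x : Fin n → R) :
    bl B (∑ i ∈ s, f i) x = ∑ i ∈ s, bl B (f i) x := by
  classical
  induction s using Finset.induction_on with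
  | empty => simp
  | insert a s h ih => simp_all

lemma bl_sum_right {ι : Type*} (s : Finset ι) (f : ι → Fin n → R) (x : Fin n → R) :
    bl B x (∑ i ∈ s, f i) = ∑ i ∈ s, bl B x (f i) := by
  classical
  induction s using Finset.induction_on with
  | empty => simp
  | insert a s h ih => simp_all

variable {B} in
lemma bl_comm (hB : B.IsSymm) (x y : Fin n → R) : bl B x y = bl B y x := by
  unfold bl
  rw [Finset.sum_comm]
  refine Finset.sum_congr rfl fun i _ => Finset.sum_congr rfl fun j _ => ?_
  rw [hB.apply]; ring

lemma bl_map (φ : R →+* S) (x y : Fin n → R) :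
    bl B (fun i => φ (x i)) (fun i => φ (y i)) = φ (bl B x y) := by
  simp [bl, map_sum]

@[simp] lemma ic_add (v w : Fin n → ℤ) : (ic (v + w) : Fin n → R) = ic v + ic w := by
  ext i; simp [ic]

@[simp] lemma ic_sub (v w : Fin n → ℤ) : (ic (v - w) : Fin n → R) = ic v - ic w := by
  ext i; simp [ic]

@[simp] lemma ic_neg (v : Fin n → ℤ) : (ic (-v) : Fin n → R) = -ic v := by
  ext i; simp [ic]

@[simp] lemma ic_smul (a : ℤ) (v : Fin n → ℤ) : (ic (a • v) : Fin n → R) = (a : R) • ic v := by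
  ext i; simp [ic]

@[simp] lemma ic_zero : (ic (0 : Fin n → ℤ) : Fin n → R) = 0 := by
  ext i; simp [ic]

@[simp] lemma bl_ic (v w : Fin n → ℤ) : bl B (ic v : Fin n → R) (ic w) = (bl B v w : ℤ) := by
  simp [bl, ic]

lemma qnorm_eq (v : Fin n → ℤ) : qnorm B v = bl B v v := by
  rw [bl_eq_dot, qnorm]
  rfl

variable {B} in
lemma bl_nondeg [IsDomain R] [CharZero R] (hB : B.det ≠ 0) {x : Fin n → R}
    (h : ∀ i, bl B x (Pi.single i 1) = 0) : x = 0 := by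
  have h1 : x ᵥ* (B.map (Int.cast : ℤ → R)) = 0 := by
    ext i
    have := h i
    rw [bl_eq_dot, dotProduct_mulVec] at this
    simpa
  refine eq_zero_of_vecMul_eq_zero ?_ h1
  have : (B.map (Int.cast : ℤ → R)).det = (B.det : R) := by
    have := (Int.castRingHom R).map_det B
    simp_all
  simp_all

lemma ic_injective [CharZero R] : Function.Injective (ic : (Fin n → ℤ) → Fin n → R) := by
  intro v w h
  ext i
  have := congrFun h i
  simpa [ic] using this

end Ring

lemma exists_ker {K : Type*} [Field K] {m k : ℕ} (M : Matrix (Fin m) (Fin k) K) (h : m < k) :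
    ∃ a : Fin k → K, a ≠ 0 ∧ M *ᵥ a = 0 := by
  have := LinearMap.ker_ne_bot_of_finrank_lt (f := M.mulVecLin) (by simpa)
  obtain ⟨a, ha, ha0⟩ := Submodule.exists_mem_ne_zero_of_ne_bot this
  tauto

/-- The hypotheses on the lattice, in the form in which they are used. -/
structure Sig (B : Matrix (Fin n) (Fin n) ℤ) : Prop where
  rk : n = 16
  symm : B.IsSymm
  even : ∀ x : Fin n → ℤ, ∃ m, bl B x x = 2 * m
  det : B.det ≠ 0
  neg : ∀ p q r : Fin n → ℝ, 0 < bl B p p → 0 < bl B q q → bl B p q = 0 → bl B r p = 0 →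
    bl B r q = 0 → r ≠ 0 → bl B r r < 0
  pos : ∃ p q : Fin n → ℝ, 0 < bl B p p ∧ 0 < bl B q q ∧ bl B p q = 0

lemma Sig.comm {R : Type*} [CommRing R] {B : Matrix (Fin n) (Fin n) ℤ} (hB : Sig B)
    (x y : Fin n → R) : bl B x y = bl B y x := bl_comm hB.symm x y

lemma sig_of_isEven {B : Matrix (Fin n) (Fin n) ℤ} (h : IsEvenLatticeOfSignature B 2 14) :
    Sig B := by
  obtain ⟨rfl, hs, he, hd, P, hP, hPd⟩ := h
  set d : Fin (2 + 14) → ℝ := fun i => if (i : ℕ) < 2 then 1 else -1 with hdd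
  have key : ∀ y z : Fin (2 + 14) → ℝ, bl B (P *ᵥ y) (P *ᵥ z) = ∑ i, d i * (y i * z i) := by
    intro y z
    rw [bl_eq_dot, mulVec_mulVec, dotProduct_comm, ← dotProduct_transpose_mulVec, mulVec_mulVec,
      ← Matrix.mul_assoc, hPd]
    simp only [dotProduct, mulVec_diagonal]
    grind
  have surj : ∀ x : Fin (2 + 14) → ℝ, ∃ y, P *ᵥ y = x := fun x =>
    ⟨P⁻¹ *ᵥ x, by simp_all⟩
  refine ⟨rfl, hs, fun x => ?_, hd, ?_, ?_⟩
  · obtain ⟨m, hm⟩ := he x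
    exact ⟨m, by rw [← qnorm_eq, hm]⟩
  · intro p q r hp hq hpq hrp hrq hr
    by_contra hn
    push Not at hn
    obtain ⟨p', rfl⟩ := surj p
    obtain ⟨q', rfl⟩ := surj q
    obtain ⟨r', rfl⟩ := surj r
    let M : Matrix (Fin 2) (Fin 3) ℝ := !![p' 0, q' 0, r' 0; p' 1, q' 1, r' 1]
    obtain ⟨a, ha, hMa⟩ := exists_ker M (by simp)
    have hMa0 : p' 0 * a 0 + q' 0 * a 1 + r' 0 * a 2 = 0 := by
      simpa [M, mulVec, dotProduct, Fin.sum_univ_three] using congrFun hMa 0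
    have hMa1 : p' 1 * a 0 + q' 1 * a 1 + r' 1 * a 2 = 0 := by
      simpa [M, mulVec, dotProduct, Fin.sum_univ_three] using congrFun hMa 1
    set v := a 0 • p' + a 1 • q' + a 2 • r' with hv
    have hv0 : v 0 = 0 := by simp [hv]; linarith
    have hv1 : v 1 = 0 := by simp [hv]; linarith
    have e1 : bl B (P *ᵥ v) (P *ᵥ v) = -∑ i, v i ^ 2 := by
      rw [key, ← Finset.sum_neg_distrib]
      refine Finset.sum_congr rfl fun i _ => ?_
      by_cases hi : (i : ℕ) < 2
      · have : i = 0 ∨ i = 1 := by simp only [Fin.ext_iff]; simp; omega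
        rcases this with rfl | rfl <;> simp [hv0, hv1]
      · simp only [hdd, hi, if_false]; ring
    have hqp := bl_comm hs (P *ᵥ p') (P *ᵥ q')
    have hpr := bl_comm hs (P *ᵥ p') (P *ᵥ r')
    have hqr := bl_comm hs (P *ᵥ q') (P *ᵥ r')
    have e2 : bl B (P *ᵥ v) (P *ᵥ v) = a 0 ^ 2 * bl B (P *ᵥ p') (P *ᵥ p') +
        a 1 ^ 2 * bl B (P *ᵥ q') (P *ᵥ q') + a 2 ^ 2 * bl B (P *ᵥ r') (P *ᵥ r') := by
      rw [hv]
      simp only [mulVec_add, mulVec_smul, bl_add_left, bl_add_right, bl_smul_left, bl_smul_right,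
        ← hqp, hpr, hqr, hpq, hrp, hrq]
      ring
    have h0 : 0 ≤ ∑ i, v i ^ 2 := Finset.sum_nonneg fun i _ => sq_nonneg _
    have s0 := mul_nonneg (sq_nonneg (a 0)) hp.le
    have s1 := mul_nonneg (sq_nonneg (a 1)) hq.le
    have s2 := mul_nonneg (sq_nonneg (a 2)) hn
    have a0 : a 0 = 0 := by
      have : a 0 ^ 2 * bl B (P *ᵥ p') (P *ᵥ p') = 0 := by linarith
      simpa [hp.ne'] using this
    have a1 : a 1 = 0 := by
      have : a 1 ^ 2 * bl B (P *ᵥ q') (P *ᵥ q') = 0 := by linarith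
      simpa [hq.ne'] using this
    have a2 : a 2 ≠ 0 := fun h => ha (by ext i; fin_cases i <;> simpa)
    have hz : ∑ i, v i ^ 2 = 0 := by linarith
    have hvz : v = 0 := by
      ext i
      have := (Finset.sum_eq_zero_iff_of_nonneg fun i _ => sq_nonneg _).1 hz i (Finset.mem_univ i)
      simpa
    rw [hv, a0, a1] at hvz
    have : r' = 0 := by simpa [a2] using hvz
    exact hr (by simp [this])
  · refine ⟨P *ᵥ Pi.single 0 1, P *ᵥ Pi.single 1 1, ?_, ?_, ?_⟩ <;> rw [key]
    · rw [Finset.sum_eq_single 0] <;> simp_all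
    · rw [Finset.sum_eq_single 1] <;> simp_all
    · refine Finset.sum_eq_zero fun i _ => ?_
      grind

/-- Real and imaginary parts of a vector. -/
def vre (Z : Fin n → ℂ) : Fin n → ℝ := fun i => (Z i).re

def vim (Z : Fin n → ℂ) : Fin n → ℝ := fun i => (Z i).im

/-- The complexification of a real vector. -/
def rc (x : Fin n → ℝ) : Fin n → ℂ := fun i => (x i : ℂ)

lemma bl_re (Z W : Fin n → ℂ) :
    (bl B Z W).re = bl B (vre Z) (vre W) - bl B (vim Z) (vim W) := by
  simp only [bl, Complex.re_sum, ← Finset.sum_sub_distrib, vre, vim]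
  simp

lemma bl_im (Z W : Fin n → ℂ) :
    (bl B Z W).im = bl B (vre Z) (vim W) + bl B (vim Z) (vre W) := by
  simp only [bl, Complex.im_sum, ← Finset.sum_add_distrib, vre, vim]
  simp

@[simp] lemma vre_rc (x : Fin n → ℝ) : vre (rc x) = x := by rfl
@[simp] lemma vim_rc (x : Fin n → ℝ) : vim (rc x) = 0 := by rfl
@[simp] lemma vre_ic (x : Fin n → ℤ) : vre (ic x) = ic x := by rfl
@[simp] lemma vim_ic (x : Fin n → ℤ) : vim (ic x) = 0 := by rfl
@[simp] lemma vim_add (x y : Fin n → ℂ) : vim (x + y) = vim x + vim y := by rfl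
@[simp] lemma vim_sub (x y : Fin n → ℂ) : vim (x - y) = vim x - vim y := by rfl
lemma vre_smul (a : ℂ) (x : Fin n → ℂ) : vre (a • x) = a.re • vre x - a.im • vim x := by
  rfl
lemma vim_smul (a : ℂ) (x : Fin n → ℂ) : vim (a • x) = a.re • vim x + a.im • vre x := by
  rfl

lemma continuous_vim : Continuous (vim : (Fin n → ℂ) → Fin n → ℝ) := by
  unfold vim; fun_prop

lemma bl_conj (Z : Fin n → ℂ) :
    (bl B Z fun i => (starRingEnd ℂ) (Z i)).re = bl B (vre Z) (vre Z) + bl B (vim Z) (vim Z) := by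
  rw [bl_re]
  have h1 : vre (fun i => (starRingEnd ℂ) (Z i)) = vre Z := by rfl
  have h2 : vim (fun i => (starRingEnd ℂ) (Z i)) = -vim Z := by rfl
  simp_all

lemma mem_cone (hB : B.IsSymm) {Z : Fin n → ℂ} : Z ∈ Cone B ↔
    bl B (vre Z) (vre Z) = bl B (vim Z) (vim Z) ∧ bl B (vre Z) (vim Z) = 0 ∧
      0 < bl B (vim Z) (vim Z) := by
  change bl B Z Z = 0 ∧ 0 < (bl B Z fun i => (starRingEnd ℂ) (Z i)).re ↔ _
  rw [bl_conj, Complex.ext_iff, bl_re, bl_im, bl_comm hB (vim Z) (vre Z)]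
  simp only [Complex.zero_re, Complex.zero_im]
  grind

lemma continuous_bl {R X : Type*} [CommRing R] [TopologicalSpace R] [IsTopologicalRing R]
    [TopologicalSpace X] {f g : X → Fin n → R} (hf : Continuous f) (hg : Continuous g) :
    Continuous fun x => bl B (f x) (g x) := by
  unfold bl; fun_prop

lemma root_bound (hB : Sig B) {Z : Fin n → ℂ} (hZ : Z ∈ Cone B) {v : Fin n → ℤ}
    (hv : bl B v v = -2) (h0 : bl B Z (ic v) = 0) (w : Fin n → ℝ) :
    (bl B (ic v) w) ^ 2 ≤
      2 * (Complex.normSq (bl B Z (rc w)) / bl B (vim Z) (vim Z) - bl B w w) := by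
  obtain ⟨h1, h2, h3⟩ := (mem_cone hB.symm).1 hZ
  have hx : bl B (vre Z) (ic v) = 0 := by simpa [bl_re] using congrArg Complex.re h0
  have hy : bl B (vim Z) (ic v) = 0 := by simpa [bl_im] using congrArg Complex.im h0
  set x := vre Z
  set y := vim Z
  set h := bl B y y
  set V : Fin n → ℝ := ic v
  have hN : Complex.normSq (bl B Z (rc w)) = bl B x w ^ 2 + bl B y w ^ 2 := by
    rw [Complex.normSq_apply, bl_re, bl_im]; simp; ring
  have c1 := hB.comm y x
  have c2 := hB.comm w x
  have c3 := hB.comm w y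
  have c4 := hB.comm V x
  have c5 := hB.comm V y
  have c6 := hB.comm V w
  have hV : bl B V V = -2 := by simp [V, hv]
  set r := w - (bl B x w / h) • x - (bl B y w / h) • y + (bl B w V / 2) • V with hr
  have hrx : bl B r x = 0 := by
    simp only [hr, bl_add_left, bl_sub_left, bl_smul_left, h1, c1, c2, c4, hx, h2]
    grind
  have hry : bl B r y = 0 := by
    simp only [hr, bl_add_left, bl_sub_left, bl_smul_left, c3, c5, hy, h2]
    change _ - _ - _ * h + _ = 0
    field_simp; ring
  have hrr : bl B r r = bl B w w - (bl B x w ^ 2 + bl B y w ^ 2) / h + bl B w V ^ 2 / 2 := by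
    simp only [hr, bl_add_left, bl_sub_left, bl_smul_left, bl_add_right, bl_sub_right,
      bl_smul_right, c1, c2, c3, c4, c5, c6, hx, hy, h1, h2, hV]
    change _ - _ * (_ - _ - _ * h + _) + _ = _
    field_simp; ring
  have hle : bl B r r ≤ 0 := by
    by_cases hr0 : r = 0
    · simp [hr0]
    · exact (hB.neg x y r (h1 ▸ h3) h3 h2 hrx hry hr0).le
  rw [hrr] at hle
  rw [hN, c6]
  linarith

lemma bounded_finite (hB : Sig B) (M : ℝ) :
    {v : Fin n → ℤ | ∀ i, ((bl B v (Pi.single i 1) : ℤ) : ℝ) ^ 2 ≤ M}.Finite := by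
  have hfin : (Set.pi univ fun _ : Fin n => Set.Icc (-⌈|M|⌉ - 1) (⌈|M|⌉ + 1)).Finite :=
    Set.Finite.pi fun _ => Set.finite_Icc _ _
  refine Set.Finite.of_finite_image (f := fun v i => bl B v (Pi.single i 1))
    (hfin.subset ?_) ?_
  · rintro _ ⟨v, hv, rfl⟩ i -
    have h1 := hv i
    have h2 := Int.le_ceil |M|
    have h3 := le_abs_self M
    set k := bl B v (Pi.single i 1)
    set N := ⌈|M|⌉
    have h4 : k ^ 2 ≤ N := by exact_mod_cast h1.trans (h3.trans h2)
    constructor <;> nlinarith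
  · intro v _ w _ h
    have : v - w = 0 := bl_nondeg hB.det fun i => by
      rw [bl_sub_left]; exact sub_eq_zero.2 (congrFun h i)
    exact sub_eq_zero.1 this

lemma roots_finite (hB : Sig B) {Z₀ : Fin n → ℂ} (hZ : Z₀ ∈ Cone B) :
    ∃ S : Set (Fin n → ℤ), S.Finite ∧ ∀ᶠ Z in 𝓝 Z₀, Z ∈ Cone B → ∀ v, bl B v v = -2 →
      bl B Z (ic v) = 0 → v ∈ S := by
  have h3 := ((mem_cone hB.symm).1 hZ).2.2
  let G : Fin n → (Fin n → ℂ) → ℝ := fun i Z =>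
    2 * (Complex.normSq (bl B Z (rc (Pi.single i 1))) / bl B (vim Z) (vim Z) -
      bl B (Pi.single i 1) (Pi.single i 1))
  have hG : ∀ i, ContinuousAt (G i) Z₀ := by
    intro i
    have e1 : Continuous fun Z : Fin n → ℂ => bl B Z (rc (Pi.single i 1)) :=
      continuous_bl continuous_id continuous_const
    have e2 : Continuous fun Z : Fin n → ℂ => bl B (vim Z) (vim Z) :=
      continuous_bl continuous_vim continuous_vim
    exact (((Complex.continuous_normSq.comp e1).continuousAt.div e2.continuousAt h3.ne').sub
      continuousAt_const).const_mul 2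
  set M := ∑ i, |G i Z₀| + 1
  refine ⟨_, bounded_finite hB M, ?_⟩
  have hev : ∀ᶠ Z in 𝓝 Z₀, ∀ i, G i Z < M := by
    rw [eventually_all]
    intro i
    refine (hG i).eventually_lt_const ?_
    have := Finset.single_le_sum (f := fun i => |G i Z₀|) (fun _ _ => abs_nonneg _)
      (Finset.mem_univ i)
    grind
  filter_upwards [hev] with Z hZ' hZc v hv h0 i
  have := root_bound hB hZc hv h0 (Pi.single i 1)
  refine le_trans (le_of_eq ?_) (this.trans (hZ' i).le)
  have : (Pi.single i 1 : Fin n → ℝ) = ic (Pi.single i 1) := by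
    ext j; by_cases h : j = i
    · subst h; simp [ic]
    · simp [ic, h]
  simp_all

lemma roots_locally_finite (hB : Sig B) {Z₀ : Fin n → ℂ} (hZ : Z₀ ∈ Cone B) :
    ∀ᶠ Z in 𝓝 Z₀, Z ∈ Cone B → ∀ v, bl B v v = -2 → bl B Z (ic v) = 0 → bl B Z₀ (ic v) = 0 := by
  obtain ⟨S, hS, h⟩ := roots_finite hB hZ
  have h2 : ∀ᶠ Z in 𝓝 Z₀, ∀ v ∈ S, bl B Z₀ (ic v) ≠ 0 → bl B Z (ic v) ≠ 0 := by
    rw [Filter.eventually_all_finite hS]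
    intro v _
    by_cases h0 : bl B Z₀ (ic v) = 0
    · simp [h0]
    · have : Continuous fun Z : Fin n → ℂ => bl B Z (ic v) :=
        continuous_bl continuous_id continuous_const
      filter_upwards [this.continuousAt.eventually_ne h0] with Z hZ _ using hZ
  filter_upwards [h, h2] with Z h h2 hZ v hv h0
  grind

/-- The action of an integral matrix over an arbitrary commutative ring. -/
def ac {R : Type*} [CommRing R] (g : Matrix (Fin n) (Fin n) ℤ) (x : Fin n → R) : Fin n → R :=
  (g.map (Int.cast : ℤ → R)).mulVec x

section Ring

variable {R : Type*} [CommRing R]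

@[simp] lemma ac_add (g : Matrix (Fin n) (Fin n) ℤ) (x y : Fin n → R) :
    ac g (x + y) = ac g x + ac g y := mulVec_add _ _ _

@[simp] lemma ac_smul (g : Matrix (Fin n) (Fin n) ℤ) (a : R) (x : Fin n → R) :
    ac g (a • x) = a • ac g x := mulVec_smul _ _ _

@[simp] lemma ac_sub (g : Matrix (Fin n) (Fin n) ℤ) (x y : Fin n → R) :
    ac g (x - y) = ac g x - ac g y := mulVec_sub _ _ _

lemma ac_mul (g h : Matrix (Fin n) (Fin n) ℤ) (x : Fin n → R) :
    ac (g * h) x = ac g (ac h x) := by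
  unfold ac
  rw [mulVec_mulVec]
  congr 1
  exact Matrix.map_mul (f := Int.castRingHom R)

@[simp] lemma ac_one (x : Fin n → R) : ac 1 x = x := by
  simp [ac]

lemma ac_ic (g : Matrix (Fin n) (Fin n) ℤ) (v : Fin n → ℤ) :
    ac g (ic v : Fin n → R) = ic (ac g v) := by
  ext i; simp [ac, ic, mulVec, dotProduct]

lemma bl_ac {g : Matrix (Fin n) (Fin n) ℤ} (hg : gᵀ * B * g = B) (x y : Fin n → R) :
    bl B (ac g x) (ac g y) = bl B x y := by
  rw [bl_eq_dot, bl_eq_dot]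
  unfold ac
  have : B.map (Int.cast : ℤ → R) =
      (g.map (Int.cast : ℤ → R))ᵀ * B.map (Int.cast : ℤ → R) * g.map (Int.cast : ℤ → R) := by
    conv_lhs => rw [← hg]
    have e := Matrix.map_mul (f := Int.castRingHom R) (L := gᵀ * B) (M := g)
    have e' := Matrix.map_mul (f := Int.castRingHom R) (L := gᵀ) (M := B)
    simp only [Int.coe_castRingHom] at e e'
    rw [e, e', transpose_map]
  conv_rhs => rw [this, Matrix.mul_assoc, ← mulVec_mulVec, ← mulVec_mulVec, dotProduct_mulVec,
    vecMul_transpose]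

/-- The endomorphism `x ↦ x + ∑ (x, a) c`, the sum being over the pairs `(c, a)` in the list. -/
def opM (B : Matrix (Fin n) (Fin n) ℤ) (l : List ((Fin n → ℤ) × (Fin n → ℤ))) :
    Matrix (Fin n) (Fin n) ℤ :=
  1 + (l.map fun p => vecMulVec p.1 (B *ᵥ p.2)).sum

lemma ac_opM (l : List ((Fin n → ℤ) × (Fin n → ℤ))) (x : Fin n → R) :
    ac (opM B l) x = x + (l.map fun p => bl B x (ic p.2) • (ic p.1 : Fin n → R)).sum := by
  have h1 : ∀ g h : Matrix (Fin n) (Fin n) ℤ, ac (g + h) x = ac g x + ac h x := by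
    intro g h; ext i; simp [ac, mulVec, dotProduct, add_mul, Finset.sum_add_distrib]
  rw [opM, h1, ac_one]
  congr 1
  induction l with
  | nil => ext i; simp [ac]
  | cons p l ih =>
    simp only [List.map_cons, List.sum_cons, h1, ih]
    congr 1
    ext i
    simp only [ac, mulVec, dotProduct, Matrix.map_apply, vecMulVec_apply, ic, bl, Pi.smul_apply,
      smul_eq_mul, Finset.sum_mul, Int.cast_mul, Int.cast_sum, Finset.mul_sum]
    grind

end Ring

lemma isom_of_bl {g : Matrix (Fin n) (Fin n) ℤ}
    (h : ∀ x y : Fin n → ℤ, bl B (ac g x) (ac g y) = bl B x y) : gᵀ * B * g = B := by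
  have key : ∀ (M : Matrix (Fin n) (Fin n) ℤ) i j,
      bl M (Pi.single i 1) (Pi.single j 1) = M i j := by
    intro M i j; simp [bl, Pi.single_apply]
  have h2 : ∀ x y : Fin n → ℤ, bl (gᵀ * B * g) x y = bl B (ac g x) (ac g y) := by
    intro x y
    have e : ∀ M : Matrix (Fin n) (Fin n) ℤ, M.map (Int.cast : ℤ → ℤ) = M := fun M => by
      rfl
    rw [bl_eq_dot, bl_eq_dot, ac, ac, e, e, e, Matrix.mul_assoc, ← mulVec_mulVec,
      ← mulVec_mulVec, dotProduct_mulVec, vecMul_transpose]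
  refine Matrix.ext fun i j => ?_
  rw [← key (gᵀ * B * g), ← key B, h2, h]

lemma actC_eq (g : Matrix (Fin n) (Fin n) ℤ) (Z : Fin n → ℂ) : actC g Z = ac g Z := rfl

lemma vre_ac (g : Matrix (Fin n) (Fin n) ℤ) (Z : Fin n → ℂ) : vre (ac g Z) = ac g (vre Z) := by
  ext i; simp [vre, ac, mulVec, dotProduct]

lemma vim_ac (g : Matrix (Fin n) (Fin n) ℤ) (Z : Fin n → ℂ) : vim (ac g Z) = ac g (vim Z) := by
  ext i; simp [vim, ac, mulVec, dotProduct]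

lemma ac_mem_cone (hB : Sig B) {g : Matrix (Fin n) (Fin n) ℤ} (hg : gᵀ * B * g = B)
    {Z : Fin n → ℂ} (hZ : Z ∈ Cone B) : ac g Z ∈ Cone B := by
  rw [mem_cone hB.symm] at hZ ⊢
  simpa only [vre_ac, vim_ac, bl_ac hg] using hZ

lemma continuous_ac (g : Matrix (Fin n) (Fin n) ℤ) :
    Continuous (ac g : (Fin n → ℂ) → Fin n → ℂ) := by
  unfold ac; fun_prop

lemma isom_inv (hB : Sig B) {g : Matrix (Fin n) (Fin n) ℤ} (hg : gᵀ * B * g = B) :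
    ∃ h : Matrix (Fin n) (Fin n) ℤ, hᵀ * B * h = B ∧ g * h = 1 ∧ h * g = 1 := by
  have hd : IsUnit g.det := by
    have := congrArg Matrix.det hg
    rw [det_mul, det_mul, det_transpose] at this
    have h2 : B.det * (g.det * g.det) = B.det * 1 := by linarith
    exact IsUnit.of_mul_eq_one _ (mul_left_cancel₀ hB.det h2)
  have h1 := Matrix.mul_nonsing_inv g hd
  have h2 := Matrix.nonsing_inv_mul g hd
  refine ⟨g⁻¹, ?_, h1, h2⟩
  have h3 : (g⁻¹)ᵀ * gᵀ = 1 := by rw [← transpose_mul, h1, transpose_one]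
  grind

lemma comp_subset_cone (hD : IsComponent B D) : D ⊆ Cone B := by
  obtain ⟨Z, -, rfl⟩ := hD
  exact connectedComponentIn_subset _ _

lemma comp_nonempty (hD : IsComponent B D) : D.Nonempty := by
  obtain ⟨Z, hZ, rfl⟩ := hD
  exact ⟨Z, mem_connectedComponentIn hZ⟩

lemma comp_conn (hD : IsComponent B D) : IsPreconnected D := by
  obtain ⟨Z, hZ, rfl⟩ := hD
  exact isPreconnected_connectedComponentIn

lemma comp_max (hD : IsComponent B D) {S : Set (Fin n → ℂ)} (hS : IsPreconnected S)
    (hSC : S ⊆ Cone B) (h : (S ∩ D).Nonempty) : S ⊆ D := by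
  obtain ⟨Z, hZ, rfl⟩ := hD
  obtain ⟨W, hW, hWD⟩ := h
  rw [connectedComponentIn_eq hWD]
  exact hS.subset_connectedComponentIn hW hSC

lemma mem_oplus (hB : Sig B) (hD : IsComponent B D) {g : Matrix (Fin n) (Fin n) ℤ}
    (hg : gᵀ * B * g = B) (h : ∃ Z ∈ D, ac g Z ∈ D) : g ∈ OPlus B D := by
  obtain ⟨Z, hZ, hgZ⟩ := h
  obtain ⟨g', hg', h1, h2⟩ := isom_inv hB hg
  have key : ∀ g : Matrix (Fin n) (Fin n) ℤ, gᵀ * B * g = B → ∀ Z ∈ D, ac g Z ∈ D →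
      ac g '' D ⊆ D := by
    intro g hg Z hZ hgZ
    refine comp_max hD ((comp_conn hD).image _ (continuous_ac g).continuousOn) ?_
      ⟨_, ⟨Z, hZ, rfl⟩, hgZ⟩
    rintro _ ⟨W, hW, rfl⟩
    exact ac_mem_cone hB hg (comp_subset_cone hD hW)
  refine ⟨hg, Subset.antisymm (key g hg Z hZ hgZ) fun W hW => ?_⟩
  have := key g' hg' (ac g Z) hgZ (by rwa [← ac_mul, h2, ac_one])
  exact ⟨ac g' W, this ⟨W, hW, rfl⟩, by rw [actC_eq, ← ac_mul, h1, ac_one]⟩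

lemma oplus_mem {g : Matrix (Fin n) (Fin n) ℤ} (hg : g ∈ OPlus B D) {Z : Fin n → ℂ}
    (hZ : Z ∈ D) : ac g Z ∈ D := hg.2 ▸ ⟨Z, hZ, rfl⟩

lemma oplus_mul {g h : Matrix (Fin n) (Fin n) ℤ} (hg : g ∈ OPlus B D) (hh : h ∈ OPlus B D) :
    g * h ∈ OPlus B D := by
  refine ⟨?_, ?_⟩
  · rw [transpose_mul]
    calc hᵀ * gᵀ * B * (g * h) = hᵀ * (gᵀ * B * g) * h := by grind
      _ = B := by rw [hg.1, hh.1]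
  · have : actC (g * h) = actC g ∘ actC h := funext fun Z => ac_mul g h Z
    rw [this, image_comp, hh.2, hg.2]

lemma oplus_inv (hB : Sig B) {g : Matrix (Fin n) (Fin n) ℤ} (hg : g ∈ OPlus B D) :
    ∃ h ∈ OPlus B D, g * h = 1 ∧ h * g = 1 := by
  obtain ⟨h, hh, h1, h2⟩ := isom_inv hB hg.1
  refine ⟨h, ⟨hh, ?_⟩, h1, h2⟩
  conv_lhs => rw [← hg.2]
  rw [← image_comp]
  have : actC h ∘ actC g = id := funext fun Z => by
    rw [Function.comp, actC_eq, actC_eq, ← ac_mul, h2, ac_one]; rfl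
  rw [this, image_id]

lemma oplus_mem_iff (hB : Sig B) {g : Matrix (Fin n) (Fin n) ℤ} (hg : g ∈ OPlus B D)
    (Z : Fin n → ℂ) : ac g Z ∈ D ↔ Z ∈ D := by
  obtain ⟨h, hh, h1, h2⟩ := oplus_inv hB hg
  refine ⟨fun H => ?_, oplus_mem hg⟩
  have := oplus_mem hh H
  rwa [← ac_mul, h2, ac_one] at this

/-- The action of a rational matrix. -/
def aq {K : Type*} [Field K] [CharZero K] (A : Matrix (Fin n) (Fin n) ℚ) (x : Fin n → K) :
    Fin n → K := (A.map (Rat.cast : ℚ → K)).mulVec x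

/-- The rational Gram matrix. -/
abbrev qm (B : Matrix (Fin n) (Fin n) ℤ) : Matrix (Fin n) (Fin n) ℚ := B.map (Int.cast : ℤ → ℚ)

lemma qm_injective : Function.Injective (qm (n := n)) :=
  Matrix.map_injective Int.cast_injective

lemma qm_mul (g h : Matrix (Fin n) (Fin n) ℤ) : qm (g * h) = qm g * qm h :=
  Matrix.map_mul (f := Int.castRingHom ℚ)

section Field

variable {K : Type*} [Field K] [CharZero K]

lemma aq_mul (A C : Matrix (Fin n) (Fin n) ℚ) (x : Fin n → K) : aq (A * C) x = aq A (aq C x) := by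
  unfold aq
  rw [mulVec_mulVec]
  congr 1
  exact Matrix.map_mul (f := Rat.castHom K)

@[simp] lemma aq_one (x : Fin n → K) : aq 1 x = x := by simp [aq]

lemma aq_qm (g : Matrix (Fin n) (Fin n) ℤ) (x : Fin n → K) : aq (qm g) x = ac g x := by
  unfold aq ac qm
  congr 1
  ext i j; simp

lemma aq_smul (A : Matrix (Fin n) (Fin n) ℚ) (a : K) (x : Fin n → K) :
    aq A (a • x) = a • aq A x := mulVec_smul _ _ _

lemma bl_aq {A : Matrix (Fin n) (Fin n) ℚ} (h : Aᵀ * qm B' * A = qm B) (x y : Fin n → K) :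
    bl B' (aq A x) (aq A y) = bl B x y := by
  have e1 : ∀ M : Matrix (Fin n) (Fin n) ℤ, M.map (Int.cast : ℤ → K) =
      (qm M).map (Rat.cast : ℚ → K) := by intro M; ext; simp
  have e := Matrix.map_mul (f := Rat.castHom K) (L := Aᵀ * qm B') (M := A)
  have e' := Matrix.map_mul (f := Rat.castHom K) (L := Aᵀ) (M := qm B')
  simp only [Rat.coe_castHom] at e e'
  rw [bl_eq_dot, bl_eq_dot, e1 B, ← h, e, e', transpose_map, e1]
  unfold aq
  conv_rhs => rw [Matrix.mul_assoc, ← mulVec_mulVec, ← mulVec_mulVec, dotProduct_mulVec,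
    vecMul_transpose]

end Field

lemma continuous_aq (A : Matrix (Fin n) (Fin n) ℚ) :
    Continuous (aq A : (Fin n → ℂ) → Fin n → ℂ) := by
  unfold aq; fun_prop

lemma differentiable_aq (A : Matrix (Fin n) (Fin n) ℚ) :
    Differentiable ℂ (aq A : (Fin n → ℂ) → Fin n → ℂ) :=
  (LinearMap.toContinuousLinearMap ((A.map (Rat.cast : ℚ → ℂ)).mulVecLin)).differentiable

lemma differentiable_ac (g : Matrix (Fin n) (Fin n) ℤ) :
    Differentiable ℂ (ac g : (Fin n → ℂ) → Fin n → ℂ) := by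
  have := differentiable_aq (qm g)
  simpa

lemma vre_aq (A : Matrix (Fin n) (Fin n) ℚ) (Z : Fin n → ℂ) : vre (aq A Z) = aq A (vre Z) := by
  ext i; simp [vre, aq, mulVec, dotProduct, Complex.re_sum]

lemma vim_aq (A : Matrix (Fin n) (Fin n) ℚ) (Z : Fin n → ℂ) : vim (aq A Z) = aq A (vim Z) := by
  ext i; simp [vim, aq, mulVec, dotProduct, Complex.im_sum]

/-- `A` is a rational isometry from `B` to `B'` with inverse `A'`. -/
structure Iso (B B' : Matrix (Fin n) (Fin n) ℤ) (A A' : Matrix (Fin n) (Fin n) ℚ) : Prop where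
  l : A * A' = 1
  iso : Aᵀ * qm B' * A = qm B

variable {A A' : Matrix (Fin n) (Fin n) ℚ}

lemma Iso.r (h : Iso B B' A A') : A' * A = 1 := mul_eq_one_comm.1 h.l

lemma Iso.symm (h : Iso B B' A A') : Iso B' B A' A := by
  refine ⟨h.r, ?_⟩
  have h1 : (A')ᵀ * Aᵀ = 1 := by rw [← transpose_mul, h.l, transpose_one]
  calc (A')ᵀ * qm B * A' = (A')ᵀ * (Aᵀ * qm B' * A) * A' := by rw [h.iso]
    _ = ((A')ᵀ * Aᵀ) * qm B' * (A * A') := by grind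
    _ = qm B' := by rw [h1, h.l]; simp

lemma Iso.trans {B'' : Matrix (Fin n) (Fin n) ℤ} {C C' : Matrix (Fin n) (Fin n) ℚ}
    (h : Iso B B' A A') (h' : Iso B' B'' C C') : Iso B B'' (C * A) (A' * C') := by
  refine ⟨?_, ?_⟩
  · calc C * A * (A' * C') = C * (A * A') * C' := by grind
      _ = 1 := by rw [h.l, Matrix.mul_one, h'.l]
  · rw [transpose_mul]
    calc Aᵀ * Cᵀ * qm B'' * (C * A) = Aᵀ * (Cᵀ * qm B'' * C) * A := by
          grind
      _ = qm B := by rw [h'.iso, h.iso]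

lemma Iso.aq_aq {K : Type*} [Field K] [CharZero K] (h : Iso B B' A A') (x : Fin n → K) :
    aq A (aq A' x) = x := by rw [← aq_mul, h.l, aq_one]

lemma Iso.sig (hB : Sig B) (h : Iso B B' A A') (he : ∀ x : Fin n → ℤ, ∃ m, bl B' x x = 2 * m) :
    Sig B' := by
  have hs := h.symm
  have hsymm : B'.IsSymm := by
    have : (qm B')ᵀ = qm B' := by
      have e : (qm B)ᵀ = qm B := by rw [← transpose_map, hB.symm]
      rw [← hs.iso]
      simp only [transpose_mul, transpose_transpose, e, Matrix.mul_assoc]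
    exact qm_injective (by simpa)
  refine ⟨hB.rk, hsymm, he, ?_, ?_, ?_⟩
  · intro h0
    have := congrArg Matrix.det h.iso
    have e : ∀ M : Matrix (Fin n) (Fin n) ℤ, (qm M).det = (M.det : ℚ) := fun M => by
      have := (Int.castRingHom ℚ).map_det M
      simp_all
    rw [det_mul, det_mul, e, e, h0] at this
    apply hB.det
    have : (B.det : ℚ) = 0 := by grind
    simpa
  · intro p q r hp hq hpq hrp hrq hr
    rw [← bl_aq hs.iso] at hp hq hpq hrp hrq ⊢
    refine hB.neg _ _ _ hp hq hpq hrp hrq fun h0 => hr ?_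
    rw [← h.aq_aq r, h0]
    simp [aq]
  · obtain ⟨p, q, h1, h2, h3⟩ := hB.pos
    exact ⟨aq A p, aq A q, by rwa [bl_aq h.iso], by rwa [bl_aq h.iso], by rwa [bl_aq h.iso]⟩

lemma Iso.cone (hB : Sig B) (hB' : Sig B') (h : Iso B B' A A') {Z : Fin n → ℂ}
    (hZ : Z ∈ Cone B) : aq A Z ∈ Cone B' := by
  rw [mem_cone hB.symm] at hZ
  rw [mem_cone hB'.symm]
  simpa only [vre_aq, vim_aq, bl_aq h.iso] using hZ

lemma Iso.comp (hB : Sig B) (hB' : Sig B') (h : Iso B B' A A') (hD : IsComponent B D) :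
    IsComponent B' (aq A '' D) := by
  obtain ⟨Z, hZ⟩ := comp_nonempty hD
  have hZC := comp_subset_cone hD hZ
  have hc := h.cone hB hB' hZC
  refine ⟨aq A Z, hc, Subset.antisymm ?_ ?_⟩
  · refine ((comp_conn hD).image _ (continuous_aq A).continuousOn).subset_connectedComponentIn
      ⟨Z, hZ, rfl⟩ ?_
    rintro _ ⟨W, hW, rfl⟩
    exact h.cone hB hB' (comp_subset_cone hD hW)
  · intro W hW
    refine ⟨aq A' W, ?_, h.aq_aq W⟩
    refine comp_max hD (isPreconnected_connectedComponentIn.image _ (continuous_aq A').continuousOn)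
      ?_ ⟨_, ⟨aq A Z, mem_connectedComponentIn hc, rfl⟩, by rwa [h.symm.aq_aq]⟩ ⟨W, hW, rfl⟩
    rintro _ ⟨W, hW, rfl⟩
    exact h.symm.cone hB' hB (connectedComponentIn_subset _ _ hW)

/-- The orbit of a function under the integral orthogonal group. -/
def orb (B : Matrix (Fin n) (Fin n) ℤ) (D : Set (Fin n → ℂ)) (P : (Fin n → ℂ) → ℂ) :
    Set ((Fin n → ℂ) → ℂ) := {φ | ∃ g ∈ OPlus B D, φ = P ∘ ac g}

lemma exists_denom (A : Matrix (Fin n) (Fin n) ℚ) :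
    ∃ (d : ℕ) (M : Matrix (Fin n) (Fin n) ℤ), d ≠ 0 ∧ (d : ℚ) • A = qm M := by
  refine ⟨∏ i, ∏ j, (A i j).den, ?_⟩
  have : ∀ i j, ∃ m : ℤ, ((∏ i, ∏ j, (A i j).den : ℕ) : ℚ) * A i j = m := by
    intro i j
    have h1 : (A i j).den ∣ ∏ i, ∏ j, (A i j).den :=
      (Finset.dvd_prod_of_mem (fun j => (A i j).den) (Finset.mem_univ j)).trans
        (Finset.dvd_prod_of_mem (fun i => ∏ j, (A i j).den) (Finset.mem_univ i))
    obtain ⟨k, hk⟩ := h1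
    refine ⟨(A i j).num * k, ?_⟩
    rw [hk]
    have := Rat.den_mul_eq_num (A i j)
    push_cast
    grind
  choose M hM using this
  refine ⟨M, ?_, ?_⟩
  · positivity
  · ext i j; tauto

theorem orb_transport (hB : Sig B) (hB' : Sig B') (h : Iso B B' A A') (hD : IsComponent B D)
    {P : (Fin n → ℂ) → ℂ} (hP : (orb B D P).Finite) :
    (orb B' (aq A '' D) (P ∘ aq A')).Finite := by
  classical
  obtain ⟨d, M, hd, hM⟩ := exists_denom A
  obtain ⟨d', M', hd', hM'⟩ := exists_denom A'
  set N := d * d'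
  have hN : N ≠ 0 := mul_ne_zero hd hd'
  have : NeZero N := ⟨hN⟩
  set D' := aq A '' D
  let res : Matrix (Fin n) (Fin n) ℤ → Matrix (Fin n) (Fin n) (ZMod N) := fun g => g.map Int.cast
  let rep : Matrix (Fin n) (Fin n) (ZMod N) → Matrix (Fin n) (Fin n) ℤ := fun c =>
    if hc : ∃ g ∈ OPlus B' D', res g = c then hc.choose else 1
  have hrep : ∀ g ∈ OPlus B' D', rep (res g) ∈ OPlus B' D' ∧ res (rep (res g)) = res g := by
    intro g hg
    have hc : ∃ g' ∈ OPlus B' D', res g' = res g := ⟨g, hg, rfl⟩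
    grind
  refine (Set.finite_iUnion fun c : Matrix (Fin n) (Fin n) (ZMod N) =>
    hP.image fun φ => φ ∘ aq A' ∘ ac (rep c)).subset ?_
  rintro _ ⟨g, hg, rfl⟩
  obtain ⟨hr1, hr2⟩ := hrep g hg
  refine mem_iUnion.2 ⟨res g, ?_⟩
  obtain ⟨r', hr', e1, e2⟩ := oplus_inv hB' hr1
  set r := rep (res g)
  have hh : g * r' ∈ OPlus B' D' := oplus_mul hg hr'
  have hX : ∃ X : Matrix (Fin n) (Fin n) ℤ, g * r' = 1 + (N : ℤ) • X := by
    have : ∀ i j, ∃ x : ℤ, g i j - r i j = N * x := by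
      intro i j
      have := congrFun (congrFun hr2 i) j
      simp only [res, Matrix.map_apply] at this
      exact (Int.modEq_iff_dvd.1 ((ZMod.intCast_eq_intCast_iff _ _ _).1 this))
    choose X hX using this
    refine ⟨Matrix.of X * r', ?_⟩
    have : g = r + (N : ℤ) • Matrix.of X := by
      ext i j; simp [← hX]
    conv_lhs => rw [this]
    rw [Matrix.add_mul, e1, Matrix.smul_mul]
  obtain ⟨X, hX⟩ := hX
  set k := g * r'
  set γ : Matrix (Fin n) (Fin n) ℤ := 1 + M' * X * M with hγ
  have hγq : qm γ = A' * qm k * A := by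
    have e3 : qm k = 1 + (N : ℚ) • qm X := by
      rw [hX]; ext i j
      simp only [qm, Matrix.map_apply, Matrix.add_apply, Matrix.smul_apply, Matrix.one_apply,
        smul_eq_mul]
      simp
    have e4 : qm γ = 1 + qm M' * qm X * qm M := by
      rw [← qm_mul, ← qm_mul, hγ]; ext i j; simp [qm, Matrix.one_apply]
    rw [e3, e4, ← hM, ← hM', Matrix.mul_add, Matrix.add_mul, Matrix.mul_one, h.r]
    congr 1
    simp only [Matrix.mul_smul, Matrix.smul_mul, smul_smul, N]
    simp
  have hγa : ∀ Z : Fin n → ℂ, ac γ Z = aq A' (ac k (aq A Z)) := by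
    intro Z
    rw [← aq_qm, hγq, aq_mul, aq_mul, aq_qm]
  have hγi : γᵀ * B * γ = B := by
    refine isom_of_bl fun x y => ?_
    have e5 : ∀ x : Fin n → ℤ, (ic (ac γ x) : Fin n → ℚ) = aq A' (ac k (aq A (ic x))) := by
      intro x
      rw [← ac_ic, ← aq_qm, hγq, aq_mul, aq_mul, aq_qm]
    have : bl B (ic (ac γ x) : Fin n → ℚ) (ic (ac γ y)) = bl B (ic x) (ic y) := by
      rw [e5, e5, bl_aq h.symm.iso, bl_ac hh.1, bl_aq h.iso]
    simpa
  have hγO : γ ∈ OPlus B D := by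
    obtain ⟨Z, hZ⟩ := comp_nonempty hD
    refine mem_oplus hB hD hγi ⟨Z, hZ, ?_⟩
    obtain ⟨W, hW, e⟩ := oplus_mem hh (⟨Z, hZ, rfl⟩ : aq A Z ∈ D')
    rw [hγa, ← e, h.symm.aq_aq]
    omega
  refine ⟨P ∘ ac γ, ⟨γ, hγO, rfl⟩, funext fun Z => ?_⟩
  simp only [Function.comp]
  rw [hγa, h.aq_aq, ← ac_mul]
  have : k * r = g := by rw [Matrix.mul_assoc, e2, Matrix.mul_one]
  rw [this]

/-- `B` is the Gram matrix of a maximal even lattice. -/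
def Maxl (B : Matrix (Fin n) (Fin n) ℤ) : Prop :=
  ∀ y : Fin n → ℚ, (∀ v : Fin n → ℤ, ∃ m : ℤ, bl B y (ic v) = m) → (∃ m : ℤ, bl B y y = 2 * m) →
    ∃ w : Fin n → ℤ, y = ic w

lemma exists_coord {y : Fin n → ℚ} (hy : ¬ ∃ w : Fin n → ℤ, y = ic w) :
    ∃ (a : ℕ) (p : ℕ) (w : Fin n → ℤ) (i : Fin n), p.Prime ∧ ((p * a : ℕ) : ℚ) • y = ic w ∧
      ¬ (p : ℤ) ∣ w i := by
  classical
  have hex : ∃ d : ℕ, d ≠ 0 ∧ ∃ w : Fin n → ℤ, (d : ℚ) • y = ic w := by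
    refine ⟨∏ i, (y i).den, Finset.prod_ne_zero_iff.2 fun i _ => (y i).den_nz, ?_⟩
    have : ∀ i, ∃ m : ℤ, ((∏ i, (y i).den : ℕ) : ℚ) * y i = m := by
      intro i
      obtain ⟨k, hk⟩ := Finset.dvd_prod_of_mem (fun i => (y i).den) (Finset.mem_univ i)
      refine ⟨(y i).num * k, ?_⟩
      rw [hk]
      have := Rat.den_mul_eq_num (y i)
      push_cast
      grind
    choose w hw using this
    exact ⟨w, funext hw⟩
  obtain ⟨hd0, w, hw⟩ := Nat.find_spec hex
  set d := Nat.find hex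
  have hd1 : d ≠ 1 := by
    intro h
    simp_all
  obtain ⟨p, hp, a, ha⟩ := Nat.exists_prime_and_dvd hd1
  have : ¬ ∀ i, (p : ℤ) ∣ w i := by
    intro hall
    choose u hu using hall
    have ha0 : a ≠ 0 := by simp_all
    refine Nat.find_min hex (m := a) ?_ ⟨ha0, u, ?_⟩
    · change a < d
      rw [ha]
      exact (Nat.lt_mul_iff_one_lt_left (Nat.pos_of_ne_zero ha0)).2 hp.one_lt
    · ext i
      have h1 := congrFun hw i
      simp only [Pi.smul_apply, smul_eq_mul, ic, hu, ha] at h1 ⊢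
      push_cast at h1
      have hp0 : (p : ℚ) ≠ 0 := by simp_all
      exact mul_left_cancel₀ hp0 (by linarith)
  push Not at this
  obtain ⟨i, hi⟩ := this
  exact ⟨a, p, w, i, hp, by simp_all, hi⟩

lemma exists_overlattice (hB : Sig B) (h : ¬ Maxl B) :
    ∃ B' A A' M, Iso B B' A A' ∧ A = qm M ∧ Sig B' ∧ B'.det.natAbs < B.det.natAbs := by
  unfold Maxl at h
  push Not at h
  obtain ⟨y, hy1, ⟨k, hk⟩, hy3⟩ := h
  obtain ⟨a, p, w, i, hp, hw, hi⟩ := exists_coord (by simpa)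
  have hp0 : (p : ℚ) ≠ 0 := by exact_mod_cast hp.ne_zero
  have hcop : IsCoprime (w i) (p : ℤ) := by
    rw [isCoprime_comm]
    exact (Nat.prime_iff_prime_int.1 hp).irreducible.coprime_iff_not_dvd.2 hi
  obtain ⟨m, u, hmu⟩ := hcop
  set e : Fin n → ℤ := Pi.single i 1 with he
  set w₂ : Fin n → ℤ := m • w + (u * p) • e with hw₂
  have hw2i : w₂ i = 1 := by simp_all
  set y₂ : Fin n → ℚ := ((m * a : ℤ) : ℚ) • y + ic (u • e) with hy₂
  have hpy : (p : ℚ) • y₂ = ic w₂ := by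
    rw [hy₂, hw₂, smul_add, smul_smul]
    simp only [ic_add, ic_smul, ← hw, smul_smul]
    congr 2 <;> push_cast <;> ring
  have hdual : ∀ v : Fin n → ℤ, ∃ c : ℤ, bl B y₂ (ic v) = c := by
    intro v
    obtain ⟨c, hc⟩ := hy1 v
    exact ⟨m * a * c + bl B (u • e) v, by simp [hy₂, hc]⟩
  have heven : ∃ c : ℤ, bl B y₂ y₂ = 2 * c := by
    obtain ⟨c, hc⟩ := hy1 (u • e)
    obtain ⟨c', hc'⟩ := hB.even (u • e)
    refine ⟨(m * a) ^ 2 * k + (m * a) * c + c', ?_⟩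
    rw [hy₂]
    simp only [bl_add_left, bl_add_right, bl_smul_left, bl_smul_right, bl_ic, hc',
      hB.comm (ic (u • e)) y, hc, hk]
    push_cast; ring
  have hform : ∀ x x' : Fin n → ℤ, ∀ c c' : ℤ, ∃ r : ℤ,
      bl B (ic x + (c : ℚ) • y₂ : Fin n → ℚ) (ic x' + (c' : ℚ) • y₂) = r := by
    intro x x' c c'
    obtain ⟨r1, h1⟩ := hdual x
    obtain ⟨r2, h2⟩ := hdual x'
    obtain ⟨r3, h3⟩ := heven
    refine ⟨bl B x x' + c' * r1 + c * r2 + c * c' * (2 * r3), ?_⟩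
    simp only [bl_add_left, bl_add_right, bl_smul_left, bl_smul_right, bl_ic, h1, h2, h3,
      hB.comm (ic x) y₂]
    push_cast; ring
  set ei : Fin n → ℚ := Pi.single i 1 with hei
  have hice : (ic e : Fin n → ℚ) = ei := by
    ext j; by_cases h : j = i
    · subst h; simp [ic, he, hei]
    · simp [ic, he, hei, h]
  let C : Matrix (Fin n) (Fin n) ℚ := 1 + vecMulVec (y₂ - ei) ei
  let M : Matrix (Fin n) (Fin n) ℤ := 1 + vecMulVec ((p : ℤ) • e - w₂) e
  have hqM : qm M = 1 + vecMulVec ((p : ℚ) • ei - ic w₂) ei := by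
    ext j l
    simp only [qm, M, Matrix.map_apply, Matrix.add_apply, vecMulVec_apply, Matrix.one_apply,
      ← hice, ic, Pi.sub_apply, Pi.smul_apply, smul_eq_mul]
    simp
  have hCM : C * qm M = 1 := by
    have e1 : ei ⬝ᵥ ((p : ℚ) • ei - ic w₂) = p - 1 := by
      rw [hei, single_dotProduct]
      simp [ic, hw2i]
    rw [hqM]
    simp only [C, Matrix.add_mul, Matrix.mul_add, Matrix.one_mul, Matrix.mul_one,
      vecMulVec_mul_vecMulVec, e1]
    rw [add_assoc, ← add_assoc (vecMulVec _ _)]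
    ext j l
    have := congrFun hpy j
    simp only [Matrix.add_apply, vecMulVec_apply, Pi.sub_apply, Pi.smul_apply, smul_eq_mul] at this ⊢
    rw [← this]
    ring
  have hCx : ∀ x : Fin n → ℤ, aq C (ic x : Fin n → ℚ) = ic (x - x i • e) + ((x i : ℤ) : ℚ) • y₂ := by
    intro x
    have : aq C (ic x : Fin n → ℚ) = ic x + (x i : ℚ) • (y₂ - ei) := by
      ext j
      simp [aq, C, add_mulVec, vecMulVec_mulVec, ic, hei]
      ring
    rw [this, ic_sub, ic_smul, hice, smul_sub]
    abel
  have hZ : ∀ j l, ∃ r : ℤ, (Cᵀ * qm B * C) j l = r := by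
    intro j l
    obtain ⟨r, hr⟩ := hform (Pi.single j 1 - (Pi.single j 1 : Fin n → ℤ) i • e)
      (Pi.single l 1 - (Pi.single l 1 : Fin n → ℤ) i • e) ((Pi.single j 1 : Fin n → ℤ) i)
      ((Pi.single l 1 : Fin n → ℤ) i)
    rw [← hCx, ← hCx] at hr
    refine ⟨r, ?_⟩
    rw [← hr]
    have hcol : ∀ l : Fin n, aq C (ic (Pi.single l 1 : Fin n → ℤ) : Fin n → ℚ) = C.col l := by
      intro l
      have : (ic (Pi.single l 1 : Fin n → ℤ) : Fin n → ℚ) = Pi.single l 1 := by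
        ext j
        by_cases h : j = l
        · subst h; simp [ic]
        · simp [ic, h]
      rw [this]
      ext j
      simp [aq]
    rw [hcol, hcol, bl_eq_dot, Matrix.mul_assoc]
    rfl
  choose B' hB' using hZ
  have hB'q : qm (Matrix.of B') = Cᵀ * qm B * C := by
    ext j l; simp [hB']
  have hiso' : Iso (Matrix.of B') B C (qm M) := ⟨hCM, hB'q.symm⟩
  refine ⟨Matrix.of B', qm M, C, M, hiso'.symm, rfl, hiso'.symm.sig hB ?_, ?_⟩
  · intro x
    obtain ⟨r1, h1⟩ := hdual (x - x i • e)
    obtain ⟨r2, h2⟩ := heven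
    obtain ⟨r3, h3⟩ := hB.even (x - x i • e)
    refine ⟨r3 + x i * r1 + x i ^ 2 * r2, ?_⟩
    have h4 : ((bl (Matrix.of B') x x : ℤ) : ℚ) = 2 * (r3 + x i * r1 + x i ^ 2 * r2) := by
      rw [← bl_ic, ← bl_aq hiso'.iso, hCx]
      simp only [bl_add_left, bl_add_right, bl_smul_left, bl_smul_right, bl_ic, h1, h2, h3,
        hB.comm (ic (x - x i • e)) y₂]
      push_cast; ring
    exact_mod_cast h4
  · have h2 : Mᵀ * Matrix.of B' * M = B := by
      refine qm_injective ?_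
      rw [← hiso'.symm.iso, qm_mul, qm_mul]
      rfl
    have hdM : M.det = p := by
      have : M = 1 + replicateCol Unit ((p : ℤ) • e - w₂) * replicateRow Unit e := by
        simp only [M]
        rw [vecMulVec_eq Unit]
      rw [this, det_one_add_replicateCol_mul_replicateRow, he, single_dotProduct]
      simp [hw2i]
    have h3 := congrArg Matrix.det h2
    rw [det_mul, det_mul, det_transpose, hdM] at h3
    rw [← h3, Int.natAbs_mul, Int.natAbs_mul, Int.natAbs_natCast]
    have : 0 < (Matrix.of B').det.natAbs := by
      rw [Nat.pos_iff_ne_zero, Ne, Int.natAbs_eq_zero]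
      intro h0
      exact hB.det (by rw [← h3, h0]; ring)
    have hp2 := hp.two_le
    nlinarith [Nat.mul_le_mul hp2 hp2]

theorem exists_maximal (hB : Sig B) :
    ∃ B' A A' M, Iso B B' A A' ∧ A = qm M ∧ Sig B' ∧ Maxl B' := by
  generalize hd : B.det.natAbs = d
  induction d using Nat.strong_induction_on generalizing B with
  | _ d ih =>
    by_cases h : Maxl B
    · exact ⟨B, 1, 1, 1, ⟨by simp, by simp⟩, by simp, hB, h⟩
    · obtain ⟨B₁, A, A', M, h1, h2, h3, h4⟩ := exists_overlattice hB h
      obtain ⟨B₂, C, C', M', g1, g2, g3, g4⟩ := ih _ (hd ▸ h4) h3 rfl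
      exact ⟨B₂, C * A, A' * C', M' * M, h1.trans g1, by rw [qm_mul, h2, g2], g3, g4⟩

lemma cone_smul {Z : Fin n → ℂ} (hZ : Z ∈ Cone B) {t : ℂ} (ht : t ≠ 0) : t • Z ∈ Cone B := by
  change bl B Z Z = 0 ∧ 0 < (bl B Z (fun i => (starRingEnd ℂ) (Z i))).re at hZ
  change bl B (t • Z) (t • Z) = 0 ∧ 0 < (bl B (t • Z) (fun i => (starRingEnd ℂ) ((t • Z) i))).re
  have : (fun i => (starRingEnd ℂ) ((t • Z) i)) =
      (starRingEnd ℂ) t • fun i => (starRingEnd ℂ) (Z i) := by ext i; simp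
  rw [this]
  simp only [bl_smul_left, bl_smul_right]
  refine ⟨by grind, ?_⟩
  rw [← mul_assoc, mul_comm ((starRingEnd ℂ) t), Complex.mul_conj, Complex.re_ofReal_mul]
  simp_all

lemma comp_smul (hD : IsComponent B D) {Z : Fin n → ℂ} (hZ : Z ∈ D) {t : ℂ} (ht : t ≠ 0) :
    t • Z ∈ D := by
  have hconn : IsPreconnected ((fun t : ℂ => t • Z) '' {0}ᶜ) := by
    refine IsPreconnected.image ?_ _ (by fun_prop)
    refine (isConnected_compl_singleton_of_one_lt_rank ?_ 0).isPreconnected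
    simp
  refine comp_max hD hconn ?_ ⟨Z, ⟨1, by simp, by simp⟩, hZ⟩ ⟨t, ht, rfl⟩
  rintro _ ⟨s, hs, rfl⟩
  exact cone_smul (comp_subset_cone hD hZ) hs

lemma comp_smul_iff (hD : IsComponent B D) {Z : Fin n → ℂ} {t : ℂ} (ht : t ≠ 0) :
    t • Z ∈ D ↔ Z ∈ D := by
  refine ⟨fun h => ?_, fun h => comp_smul hD h ht⟩
  have := comp_smul hD h (inv_ne_zero ht)
  simp_all

/-- A form of weight `k`, extended by zero, whose zeros lie on hyperplanes of roots. -/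
structure MF (B : Matrix (Fin n) (Fin n) ℤ) (D : Set (Fin n → ℂ)) (k : ℤ)
    (P : (Fin n → ℂ) → ℂ) : Prop where
  supp : ∀ Z, Z ∉ D → P Z = 0
  hol : DifferentiableOn ℂ P D
  hom : ∀ t : ℂ, t ≠ 0 → ∀ Z ∈ D, P (t • Z) = t ^ (-k) * P Z
  zeros : ∀ Z ∈ D, P Z = 0 → ∃ v : Fin n → ℤ, bl B v v = -2 ∧ bl B Z (ic v) = 0

lemma MF.comp (hB : Sig B) (h : MF B D k P) {g : Matrix (Fin n) (Fin n) ℤ} (hg : g ∈ OPlus B D) :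
    MF B D k (P ∘ ac g) := by
  refine ⟨fun Z hZ => h.supp _ fun H => hZ ((oplus_mem_iff hB hg Z).1 H),
    h.hol.comp (differentiable_ac g).differentiableOn fun Z hZ => oplus_mem hg hZ, ?_, ?_⟩
  · intro t ht Z hZ
    simp only [Function.comp, ac_smul]
    exact h.hom t ht _ (oplus_mem hg hZ)
  · intro Z hZ hP
    obtain ⟨v, hv, hv'⟩ := h.zeros _ (oplus_mem hg hZ) hP
    obtain ⟨g', hg', h1, h2⟩ := oplus_inv hB hg
    refine ⟨ac g' v, by rw [bl_ac hg'.1, hv], ?_⟩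
    rw [← bl_ac hg.1, ac_ic, ← ac_mul, h1, ac_one]
    omega

lemma MF.prod {ι : Type*} {s : Finset ι} (hs : s.Nonempty)
    {φ : ι → (Fin n → ℂ) → ℂ} (h : ∀ i ∈ s, MF B D k (φ i)) :
    MF B D (s.card * k) (fun Z => ∏ i ∈ s, φ i Z) := by
  refine ⟨?_, ?_, ?_, ?_⟩
  · intro Z hZ
    obtain ⟨i, hi⟩ := hs
    exact Finset.prod_eq_zero hi ((h i hi).supp Z hZ)
  · classical
    clear hs
    induction s using Finset.induction_on with
    | empty => simp
    | insert i s his ih =>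
      simp only [Finset.prod_insert his]
      exact (h i (Finset.mem_insert_self i s)).hol.mul
        (ih fun j hj => h j (Finset.mem_insert_of_mem hj))
  · intro t ht Z hZ
    rw [Finset.prod_congr rfl fun i hi => (h i hi).hom t ht Z hZ, Finset.prod_mul_distrib,
      Finset.prod_const, ← zpow_natCast, ← _root_.zpow_mul]
    grind
  · intro Z hZ h0
    obtain ⟨i, hi, h1⟩ := Finset.prod_eq_zero_iff.1 h0
    exact (h i hi).zeros Z hZ h1

lemma orb_comp {g : Matrix (Fin n) (Fin n) ℤ} (hg : g ∈ OPlus B D) {φ : (Fin n → ℂ) → ℂ}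
    (hφ : φ ∈ orb B D P) : φ ∘ ac g ∈ orb B D P := by
  obtain ⟨h, hh, rfl⟩ := hφ
  refine ⟨h * g, oplus_mul hh hg, funext fun Z => ?_⟩
  simp [ac_mul]

lemma orb_self (hB : Sig B) (hD : IsComponent B D) : P ∈ orb B D P := by
  obtain ⟨Z, hZ⟩ := comp_nonempty hD
  exact ⟨1, mem_oplus hB hD (by simp) ⟨Z, hZ, by simpa⟩, funext fun Z => by simp⟩

lemma orb_prod_invariant (hB : Sig B) (hf : (orb B D P).Finite) (G : ℂ → ℂ)
    {g : Matrix (Fin n) (Fin n) ℤ} (hg : g ∈ OPlus B D) (Z : Fin n → ℂ) :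
    ∏ φ ∈ hf.toFinset, G (φ (ac g Z)) = ∏ φ ∈ hf.toFinset, G (φ Z) := by
  obtain ⟨g', hg', h1, h2⟩ := oplus_inv hB hg
  refine Finset.prod_nbij' (fun φ => φ ∘ ac g) (fun φ => φ ∘ ac g') ?_ ?_ ?_ ?_ ?_
  · intro φ hφ
    rw [Set.Finite.mem_toFinset] at hφ ⊢
    exact orb_comp hg hφ
  · intro φ hφ
    rw [Set.Finite.mem_toFinset] at hφ ⊢
    exact orb_comp hg' hφ
  · intro φ _
    funext W
    simp [← ac_mul, h1]
  · intro φ _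
    funext W
    simp [← ac_mul, h2]
  simp

theorem MF.norm (hB : Sig B) (hD : IsComponent B D) (h : MF B D k P) (hf : (orb B D P).Finite) :
    ∃ (m : ℕ) (Q : _), m ≠ 0 ∧ MF B D (m * k) Q ∧ ∀ g ∈ OPlus B D, ∀ Z, Q (ac g Z) = Q Z := by
  have hne : hf.toFinset.Nonempty := ⟨P, by simpa using orb_self hB hD⟩
  refine ⟨hf.toFinset.card, fun Z => ∏ φ ∈ hf.toFinset, φ Z, by positivity,
    MF.prod hne ?_, fun g hg Z => orb_prod_invariant hB hf (fun z => z) hg Z⟩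
  intro φ hφ
  rw [Set.Finite.mem_toFinset] at hφ
  obtain ⟨g, hg, rfl⟩ := hφ
  exact h.comp hB hg

lemma MF.transport {M : Matrix (Fin n) (Fin n) ℤ}
    {A' : Matrix (Fin n) (Fin n) ℚ} (hi : Iso B B' (qm M) A') (h : MF B D k P) :
    MF B' (aq (qm M) '' D) k (P ∘ aq A') := by
  have hmem : ∀ Z, Z ∈ aq (qm M) '' D ↔ aq A' Z ∈ D := by
    intro Z
    constructor
    · rintro ⟨W, hW, rfl⟩
      rwa [hi.symm.aq_aq]
    · intro h
      exact ⟨_, h, hi.aq_aq Z⟩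
  refine ⟨fun Z hZ => h.supp _ fun H => hZ ((hmem Z).2 H),
    h.hol.comp (differentiable_aq A').differentiableOn fun Z hZ => (hmem Z).1 hZ, ?_, ?_⟩
  · intro t ht Z hZ
    simp only [Function.comp, aq_smul]
    exact h.hom t ht _ ((hmem Z).1 hZ)
  · intro Z hZ h0
    obtain ⟨v, hv, hv'⟩ := h.zeros _ ((hmem Z).1 hZ) h0
    refine ⟨ac M v, ?_, ?_⟩
    · have : bl B' (ic (ac M v) : Fin n → ℚ) (ic (ac M v)) = bl B (ic v) (ic v) := by
        rw [← ac_ic, ← aq_qm, bl_aq hi.iso]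
      rw [bl_ic, bl_ic] at this
      rw [← hv]; simpa
    · rw [← hv', ← bl_aq hi.iso, hi.aq_aq, aq_qm, ac_ic]

lemma char_pow {Γ : Set (Matrix (Fin n) (Fin n) ℤ)} {χ : Matrix (Fin n) (Fin n) ℤ → ℂ}
    (hΓ : IsFiniteIndexSubgroup B D Γ) (hχ : IsCharacter Γ χ) :
    ∃ N : ℕ, N ≠ 0 ∧ ∀ g ∈ Γ, χ g ^ N = 1 := by
  have hone : ∀ z ∈ χ '' Γ, ∃ m : ℕ, m ≠ 0 ∧ z ^ m = 1 := by
    rintro _ ⟨g, hg, rfl⟩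
    have hp : ∀ m : ℕ, g ^ m ∈ Γ ∧ χ (g ^ (m + 1)) = χ g ^ (m + 1) := by
      intro m
      induction m with
      | zero => exact ⟨by simpa using hΓ.one_mem, by simp⟩
      | succ m ih =>
        have h1 : g ^ (m + 1) ∈ Γ := by rw [pow_succ]; exact hΓ.mul_mem _ ih.1 _ hg
        exact ⟨h1, by rw [pow_succ, hχ.map_mul _ h1 _ hg, ih.2, pow_succ (χ g) (m + 1)]⟩
    obtain ⟨a, -, b, -, hab, he⟩ := Set.infinite_univ.exists_ne_map_eq_of_mapsTo
      (f := fun m : ℕ => χ g ^ (m + 1)) (t := χ '' Γ)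
      (fun m _ => ⟨g ^ (m + 1), (hp (m + 1)).1, (hp m).2⟩) hχ.finite_image
    wlog hlt : a < b generalizing a b
    · grind
    refine ⟨b - a, by omega, ?_⟩
    have h1 : χ g ^ (b + 1) = χ g ^ (a + 1) * χ g ^ (b - a) := by
      rw [← pow_add]; grind
    rw [h1] at he
    have h2 := pow_ne_zero (a + 1) (hχ.ne_zero g hg)
    grind
  choose! m hm0 hm using hone
  refine ⟨∏ z ∈ hχ.finite_image.toFinset, m z, Finset.prod_ne_zero_iff.2 fun z hz =>
    hm0 z (by simp_all), fun g hg => ?_⟩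
  have hz : χ g ∈ χ '' Γ := ⟨g, hg, rfl⟩
  obtain ⟨c, hc⟩ := Finset.dvd_prod_of_mem m ((Set.Finite.mem_toFinset hχ.finite_image).2 hz)
  rw [hc, pow_mul, hm _ hz, one_pow]

lemma const_of_finite {X : Type*} [TopologicalSpace X] {S : Set X} (hS : IsPreconnected S)
    {f : X → ℂ} (hf : ContinuousOn f S) {V : Set ℂ} (hV : V.Finite) (h : ∀ x ∈ S, f x ∈ V)
    {x y : X} (hx : x ∈ S) (hy : y ∈ S) : f x = f y := by
  have h1 : IsPreconnected (f '' S) := hS.image f hf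
  have h2 : (f '' S).Finite := hV.subset (by simpa)
  by_contra hne
  exact h1.infinite_of_nontrivial ⟨_, ⟨x, hx, rfl⟩, _, ⟨y, hy, rfl⟩, hne⟩ h2

theorem exists_MF (hB : Sig B) (h : Is2Reflective B) :
    ∃ (B' : Matrix (Fin n) (Fin n) ℤ) (D' : Set (Fin n → ℂ)) (k : ℤ) (Q : (Fin n → ℂ) → ℂ),
      Sig B' ∧ Maxl B' ∧ IsComponent B' D' ∧ MF B' D' k Q ∧ (orb B' D' Q).Finite ∧
      ∃ Z ∈ D', ∃ W ∈ D', Q Z ≠ Q W := by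
  classical
  obtain ⟨D, hD, Γ, χ, k, F, hΓ, hχ, hF, hnc, hz⟩ := h
  obtain ⟨N, hN, hχN⟩ := char_pow hΓ hχ
  set Q : (Fin n → ℂ) → ℂ := D.indicator fun Z => F Z ^ N with hQ
  have hQD : ∀ Z ∈ D, Q Z = F Z ^ N := fun Z hZ => indicator_of_mem hZ _
  have hMF : MF B D (N * k) Q := by
    refine ⟨fun Z hZ => indicator_of_notMem hZ _, ?_, ?_, ?_⟩
    · exact (hF.holo.pow N).congr hQD
    · intro t ht Z hZ
      rw [hQD _ hZ, hQD _ (comp_smul hD hZ ht), hF.homogeneous t ht Z hZ, mul_pow,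
        ← zpow_natCast, ← _root_.zpow_mul]
      grind
    · intro Z hZ h0
      rw [hQD _ hZ] at h0
      obtain ⟨v, hv, hv'⟩ := hz Z hZ (pow_eq_zero_iff hN |>.1 h0)
      exact ⟨v, by rw [← hv, qnorm_eq], hv'⟩
  have hinv : ∀ g ∈ Γ, Q ∘ ac g = Q := by
    intro g hg
    funext Z
    by_cases hZ : Z ∈ D
    · have := hF.equivariant g hg Z hZ
      rw [actC_eq] at this
      simp only [Function.comp]
      rw [hQD _ hZ, hQD _ (oplus_mem (hΓ.subset hg) hZ), this, mul_pow, hχN g hg, one_mul]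
    · simp only [Function.comp]
      rw [hMF.supp _ hZ, hMF.supp _ fun H => hZ ((oplus_mem_iff hB (hΓ.subset hg) Z).1 H)]
  have hfin : (orb B D Q).Finite := by
    obtain ⟨S, hS⟩ := hΓ.finite_index
    have hinvS : ∀ s ∈ S, s ∈ OPlus B D → ∃ s', s * s' = 1 := fun s _ hs => by
      obtain ⟨s', _, h1, _⟩ := oplus_inv hB hs
      grind
    refine (Set.Finite.image (fun s : Matrix (Fin n) (Fin n) ℤ => Q ∘ ac s⁻¹)
      S.finite_toSet).subset ?_
    rintro _ ⟨g, hg, rfl⟩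
    obtain ⟨g', hg', h1, h2⟩ := oplus_inv hB hg
    obtain ⟨s, hs, γ, hγ, e⟩ := hS g' hg'
    refine ⟨s, hs, ?_⟩
    have e1 : γ * g * s = 1 := by
      have : s * (γ * g) = 1 := by grind
      exact mul_eq_one_comm.1 this
    have e2 : s⁻¹ = γ * g := Matrix.inv_eq_left_inv e1
    funext Z
    simp only [Function.comp]
    rw [e2, ac_mul]
    exact congrFun (hinv γ hγ) _
  have hQnc : ∃ Z ∈ D, ∃ W ∈ D, Q Z ≠ Q W := by
    by_contra! hc
    obtain ⟨Z₀, hZ₀⟩ := comp_nonempty hD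
    refine hnc ⟨F Z₀, fun Z hZ => ?_⟩
    have hroots : {z : ℂ | z ^ N = F Z₀ ^ N}.Finite := by
      refine (Polynomial.nthRoots N (F Z₀ ^ N)).toFinset.finite_toSet.subset fun z hz => ?_
      simpa [Polynomial.mem_nthRoots (Nat.pos_of_ne_zero hN)] using hz
    refine const_of_finite (comp_conn hD) hF.holo.continuousOn hroots (fun W hW => ?_) hZ hZ₀
    grind
  obtain ⟨B', A, A', M, hi, rfl, hB', hmax⟩ := exists_maximal hB
  obtain ⟨Z, hZ, W, hW, hne⟩ := hQnc
  refine ⟨B', _, _, _, hB', hmax, hi.comp hB hB' hD, hMF.transport hi,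
    orb_transport hB hB' hi hD hfin, _, ⟨Z, hZ, rfl⟩, _, ⟨W, hW, rfl⟩, ?_⟩
  simpa only [Function.comp, hi.symm.aq_aq] using hne

/-- Four vectors spanning two orthogonal hyperbolic planes. -/
structure Fr (B : Matrix (Fin n) (Fin n) ℤ) (E E' e f : Fin n → ℤ) : Prop where
  EE : bl B E E = 0
  E'E' : bl B E' E' = 0
  EE' : bl B E E' = 1
  ee : bl B e e = 0
  ff : bl B f f = 0
  ef : bl B e f = 1
  Ee : bl B E e = 0
  Ef : bl B E f = 0
  E'e : bl B E' e = 0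
  E'f : bl B E' f = 0

lemma Fr.gr (hB : Sig B) (h : Fr B E E' e f) (R : Type*) [CommRing R] :
    bl B (ic E : Fin n → R) (ic E) = 0 ∧ bl B (ic E' : Fin n → R) (ic E') = 0 ∧
    bl B (ic E : Fin n → R) (ic E') = 1 ∧ bl B (ic E' : Fin n → R) (ic E) = 1 ∧
    bl B (ic e : Fin n → R) (ic e) = 0 ∧ bl B (ic f : Fin n → R) (ic f) = 0 ∧
    bl B (ic e : Fin n → R) (ic f) = 1 ∧ bl B (ic f : Fin n → R) (ic e) = 1 ∧
    bl B (ic E : Fin n → R) (ic e) = 0 ∧ bl B (ic e : Fin n → R) (ic E) = 0 ∧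
    bl B (ic E : Fin n → R) (ic f) = 0 ∧ bl B (ic f : Fin n → R) (ic E) = 0 ∧
    bl B (ic E' : Fin n → R) (ic e) = 0 ∧ bl B (ic e : Fin n → R) (ic E') = 0 ∧
    bl B (ic E' : Fin n → R) (ic f) = 0 ∧ bl B (ic f : Fin n → R) (ic E') = 0 := by
  simp only [bl_ic, hB.comm E' E, hB.comm f e, hB.comm e E,
    hB.comm f E, hB.comm e E', hB.comm f E', h.EE, h.E'E', h.EE', h.ee,
    h.ff, h.ef, h.Ee, h.Ef, h.E'e, h.E'f]
  simp

lemma Fr.gz (hB : Sig B) (h : Fr B E E' e f) :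
    bl B E E = 0 ∧ bl B E' E' = 0 ∧ bl B E E' = 1 ∧ bl B E' E = 1 ∧
    bl B e e = 0 ∧ bl B f f = 0 ∧ bl B e f = 1 ∧ bl B f e = 1 ∧
    bl B E e = 0 ∧ bl B e E = 0 ∧ bl B E f = 0 ∧ bl B f E = 0 ∧
    bl B E' e = 0 ∧ bl B e E' = 0 ∧ bl B E' f = 0 ∧ bl B f E' = 0 := by
  simp only [hB.comm E' E, hB.comm f e, hB.comm e E,
    hB.comm f E, hB.comm e E', hB.comm f E', h.EE, h.E'E', h.EE', h.ee,
    h.ff, h.ef, h.Ee, h.Ef, h.E'e, h.E'f]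
  simp

lemma Fr.swap (hB : Sig B) (h : Fr B E E' e f) : Fr B E E' f e :=
  ⟨h.EE, h.E'E', h.EE', h.ff, h.ee, by rw [hB.comm, h.ef], h.Ef, h.Ee, h.E'f, h.E'e⟩

lemma Fr.neg' (h : Fr B E E' e f) : Fr B E E' (-e) (-f) := by
  constructor <;> simp [h.EE, h.E'E', h.EE', h.ee, h.ff, h.ef, h.Ee, h.Ef, h.E'e, h.E'f]

lemma Fr.lt (hB : Sig B) (h : Fr B E E' e f) {y : Fin n → ℝ} (h1 : bl B y (ic E) = 0)
    (h2 : bl B y (ic E') = 0) (h3 : bl B y (ic e) = 0) (h4 : bl B y (ic f) = 0) (hy : y ≠ 0) :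
    bl B y y < 0 := by
  have G := h.gr hB ℝ
  refine hB.neg (ic E + ic E') (ic e + ic f) y ?_ ?_ ?_ ?_ ?_ hy <;>
    simp_all

lemma Fr.le (hB : Sig B) (h : Fr B E E' e f) {y : Fin n → ℝ} (h1 : bl B y (ic E) = 0)
    (h2 : bl B y (ic E') = 0) (h3 : bl B y (ic e) = 0) (h4 : bl B y (ic f) = 0) :
    bl B y y ≤ 0 := by
  by_cases hy : y = 0
  · simp [hy]
  · exact (h.lt hB h1 h2 h3 h4 hy).le

lemma Fr.le' (hB : Sig B) (h : Fr B E E' e f) {w : Fin n → ℝ} (h1 : bl B w (ic E) = 0)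
    (h2 : bl B w (ic E') = 0) (h3 : bl B w (ic e) = 0) : bl B w w ≤ 0 := by
  have G := h.gr hB ℝ
  have := h.le hB (y := w - bl B w (ic f) • ic e) (by simp_all) (by simp_all)
    (by simp_all) (by simp [G])
  simpa [G, h3, hB.comm (ic e) w] using this

lemma isotropic_ne (hB : Sig B) {v : Fin n → ℤ} (hv : v ≠ 0) (h0 : bl B v v = 0)
    {Z : Fin n → ℂ} (hZ : Z ∈ Cone B) : bl B Z (ic v) ≠ 0 := by
  intro hc
  obtain ⟨h1, h2, h3⟩ := (mem_cone hB.symm).1 hZ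
  have hr := congrArg Complex.re hc
  have hi := congrArg Complex.im hc
  rw [bl_re] at hr
  rw [bl_im] at hi
  simp only [vre_ic, vim_ic, bl_zero_right, sub_zero, zero_add, Complex.zero_re,
    Complex.zero_im] at hr hi
  have := hB.neg (vre Z) (vim Z) (ic v) (h1 ▸ h3) h3 h2 (by rw [hB.comm, hr])
    (by rw [hB.comm, hi]) (fun h => hv (ic_injective (by simpa)))
  simp_all

lemma Fr.E_ne (h : Fr B E E' e f) : E ≠ 0 := by
  rintro rfl; simpa using h.EE'

noncomputable def pt (B : Matrix (Fin n) (Fin n) ℤ) (E E' : Fin n → ℤ) (X : Fin n → ℂ) : Fin n → ℂ :=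
  ic E' + X - (bl B X X / 2) • ic E

/-- The tube domain. -/
def TT (B : Matrix (Fin n) (Fin n) ℤ) (E E' e : Fin n → ℤ) : Set (Fin n → ℂ) :=
  {X | bl B X (ic E) = 0 ∧ bl B X (ic E') = 0 ∧ 0 < (bl B X (ic e)).im ∧ 0 < bl B (vim X) (vim X)}

lemma continuous_pt : Continuous (pt B E E') := by
  unfold pt
  exact (continuous_const.add continuous_id).sub
    (((continuous_bl continuous_id continuous_id).div_const 2).smul continuous_const)

lemma im_bl_ic (X : Fin n → ℂ) (v : Fin n → ℤ) : (bl B X (ic v)).im = bl B (vim X) (ic v) := by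
  rw [bl_im]; simp

lemma re_bl_ic (X : Fin n → ℂ) (v : Fin n → ℤ) : (bl B X (ic v)).re = bl B (vre X) (ic v) := by
  rw [bl_re]; simp

lemma Fr.pt_cone (hB : Sig B) (h : Fr B E E' e f) {X : Fin n → ℂ} (h1 : bl B X (ic E) = 0)
    (h2 : bl B X (ic E') = 0) : pt B E E' X ∈ Cone B ↔ 0 < bl B (vim X) (vim X) := by
  have G := h.gr hB ℂ
  have G' := h.gr hB ℝ
  have hpp : bl B (pt B E E' X) (pt B E E' X) = 0 := by
    simp only [pt, bl_sub_left, bl_sub_right, bl_add_left, bl_add_right, bl_smul_left,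
      bl_smul_right, G, h1, h2, hB.comm (ic E) X, hB.comm (ic E') X]
    ring
  have hv : bl B (vim (pt B E E' X)) (vim (pt B E E' X)) = bl B (vim X) (vim X) := by
    have h3 : bl B (vim X) (ic E) = 0 := by rw [← im_bl_ic, h1]; rfl
    simp only [pt, vim_sub, vim_add, vim_smul, vim_ic, vre_ic, bl_sub_left, bl_sub_right,
      bl_add_left, bl_add_right, bl_smul_left, bl_smul_right, bl_zero_left, bl_zero_right, G', h3,
      hB.comm (ic E) (vim X)]
    ring
  have hre := congrArg Complex.re hpp
  rw [bl_re, hv] at hre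
  change _ ∧ 0 < (bl B (pt B E E' X) fun i => (starRingEnd ℂ) (pt B E E' X i)).re ↔ _
  rw [bl_conj, hv]
  simp only [Complex.zero_re] at hre
  constructor
  · grind
  · intro h4; exact ⟨hpp, by grind⟩

lemma Fr.exists_pt (hB : Sig B) (h : Fr B E E' e f) {Z : Fin n → ℂ} (hZ : Z ∈ Cone B) :
    ∃ X : Fin n → ℂ, bl B X (ic E) = 0 ∧ bl B X (ic E') = 0 ∧ bl B Z (ic E) ≠ 0 ∧
      Z = bl B Z (ic E) • pt B E E' X := by
  have G := h.gr hB ℂ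
  have hne := isotropic_ne hB h.E_ne h.EE hZ
  have hZZ : bl B Z Z = 0 := hZ.1
  set t := bl B Z (ic E) with ht
  refine ⟨t⁻¹ • Z - ic E' - (t⁻¹ * bl B Z (ic E')) • ic E, ?_, ?_, hne, ?_⟩
  · simp_all
  · simp [G]
  · have : bl B (t⁻¹ • Z - ic E' - (t⁻¹ * bl B Z (ic E')) • ic E)
        (t⁻¹ • Z - ic E' - (t⁻¹ * bl B Z (ic E')) • ic E) = - 2 * (t⁻¹ * bl B Z (ic E')) := by
      simp only [bl_sub_left, bl_sub_right, bl_smul_left, bl_smul_right, G, hZZ, ← ht,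
        hB.comm (ic E) Z, hB.comm (ic E') Z]
      grind
    unfold pt
    rw [this]
    ext i
    simp only [Pi.smul_apply, Pi.sub_apply, Pi.add_apply, smul_eq_mul]
    grind

lemma Fr.bl_pt_E (hB : Sig B) (h : Fr B E E' e f) {X : Fin n → ℂ} (h1 : bl B X (ic E) = 0) :
    bl B (pt B E E' X) (ic E) = 1 := by
  simp [pt, h.gr hB ℂ, h1]

lemma Fr.bl_pt (hB : Sig B) {X : Fin n → ℂ} {v : Fin n → ℤ}
    (hv : bl B v E = 0) : bl B (pt B E E' X) (ic v) = bl B X (ic v) + (bl B v E' : ℤ) := by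
  simp only [pt, bl_sub_left, bl_add_left, bl_smul_left, bl_ic, hB.comm E v,
    hB.comm E' v, hv]
  ring

lemma Fr.bl_pt_e (hB : Sig B) (h : Fr B E E' e f) (X : Fin n → ℂ) :
    bl B (pt B E E' X) (ic e) = bl B X (ic e) := by
  rw [Fr.bl_pt hB (by rw [hB.comm, h.Ee]), hB.comm e, h.E'e]
  simp

/-- A frame adapted to the component `D`. -/
structure Datum (B : Matrix (Fin n) (Fin n) ℤ) (D : Set (Fin n → ℂ)) (E E' e f : Fin n → ℤ) :
    Prop extends Fr B E E' e f where
  pos : ∀ Z, Z ∈ D ↔ Z ∈ Cone B ∧ 0 < (bl B Z (ic e) / bl B Z (ic E)).im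

lemma Fr.TT_convex (hB : Sig B) (h : Fr B E E' e f) : Convex ℝ (TT B E E' e) := by
  intro X hX Y hY s t hs ht hst
  obtain ⟨x1, x2, x3, x4⟩ := hX
  obtain ⟨y1, y2, y3, y4⟩ := hY
  have hsm : ∀ (s : ℝ) (X : Fin n → ℂ), s • X = (s : ℂ) • X := fun s X => by rfl
  have hv : ∀ (s : ℝ) (X : Fin n → ℂ), vim ((s : ℂ) • X) = s • vim X := fun s X => by
    rw [vim_smul]; simp
  simp only [hsm]
  refine ⟨by simp only [bl_add_left, bl_smul_left, x1, y1]; ring,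
    by simp only [bl_add_left, bl_smul_left, x2, y2]; ring, ?_, ?_⟩
  · simp only [bl_add_left, bl_smul_left, Complex.add_im, Complex.im_ofReal_mul]
    rcases hs.eq_or_lt with rfl | hs
    · simp_all
    positivity
  · rw [im_bl_ic] at x3 y3
    have hE : ∀ v : Fin n → ℤ, ∀ X : Fin n → ℂ, bl B X (ic v) = 0 → bl B (vim X) (ic v) = 0 := by
      intro v X hX; rw [← im_bl_ic, hX]; rfl
    have key := h.le' hB (w := bl B (vim X) (ic e) • vim Y - bl B (vim Y) (ic e) • vim X)
      (by simp_all) (by simp_all)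
      (by simp; ring)
    simp only [bl_sub_left, bl_sub_right, bl_smul_left, bl_smul_right,
      hB.comm (vim Y) (vim X)] at key
    set b := bl B (vim X) (ic e)
    set b' := bl B (vim Y) (ic e)
    have hpos : 0 < bl B (vim X) (vim Y) := by
      have h1 := mul_pos (mul_pos x3 x3) y4
      have h2 := mul_pos (mul_pos y3 y3) x4
      have h3 : 0 < 2 * (b * b') * bl B (vim X) (vim Y) := by grind
      simp_all
    simp only [vim_add, hv, bl_add_left, bl_add_right, bl_smul_left, bl_smul_right,
      hB.comm (vim Y) (vim X)]
    rcases hs.eq_or_lt with rfl | hs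
    · simp_all
    positivity

theorem Fr.datum (hB : Sig B) (hD : IsComponent B D) (h : Fr B E E' e f) :
    Datum B D E E' e f ∨ Datum B D E E' (-e) (-f) := by
  obtain ⟨Z₀, hZ₀⟩ := comp_nonempty hD
  have hC₀ := comp_subset_cone hD hZ₀
  have hne : ∀ Z ∈ Cone B, ∀ e f : Fin n → ℤ, Fr B E E' e f →
      (bl B Z (ic e) / bl B Z (ic E)).im ≠ 0 := by
    intro Z hZ e f h
    obtain ⟨X, h1, h2, ht, hX⟩ := h.exists_pt hB hZ
    set t := bl B Z (ic E)
    have hp : pt B E E' X ∈ Cone B := by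
      have := cone_smul hZ (inv_ne_zero ht)
      simp_all
    rw [h.pt_cone hB h1 h2] at hp
    have : bl B Z (ic e) / t = bl B X (ic e) := by
      rw [hX, bl_smul_left, h.bl_pt_e hB]; grind
    rw [this, im_bl_ic]
    intro h0
    have := h.le' hB (w := vim X) (by rw [← im_bl_ic, h1]; rfl) (by rw [← im_bl_ic, h2]; rfl) h0
    grind
  have main : ∀ e f : Fin n → ℤ, Fr B E E' e f →
      0 < (bl B Z₀ (ic e) / bl B Z₀ (ic E)).im → Datum B D E E' e f := by
    intro e f h h0
    refine ⟨h, fun Z => ⟨fun hZ => ⟨comp_subset_cone hD hZ, ?_⟩, ?_⟩⟩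
    · have hcont : ContinuousOn (fun Z => (bl B Z (ic e) / bl B Z (ic E)).im) D := by
        refine Complex.continuous_im.comp_continuousOn (ContinuousOn.div ?_ ?_ ?_)
        · exact (continuous_bl continuous_id continuous_const).continuousOn
        · exact (continuous_bl continuous_id continuous_const).continuousOn
        · intro Z hZ; exact isotropic_ne hB h.E_ne h.EE (comp_subset_cone hD hZ)
      by_contra hle
      obtain ⟨W, hW, hW0⟩ := (comp_conn hD).intermediate_value hZ hZ₀ hcont
        (show (0 : ℝ) ∈ _ from ⟨not_lt.1 hle, h0.le⟩)
      exact hne W (comp_subset_cone hD hW) e f h hW0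
    · rintro ⟨hZ, hpos⟩
      have hmem : ∀ Z ∈ Cone B, 0 < (bl B Z (ic e) / bl B Z (ic E)).im →
          Z ∈ (fun p : ℂ × (Fin n → ℂ) => p.1 • pt B E E' p.2) '' ({0}ᶜ ×ˢ TT B E E' e) := by
        intro Z hZ hpos
        obtain ⟨X, h1, h2, ht, hX⟩ := h.exists_pt hB hZ
        refine ⟨(bl B Z (ic E), X), ⟨ht, h1, h2, ?_, ?_⟩, hX.symm⟩
        · have : bl B Z (ic e) / bl B Z (ic E) = bl B X (ic e) := by
            conv_lhs => enter [1]; rw [hX]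
            rw [bl_smul_left, h.bl_pt_e hB]; grind
          grind
        · rw [← h.pt_cone hB h1 h2]
          have := cone_smul hZ (inv_ne_zero ht)
          conv at this => enter [2, 2]; rw [hX]
          rwa [smul_smul, inv_mul_cancel₀ ht, one_smul] at this
      refine comp_max hD ?_ ?_ ⟨Z₀, hmem Z₀ hC₀ h0, hZ₀⟩ (hmem Z hZ hpos)
      · refine IsPreconnected.image (IsPreconnected.prod ?_ (h.TT_convex hB).isPreconnected) _
          (continuous_fst.smul (continuous_pt.comp continuous_snd)).continuousOn
        refine (isConnected_compl_singleton_of_one_lt_rank ?_ 0).isPreconnected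
        simp
      · rintro _ ⟨⟨t, X⟩, ⟨ht, hX1, hX2, -, hX4⟩, rfl⟩
        exact cone_smul ((h.pt_cone hB hX1 hX2).2 hX4) ht
  rcases (hne Z₀ hC₀ e f h).lt_or_gt with h0 | h0
  · right
    refine main _ _ h.neg' ?_
    simpa [neg_div] using h0
  simp_all

lemma Datum.pt_mem (hB : Sig B) (h : Datum B D E E' e f) {X : Fin n → ℂ} (h1 : bl B X (ic E) = 0)
    (h2 : bl B X (ic E') = 0) : pt B E E' X ∈ D ↔ X ∈ TT B E E' e := by
  rw [h.pos, h.toFr.pt_cone hB h1 h2, h.toFr.bl_pt_e hB, h.toFr.bl_pt_E hB h1, div_one]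
  exact ⟨fun ⟨a, b⟩ => ⟨h1, h2, b, a⟩, fun ⟨_, _, b, a⟩ => ⟨a, b⟩⟩

lemma Fr.TT_swap (hB : Sig B) (h : Fr B E E' e f) {X : Fin n → ℂ} (hX : X ∈ TT B E E' e) :
    X ∈ TT B E E' f := by
  obtain ⟨h1, h2, h3, h4⟩ := hX
  refine ⟨h1, h2, ?_, h4⟩
  have G := h.gr hB ℝ
  rw [im_bl_ic] at h3 ⊢
  have e1 : bl B (vim X) (ic E) = 0 := by rw [← im_bl_ic, h1]; rfl
  have e2 : bl B (vim X) (ic E') = 0 := by rw [← im_bl_ic, h2]; rfl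
  have key := h.le hB (y := vim X - bl B (vim X) (ic f) • ic e - bl B (vim X) (ic e) • ic f)
    (by simp_all) (by simp_all) (by simp [G]) (by simp [G])
  simp only [bl_sub_left, bl_sub_right, bl_smul_left, bl_smul_right, G,
    hB.comm (ic e) (vim X), hB.comm (ic f) (vim X)] at key
  have : 0 < bl B (vim X) (ic e) * bl B (vim X) (ic f) := by grind
  simp_all

lemma Fr.TT_swap_eq (hB : Sig B) (h : Fr B E E' e f) : TT B E E' e = TT B E E' f :=
  Subset.antisymm (fun _ => h.TT_swap hB) (fun _ => (h.swap hB).TT_swap hB)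

lemma Datum.swap (hB : Sig B) (hD : IsComponent B D) (h : Datum B D E E' e f) :
    Datum B D E E' f e := by
  rcases (h.toFr.swap hB).datum hB hD with h' | h'
  · omega
  exfalso
  obtain ⟨Z, hZ⟩ := comp_nonempty hD
  obtain ⟨X, h1, h2, ht, hX⟩ := h.toFr.exists_pt hB (comp_subset_cone hD hZ)
  have hm : pt B E E' X ∈ D := by
    rw [hX] at hZ; exact (comp_smul_iff hD ht).1 hZ
  have m1 := h.toFr.TT_swap hB ((h.pt_mem hB h1 h2).1 hm)
  have m2 := (h'.pt_mem hB h1 h2).1 hm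
  have := m1.2.2.1
  have := m2.2.2.1
  simp at this
  linarith

/-- A homogeneous invariant holomorphic function on the affine cone. -/
structure Fm (B : Matrix (Fin n) (Fin n) ℤ) (D : Set (Fin n → ℂ)) (k : ℤ)
    (P : (Fin n → ℂ) → ℂ) : Prop where
  supp : ∀ Z, Z ∉ D → P Z = 0
  hol : DifferentiableOn ℂ P D
  hom : ∀ t : ℂ, t ≠ 0 → ∀ Z ∈ D, P (t • Z) = t ^ (-k) * P Z
  inv : ∀ g ∈ OPlus B D, ∀ Z, P (ac g Z) = P Z

/-- Integral vectors orthogonal to the frame. -/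
structure Lz (B : Matrix (Fin n) (Fin n) ℤ) (E E' e f ζ : Fin n → ℤ) : Prop where
  E : bl B ζ E = 0
  E' : bl B ζ E' = 0
  e : bl B ζ e = 0
  f : bl B ζ f = 0

/-- Vectors with coefficients in a ring orthogonal to the frame. -/
structure Pp {R : Type*} [CommRing R] (B : Matrix (Fin n) (Fin n) ℤ) (E E' e f : Fin n → ℤ)
    (z : Fin n → R) : Prop where
  E : bl B z (ic E) = 0
  E' : bl B z (ic E') = 0
  e : bl B z (ic e) = 0
  f : bl B z (ic f) = 0

section Pp

variable {R : Type*} [CommRing R]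

lemma Lz.pp {ζ : Fin n → ℤ} (h : Lz B E E' e f ζ) : Pp B E E' e f (ic ζ : Fin n → R) := by
  constructor <;> simp [bl_ic, h.E, h.E', h.e, h.f]

lemma Pp.add {x y : Fin n → R} (h : Pp B E E' e f x) (h' : Pp B E E' e f y) :
    Pp B E E' e f (x + y) := by
  constructor <;> simp [h.E, h.E', h.e, h.f, h'.E, h'.E', h'.e, h'.f]

lemma Pp.smul {x : Fin n → R} (h : Pp B E E' e f x) (c : R) : Pp B E E' e f (c • x) := by
  constructor <;> simp [h.E, h.E', h.e, h.f]

lemma Pp.zero : Pp B E E' e f (0 : Fin n → R) := by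
  constructor <;> simp

lemma Pp.rc {z : Fin n → ℝ} (h : Pp B E E' e f z) : Pp B E E' e f (rc z) := by
  have key : ∀ v : Fin n → ℤ, bl B z (ic v) = 0 → bl B (Refl.rc z) (ic v : Fin n → ℂ) = 0 := by
    intro v hv
    apply Complex.ext
    · rw [re_bl_ic]; simpa
    · rw [im_bl_ic]; simp
  exact ⟨key _ h.E, key _ h.E', key _ h.e, key _ h.f⟩

lemma Pp.vim {X : Fin n → ℂ} (h : Pp B E E' e f X) : Pp B E E' e f (vim X) := by
  constructor
  · rw [← im_bl_ic, h.E]; rfl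
  · rw [← im_bl_ic, h.E']; rfl
  · rw [← im_bl_ic, h.e]; rfl
  · rw [← im_bl_ic, h.f]; rfl

lemma Lz.swap {ζ : Fin n → ℤ} (h : Lz B E E' e f ζ) : Lz B E E' f e ζ := ⟨h.E, h.E', h.f, h.e⟩

lemma Pp.swap {z : Fin n → R} (h : Pp B E E' e f z) : Pp B E E' f e z := ⟨h.E, h.E', h.f, h.e⟩

end Pp

@[simp] lemma ic_int (v : Fin n → ℤ) : (ic v : Fin n → ℤ) = v := by rfl

@[simp] lemma vim_zero : vim (0 : Fin n → ℂ) = 0 := by rfl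

/-- Points of the tube domain in Fourier–Jacobi coordinates. -/
noncomputable def XX (e f : Fin n → ℤ) (τ ω : ℂ) (z : Fin n → ℂ) : Fin n → ℂ :=
  τ • ic f + ω • ic e + z

lemma XX_swap (τ ω : ℂ) (z : Fin n → ℂ) : XX e f τ ω z = XX f e ω τ z := by
  simp only [XX]; abel

section

variable (hB : Sig B)
include hB

lemma Fr.XX_bl (h : Fr B E E' e f) {z : Fin n → ℂ} (hz : Pp B E E' e f z) (τ ω : ℂ) :
    bl B (XX e f τ ω z) (ic E) = 0 ∧ bl B (XX e f τ ω z) (ic E') = 0 ∧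
    bl B (XX e f τ ω z) (ic e) = τ ∧ bl B (XX e f τ ω z) (ic f) = ω ∧
    bl B (XX e f τ ω z) (XX e f τ ω z) = 2 * τ * ω + bl B z z := by
  have G := h.gr hB ℂ
  have c := fun v : Fin n → ℤ => hB.comm (ic v : Fin n → ℂ) z
  simp only [XX, bl_add_left, bl_smul_left, bl_add_right, bl_smul_right, G, hz.E, hz.E', hz.e,
    hz.f, c]
  grind

lemma Fr.XX_TT (h : Fr B E E' e f) {z : Fin n → ℂ} (hz : Pp B E E' e f z) (τ ω : ℂ) :
    XX e f τ ω z ∈ TT B E E' e ↔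
      0 < τ.im ∧ 0 < 2 * τ.im * ω.im + bl B (vim z) (vim z) := by
  have G := h.gr hB ℝ
  have hv := hz.vim
  have c := fun v : Fin n → ℤ => hB.comm (ic v : Fin n → ℝ) (vim z)
  obtain ⟨h1, h2, h3, h4, h5⟩ := h.XX_bl hB hz τ ω
  have : vim (XX e f τ ω z) = τ.im • ic f + ω.im • ic e + vim z := by
    ext i; simp [XX, Refl.vim, ic]
  change (_ ∧ _ ∧ _ ∧ _) ↔ _
  rw [h1, h2, h3, this]
  simp only [bl_add_left, bl_smul_left, bl_add_right, bl_smul_right, G, hv.e, hv.f, c]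
  ring_nf
  simp

lemma Fr.base (h : Fr B E E' e f) : XX e f I I 0 ∈ TT B E E' e := by
  rw [h.XX_TT hB Pp.zero]
  simp

omit hB in
lemma isom_pt {g : Matrix (Fin n) (Fin n) ℤ} (hg : gᵀ * B * g = B)
    (h1 : ac g E = E) (h2 : ac g E' = E') (X : Fin n → ℂ) :
    ac g (pt B E E' X) = pt B E E' (ac g X) := by
  simp only [pt, ac_add, ac_sub, ac_smul, ac_ic, h1, h2, bl_ac hg]

lemma Datum.mem_oplus (hD : IsComponent B D) (h : Datum B D E E' e f)
    {g : Matrix (Fin n) (Fin n) ℤ} (hg : gᵀ * B * g = B) (h1 : ac g E = E) (h2 : ac g E' = E')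
    {X : Fin n → ℂ} (hX : X ∈ TT B E E' e) (hX' : ac g X ∈ TT B E E' e) : g ∈ OPlus B D := by
  refine Refl.mem_oplus hB hD hg ⟨pt B E E' X, (h.pt_mem hB hX.1 hX.2.1).2 hX, ?_⟩
  rw [isom_pt hg h1 h2]
  exact (h.pt_mem hB hX'.1 hX'.2.1).2 hX'

def eich (B : Matrix (Fin n) (Fin n) ℤ) (a y : Fin n → ℤ) (m : ℤ) : Matrix (Fin n) (Fin n) ℤ :=
  opM B [(y, a), (-a, y), (-(m • a), a)]

omit hB in
lemma ac_eich {R : Type*} [CommRing R] (a y : Fin n → ℤ) (m : ℤ) (x : Fin n → R) :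
    ac (eich B a y m) x = x + bl B x (ic a) • ic y - bl B x (ic y) • ic a -
      (bl B x (ic a) * m) • ic a := by
  rw [eich, ac_opM]
  simp only [List.map_cons, List.map_nil, List.sum_cons, List.sum_nil, ic_neg, ic_smul]
  module

omit hB in
lemma acz_eich (a y : Fin n → ℤ) (m : ℤ) (x : Fin n → ℤ) :
    ac (eich B a y m) x = x + bl B x a • y - bl B x y • a - (bl B x a * m) • a := by
  have := ac_eich (B := B) a y m x
  simpa

lemma eich_isom {a y : Fin n → ℤ} {m : ℤ} (h0 : bl B a a = 0) (h1 : bl B a y = 0)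
    (h2 : bl B y y = 2 * m) : (eich B a y m)ᵀ * B * eich B a y m = B := by
  apply isom_of_bl
  intro x z
  simp only [acz_eich, bl_sub_left, bl_add_left, bl_smul_left, bl_sub_right, bl_add_right,
    bl_smul_right, hB.comm a z, hB.comm y z, hB.comm y a, h0, h1, h2]
  ring

/-- Reflection in a root. -/
def refl (B : Matrix (Fin n) (Fin n) ℤ) (v : Fin n → ℤ) : Matrix (Fin n) (Fin n) ℤ :=
  opM B [(v, v)]

omit hB in
lemma ac_refl {R : Type*} [CommRing R] (v : Fin n → ℤ) (x : Fin n → R) :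
    ac (refl B v) x = x + bl B x (ic v) • ic v := by
  rw [refl, ac_opM]; simp

omit hB in
lemma acz_refl (v x : Fin n → ℤ) : ac (refl B v) x = x + bl B x v • v := by
  have := ac_refl (B := B) v x
  simpa

lemma refl_isom {v : Fin n → ℤ} (h : bl B v v = -2) : (refl B v)ᵀ * B * refl B v = B := by
  apply isom_of_bl
  intro x z
  simp only [acz_refl, bl_add_left, bl_smul_left, bl_add_right,
    bl_smul_right, hB.comm v z, h]
  ring

lemma Datum.transl (hD : IsComponent B D) (h : Datum B D E E' e f) {y : Fin n → ℤ}
    (h1 : bl B y E = 0) (h2 : bl B y E' = 0) :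
    ∃ g ∈ OPlus B D, ∀ X : Fin n → ℂ, bl B X (ic E) = 0 →
      ac g (pt B E E' X) = pt B E E' (X + ic y) := by
  obtain ⟨m, hm⟩ := hB.even y
  have hg := eich_isom hB h.EE (by rw [hB.comm, h1]) (y := y) (m := m) (by omega)
  have G := h.gr hB ℂ
  have e1 : bl B (ic y : Fin n → ℂ) (ic E) = 0 := by simpa
  have e2 : bl B (ic y : Fin n → ℂ) (ic E') = 0 := by simpa
  have e3 : bl B (ic y : Fin n → ℂ) (ic y) = 2 * m := by simp_all
  have key : ∀ X : Fin n → ℂ, bl B X (ic E) = 0 →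
      ac (eich B E y m) (pt B E E' X) = pt B E E' (X + ic y) := by
    intro X hX
    have : bl B (pt B E E' X) (ic y) = bl B X (ic y) := by
      rw [pt]
      simp [hB.comm (ic E') (ic y), hB.comm (ic E) (ic y), e1, e2]
    rw [ac_eich, h.bl_pt_E hB hX, this, pt, pt]
    simp only [bl_add_left, bl_add_right, e3, hB.comm (ic y) X]
    module
  refine ⟨_, ?_, key⟩
  have hb := h.toFr.base hB
  refine Refl.mem_oplus hB hD hg ⟨pt B E E' (XX e f I I 0), (h.pt_mem hB hb.1 hb.2.1).2 hb, ?_⟩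
  rw [key _ hb.1]
  have a1 : bl B (XX e f I I 0 + ic y) (ic E) = 0 := by rw [bl_add_left, hb.1, e1, add_zero]
  have a2 : bl B (XX e f I I 0 + ic y) (ic E') = 0 := by rw [bl_add_left, hb.2.1, e2, add_zero]
  refine (h.pt_mem hB a1 a2).2 ⟨a1, a2, ?_, ?_⟩
  · rw [im_bl_ic]; simpa [← im_bl_ic] using hb.2.2.1
  · simpa using hb.2.2.2

lemma Datum.transv (hD : IsComponent B D) (h : Datum B D E E' e f) {y : Fin n → ℤ} {m : ℤ}
    (h1 : bl B y E = 0) (h2 : bl B y E' = 0) (h3 : bl B y e = 0) (hm : bl B y y = 2 * m) :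
    eich B e y m ∈ OPlus B D ∧ ∀ X : Fin n → ℂ,
      ac (eich B e y m) (pt B E E' X) = pt B E E' (ac (eich B e y m) X) := by
  have hg := eich_isom hB h.ee (by rw [hB.comm, h3]) hm
  have G := h.gz hB
  have k1 : ac (eich B e y m) E = E := by
    rw [acz_eich]; simp [G, hB.comm E y, h1]
  have k2 : ac (eich B e y m) E' = E' := by
    rw [acz_eich]; simp [G, hB.comm E' y, h2]
  refine ⟨h.mem_oplus hB hD hg k1 k2 (h.toFr.base hB) ?_, isom_pt hg k1 k2⟩
  have hb := h.toFr.base hB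
  have k3 : ac (eich B e y m) e = e := by
    rw [acz_eich]; simp [G, hB.comm e y, h3]
  have tr : ∀ (X : Fin n → ℂ) (v : Fin n → ℤ), ac (eich B e y m) v = v →
      bl B (ac (eich B e y m) X) (ic v) = bl B X (ic v) := by
    intro X v hv
    conv_lhs => rw [← hv, ← ac_ic, bl_ac hg]
  refine ⟨by rw [tr _ _ k1]; exact hb.1, by rw [tr _ _ k2]; exact hb.2.1,
    by rw [tr _ _ k3]; exact hb.2.2.1, ?_⟩
  rw [vim_ac, bl_ac hg]
  exact hb.2.2.2

lemma Datum.inv_transl (hD : IsComponent B D) (h : Datum B D E E' e f) (hP : Fm B D k P)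
    {y : Fin n → ℤ} (h1 : bl B y E = 0) (h2 : bl B y E' = 0) {X : Fin n → ℂ}
    (hX : bl B X (ic E) = 0) : P (pt B E E' (X + ic y)) = P (pt B E E' X) := by
  obtain ⟨g, hg, hg'⟩ := h.transl hB hD h1 h2
  rw [← hg' X hX, hP.inv g hg]

lemma Datum.inv_transv (hD : IsComponent B D) (h : Datum B D E E' e f) (hP : Fm B D k P)
    {y : Fin n → ℤ} (h1 : bl B y E = 0) (h2 : bl B y E' = 0) (h3 : bl B y e = 0)
    (X : Fin n → ℂ) :
    P (pt B E E' (X + bl B X (ic e) • ic y - bl B X (ic y) • ic e -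
      (bl B X (ic e) * (bl B y y / 2 : ℂ)) • ic e)) = P (pt B E E' X) := by
  obtain ⟨m, hm⟩ := hB.even y
  have hm' : bl B y y = 2 * m := by omega
  obtain ⟨h4, h5⟩ := h.transv hB hD h1 h2 h3 hm'
  have e1 : ((bl B y y : ℤ) / 2 : ℂ) = m := by simp_all
  rw [e1, ← ac_eich, ← h5, hP.inv _ h4]

lemma Datum.inv_S (hD : IsComponent B D) (h : Datum B D E E' e f) (hP : Fm B D k P)
    {τ ω : ℂ} (hτ : 0 < τ.im) (hω : 0 < ω.im) :
    P (pt B E E' (XX e f (-1 / τ) ω 0)) = τ ^ k * P (pt B E E' (XX e f τ ω 0)) := by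
  set g := opM B [(-f - E', E), (-e - E, E'), (E' - f, e), (E - e, f)] with hgd
  have G := h.gr hB ℂ
  have hgz : ∀ x : Fin n → ℤ, ac g x = x + (bl B x E • (-f - E') + (bl B x E' • (-e - E) +
      (bl B x e • (E' - f) + bl B x f • (E - e)))) := by
    intro x
    have := ac_opM (B := B) [(-f - E', E), (-e - E, E'), (E' - f, e), (E - e, f)] x
    simpa
  have hg : gᵀ * B * g = B := by
    apply isom_of_bl
    intro x z
    have Gz := h.gz hB
    simp only [hgz, bl_add_left, bl_smul_left, bl_add_right, bl_smul_right, bl_sub_left,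
      bl_sub_right, bl_neg_left, bl_neg_right, Gz, hB.comm E z, hB.comm E' z,
      hB.comm e z, hB.comm f z]
    ring
  have key : ∀ τ ω : ℂ, τ ≠ 0 →
      ac g (pt B E E' (XX e f τ ω 0)) = τ • pt B E E' (XX e f (-1 / τ) ω 0) := by
    intro τ ω hτ
    rw [hgd, ac_opM, pt, pt, (h.toFr.XX_bl hB Pp.zero _ _).2.2.2.2,
      (h.toFr.XX_bl hB Pp.zero _ _).2.2.2.2]
    simp only [XX, List.map_cons, List.map_nil, List.sum_cons, List.sum_nil, bl_add_left,
      bl_smul_left, bl_sub_left, G, ic_sub, ic_neg, bl_zero_right, add_zero]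
    have e1 : (2 * (-1 / τ) * ω / 2) = - (τ⁻¹ * ω) := by ring
    have e2 : (-1 / τ) = -τ⁻¹ := by ring
    rw [e1, e2]
    simp only [smul_sub, smul_add, smul_smul]
    have e3 : τ * -τ⁻¹ = -1 := by field_simp
    have e4 : τ * -(τ⁻¹ * ω) = -ω := by field_simp
    rw [e3, e4]
    module
  have memD : ∀ τ ω : ℂ, 0 < τ.im → 0 < ω.im → pt B E E' (XX e f τ ω 0) ∈ D := by
    intro τ ω h1 h2
    have hX := h.toFr.XX_bl hB Pp.zero τ ω
    rw [h.pt_mem hB hX.1 hX.2.1, h.toFr.XX_TT hB Pp.zero]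
    simp_all
  have hinv : ∀ τ : ℂ, 0 < τ.im → 0 < (-1 / τ).im := by
    intro τ hτ
    have : τ ≠ 0 := by rintro rfl; simp_all
    rw [neg_div, one_div, Complex.neg_im, Complex.inv_im, neg_div, neg_neg]
    simp_all
  have hgO : g ∈ OPlus B D := by
    refine Refl.mem_oplus hB hD hg ⟨_, memD I I (by simp) (by simp), ?_⟩
    rw [key _ _ Complex.I_ne_zero, comp_smul_iff hD Complex.I_ne_zero]
    exact memD _ _ (hinv _ (by simp)) (by simp)
  have hτ0 : τ ≠ 0 := by rintro rfl; simp_all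
  have := hP.inv g hgO (pt B E E' (XX e f τ ω 0))
  rw [key _ _ hτ0, hP.hom _ hτ0 _ (memD _ _ (hinv _ hτ) hω)] at this
  rw [← this, ← mul_assoc, ← zpow_add₀ hτ0, add_neg_cancel, zpow_zero, one_mul]

end

lemma exists_int_multiple (x : Fin n → ℚ) :
    ∃ (d : ℕ) (y : Fin n → ℤ), d ≠ 0 ∧ (ic y : Fin n → ℚ) = (d : ℚ) • x := by
  obtain ⟨d, M, hd, hM⟩ := exists_denom (Matrix.of fun i _ : Fin n => x i)
  refine ⟨d, fun i => M i i, hd, ?_⟩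
  ext i
  have := congrFun (congrFun hM i) i
  tauto

lemma exists_perp {m : ℕ} (hm : m < n) (v : Fin m → Fin n → ℤ) :
    ∃ ζ : Fin n → ℤ, ζ ≠ 0 ∧ ∀ i, bl B ζ (v i) = 0 := by
  obtain ⟨a, ha, h⟩ := exists_ker (K := ℚ)
    (Matrix.of fun i j => bl B (Pi.single j 1) (ic (v i) : Fin n → ℚ)) hm
  obtain ⟨d, y, hd, hy⟩ := exists_int_multiple a
  refine ⟨y, ?_, fun i => ?_⟩
  · rintro rfl
    rw [ic_zero] at hy
    exact ha ((smul_eq_zero.1 hy.symm).resolve_left (by simpa))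
  · have h1 : bl B a (ic (v i) : Fin n → ℚ) = 0 := by
      have := congrFun h i
      simp only [mulVec, dotProduct, Matrix.of_apply, Pi.zero_apply] at this
      have e : a = ∑ j, a j • (Pi.single j 1 : Fin n → ℚ) := by
        ext j; simp [Finset.sum_apply, Pi.single_apply]
      rw [e, bl_sum_left, ← this]
      exact Finset.sum_congr rfl fun j _ => by rw [bl_smul_left, mul_comm]
    have h2 : bl B (ic y : Fin n → ℚ) (ic (v i)) = 0 := by
      simp_all
    rw [bl_ic] at h2
    simp_all

lemma exists_Lz (hB : Sig B) : ∃ ζ, ζ ≠ 0 ∧ Lz B E E' e f ζ := by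
  obtain ⟨ζ, h0, h⟩ := exists_perp (B := B) (by rw [hB.rk]; simp) ![E, E', e, f]
  exact ⟨ζ, h0, h 0, h 1, h 2, h 3⟩

/-- The Fourier–Jacobi restriction of a function on the cone. -/
noncomputable def jac (P : (Fin n → ℂ) → ℂ) (B : Matrix (Fin n) (Fin n) ℤ) (E E' e f : Fin n → ℤ)
    (τ : ℂ) (z0 : Fin n → ℝ) (ζ : Fin n → ℤ) (w ω : ℂ) : ℂ :=
  P (pt B E E' (XX e f τ ω (rc z0 + w • ic ζ)))

section

variable (hB : Sig B)
include hB

lemma Fr.Lz_neg (h : Fr B E E' e f) {ζ : Fin n → ℤ} (hζ : Lz B E E' e f ζ) (h0 : ζ ≠ 0) :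
    bl B ζ ζ < 0 := by
  have hp : Pp B E E' e f (ic ζ : Fin n → ℝ) := hζ.pp
  have := h.lt hB hp.E hp.E' hp.e hp.f (fun h => h0 (ic_injective (by simpa)))
  simpa

theorem Datum.FJ (hD : IsComponent B D) (h : Datum B D E E' e f) (hP : Fm B D k P)
    {τ : ℂ} (hτ : 0 < τ.im) {z0 : Fin n → ℝ} (hz : Pp B E E' e f z0) {ζ : Fin n → ℤ}
    (hζ : Lz B E E' e f ζ) (h0 : ζ ≠ 0) :
    FJ τ (-(bl B ζ ζ : ℤ)) ((-(bl B ζ ζ : ℤ) : ℝ) * τ / 2 - (bl B z0 (ic ζ) : ℝ))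
      (jac P B E E' e f τ z0 ζ) := by
  have hzc : Pp B E E' e f (Refl.rc z0) := hz.rc
  have hζc : Pp B E E' e f (ic ζ : Fin n → ℂ) := hζ.pp
  have hw : ∀ w : ℂ, Pp B E E' e f (Refl.rc z0 + w • ic ζ) := fun w => hzc.add (hζc.smul w)
  have hneg := h.toFr.Lz_neg hB hζ h0
  have hzζ : bl B (Refl.rc z0) (ic ζ) = (bl B z0 (ic ζ) : ℝ) := by
    apply Complex.ext
    · rw [re_bl_ic]; simp
    · rw [im_bl_ic]; simp
  have G := h.gz hB
  refine ⟨hτ, by simpa, ?_, ?_, ?_, ?_, ?_⟩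
  · simp
  · intro w ω
    have := h.inv_transl hB hD hP hζ.E hζ.E' (h.toFr.XX_bl hB (hw w) τ ω).1
    rw [jac, jac, ← this]
    congr 2
    simp only [XX]; module
  · intro w ω
    have := h.inv_transl hB hD hP (y := e) G.2.2.2.2.2.2.2.2.2.1 G.2.2.2.2.2.2.2.2.2.2.2.2.2.1
      (h.toFr.XX_bl hB (hw w) τ ω).1
    rw [jac, jac, ← this]
    congr 2
    simp only [XX]; module
  · intro w ω
    have := h.inv_transv hB hD hP hζ.E hζ.E' hζ.e (XX e f τ ω (Refl.rc z0 + w • ic ζ))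
    rw [(h.toFr.XX_bl hB (hw w) τ ω).2.2.1] at this
    have e2 : bl B (XX e f τ ω (Refl.rc z0 + w • ic ζ)) (ic ζ) =
        (bl B z0 (ic ζ) : ℝ) + w * (bl B ζ ζ : ℤ) := by
      rw [XX]
      simp only [bl_add_left, bl_smul_left, bl_ic, hzζ, hB.comm f ζ, hB.comm e ζ,
        hζ.e, hζ.f]
      simp
    rw [e2] at this
    rw [jac, jac, ← this]
    congr 2
    simp only [XX]
    push_cast
    module
  · refine hP.hol.comp (f := fun p : ℂ × ℂ =>
      pt B E E' (XX e f τ p.2 (Refl.rc z0 + p.1 • ic ζ))) ?_ ?_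
    · apply Differentiable.differentiableOn
      have hX : Differentiable ℂ fun p : ℂ × ℂ => XX e f τ p.2 (Refl.rc z0 + p.1 • ic ζ) := by
        unfold XX; fun_prop
      unfold pt
      have : Differentiable ℂ fun p : ℂ × ℂ => bl B (XX e f τ p.2 (Refl.rc z0 + p.1 • ic ζ))
          (XX e f τ p.2 (Refl.rc z0 + p.1 • ic ζ)) := by
        unfold bl
        fun_prop
      fun_prop
    · rintro ⟨w, ω⟩ hp
      change (-(bl B ζ ζ : ℤ) : ℝ) * w.im ^ 2 < 2 * τ.im * ω.im at hp
      have hX := h.toFr.XX_bl hB (hw w) τ ω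
      refine (h.pt_mem hB hX.1 hX.2.1).2 ((h.toFr.XX_TT hB (hw w) τ ω).2 ⟨hτ, ?_⟩)
      have : vim (Refl.rc z0 + w • ic ζ) = w.im • ic ζ := by
        ext i; simp [Refl.vim, Refl.rc, ic]
      rw [this]
      simp only [bl_smul_left, bl_smul_right, bl_ic]
      linarith

end

/-- Convergence to the cusp. -/
def toCusp : Filter ℂ := comap Complex.im atTop

instance : toCusp.NeBot := NeBot.comap_of_surj inferInstance Complex.im_surjective

lemma tendsto_ee : Tendsto ee toCusp (𝓝 0) := by
  rw [tendsto_zero_iff_norm_tendsto_zero]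
  have : (fun ω => ‖ee ω‖) = (fun t : ℝ => Real.exp (-(2 * Real.pi * t))) ∘ Complex.im := by
    ext ω; rw [norm_ee]; simp
  rw [this]
  refine Tendsto.comp (y := atTop) ?_ tendsto_comap
  refine Real.tendsto_exp_neg_atTop_nhds_zero.comp ?_
  exact tendsto_id.const_mul_atTop (by positivity)

lemma norm_ee_lt_one_iff {ω : ℂ} : ‖ee ω‖ < 1 ↔ 0 < ω.im := by
  rw [norm_ee, Real.exp_lt_one_iff]
  have := Real.pi_pos
  simp_all

lemma rc_zero : rc (0 : Fin n → ℝ) = 0 := by rfl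

lemma tendsto_toCusp_add (c : ℂ) : Tendsto (fun ω => ω + c) toCusp toCusp := by
  refine tendsto_comap_iff.2 ?_
  have : Complex.im ∘ (fun ω => ω + c) = fun ω => ω.im + c.im := by rfl
  rw [this]
  exact tendsto_atTop_add_const_right _ _ tendsto_comap

lemma eventually_toCusp {p : ℂ → Prop} : (∀ᶠ ω in toCusp, p ω) ↔ ∃ H : ℝ, ∀ ω : ℂ, H ≤ ω.im → p ω := by
  rw [toCusp, eventually_comap, eventually_atTop]
  exact ⟨fun ⟨H, h⟩ => ⟨H, fun ω hω => h _ hω _ rfl⟩, fun ⟨H, h⟩ => ⟨H, fun b hb a hab => h a (hab ▸ hb)⟩⟩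

lemma FJ.tendsto {τ : ℂ} {A : ℝ} {β : ℂ} {f : ℂ → ℂ → ℂ} (h : FJ τ A β f) (w : ℂ) :
    Tendsto (f w) toCusp (𝓝 (cusp f w 0)) := by
  have h1 := (h.fam.ht (w, 0) (FJdom_zero τ A w)).continuousAt
  have h2 : f w = fun ω => cusp f w (ee ω) := by
    ext ω; rw [cusp_ee (h.p2 w)]
  rw [h2]
  exact h1.tendsto.comp tendsto_ee

lemma FJ.lead_const {τ : ℂ} {A : ℝ} {β : ℂ} {f : ℂ → ℂ → ℂ} (h : FJ τ A β f) (w w' : ℂ) :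
    cusp f w 0 = cusp f w' 0 := by
  refine doubly_periodic_const (f := fun w => cusp f w 0)
    (fun w => h.fam.diff_zero (FJdom_zero τ A w)) h.hτ ?_ ?_ w w'
  · intro w
    have : f (w + 1) = f w := funext (h.p1 w)
    simp only [cusp, this]
  · intro w
    have h1 := (h.tendsto (w + τ)).comp (tendsto_toCusp_add (A * w + β))
    refine tendsto_nhds_unique h1 ((h.tendsto w).congr fun ω => ?_)
    rw [← h.p3 w ω, Function.comp, add_assoc]

/-- The constant term at the cusp. -/
noncomputable def lead (P : (Fin n → ℂ) → ℂ) (B : Matrix (Fin n) (Fin n) ℤ)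
    (E E' e f : Fin n → ℤ) (τ : ℂ) (z : Fin n → ℂ) : ℂ :=
  cusp (fun _ ω => P (pt B E E' (XX e f τ ω z))) 0 0

lemma lead_jac (τ : ℂ) (z0 : Fin n → ℝ) (ζ : Fin n → ℤ) (w : ℂ) :
    cusp (jac P B E E' e f τ z0 ζ) w 0 = lead P B E E' e f τ (rc z0 + w • ic ζ) := rfl

/-- Projection to the orthogonal complement of the frame. -/
def proj (B : Matrix (Fin n) (Fin n) ℤ) (E E' e f x : Fin n → ℤ) : Fin n → ℤ :=
  x - bl B x E' • E - bl B x E • E' - bl B x f • e - bl B x e • f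

section

variable (hB : Sig B)
include hB

lemma Fr.proj_Lz (h : Fr B E E' e f) (x : Fin n → ℤ) : Lz B E E' e f (proj B E E' e f x) := by
  have G := h.gz hB
  constructor <;> simp only [proj, bl_sub_left, bl_smul_left, G] <;> ring

omit hB in
lemma Pp.sum_proj {z : Fin n → ℝ} (hz : Pp B E E' e f z) :
    z = ∑ i, z i • (ic (proj B E E' e f (Pi.single i 1)) : Fin n → ℝ) := by
  have e0 : z = ∑ i, z i • (ic (Pi.single i 1) : Fin n → ℝ) := by
    ext j; simp [Finset.sum_apply, Pi.single_apply, ic]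
  have key : ∀ v : Fin n → ℤ, bl B z (ic v) = ∑ i, z i * (bl B (Pi.single i 1) v : ℤ) := by
    intro v
    conv_lhs => rw [e0, bl_sum_left]
    simp
  have h1 := key E; have h2 := key E'; have h3 := key e; have h4 := key f
  rw [hz.E] at h1; rw [hz.E'] at h2; rw [hz.e] at h3; rw [hz.f] at h4
  have : ∑ i, z i • (ic (proj B E E' e f (Pi.single i 1)) : Fin n → ℝ) =
      z - (∑ i, z i * (bl B (Pi.single i 1) E' : ℤ)) • (ic E)
        - (∑ i, z i * (bl B (Pi.single i 1) E : ℤ)) • (ic E')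
        - (∑ i, z i * (bl B (Pi.single i 1) f : ℤ)) • (ic e)
        - (∑ i, z i * (bl B (Pi.single i 1) e : ℤ)) • (ic f) := by
    conv_rhs => enter [1, 1, 1, 1]; rw [e0]
    simp only [proj, ic_sub, ic_smul, smul_sub, Finset.sum_sub_distrib, Finset.sum_smul, smul_smul]
  rw [this, ← h1, ← h2, ← h3, ← h4]
  simp

theorem Datum.lead_eq (hD : IsComponent B D) (h : Datum B D E E' e f) (hP : Fm B D k P)
    {τ : ℂ} (hτ : 0 < τ.im) {z : Fin n → ℝ} (hz : Pp B E E' e f z) :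
    lead P B E E' e f τ (rc z) = lead P B E E' e f τ 0 := by
  classical
  have step : ∀ {z0 : Fin n → ℝ}, Pp B E E' e f z0 → ∀ {ζ}, Lz B E E' e f ζ → ∀ c : ℝ,
      lead P B E E' e f τ (Refl.rc (z0 + c • ic ζ)) = lead P B E E' e f τ (Refl.rc z0) := by
    intro z0 hz0 ζ hζ c
    by_cases h0 : ζ = 0
    · simp [h0]
    have := (h.FJ hB hD hP hτ hz0 hζ h0).lead_const c 0
    rw [lead_jac, lead_jac] at this
    have e1 : Refl.rc (z0 + c • ic ζ) = Refl.rc z0 + (c : ℂ) • ic ζ := by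
      ext i; simp [Refl.rc, ic]
    simp_all
  have gen : ∀ s : Finset (Fin n),
      Pp B E E' e f (∑ i ∈ s, z i • (ic (proj B E E' e f (Pi.single i 1)) : Fin n → ℝ)) ∧
      lead P B E E' e f τ (Refl.rc (∑ i ∈ s, z i • (ic (proj B E E' e f (Pi.single i 1)))))
        = lead P B E E' e f τ 0 := by
    intro s
    induction s using Finset.induction_on with
    | empty =>
      refine ⟨by simpa using Pp.zero, ?_⟩
      rfl
    | insert a s ha ih =>
      rw [Finset.sum_insert ha, add_comm]
      have hl := h.toFr.proj_Lz hB (Pi.single a 1)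
      exact ⟨ih.1.add (hl.pp.smul _), by simp_all⟩
  conv_lhs => rw [hz.sum_proj]
  grind

lemma Datum.tendsto_lead (hD : IsComponent B D) (h : Datum B D E E' e f) (hP : Fm B D k P)
    {τ : ℂ} (hτ : 0 < τ.im) {z : Fin n → ℝ} (hz : Pp B E E' e f z) :
    Tendsto (fun ω => P (pt B E E' (XX e f τ ω (rc z)))) toCusp
      (𝓝 (lead P B E E' e f τ 0)) := by
  obtain ⟨ζ, h0, hζ⟩ := exists_Lz (E := E) (E' := E') (e := e) (f := f) hB
  have := (h.FJ hB hD hP hτ hz hζ h0).tendsto 0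
  rw [lead_jac, zero_smul, add_zero, h.lead_eq hB hD hP hτ hz] at this
  refine this.congr fun ω => ?_
  rw [jac, zero_smul, add_zero]

lemma Datum.tendsto_lead0 (hD : IsComponent B D) (h : Datum B D E E' e f) (hP : Fm B D k P)
    {τ : ℂ} (hτ : 0 < τ.im) :
    Tendsto (fun ω => P (pt B E E' (XX e f τ ω 0))) toCusp (𝓝 (lead P B E E' e f τ 0)) := by
  have := h.tendsto_lead hB hD hP hτ Pp.zero
  simpa

omit hB in
lemma Fr.differentiable_pt_XX (z : Fin n → ℂ) :
    Differentiable ℂ fun p : ℂ × ℂ => pt B E E' (XX e f p.1 p.2 z) := by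
  have hX : Differentiable ℂ fun p : ℂ × ℂ => XX e f p.1 p.2 z := by
    unfold XX; fun_prop
  unfold pt
  have : Differentiable ℂ fun p : ℂ × ℂ => bl B (XX e f p.1 p.2 z) (XX e f p.1 p.2 z) := by
    unfold bl
    fun_prop
  fun_prop

lemma Datum.pt_mem_of_im (h : Datum B D E E' e f) {z : Fin n → ℝ} (hz : Pp B E E' e f z)
    {τ ω : ℂ} (hτ : 0 < τ.im) (hω : 0 < ω.im) : pt B E E' (XX e f τ ω (rc z)) ∈ D := by
  have hX := h.toFr.XX_bl hB hz.rc τ ω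
  rw [h.pt_mem hB hX.1 hX.2.1, h.toFr.XX_TT hB hz.rc]
  simp_all

lemma Datum.fam (hD : IsComponent B D) (h : Datum B D E E' e f) (hP : Fm B D k P)
    {z : Fin n → ℝ} (hz : Pp B E E' e f z) :
    Fam {p : ℂ × ℂ | 0 < p.1.im ∧ ‖p.2‖ < 1}
      (cusp fun τ ω => P (pt B E E' (XX e f τ ω (rc z)))) := by
  have G := h.gz hB
  refine fam_cusp (W := {p : ℂ × ℂ | 0 < p.1.im ∧ 0 < p.2.im}) ?_ ?_ ?_ ?_ ?_ ?_
  · intro τ ω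
    have := h.inv_transl hB hD hP (y := e) G.2.2.2.2.2.2.2.2.2.1 G.2.2.2.2.2.2.2.2.2.2.2.2.2.1
      (h.toFr.XX_bl hB hz.rc τ ω).1
    rw [← this]
    congr 2
    simp only [XX]; module
  · exact (isOpen_lt continuous_const (Complex.continuous_im.comp continuous_fst)).inter
      (isOpen_lt (continuous_norm.comp continuous_snd) continuous_const)
  · exact (isOpen_lt continuous_const (Complex.continuous_im.comp continuous_fst)).inter
      (isOpen_lt continuous_const (Complex.continuous_im.comp continuous_snd))
  · intro u ω
    exact and_congr_right fun _ => norm_ee_lt_one_iff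
  · exact hP.hol.comp (Fr.differentiable_pt_XX (rc z)).differentiableOn
      fun p hp => h.pt_mem_of_im hB hz hp.1 hp.2
  · rintro u ⟨hu, -⟩
    obtain ⟨ζ, h0, hζ⟩ := exists_Lz (E := E) (E' := E') (e := e) (f := f) hB
    obtain ⟨M, hM⟩ := (h.FJ hB hD hP hu hz hζ h0).bound
    refine ⟨M, 1, fun ω hω => ?_⟩
    have := hM 0 ω (by simpa [Refl.ht] using hω)
    simpa [jac] using this

lemma Datum.lead_hol (hD : IsComponent B D) (h : Datum B D E E' e f) (hP : Fm B D k P) :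
    DifferentiableOn ℂ (fun τ => lead P B E E' e f τ 0) {τ | 0 < τ.im} := by
  intro τ hτ
  have := (h.fam hB hD hP Pp.zero).diff_zero (u₀ := τ) ⟨hτ, by simp⟩
  rw [rc_zero] at this
  exact this.differentiableWithinAt

lemma Datum.lead_T (hD : IsComponent B D) (h : Datum B D E E' e f) (hP : Fm B D k P)
    {τ : ℂ} (hτ : 0 < τ.im) : lead P B E E' e f (τ + 1) 0 = lead P B E E' e f τ 0 := by
  have G := h.gz hB
  refine tendsto_nhds_unique (h.tendsto_lead0 hB hD hP (by simpa))
    ((h.tendsto_lead0 hB hD hP hτ).congr fun ω => ?_)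
  have := h.inv_transl hB hD hP (y := f) G.2.2.2.2.2.2.2.2.2.2.2.1
    G.2.2.2.2.2.2.2.2.2.2.2.2.2.2.2 (h.toFr.XX_bl hB Pp.zero τ ω).1
  rw [← this]
  congr 2
  simp only [XX]; module

lemma Datum.lead_S (hD : IsComponent B D) (h : Datum B D E E' e f) (hP : Fm B D k P)
    {τ : ℂ} (hτ : 0 < τ.im) : lead P B E E' e f (-1 / τ) 0 = τ ^ k * lead P B E E' e f τ 0 := by
  have h1 : 0 < (-1 / τ).im := by
    have : τ ≠ 0 := by rintro rfl; simp_all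
    rw [neg_div, one_div, Complex.neg_im, Complex.inv_im, neg_div, neg_neg]
    simp_all
  refine tendsto_nhds_unique (h.tendsto_lead0 hB hD hP h1)
    (((h.tendsto_lead0 hB hD hP hτ).const_mul (τ ^ k)).congr' ?_)
  refine eventually_toCusp.2 ⟨1, fun ω hω => ?_⟩
  exact (h.inv_S hB hD hP hτ (by grind)).symm

end

/-- A rational vector with coefficients in a field of characteristic zero. -/
def cb {K : Type*} [Field K] (b : Fin n → ℚ) : Fin n → K := fun i => (b i : K)

/-- The rational Eichler transvection along `E`. -/
def eichQ (B : Matrix (Fin n) (Fin n) ℤ) (E : Fin n → ℤ) (b : Fin n → ℚ) :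
    Matrix (Fin n) (Fin n) ℚ :=
  1 + vecMulVec (b - (bl B b b / 2) • ic E) (qm B *ᵥ ic E) - vecMulVec (ic E) (qm B *ᵥ b)

section

variable {K : Type*} [Field K] [CharZero K]

omit [CharZero K] in
lemma cb_ic (v : Fin n → ℤ) : (cb (ic v) : Fin n → K) = ic v := by ext i; simp [cb, ic]

lemma bl_cb (x y : Fin n → ℚ) : bl B (cb x : Fin n → K) (cb y) = (bl B x y : ℚ) :=
  bl_map B (Rat.castHom K) x y

lemma aq_vecMulVec (a c : Fin n → ℚ) (x : Fin n → K) :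
    aq (vecMulVec a (qm B *ᵥ c)) x = bl B x (cb c) • (cb a : Fin n → K) := by
  ext i
  simp only [aq, mulVec, dotProduct, Matrix.map_apply, vecMulVec_apply, cb, bl, Pi.smul_apply,
    smul_eq_mul, Finset.sum_mul, Rat.cast_mul, Rat.cast_sum, Finset.mul_sum]
  exact Finset.sum_congr rfl fun _ _ => Finset.sum_congr rfl fun _ _ => by push_cast; ring

lemma aq_eichQ (b : Fin n → ℚ) (x : Fin n → K) :
    aq (eichQ B E b) x = x + bl B x (ic E) • (cb b - ((bl B b b / 2 : ℚ) : K) • ic E) -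
      bl B x (cb b) • ic E := by
  have h1 : ∀ g h : Matrix (Fin n) (Fin n) ℚ, aq (g + h) x = aq g x + aq h x := by
    intro g h; ext i; simp [aq, mulVec, dotProduct, add_mul, Finset.sum_add_distrib]
  have h2 : ∀ g h : Matrix (Fin n) (Fin n) ℚ, aq (g - h) x = aq g x - aq h x := by
    intro g h; ext i; simp [aq, mulVec, dotProduct, sub_mul, Finset.sum_sub_distrib]
  rw [eichQ, h2, h1, aq_one, aq_vecMulVec, aq_vecMulVec, cb_ic]
  congr 3
  ext i; simp [cb, ic]

end

lemma differentiable_pt : Differentiable ℂ (pt B E E') := by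
  unfold pt
  have : Differentiable ℂ fun X : Fin n → ℂ => bl B X X := by unfold bl; fun_prop
  fun_prop

lemma cb_rat (b : Fin n → ℚ) : (cb b : Fin n → ℚ) = b := by rfl

lemma aq_ext {A A' : Matrix (Fin n) (Fin n) ℚ} (h : ∀ x : Fin n → ℚ, aq A x = aq A' x) :
    A = A' := by
  refine Matrix.ext_of_mulVec_single fun i => ?_
  tauto

lemma eichQ_iso (hB : Sig B) (h0 : bl B E E = 0) {b : Fin n → ℚ} (hb : bl B b (ic E) = 0) :
    Iso B B (eichQ B E b) (eichQ B E (-b)) := by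
  have h0' : bl B (ic E : Fin n → ℚ) (ic E) = 0 := by simpa
  have hb' : bl B (ic E) b = 0 := by rw [hB.comm, hb]
  have hv : ∀ b x, aq (eichQ B E b) x = x + bl B x (ic E) • (b - (bl B b b / 2) • ic E) -
      bl B x b • ic E := by
    intro b x
    have := aq_eichQ (B := B) (E := E) b x
    simpa
  constructor
  · refine aq_ext fun x => ?_
    rw [aq_mul, aq_one, hv, hv]
    simp only [bl_add_left, bl_sub_left, bl_smul_left, bl_neg_left, bl_neg_right, hb, hb', h0']
    module
  · have hA : ∀ x y : Fin n → ℚ, bl B (aq (eichQ B E b) x) (aq (eichQ B E b) y) = bl B x y := by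
      intro x y
      simp only [hv, bl_sub_left, bl_add_left, bl_smul_left, bl_sub_right, bl_add_right,
        bl_smul_right, hB.comm (ic E) y, hB.comm b y, hb, hb', h0']
      ring
    have hbl : ∀ x y : Fin n → ℚ, bl B x y = x ⬝ᵥ qm B *ᵥ y := fun x y => bl_eq_dot B x y
    have ha : ∀ (A : Matrix (Fin n) (Fin n) ℚ) x, aq A x = A *ᵥ x := by
      tauto
    have hM : ∀ x y : Fin n → ℚ, x ⬝ᵥ ((eichQ B E b)ᵀ * qm B * eichQ B E b) *ᵥ y =
        x ⬝ᵥ qm B *ᵥ y := by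
      intro x y
      rw [← hbl, ← hA, hbl, ha, ha, ← mulVec_mulVec, ← mulVec_mulVec, dotProduct_mulVec x,
        vecMul_transpose]
    exact Matrix.ext_of_mulVec_single fun j => funext fun i => by
      simpa using hM (Pi.single i 1) (Pi.single j 1)

section

variable (hB : Sig B)
include hB

lemma Datum.bdd (hD : IsComponent B D) (h : Datum B D E E' e f) (hP : Fm B D k P)
    {τ : ℂ} (hτ : 0 < τ.im) :
    ∃ M, ∀ ω : ℂ, 1 ≤ ω.im → ‖P (pt B E E' (XX e f τ ω 0))‖ ≤ M := by
  obtain ⟨ζ, h0, hζ⟩ := exists_Lz (E := E) (E' := E') (e := e) (f := f) hB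
  obtain ⟨M, hM⟩ := (h.FJ hB hD hP hτ Pp.zero hζ h0).bound
  refine ⟨M, fun ω hω => ?_⟩
  have := hM 0 ω (by simpa [Refl.ht] using hω)
  simpa [jac, rc_zero] using this

lemma Datum.differentiableOn_right (h : Datum B D E E' e f) (hP : DifferentiableOn ℂ P D)
    {τ : ℂ} (hτ : 0 < τ.im) :
    DifferentiableOn ℂ (fun ω => P (pt B E E' (XX e f τ ω 0))) {ω | 0 < ω.im} := by
  refine hP.comp ((Fr.differentiable_pt_XX (B := B) (E := E) (E' := E') (e := e) (f := f) 0).comp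
    (f := fun ω : ℂ => (τ, ω)) (by fun_prop)).differentiableOn fun ω hω => ?_
  have := h.pt_mem_of_im hB Pp.zero hτ hω
  simpa

lemma Datum.const_left (hD : IsComponent B D) (h : Datum B D E E' e f) (hP : Fm B D 0 P)
    {τ τ' ω : ℂ} (hτ : 0 < τ.im) (hτ' : 0 < τ'.im) (hω : 0 < ω.im) :
    P (pt B E E' (XX e f τ ω 0)) = P (pt B E E' (XX e f τ' ω 0)) := by
  have hs := h.swap hB hD
  have G := h.gz hB
  have := (level_one (k := 0) (F := fun τ => P (pt B E E' (XX e f τ ω 0))) ?_ ?_ ?_ ?_).2 rfl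
  · grind
  · have := hs.differentiableOn_right hB hP.hol hω
    simpa only [← XX_swap] using this
  · intro τ hτ
    have hX := h.toFr.XX_bl hB Pp.zero τ ω
    have := h.inv_transl hB hD hP (y := f) G.2.2.2.2.2.2.2.2.2.2.2.1
      G.2.2.2.2.2.2.2.2.2.2.2.2.2.2.2 hX.1
    rw [← this]
    congr 2
    simp only [XX]; module
  · intro τ hτ
    exact h.inv_S hB hD hP hτ hω
  · obtain ⟨M, hM⟩ := hs.bdd hB hD hP hω
    exact ⟨M, 1, fun τ hτ => by rw [XX_swap]; grind⟩

lemma Datum.const_plane (hD : IsComponent B D) (h : Datum B D E E' e f) (hP : Fm B D 0 P)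
    {τ τ' ω ω' : ℂ} (hτ : 0 < τ.im) (hτ' : 0 < τ'.im) (hω : 0 < ω.im) (hω' : 0 < ω'.im) :
    P (pt B E E' (XX e f τ ω 0)) = P (pt B E E' (XX e f τ' ω' 0)) := by
  rw [h.const_left hB hD hP hτ hτ' hω, XX_swap,
    (h.swap hB hD).const_left hB hD hP hω hω' hτ', ← XX_swap]

lemma Fm.of_orb (hD : IsComponent B D) (hh : DifferentiableOn ℂ P D)
    (hom : ∀ t : ℂ, t ≠ 0 → ∀ Z ∈ D, P (t • Z) = P Z) (hf : (orb B D P).Finite) (α : ℂ) :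
    Fm B D 0 (D.indicator fun Z => ∏ φ ∈ hf.toFinset, (α - φ Z)) := by
  have hφ : ∀ φ ∈ hf.toFinset, DifferentiableOn ℂ φ D ∧
      ∀ t : ℂ, t ≠ 0 → ∀ Z ∈ D, φ (t • Z) = φ Z := by
    intro φ hφ
    rw [Set.Finite.mem_toFinset] at hφ
    obtain ⟨g, hg, rfl⟩ := hφ
    refine ⟨hh.comp (differentiable_ac g).differentiableOn fun Z hZ => oplus_mem hg hZ, ?_⟩
    intro t ht Z hZ
    simp only [Function.comp, ac_smul]
    exact hom t ht _ (oplus_mem hg hZ)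
  refine ⟨fun Z hZ => indicator_of_notMem hZ _, ?_, ?_, ?_⟩
  · refine DifferentiableOn.congr (f := fun Z => ∏ φ ∈ hf.toFinset, (α - φ Z)) ?_
      fun Z hZ => indicator_of_mem hZ _
    generalize hf.toFinset = s at hφ
    classical
    induction s using Finset.induction_on with
    | empty => simp
    | insert i s his ih =>
      simp only [Finset.prod_insert his]
      exact ((hφ i (Finset.mem_insert_self i s)).1.const_sub α).mul
        (ih fun j hj => hφ j (Finset.mem_insert_of_mem hj))
  · intro t ht Z hZ
    rw [indicator_of_mem (comp_smul hD hZ ht), indicator_of_mem hZ, neg_zero, zpow_zero, one_mul]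
    exact Finset.prod_congr rfl fun φ h => by grind
  · intro g hg Z
    by_cases hZ : Z ∈ D
    · rw [indicator_of_mem (oplus_mem hg hZ), indicator_of_mem hZ]
      exact orb_prod_invariant hB hf (fun x => α - x) hg Z
    · rw [indicator_of_notMem hZ, indicator_of_notMem fun H => hZ ((oplus_mem_iff hB hg Z).1 H)]

lemma Datum.const_plane_orb (hD : IsComponent B D) (h : Datum B D E E' e f)
    (hh : DifferentiableOn ℂ P D) (hom : ∀ t : ℂ, t ≠ 0 → ∀ Z ∈ D, P (t • Z) = P Z)
    (hf : (orb B D P).Finite)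
    {τ ω ω' : ℂ} (hτ : 0 < τ.im) (hω : 0 < ω.im) (hω' : 0 < ω'.im) :
    P (pt B E E' (XX e f τ ω 0)) = P (pt B E E' (XX e f τ ω' 0)) := by
  have hm : ∀ ω : ℂ, 0 < ω.im → pt B E E' (XX e f τ ω 0) ∈ D := fun ω hω => by
    have := h.pt_mem_of_im hB Pp.zero hτ hω
    simpa
  refine const_of_finite (S := {ω : ℂ | 0 < ω.im}) (convex_halfSpace_im_gt 0).isPreconnected
    (f := fun ω => P (pt B E E' (XX e f τ ω 0)))
    (h.differentiableOn_right hB hh hτ).continuousOn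
    (hf.image fun φ => φ (pt B E E' (XX e f τ I 0))) ?_ hω hω'
  intro ω hω
  have hI : 0 < I.im := by simp
  have := h.const_plane hB hD (Fm.of_orb hB hD hh hom hf (P (pt B E E' (XX e f τ ω 0))))
    hτ hτ hω hI
  rw [indicator_of_mem (hm ω hω), indicator_of_mem (hm I hI)] at this
  have hself : P ∈ hf.toFinset := by rw [Set.Finite.mem_toFinset]; exact orb_self hB hD
  have h0 := Finset.prod_eq_zero (f := fun φ => P (pt B E E' (XX e f τ ω 0)) -
    φ (pt B E E' (XX e f τ ω 0))) hself (sub_self _)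
  rw [h0, eq_comm, Finset.prod_eq_zero_iff] at this
  obtain ⟨φ, hφ, h0⟩ := this
  exact ⟨φ, by simp_all, (sub_eq_zero.1 h0).symm⟩

lemma Datum.const_rat (hD : IsComponent B D) (h : Datum B D E E' e f) (hP : Fm B D 0 P)
    {b : Fin n → ℚ} (hb : Pp B E E' e f b) {τ ω : ℂ} (hτ : 0 < τ.im) (hω : 0 < ω.im) :
    P (pt B E E' (XX e f τ ω (cb b))) = lead P B E E' e f τ 0 := by
  have hi := eichQ_iso hB h.EE hb.E
  have hi' := hi.symm
  set A := eichQ B E b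
  set A' := eichQ B E (-b)
  have hc : (cb b : Fin n → ℂ) = rc (cb b) := by rfl
  have hbr : Pp B E E' e f (cb b : Fin n → ℝ) := by
    constructor <;> rw [← cb_ic, bl_cb]
    · rw [hb.E]; simp
    · rw [hb.E']; simp
    · rw [hb.e]; simp
    · rw [hb.f]; simp
  have key : ∀ ω : ℂ, aq A (pt B E E' (XX e f τ ω 0)) = pt B E E' (XX e f τ ω (cb b)) := by
    intro ω
    have hbc := hbr.rc
    rw [← hc] at hbc
    have e3 : bl B (cb b : Fin n → ℂ) (cb b) = (bl B b b : ℚ) := bl_cb b b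
    have c := fun v : Fin n → ℤ => hB.comm (ic v : Fin n → ℂ) (cb b)
    rw [aq_eichQ, h.bl_pt_E hB (h.toFr.XX_bl hB Pp.zero _ _).1, pt, pt,
      (h.toFr.XX_bl hB Pp.zero _ _).2.2.2.2, (h.toFr.XX_bl hB hbc _ _).2.2.2.2]
    simp only [XX, bl_add_left, bl_sub_left, bl_smul_left, c, hbc.E, hbc.E', hbc.e, hbc.f, e3,
      bl_zero_left]
    push_cast
    module
  have hm : ∀ ω : ℂ, 0 < ω.im → pt B E E' (XX e f τ ω 0) ∈ D := fun ω hω => by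
    have := h.pt_mem_of_im hB Pp.zero hτ hω
    simpa
  have hDD : aq A' '' D = D := by
    have hp1 := hm I (by simp)
    have hp2 : aq A (pt B E E' (XX e f τ I 0)) ∈ D := by
      rw [key, hc]
      exact h.pt_mem_of_im hB hbr hτ (by simp)
    refine Subset.antisymm ?_ ?_
    · refine comp_max hD ((comp_conn hD).image _ (continuous_aq A').continuousOn) ?_
        ⟨_, ⟨_, hp2, rfl⟩, by rwa [hi'.aq_aq]⟩
      rintro _ ⟨Z, hZ, rfl⟩
      exact hi'.cone hB hB (comp_subset_cone hD hZ)
    · have : aq A '' D ⊆ D := by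
        refine comp_max hD ((comp_conn hD).image _ (continuous_aq A).continuousOn) ?_
          ⟨_, ⟨_, hp1, rfl⟩, hp2⟩
        rintro _ ⟨Z, hZ, rfl⟩
        exact hi.cone hB hB (comp_subset_cone hD hZ)
      intro Z hZ
      exact ⟨aq A Z, this ⟨Z, hZ, rfl⟩, hi'.aq_aq Z⟩
  have hcst : ∀ ω ω' : ℂ, 0 < ω.im → 0 < ω'.im → P (pt B E E' (XX e f τ ω (cb b))) =
      P (pt B E E' (XX e f τ ω' (cb b))) := by
    intro ω ω' hω hω'
    have hP1 : (orb B D P).Finite := by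
      refine (Set.finite_singleton P).subset ?_
      rintro φ ⟨g, hg, rfl⟩
      exact funext fun Z => hP.inv g hg Z
    have h2 := orb_transport hB hB hi' hD hP1
    rw [hDD] at h2
    have hmA : ∀ Z ∈ D, aq A Z ∈ D := by
      intro Z hZ
      rw [← hDD] at hZ
      obtain ⟨W, hW, rfl⟩ := hZ
      rwa [hi.aq_aq]
    have := h.const_plane_orb hB hD (P := P ∘ aq A)
      (hP.hol.comp (differentiable_aq A).differentiableOn hmA) ?_ h2 hτ hω hω'
    · simp_all
    · intro t ht Z hZ
      simp only [Function.comp, aq_smul]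
      rw [hP.hom t ht _ (hmA Z hZ)]; simp
  have ht := h.tendsto_lead hB hD hP hτ hbr
  rw [← hc] at ht
  refine tendsto_nhds_unique (tendsto_const_nhds.congr' ?_) ht
  exact eventually_toCusp.2 ⟨1, fun ω' hω' => hcst ω ω' hω (by linarith)⟩

lemma Datum.const_real (hD : IsComponent B D) (h : Datum B D E E' e f) (hP : Fm B D 0 P)
    {z : Fin n → ℝ} (hz : Pp B E E' e f z) {τ ω : ℂ} (hτ : 0 < τ.im) (hω : 0 < ω.im) :
    P (pt B E E' (XX e f τ ω (rc z))) = lead P B E E' e f τ 0 := by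
  set y : Fin n → Fin n → ℤ := fun i => proj B E E' e f (Pi.single i 1)
  have hy : ∀ i, Lz B E E' e f (y i) := fun i => h.toFr.proj_Lz hB _
  have hsum : ∀ {R : Type} [CommRing R] (s : Fin n → R), Pp B E E' e f (∑ i, s i • (ic (y i) : Fin n → R)) := by
    intro R _ s
    constructor <;> rw [bl_sum_left] <;> refine Finset.sum_eq_zero fun i _ => ?_ <;>
      rw [bl_smul_left]
    · rw [(hy i).pp.E, mul_zero]
    · rw [(hy i).pp.E', mul_zero]
    · rw [(hy i).pp.e, mul_zero]
    · rw [(hy i).pp.f, mul_zero]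
  have hcont : Continuous fun s : Fin n → ℝ =>
      P (pt B E E' (XX e f τ ω (rc (∑ i, s i • ic (y i))))) := by
    refine hP.hol.continuousOn.comp_continuous ?_ fun s => h.pt_mem_of_im hB (hsum s) hτ hω
    refine continuous_pt.comp ?_
    have : Continuous fun s : Fin n → ℝ => (rc (∑ i, s i • ic (y i)) : Fin n → ℂ) := by
      refine continuous_pi fun j => ?_
      simp only [rc, Finset.sum_apply, Pi.smul_apply, smul_eq_mul]
      fun_prop
    unfold XX
    fun_prop
  have hd : DenseRange fun (q : Fin n → ℚ) (i : Fin n) => (q i : ℝ) :=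
    DenseRange.piMap fun _ => Rat.denseRange_cast
  have := hd.equalizer hcont (continuous_const (y := lead P B E E' e f τ 0)) (funext fun q => ?_)
  · rw [hz.sum_proj]
    exact congrFun this z
  · have := h.const_rat hB hD hP (hsum q) hτ hω
    rw [← this]
    simp only [Function.comp]
    congr 3
    ext j
    simp [rc, cb, Finset.sum_apply, ic]

theorem Datum.const_of_weight_zero (hD : IsComponent B D) (h : Datum B D E E' e f)
    (hP : Fm B D 0 P) {Z : Fin n → ℂ} (hZ : Z ∈ D) : P Z = lead P B E E' e f I 0 := by
  obtain ⟨X, h1, h2, ht, hX⟩ := h.toFr.exists_pt hB (comp_subset_cone hD hZ)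
  have hm : pt B E E' X ∈ D := by
    rw [hX] at hZ; exact (comp_smul_iff hD ht).1 hZ
  rw [hX, hP.hom _ ht _ hm, neg_zero, zpow_zero, one_mul]
  have hT := (h.pt_mem hB h1 h2).1 hm
  set τ := bl B X (ic e) with hτ
  set ω := bl B X (ic f) with hω
  have G := h.gr hB ℂ
  set z : Fin n → ℂ := X - τ • ic f - ω • ic e with hz
  have hzP : Pp B E E' e f z := by
    constructor <;> simp only [hz, bl_sub_left, bl_smul_left, h1, h2, G, ← hτ, ← hω] <;> ring
  have hXX : X = XX e f τ ω z := by rw [XX, hz]; abel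
  rw [hXX, h.toFr.XX_TT hB hzP] at hT
  have hx : Pp B E E' e f (vre z) := by
    have k := fun v : Fin n → ℤ => re_bl_ic (B := B) z v
    constructor
    · rw [← k, hzP.E]; rfl
    · rw [← k, hzP.E']; rfl
    · rw [← k, hzP.e]; rfl
    · rw [← k, hzP.f]; rfl
  have hyv := hzP.vim
  have hzw : ∀ w : ℂ, Pp B E E' e f (rc (vre z) + w • rc (vim z)) := fun w =>
    hx.rc.add (hyv.rc.smul w)
  have hvw : ∀ w : ℂ, vim (rc (vre z) + w • rc (vim z)) = w.im • vim z := by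
    intro w; ext i; simp [Refl.vim, Refl.rc]
  have hzI : z = rc (vre z) + I • rc (vim z) := by
    ext i
    simp only [Refl.rc, vre, Refl.vim, Pi.add_apply, Pi.smul_apply, smul_eq_mul]
    rw [mul_comm]; simp
  set N := bl B (vim z) (vim z) with hN
  set U : Set ℂ := {w | 0 < 2 * τ.im * ω.im + w.im ^ 2 * N} with hU
  have hUT : ∀ w ∈ U, pt B E E' (XX e f τ ω (rc (vre z) + w • rc (vim z))) ∈ D := by
    intro w hw
    have hb := h.toFr.XX_bl hB (hzw w) τ ω
    rw [h.pt_mem hB hb.1 hb.2.1, h.toFr.XX_TT hB (hzw w), hvw]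
    refine ⟨hT.1, ?_⟩
    simp only [bl_smul_left, bl_smul_right, ← hN]
    have : 0 < 2 * τ.im * ω.im + w.im ^ 2 * N := hw
    grind
  have hN0 : N ≤ 0 := h.toFr.le hB hyv.E hyv.E' hyv.e hyv.f
  have hω0 : 0 < ω.im := by nlinarith [hT.1, hT.2]
  have hU0 : IsOpen U := isOpen_lt continuous_const
    (continuous_const.add ((Complex.continuous_im.pow 2).mul continuous_const))
  have h0U : (0 : ℂ) ∈ U := by
    change 0 < 2 * τ.im * ω.im + (0 : ℂ).im ^ 2 * N
    have := mul_pos hT.1 hω0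
    simp only [Complex.zero_im]; grind
  have hUc : IsPreconnected U := by
    have : StarConvex ℝ (0 : ℂ) U := by
      refine starConvex_zero_iff.2 fun w hw a ha ha1 => ?_
      have hw' : 0 < 2 * τ.im * ω.im + w.im ^ 2 * N := hw
      change 0 < 2 * τ.im * ω.im + (a • w).im ^ 2 * N
      rw [Complex.smul_im, smul_eq_mul]
      have : (a * w.im) ^ 2 ≤ w.im ^ 2 := by nlinarith [sq_nonneg w.im, mul_le_one₀ ha1 ha ha1]
      nlinarith
    exact (this.isPathConnected h0U).isConnected.isPreconnected
  have hg : DifferentiableOn ℂ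
      (fun w : ℂ => P (pt B E E' (XX e f τ ω (rc (vre z) + w • rc (vim z))))) U := by
    refine hP.hol.comp (differentiable_pt.comp ?_).differentiableOn hUT
    unfold XX
    simp
  have hga := hg.analyticOnNhd hU0
  have hgc : AnalyticOnNhd ℂ (fun _ : ℂ => lead P B E E' e f τ 0) U := fun _ _ => analyticAt_const
  have hIU : I ∈ U := by simpa [hU] using hT.2
  have hfr : ∃ᶠ w in 𝓝[≠] (0 : ℂ), P (pt B E E' (XX e f τ ω (rc (vre z) + w • rc (vim z)))) =
      lead P B E E' e f τ 0 := by
    have hreal : ∀ t : ℝ, P (pt B E E' (XX e f τ ω (rc (vre z) + (t : ℂ) • rc (vim z)))) =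
        lead P B E E' e f τ 0 := by
      intro t
      have := h.const_real hB hD hP (hx.add (hyv.smul t)) hT.1 hω0
      rw [← this]
      congr 3
      ext i; simp [Refl.rc]
    have ht : Tendsto (fun t : ℝ => (t : ℂ)) (𝓝[≠] 0) (𝓝[≠] 0) := by
      refine tendsto_nhdsWithin_iff.2 ⟨?_, ?_⟩
      · exact (Complex.continuous_ofReal.tendsto' 0 0 (by simp)).mono_left nhdsWithin_le_nhds
      · filter_upwards [self_mem_nhdsWithin] with t h0
        simpa
    exact ht.frequently (Eventually.of_forall hreal).frequently
  have h3 := hga.eqOn_of_preconnected_of_frequently_eq hgc hUc h0U hfr hIU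
  simp only [← hzI] at h3
  rw [hXX, h3]
  refine tendsto_nhds_unique (h.tendsto_lead0 hB hD hP hT.1)
    ((h.tendsto_lead0 hB hD hP (τ := I) (by simp)).congr' ?_)
  refine eventually_toCusp.2 ⟨1, fun ω hω => ?_⟩
  exact h.const_left hB hD hP (by simp) hT.1 (by grind)

theorem Datum.weight_ne_zero (hD : IsComponent B D) (h : Datum B D E E' e f) (hP : MF B D k P)
    (hf : (orb B D P).Finite) (hne : ∃ Z ∈ D, ∃ W ∈ D, P Z ≠ P W) : k ≠ 0 := by
  rintro rfl
  obtain ⟨Z, hZ, W, hW, hne⟩ := hne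
  refine hne (const_of_finite (comp_conn hD) hP.hol.continuousOn
    (hf.image fun φ => φ Z) (fun Y hY => ?_) hZ hW)
  have hF := Fm.of_orb hB hD hP.hol (fun t ht Z hZ => by simpa using hP.hom t ht Z hZ) hf (P Y)
  have := (h.const_of_weight_zero hB hD hF hY).trans (h.const_of_weight_zero hB hD hF hZ).symm
  have hself : P ∈ hf.toFinset := by rw [Set.Finite.mem_toFinset]; exact orb_self hB hD
  have h0 := Finset.prod_eq_zero (f := fun φ => P Y - φ Y) hself (sub_self _)
  rw [indicator_of_mem hY, indicator_of_mem hZ, h0, eq_comm, Finset.prod_eq_zero_iff] at this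
  obtain ⟨φ, hφ, h0⟩ := this
  exact ⟨φ, by simp_all, (sub_eq_zero.1 h0).symm⟩

end

/-- Invariant forms whose zeros lie on mirrors of roots. -/
structure Rm (B : Matrix (Fin n) (Fin n) ℤ) (D : Set (Fin n → ℂ)) (k : ℤ)
    (P : (Fin n → ℂ) → ℂ) : Prop extends Fm B D k P where
  zeros : ∀ Z ∈ D, P Z = 0 → ∃ v : Fin n → ℤ, bl B v v = -2 ∧ bl B Z (ic v) = 0

/-- Vectors orthogonal to `E` and `E'`. -/
def Kp {R : Type*} [CommRing R] (B : Matrix (Fin n) (Fin n) ℤ) (E E' : Fin n → ℤ)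
    (x : Fin n → R) : Prop := bl B x (ic E) = 0 ∧ bl B x (ic E') = 0

section Kp

variable {R : Type*} [CommRing R] {x y : Fin n → R}

lemma Kp.add (h : Kp B E E' x) (h' : Kp B E E' y) : Kp B E E' (x + y) := by
  constructor <;> simp [h.1, h.2, h'.1, h'.2]

lemma Kp.sub (h : Kp B E E' x) (h' : Kp B E E' y) : Kp B E E' (x - y) := by
  constructor <;> simp [h.1, h.2, h'.1, h'.2]

lemma Kp.smul (h : Kp B E E' x) (c : R) : Kp B E E' (c • x) := by
  constructor <;> simp [h.1, h.2]

lemma Kp.ic {v : Fin n → ℤ} (h1 : bl B v E = 0) (h2 : bl B v E' = 0) :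
    Kp B E E' (ic v : Fin n → R) := by
  constructor <;> simp_all

lemma Kp.ac {g : Matrix (Fin n) (Fin n) ℤ} (hg : gᵀ * B * g = B) (h1 : ac g E = E)
    (h2 : ac g E' = E') (h : Kp B E E' x) : Kp B E E' (ac g x) := by
  constructor
  · conv_lhs => rw [← h1, ← ac_ic, bl_ac hg]
    exact h.1
  · conv_lhs => rw [← h2, ← ac_ic, bl_ac hg]
    exact h.2

end Kp

/-- A point on the mirror of `v` near which `P` vanishes only on that mirror. -/
def Gd (P : (Fin n → ℂ) → ℂ) (B : Matrix (Fin n) (Fin n) ℤ) (E E' e v : Fin n → ℤ)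
    (X : Fin n → ℂ) : Prop :=
  X ∈ TT B E E' e ∧ bl B (pt B E E' X) (ic v) = 0 ∧
    ∀ᶠ Y in 𝓝 X, Y ∈ TT B E E' e → P (pt B E E' Y) = 0 → bl B (pt B E E' Y) (ic v) = 0

/-- `P` vanishes to order `m` along the mirror of `v`. -/
def HasMult (P : (Fin n → ℂ) → ℂ) (B : Matrix (Fin n) (Fin n) ℤ) (E E' e v : Fin n → ℤ)
    (m : ℕ) : Prop :=
  ∀ X, Gd P B E E' e v X → ∀ ξ : Fin n → ℂ, Kp B E E' ξ → bl B ξ (ic v) ≠ 0 →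
    HasOrd (fun t => P (pt B E E' (X + t • ξ))) m

lemma TT_open {T : Type*} [TopologicalSpace T] {γ : T → Fin n → ℂ} (hγ : Continuous γ)
    (hK : ∀ p, Kp B E E' (γ p)) : IsOpen {p | γ p ∈ TT B E E' e} := by
  have : {p | γ p ∈ TT B E E' e} = {p | 0 < (bl B (γ p) (ic e)).im} ∩
      {p | 0 < bl B (vim (γ p)) (vim (γ p))} := by
    ext p
    exact ⟨fun h => ⟨h.2.2.1, h.2.2.2⟩, fun h => ⟨(hK p).1, (hK p).2, h.1, h.2⟩⟩
  rw [this]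
  exact (isOpen_lt continuous_const (Complex.continuous_im.comp
    (continuous_bl hγ continuous_const))).inter (isOpen_lt continuous_const
    (continuous_bl (continuous_vim.comp hγ) (continuous_vim.comp hγ)))

section

variable (hB : Sig B)
include hB

lemma Datum.curve_diff (h : Datum B D E E' e f) (hP : DifferentiableOn ℂ P D)
    {T : Type*} [NormedAddCommGroup T] [NormedSpace ℂ T] {γ : T → Fin n → ℂ}
    (hγ : Differentiable ℂ γ) (hK : ∀ p, Kp B E E' (γ p)) {p : T} (hp : γ p ∈ TT B E E' e) :
    DifferentiableAt ℂ (fun p => P (pt B E E' (γ p))) p := by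
  have ho := TT_open (e := e) hγ.continuous hK
  have : DifferentiableOn ℂ (fun p => P (pt B E E' (γ p))) {p | γ p ∈ TT B E E' e} :=
    hP.comp (differentiable_pt.comp hγ).differentiableOn
      fun q hq => (h.pt_mem hB (hK q).1 (hK q).2).2 hq
  exact this.differentiableAt (ho.mem_nhds hp)

lemma Gd.good {v : Fin n → ℤ} (hv : bl B v E = 0)
    {X Y ξ η : Fin n → ℂ} (hY : Kp B E E' Y)
    (hξ : Kp B E E' ξ) (hη : Kp B E E' η)
    (h2 : bl B Y (ic v) = 0) (h3 : bl B ξ (ic v) = 1) (h4 : bl B η (ic v) = 0) {u : ℂ}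
    (hX : Gd P B E E' e v (X + u • Y)) (hX0 : Kp B E E' X)
    (hXv : bl B (pt B E E' X) (ic v) = 0) :
    Good (fun u t => P (pt B E E' (X + u • Y + t • (ξ + u • η)))) u := by
  have hc : Continuous fun p : ℂ × ℂ => X + p.1 • Y + p.2 • (ξ + p.1 • η) := by fun_prop
  have hK : ∀ p : ℂ × ℂ, Kp B E E' (X + p.1 • Y + p.2 • (ξ + p.1 • η)) := fun p =>
    ((hX0.add (hY.smul _)).add ((hξ.add (hη.smul _)).smul _))
  have ho := TT_open (e := e) hc hK
  have h5 : ∀ᶠ p : ℂ × ℂ in 𝓝 (u, 0), X + p.1 • Y + p.2 • (ξ + p.1 • η) ∈ TT B E E' e ∧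
      (P (pt B E E' (X + p.1 • Y + p.2 • (ξ + p.1 • η))) = 0 →
        bl B (pt B E E' (X + p.1 • Y + p.2 • (ξ + p.1 • η))) (ic v) = 0) := by
    have t1 : Tendsto (fun p : ℂ × ℂ => X + p.1 • Y + p.2 • (ξ + p.1 • η)) (𝓝 (u, 0))
        (𝓝 (X + u • Y)) := by
      simpa only [zero_smul, add_zero] using hc.tendsto (u, 0)
    filter_upwards [ho.mem_nhds (show (u, (0:ℂ)) ∈ {p : ℂ × ℂ |
      X + p.1 • Y + p.2 • (ξ + p.1 • η) ∈ TT B E E' e} by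
      change X + u • Y + (0:ℂ) • (ξ + u • η) ∈ TT B E E' e; simpa using hX.1), t1.eventually hX.2.2]
      with p h6 h7
    grind
  obtain ⟨ε, hε, h6⟩ := Metric.eventually_nhds_iff_ball.1 h5
  refine ⟨ε / 2, by simpa, ε / 2, by simpa, fun w hw t ht htε h0 => ht ?_⟩
  have h7 := (h6 (w, t) ?_).2 h0
  · rw [Fr.bl_pt hB hv] at h7 hXv
    simp only [bl_add_left, bl_smul_left, h2, h3, h4] at h7
    grind
  · rw [mem_ball, Prod.dist_eq]
    have := mem_ball.1 hw
    simp only [dist_zero_right]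
    grind

theorem Datum.exists_mult (h : Datum B D E E' e f) (hP : Rm B D k P) {v : Fin n → ℤ}
    (hv : bl B v E = 0) : ∃ m, HasMult P B E E' e v m := by
  by_cases hex : ∃ X ξ : Fin n → ℂ, Gd P B E E' e v X ∧ Kp B E E' ξ ∧ bl B ξ (ic v) ≠ 0
  swap
  · exact ⟨0, fun X hX ξ hξ hξv => absurd ⟨X, ξ, hX, hξ, hξv⟩ hex⟩
  obtain ⟨X0, ξ0', hX0, hξ0', hξv'⟩ := hex
  obtain ⟨ξ0, hξ0, hξv⟩ : ∃ ξ0 : Fin n → ℂ, Kp B E E' ξ0 ∧ bl B ξ0 (ic v) = 1 :=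
    ⟨(bl B ξ0' (ic v))⁻¹ • ξ0', hξ0'.smul _, by simp_all⟩
  have K0 : Kp B E E' X0 := ⟨hX0.1.1, hX0.1.2.1⟩
  have main : ∀ X ξ : Fin n → ℂ, Gd P B E E' e v X → Kp B E E' ξ → bl B ξ (ic v) = 1 → ∀ m,
      HasOrd (fun t => P (pt B E E' (X0 + t • ξ0))) m →
      HasOrd (fun t => P (pt B E E' (X + t • ξ))) m := by
    intro X ξ hX hξ hξ1 m hm
    have KX : Kp B E E' X := ⟨hX.1.1, hX.1.2.1⟩
    have KY := KX.sub K0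
    have Kη := hξ.sub hξ0
    have pv := hX.2.1
    have pv0 := hX0.2.1
    rw [Fr.bl_pt hB hv] at pv pv0
    have y0 : bl B (X - X0) (ic v) = 0 := by
      rw [bl_sub_left]; grind
    have e0 : bl B (ξ - ξ0) (ic v) = 0 := by simp_all
    set γ : ℂ → ℂ → Fin n → ℂ := fun u t => X0 + u • (X - X0) + t • (ξ0 + u • (ξ - ξ0)) with hγ
    have hK : ∀ u t, Kp B E E' (γ u t) := fun u t =>
      (K0.add (KY.smul _)).add ((hξ0.add (Kη.smul _)).smul _)
    set Ω : Set (ℂ × ℂ) := {p | γ p.1 p.2 ∈ TT B E E' e} with hΩ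
    have hγd : Differentiable ℂ fun p : ℂ × ℂ => γ p.1 p.2 := by
      fun_prop
    have hd : ∀ p ∈ Ω, DifferentiableAt ℂ (fun p : ℂ × ℂ => P (pt B E E' (γ p.1 p.2))) p :=
      fun p hp => h.curve_diff hB hP.hol hγd (fun p => hK p.1 p.2) hp
    have hfam : Fam Ω fun u t => P (pt B E E' (γ u t)) := by
      refine ⟨TT_open hγd.continuous fun p => hK p.1 p.2, fun p hp _ => (hd p hp).continuousAt,
        fun p hp _ => ?_, fun p hp => ?_⟩
      · exact (hd p hp).comp p.1 (f := fun u : ℂ => (u, p.2)) (by simp)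
      · exact (hd p hp).comp p.2 (f := fun t : ℂ => (p.1, t)) (by fun_prop)
    set U : Set ℂ := {u | X0 + u • (X - X0) ∈ TT B E E' e} with hU
    have hUΩ : ∀ u, (u, (0:ℂ)) ∈ Ω ↔ u ∈ U := fun u => by
      change γ u 0 ∈ TT B E E' e ↔ X0 + u • (X - X0) ∈ TT B E E' e
      simp [hγ]
    have hUo : IsOpen U := TT_open (by fun_prop) fun u => K0.add (KY.smul _)
    have hUc : Convex ℝ U := by
      intro u hu w hw s t hs ht hst
      have := h.toFr.TT_convex hB hu hw hs ht hst
      change X0 + (s • u + t • w) • (X - X0) ∈ TT B E E' e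
      convert this using 1
      have e1 : (t : ℂ) = 1 - s := by
        rw [← Complex.ofReal_one, ← hst]; simp
      ext i
      simp only [Pi.add_apply, Pi.smul_apply, smul_eq_mul, Complex.real_smul, Pi.sub_apply, e1]
      ring
    have hu0 : (0:ℂ) ∈ U := by change _ + (0:ℂ) • _ ∈ TT B E E' e; simpa using hX0.1
    have hu1 : (1:ℂ) ∈ U := by change _ + (1:ℂ) • _ ∈ TT B E E' e; simpa using hX.1
    have g0 : Good (fun u t => P (pt B E E' (γ u t))) 0 :=
      Gd.good hB hv KY hξ0 Kη y0 hξv e0 (by simpa) K0 hX0.2.1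
    have g1 : Good (fun u t => P (pt B E E' (γ u t))) 1 :=
      Gd.good hB hv KY hξ0 Kη y0 hξv e0 (by simpa) K0 hX0.2.1
    obtain ⟨H, hH, h1, h2⟩ := hfam.order hUo hUc.isPreconnected hu0 hUΩ g0 (m := m)
      (hm.congr fun t _ => by simp [hγ])
    exact (hH.hasOrd (f := fun u t => P (pt B E E' (γ u t))) ((hUΩ 1).2 hu1) (h1 1)
      (h2 1 hu1 g1)).congr fun t _ => by
        simp only [hγ, one_smul, add_sub_cancel]
  have hm : ∃ m, HasOrd (fun t => P (pt B E E' (X0 + t • ξ0))) m := by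
    have hKt : ∀ t : ℂ, Kp B E E' (X0 + t • ξ0) := fun t => K0.add (hξ0.smul _)
    refine exists_ord ?_ ?_
    · have ho : IsOpen {t : ℂ | X0 + t • ξ0 ∈ TT B E E' e} := TT_open (by fun_prop) hKt
      refine DifferentiableOn.analyticAt (s := {t : ℂ | X0 + t • ξ0 ∈ TT B E E' e})
        (fun t ht => ?_) (ho.mem_nhds ?_)
      · exact (h.curve_diff hB hP.hol (γ := fun t : ℂ => X0 + t • ξ0) (by simp) hKt
          ht).differentiableWithinAt
      · change _ + (0:ℂ) • _ ∈ TT B E E' e; simpa using hX0.1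
    · obtain ⟨ρ, hρ, δ, hδ, hg⟩ := Gd.good hB hv (u := 0) (X := X0) (Y := 0) (ξ := ξ0) (η := 0)
        (P := P) (by constructor <;> simp) hξ0 (by constructor <;> simp) (by simp) hξv (by simp)
        (by simpa) K0 hX0.2.1
      have : ∃ᶠ t in 𝓝[≠] (0:ℂ), P (pt B E E' (X0 + t • ξ0)) ≠ 0 := by
        refine Eventually.frequently ?_
        filter_upwards [self_mem_nhdsWithin, nhdsWithin_le_nhds (closedBall_mem_nhds (0:ℂ) hρ)]
          with t ht ht'
        simpa using hg 0 (by simpa) t ht (by simp_all)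
      exact this.filter_mono nhdsWithin_le_nhds
  obtain ⟨m, hm⟩ := hm
  refine ⟨m, fun X hX ξ hξ hξv2 => ?_⟩
  have := (main X ((bl B ξ (ic v))⁻¹ • ξ) hX (hξ.smul _) (by simp_all) m hm).comp_mul
    (c := bl B ξ (ic v)) hξv2
  exact this.congr fun t _ => by
    rw [smul_smul, mul_comm, ← mul_assoc, inv_mul_cancel₀ hξv2, one_mul]

end

lemma HasMult.transport {v v' : Fin n → ℤ} {m : ℕ} (hm : HasMult P B E E' e v m)
    {L L' : (Fin n → ℂ) → Fin n → ℂ} {A : (Fin n → ℂ) → Fin n → ℂ}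
    (hA : ∀ X ξ (t : ℂ), L (X + t • ξ) = L X + t • A ξ)
    (hL : ∀ X, L (L' X) = X) (hL' : ∀ X, L' (L X) = X) (hc : Continuous L')
    (hT : ∀ X, L X ∈ TT B E E' e ↔ X ∈ TT B E E' e)
    (hPL : ∀ X, Kp B E E' X → P (pt B E E' (L X)) = P (pt B E E' X))
    (hv : ∀ X, Kp B E E' X → bl B (pt B E E' (L X)) (ic v) = bl B (pt B E E' X) (ic v'))
    (hK : ∀ ξ, Kp B E E' ξ → Kp B E E' (A ξ) ∧ bl B (A ξ) (ic v) = bl B ξ (ic v')) :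
    HasMult P B E E' e v' m := by
  rintro X ⟨h1, h2, h3⟩ ξ hξ hξv
  have KX : ∀ X ∈ TT B E E' e, Kp B E E' X := fun X h => ⟨h.1, h.2.1⟩
  have hg : Gd P B E E' e v (L X) := by
    refine ⟨(hT X).2 h1, by grind, ?_⟩
    have : Tendsto L' (𝓝 (L X)) (𝓝 X) := by
      have := hc.tendsto (L X)
      grind
    filter_upwards [this.eventually h3] with Y hY hYT hY0
    grind
  refine (hm _ hg (A ξ) (hK ξ hξ).1 (by grind)).congr fun t _ => ?_
  rw [← hA, hPL _ ((KX X h1).add (hξ.smul t))]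

section

variable (hB : Sig B) (hD : IsComponent B D) (h : Datum B D E E' e f)
include hB hD h

omit hD in
lemma HasMult.isom (hP : Fm B D k P) {v v' : Fin n → ℤ} {m : ℕ} (hm : HasMult P B E E' e v m)
    {g : Matrix (Fin n) (Fin n) ℤ} (hg : g ∈ OPlus B D) (h1 : ac g E = E) (h2 : ac g E' = E')
    (hv : ac g v' = v) : HasMult P B E E' e v' m := by
  obtain ⟨g', hg', h3, h4⟩ := oplus_inv hB hg
  have hi := hg.1
  have i1 : ∀ X : Fin n → ℂ, ac g (ac g' X) = X := fun X => by rw [← ac_mul, h3, ac_one]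
  have i2 : ∀ X : Fin n → ℂ, ac g' (ac g X) = X := fun X => by rw [← ac_mul, h4, ac_one]
  have k1 : ac g' E = E := by
    conv_lhs => rw [← h1]
    rw [← ac_mul, h4, ac_one]
  have k2 : ac g' E' = E' := by
    conv_lhs => rw [← h2]
    rw [← ac_mul, h4, ac_one]
  refine hm.transport (L := ac g) (L' := ac g') (A := ac g) (fun X ξ t => by simp)
    i1 i2 (continuous_ac _) (fun X => ?_) (fun X _ => ?_) (fun X _ => ?_) fun ξ hξ => ⟨?_, ?_⟩
  · have key : ∀ X, Kp B E E' X → (ac g X ∈ TT B E E' e ↔ X ∈ TT B E E' e) := fun X hX => by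
      have := hX.ac hi h1 h2
      rw [← h.pt_mem hB this.1 this.2, ← isom_pt hi h1 h2, oplus_mem_iff hB hg,
        h.pt_mem hB hX.1 hX.2]
    refine ⟨fun hX => ?_, fun hX => (key X ⟨hX.1, hX.2.1⟩).2 hX⟩
    refine (key X ?_).1 hX
    rw [← i2 X]
    exact Kp.ac hg'.1 k1 k2 ⟨hX.1, hX.2.1⟩
  · rw [← isom_pt hi h1 h2, hP.inv g hg]
  · rw [← isom_pt hi h1 h2, ← hv, ← ac_ic, bl_ac hi]
  · exact hξ.ac hi h1 h2
  · rw [← hv, ← ac_ic, bl_ac hi]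

lemma HasMult.transl (hP : Fm B D k P) {v v' y : Fin n → ℤ} {m : ℕ}
    (hm : HasMult P B E E' e v m) (h1 : bl B y E = 0) (h2 : bl B y E' = 0)
    (h3 : bl B v E = 0) (h4 : v' = v + bl B y v • E) (h5 : bl B v E' = 0) :
    HasMult P B E E' e v' m := by
  have hy : Kp B E E' (ic y : Fin n → ℂ) := Kp.ic h1 h2
  have G := h.gz hB
  have hv' : bl B v' E = 0 := by rw [h4]; simp only [bl_add_left, bl_smul_left, G, h3]; simp
  refine hm.transport (L := fun X => X + ic y) (L' := fun X => X - ic y) (A := id)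
    (fun X ξ t => by simp only [id]; abel) (fun X => by simp) (fun X => by simp) (by fun_prop)
    (fun X => ?_) (fun X hX => h.inv_transl hB hD hP h1 h2 hX.1) (fun X hX => ?_)
    fun ξ hξ => ⟨hξ, ?_⟩
  · change (_ ∧ _ ∧ _ ∧ _) ↔ (_ ∧ _ ∧ _ ∧ _)
    simp_all
  · rw [Fr.bl_pt hB h3, Fr.bl_pt hB hv', h5, h4, bl_add_left, bl_add_left, ic_add, ic_smul,
      bl_add_right, bl_smul_right, bl_smul_left, bl_ic, hX.1, G.2.2.1, h5]
    simp
  · simp only [id]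
    rw [h4, ic_add, ic_smul, bl_add_right, bl_smul_right, hξ.1]
    simp

lemma Datum.refl_mem {u : Fin n → ℤ} (hu : bl B u u = -2) (h1 : bl B u E = 0)
    (h2 : bl B u E' = 0) : refl B u ∈ OPlus B D ∧ ac (refl B u) E = E ∧ ac (refl B u) E' = E' := by
  have a1 : ac (refl B u) E = E := by rw [acz_refl, hB.comm, h1]; simp
  have a2 : ac (refl B u) E' = E' := by rw [acz_refl, hB.comm, h2]; simp
  refine ⟨?_, a1, a2⟩
  have G := h.gr hB ℝ
  have hub : ∀ x : Fin n → ℤ, bl B (ic u : Fin n → ℝ) (ic x) = (bl B u x : ℤ) := fun x => bl_ic ..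
  set s : ℝ := bl B (ic e + ic f) (ic u) / 2 with hs
  set Y : Fin n → ℝ := ic e + ic f + s • ic u with hY
  have uu : bl B (ic u : Fin n → ℝ) (ic u) = -2 := by simp_all
  have hs2 : bl B (ic e : Fin n → ℝ) (ic u) + bl B (ic f : Fin n → ℝ) (ic u) = 2 * s := by
    rw [hs, bl_add_left]; ring
  have YE : bl B Y (ic E) = 0 := by
    simp only [hY, bl_add_left, bl_smul_left, G, hub, h1]; simp
  have YE' : bl B Y (ic E') = 0 := by
    simp only [hY, bl_add_left, bl_smul_left, G, hub, h2]; simp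
  have Yu : bl B Y (ic u) = 0 := by
    simp only [hY, bl_add_left, bl_smul_left, uu]; linarith
  have YY : 0 < bl B Y Y := by
    have : bl B Y Y = 2 + 2 * s ^ 2 := by
      simp only [hY, bl_add_left, bl_smul_left, bl_add_right, bl_smul_right, uu, G,
        hB.comm (ic u) (ic e), hB.comm (ic u) (ic f)]
      linear_combination 2 * s * hs2
    rw [this]; positivity
  have Ye : bl B Y (ic e) ≠ 0 := fun h0 => by
    have := h.toFr.le' hB YE YE' h0
    linarith
  have main : ∀ c : ℝ, c ≠ 0 → 0 < c * bl B Y (ic e) → refl B u ∈ OPlus B D := by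
    intro c hc hpos
    have hX : (I : ℂ) • rc (c • Y) ∈ TT B E E' e := by
      have hv : vim ((I : ℂ) • rc (c • Y)) = c • Y := by rw [vim_smul]; simp
      have hb : ∀ x : Fin n → ℤ, bl B Y (ic x) = 0 → bl B ((I : ℂ) • rc (c • Y)) (ic x) = 0 := by
        intro x hx
        apply Complex.ext
        · rw [re_bl_ic, vre_smul]; simp
        · rw [im_bl_ic, hv]; simp [hx]
      refine ⟨hb E YE, hb E' YE', ?_, ?_⟩
      · rw [im_bl_ic, hv]; simpa
      · rw [hv, bl_smul_left, bl_smul_right]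
        have := mul_pos (mul_self_pos.2 hc) YY
        linarith
    refine h.mem_oplus hB hD (refl_isom hB hu) a1 a2 hX ?_
    have : ac (refl B u) ((I : ℂ) • rc (c • Y)) = (I : ℂ) • rc (c • Y) := by
      rw [ac_refl]
      have : bl B ((I : ℂ) • rc (c • Y)) (ic u) = 0 := by
        apply Complex.ext
        · rw [re_bl_ic, vre_smul]; simp
        · rw [im_bl_ic, vim_smul]; simp [Yu]
      rw [this]; simp
    rw [this]; omega
  rcases lt_or_gt_of_ne Ye with h0 | h0
  · exact main (-1) (by simp) (by simpa)
  · exact main 1 (by simp) (by simpa)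

lemma HasMult.of_pair (hP : Fm B D k P) {u v : Fin n → ℤ} {m : ℕ}
    (hm : HasMult P B E E' e u m) (hu : bl B u u = -2) (h1 : bl B u E = 0) (h2 : bl B u E' = 0)
    (hv : bl B v v = -2) (h3 : bl B v E = 0) (h4 : bl B v E' = 0) (huv : bl B u v = 1) :
    HasMult P B E E' e v m := by
  obtain ⟨a1, a2, a3⟩ := h.refl_mem hB hD hu h1 h2
  obtain ⟨b1, b2, b3⟩ := h.refl_mem hB hD hv h3 h4
  have huv' : bl B v u = 1 := by rw [hB.comm, huv]
  refine (hm.isom hB h hP (v' := u + v) b1 b2 b3 ?_).isom hB h hP a1 a2 a3 ?_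
  · rw [acz_refl, bl_add_left, huv, hv]; module
  · rw [acz_refl, huv', one_smul, add_comm]

theorem Datum.mult_div_one (hP : Fm B D k P) {c : ℕ} (hm : HasMult P B E E' e (f - e) c)
    {v x : Fin n → ℤ} (hv : bl B v v = -2) (h1 : bl B v E = 0) (h2 : bl B v e = 0)
    (hx : Lz B E E' e f x) (hvx : bl B v x = 1) : HasMult P B E E' e v c := by
  have G := h.gz hB
  set a := bl B v f with ha
  obtain ⟨m, hm'⟩ := hB.even ((1 - a) • x)
  have c1 := hB.comm e x
  have c2 := hB.comm f x
  have y1 : bl B ((1 - a) • x) E = 0 := by rw [bl_smul_left, hx.E, mul_zero]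
  have y2 : bl B ((1 - a) • x) E' = 0 := by rw [bl_smul_left, hx.E', mul_zero]
  have y3 : bl B ((1 - a) • x) e = 0 := by rw [bl_smul_left, hx.e, mul_zero]
  have y4 : bl B ((1 - a) • x) f = 0 := by rw [bl_smul_left, hx.f, mul_zero]
  set y := (1 - a) • x with hy
  have vy : bl B v y = 1 - a := by rw [hy, bl_smul_right, hvx, mul_one]
  have c3 := hB.comm e y
  have c4 := hB.comm f y
  set u := f + y - (1 + m) • e with hu
  have ue : bl B u e = 1 := by
    simp only [hu, bl_sub_left, bl_add_left, bl_smul_left, G, y3]; ring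
  have uy : bl B u y = 2 * m := by
    simp only [hu, bl_sub_left, bl_add_left, bl_smul_left, c3, c4, y3, y4, hm']; ring
  have uf : bl B u f = -(1 + m) := by
    simp only [hu, bl_sub_left, bl_add_left, bl_smul_left, G, y4]; ring
  have uu : bl B u u = -2 := by
    conv_lhs => arg 3; rw [hu]
    rw [bl_sub_right, bl_add_right, bl_smul_right _ (1 + m), uf, uy, ue]; ring
  have uE : bl B u E = 0 := by
    simp only [hu, bl_sub_left, bl_add_left, bl_smul_left, G, y1]; ring
  have uE' : bl B u E' = 0 := by
    simp only [hu, bl_sub_left, bl_add_left, bl_smul_left, G, y2]; ring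
  have yn : bl B (-y) (-y) = 2 * m := by simpa
  obtain ⟨t1, -⟩ := h.transv hB hD (y := -y) (m := m) (by simpa)
    (by simpa) (by simpa) yn
  have hmu : HasMult P B E E' e u c := by
    refine hm.isom hB h hP t1 ?_ ?_ ?_
    · rw [acz_eich, bl_neg_right, hB.comm E y, y1, G.2.2.2.2.2.2.2.2.1]; simp
    · rw [acz_eich, bl_neg_right, hB.comm E' y, y2, G.2.2.2.2.2.2.2.2.2.2.2.2.1]; simp
    · rw [acz_eich, bl_neg_right, ue, uy, hu]; module
  set w := v - bl B v E' • E with hw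
  have wE : bl B w E = 0 := by
    simp only [hw, bl_sub_left, bl_smul_left, G, h1]; ring
  have wE' : bl B w E' = 0 := by
    simp only [hw, bl_sub_left, bl_smul_left, G]; ring
  have ww : bl B w w = -2 := by
    conv_lhs => arg 2; rw [hw]
    rw [bl_sub_left, bl_smul_left, hB.comm E, wE, hw, bl_sub_right, bl_smul_right, hv, h1]; ring
  have uw : bl B u w = 1 := by
    rw [hw, bl_sub_right, bl_smul_right, uE, hB.comm u v, hu]
    simp only [bl_sub_right, bl_add_right, bl_smul_right, h2, vy, ← ha]; ring
  have hmw := hmu.of_pair hB hD h hP uu uE uE' ww wE wE' uw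
  refine hmw.transl hB hD h hP (y := bl B v E' • x) (v' := v) ?_ ?_ wE ?_ wE'
  · rw [bl_smul_left, hx.E, mul_zero]
  · rw [bl_smul_left, hx.E', mul_zero]
  · rw [bl_smul_left, hB.comm x w, hw, bl_sub_left, bl_smul_left, hvx,
      hB.comm E x, hx.E]
    simp

end

lemma lattice_sep {τ : ℂ} (hτ : 0 < τ.im) {p q : ℤ} (h : ‖(p : ℂ) + q * τ‖ < min 1 τ.im) :
    p = 0 ∧ q = 0 := by
  obtain ⟨h1, h2⟩ := lt_min_iff.1 h
  have hq : q = 0 := by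
    have h3 : |(q : ℝ) * τ.im| < τ.im := by
      refine lt_of_le_of_lt ?_ h2
      simpa using Complex.abs_im_le_norm ((p : ℂ) + q * τ)
    rw [abs_mul, abs_of_pos hτ, mul_lt_iff_lt_one_left hτ] at h3
    have : |q| < 1 := by exact_mod_cast h3
    simpa
  subst hq
  have : |p| < 1 := by
    have : ‖(p : ℂ)‖ < 1 := by simp_all
    rw [Complex.norm_intCast] at this
    exact_mod_cast this
  simpa

lemma lattice_discrete {τ : ℂ} (hτ : 0 < τ.im) (z : ℂ) :
    ∀ᶠ z' in 𝓝[≠] z, ∀ p q : ℤ, z' ≠ p + q * τ := by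
  have hm : 0 < min 1 τ.im / 2 := half_pos (lt_min one_pos hτ)
  by_cases H : ∃ y ∈ ball z (min 1 τ.im / 2), y ≠ z ∧ ∃ p q : ℤ, y = p + q * τ
  · obtain ⟨y, hy, hyz, p, q, hpq⟩ := H
    have h1 : ∀ᶠ z' in 𝓝[≠] z, z' ∈ ball z (min 1 τ.im / 2) :=
      mem_nhdsWithin_of_mem_nhds (ball_mem_nhds z hm)
    have h2 : ∀ᶠ z' in 𝓝[≠] z, z' ≠ y :=
      mem_nhdsWithin_of_mem_nhds (isOpen_ne.mem_nhds hyz.symm)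
    filter_upwards [h1, h2] with z' h1 h2 p' q' h3
    apply h2
    have h4 : ‖((p' - p : ℤ) : ℂ) + (q' - q : ℤ) * τ‖ < min 1 τ.im := by
      have : ((p' - p : ℤ) : ℂ) + (q' - q : ℤ) * τ = z' - y := by grind
      rw [this, ← dist_eq_norm]
      calc dist z' y ≤ dist z' z + dist y z := dist_triangle_right _ _ _
        _ < _ := by linarith [mem_ball.1 h1, mem_ball.1 hy]
    obtain ⟨h5, h6⟩ := lattice_sep hτ h4
    grind
  · push Not at H
    have h1 : ∀ᶠ z' in 𝓝[≠] z, z' ∈ ball z (min 1 τ.im / 2) :=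
      mem_nhdsWithin_of_mem_nhds (ball_mem_nhds z hm)
    filter_upwards [h1, self_mem_nhdsWithin] with z' h1 h2
    grind

/-- A point at which no mirror of a vector orthogonal to the frame takes an integral value. -/
def Gen (B : Matrix (Fin n) (Fin n) ℤ) (E E' e f : Fin n → ℤ) (z : Fin n → ℝ) : Prop :=
  Pp B E E' e f z ∧ ∀ u, Lz B E E' e f u → u ≠ 0 → ∀ p : ℤ, bl B z (ic u) ≠ p

lemma Pp.sum {ι R : Type*} [CommRing R] {s : Finset ι} {v : ι → Fin n → R}
    (h : ∀ i ∈ s, Pp B E E' e f (v i)) : Pp B E E' e f (∑ i ∈ s, v i) := by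
  constructor <;> rw [bl_sum_left] <;> refine Finset.sum_eq_zero fun i hi => ?_
  exacts [(h i hi).E, (h i hi).E', (h i hi).e, (h i hi).f]

section

variable (hB : Sig B)
include hB

lemma bl_proj {u : Fin n → ℤ} (hu : Lz B E E' e f u) (x : Fin n → ℤ) :
    bl B (proj B E E' e f x) u = bl B x u := by
  have c := fun v => hB.comm v u
  simp only [proj, bl_sub_left, bl_smul_left, c E, c E', c e, c f, hu.E, hu.E', hu.e, hu.f]
  ring

lemma Fr.proj_sq (h : Fr B E E' e f) {v : Fin n → ℤ} (h1 : bl B v E = 0) (h2 : bl B v e = 0) :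
    bl B (proj B E E' e f v) (proj B E E' e f v) = bl B v v := by
  rw [bl_proj hB (h.proj_Lz hB v), hB.comm]
  simp only [proj, bl_sub_left, bl_smul_left, h1, h2, hB.comm E v, hB.comm e v]
  ring

theorem Fr.exists_gen (h : Fr B E E' e f) : ∃ z : Fin n → ℝ, Gen B E E' e f z := by
  classical
  let q : (Fin n → ℤ) × ℤ → Polynomial ℝ := fun u =>
    ∑ i : Fin n, Polynomial.C ((bl B (Pi.single i 1) u.1 : ℤ) : ℝ) * Polynomial.X ^ ((i : ℕ) + 1)
      - Polynomial.C (u.2 : ℝ)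
  have hq : ∀ u : (Fin n → ℤ) × ℤ, u.1 ≠ 0 → q u ≠ 0 := by
    intro u hu h0
    apply hu
    have : ∀ i, bl B u.1 (Pi.single i 1) = 0 := by
      intro i
      have := congrArg (fun p => p.coeff ((i : ℕ) + 1)) h0
      simp only [q, Polynomial.coeff_sub, Polynomial.finsetSum_coeff, Polynomial.coeff_C_mul,
        Polynomial.coeff_X_pow, Polynomial.coeff_C, Polynomial.coeff_zero] at this
      simp only [add_left_inj, Nat.add_eq_zero_iff, one_ne_zero, and_false, if_false, sub_zero,
        mul_ite, mul_one, mul_zero, Fin.val_inj, Finset.sum_ite_eq, Finset.mem_univ,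
        if_true] at this
      rw [hB.comm]
      simpa
    exact bl_nondeg hB.det this
  have hc : (⋃ u ∈ {u : (Fin n → ℤ) × ℤ | u.1 ≠ 0}, {s : ℝ | (q u).IsRoot s}).Countable := by
    refine Set.Countable.biUnion (Set.to_countable _) fun u hu => ?_
    exact (Polynomial.finite_setOfPred_isRoot (hq u hu)).countable
  obtain ⟨s, hs⟩ : ∃ s : ℝ, s ∉ ⋃ u ∈ {u : (Fin n → ℤ) × ℤ | u.1 ≠ 0}, {s : ℝ | (q u).IsRoot s} := by
    by_contra! H
    exact Set.not_countable_univ (hc.mono fun s _ => H s)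
  refine ⟨∑ i : Fin n, s ^ ((i : ℕ) + 1) • ic (proj B E E' e f (Pi.single i 1)),
    Pp.sum fun i _ => (h.proj_Lz hB _).pp.smul _, fun u hu h0 p hp => hs ?_⟩
  refine Set.mem_biUnion (x := (u, p)) h0 ?_
  change Polynomial.eval s (q (u, p)) = 0
  rw [bl_sum_left] at hp
  simp only [bl_smul_left, bl_ic, bl_proj hB hu] at hp
  simp only [q, Polynomial.eval_sub, Polynomial.eval_finsetSum, Polynomial.eval_mul,
    Polynomial.eval_C, Polynomial.eval_pow, Polynomial.eval_X]
  rw [← hp, sub_eq_zero]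
  exact Finset.sum_congr rfl fun i _ => mul_comm _ _

lemma Fr.vim_pt_sq (h : Fr B E E' e f) {X : Fin n → ℂ} (h1 : bl B X (ic E) = 0) :
    bl B (vim (pt B E E' X)) (vim (pt B E E' X)) = bl B (vim X) (vim X) := by
  have G' := h.gr hB ℝ
  have h3 : bl B (vim X) (ic E) = 0 := by rw [← im_bl_ic, h1]; rfl
  simp only [pt, vim_sub, vim_add, vim_smul, vim_ic, vre_ic, bl_sub_left, bl_sub_right,
    bl_add_left, bl_add_right, bl_smul_left, bl_smul_right, bl_zero_left, bl_zero_right, G', h3,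
    hB.comm (ic E) (vim X)]
  ring

lemma Fr.cusp_root (h : Fr B E E' e f) {X : Fin n → ℂ} (hX : X ∈ TT B E E' e)
    (h1 : 2 < bl B (vim X) (vim X))
    (h2 : 2 * Complex.normSq (bl B X (ic e)) < bl B (vim X) (vim X))
    {v : Fin n → ℤ} (hv : bl B v v = -2) (h0 : bl B (pt B E E' X) (ic v) = 0) :
    bl B v E = 0 ∧ bl B v e = 0 := by
  have hZ := (h.pt_cone hB hX.1 hX.2.1).2 hX.2.2.2
  have hpos := hX.2.2.2
  have key : ∀ x : Fin n → ℤ, bl B x x = 0 →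
      2 * Complex.normSq (bl B (pt B E E' X) (ic x)) < bl B (vim X) (vim X) → bl B v x = 0 := by
    intro x hx hlt
    have := root_bound hB hZ hv h0 (ic x)
    have e1 : rc (ic x : Fin n → ℝ) = ic x := by rfl
    rw [e1, h.vim_pt_sq hB hX.1, bl_ic, bl_ic, hx] at this
    have h3 : ((bl B v x : ℤ) : ℝ) ^ 2 < 1 := by
      refine lt_of_le_of_lt this ?_
      rw [Int.cast_zero, sub_zero, ← mul_div_assoc, div_lt_one hpos]
      omega
    have h4 : (bl B v x) ^ 2 < 1 := by exact_mod_cast h3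
    simp_all
  refine ⟨key E h.EE ?_, key e h.ee ?_⟩
  · rw [h.bl_pt_E hB hX.1]; simpa
  · rw [h.bl_pt_e hB]; omega

end

lemma proj_neg (v : Fin n → ℤ) : proj B E E' e f (-v) = -proj B E E' e f v := by
  simp only [proj, bl_neg_left, neg_smul]; abel

lemma proj_add {v : Fin n → ℤ} (h1 : bl B v E = 0) (h2 : bl B v e = 0) :
    v = proj B E E' e f v + bl B v E' • E + bl B v f • e := by
  simp only [proj, h1, h2, zero_smul]; abel

section

variable (hB : Sig B)
include hB

lemma wall_eq {z0 : Fin n → ℝ} (hz : Pp B E E' e f z0) {ζ : Fin n → ℤ}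
    (hζ : Lz B E E' e f ζ) (τ ω w : ℂ) {v : Fin n → ℤ} (h1 : bl B v E = 0) (h2 : bl B v e = 0) :
    bl B (pt B E E' (XX e f τ ω (rc z0 + w • ic ζ))) (ic v) =
      (bl B (proj B E E' e f v) ζ : ℤ) * w + (bl B z0 (ic (proj B E E' e f v)) : ℝ) +
        (bl B v E' : ℤ) + (bl B v f : ℤ) * τ := by
  rw [Fr.bl_pt hB h1]
  have hx : Pp B E E' e f (rc z0 + w • ic ζ) := hz.rc.add (hζ.pp.smul w)
  have hzc : ∀ u : Fin n → ℤ, bl B (rc z0) (ic u) = ((bl B z0 (ic u) : ℝ) : ℂ) := by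
    intro u
    apply Complex.ext
    · rw [re_bl_ic]; simp
    · rw [im_bl_ic]; simp
  have e1 : bl B (rc z0 + w • ic ζ) (ic v) =
      bl B (rc z0 + w • ic ζ) (ic (proj B E E' e f v)) := by
    conv_lhs => rw [proj_add (E' := E') (f := f) h1 h2]
    simp only [ic_add, ic_smul, bl_add_right, bl_smul_right, hx.E, hx.e]
    simp
  have e2 : bl B (rc z0 + w • ic ζ) (ic (proj B E E' e f v)) =
      (bl B z0 (ic (proj B E E' e f v)) : ℝ) + w * (bl B (proj B E E' e f v) ζ : ℤ) := by
    rw [bl_add_left, bl_smul_left, bl_ic, hzc, hB.comm ζ]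
  rw [XX, bl_add_left, bl_add_left, bl_smul_left, bl_smul_left, bl_ic, bl_ic, e1, e2,
    hB.comm f v, hB.comm e v, h2]
  ring

lemma Fr.walls (h : Fr B E E' e f) {z0 : Fin n → ℝ} (hz : Gen B E E' e f z0) {ζ : Fin n → ℤ}
    (hζ : Lz B E E' e f ζ) {τ : ℂ} (hτ : 0 < τ.im) (w₀ : ℂ) :
    ∃ H : ℝ, ∀ ω : ℂ, H ≤ ω.im → ∀ w ∈ ball w₀ 1, XX e f τ ω (rc z0 + w • ic ζ) ∈ TT B E E' e ∧
      ∀ v : Fin n → ℤ, bl B v v = -2 →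
        bl B (pt B E E' (XX e f τ ω (rc z0 + w • ic ζ))) (ic v) = 0 →
        bl B v E = 0 ∧ bl B v e = 0 ∧ bl B (proj B E E' e f v) ζ ≠ 0 ∧
        (bl B (proj B E E' e f v) ζ : ℤ) * w + (bl B z0 (ic (proj B E E' e f v)) : ℝ) =
          (-bl B v E' : ℤ) + (-bl B v f : ℤ) * τ := by
  set N : ℝ := 2 + 2 * Complex.normSq τ with hN
  set A : ℝ := (|w₀.im| + 1) ^ 2 * |((bl B ζ ζ : ℤ) : ℝ)| with hA
  refine ⟨(N + A + 1) / (2 * τ.im), fun ω hω w hw => ?_⟩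
  have hx : Pp B E E' e f (rc z0 + w • ic ζ) := hz.1.rc.add (hζ.pp.smul w)
  have hvx : vim (rc z0 + w • ic ζ) = w.im • ic ζ := by
    ext i; simp [Refl.vim, Refl.rc, ic]
  have hwi : |w.im| ≤ |w₀.im| + 1 := by
    have h1 : |(w - w₀).im| < 1 :=
      lt_of_le_of_lt (Complex.abs_im_le_norm _) (by rw [← dist_eq_norm]; simpa)
    rw [Complex.sub_im] at h1
    have := abs_sub_abs_le_abs_sub w.im w₀.im
    linarith
  have hAw : -A ≤ bl B (vim (rc z0 + w • ic ζ)) (vim (rc z0 + w • ic ζ)) := by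
    rw [hvx, bl_smul_left, bl_smul_right, bl_ic]
    have h1 : w.im ^ 2 ≤ (|w₀.im| + 1) ^ 2 := by
      rw [← sq_abs]; exact pow_le_pow_left₀ (abs_nonneg _) hwi 2
    have h2 : w.im ^ 2 * |((bl B ζ ζ : ℤ) : ℝ)| ≤ A :=
      mul_le_mul_of_nonneg_right h1 (abs_nonneg _)
    have h3 := neg_abs_le ((bl B ζ ζ : ℤ) : ℝ)
    nlinarith [sq_nonneg w.im]
  have hωN : N + A + 1 ≤ 2 * τ.im * ω.im := by
    rw [div_le_iff₀ (by simpa)] at hω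
    linarith
  have hnn := Complex.normSq_nonneg τ
  have hX : XX e f τ ω (rc z0 + w • ic ζ) ∈ TT B E E' e := by
    rw [h.XX_TT hB hx]
    exact ⟨hτ, by linarith⟩
  have hsq : N < bl B (vim (XX e f τ ω (rc z0 + w • ic ζ)))
      (vim (XX e f τ ω (rc z0 + w • ic ζ))) := by
    have G := h.gr hB ℝ
    have hv := hx.vim
    have c := fun v : Fin n → ℤ => hB.comm (ic v : Fin n → ℝ) (vim (rc z0 + w • ic ζ))
    have : vim (XX e f τ ω (rc z0 + w • ic ζ)) =
        τ.im • ic f + ω.im • ic e + vim (rc z0 + w • ic ζ) := by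
      ext i; simp [XX, Refl.vim, Refl.rc, ic]
    rw [this]
    simp only [bl_add_left, bl_smul_left, bl_add_right, bl_smul_right, G, hv.e, hv.f, c]
    linarith
  refine ⟨hX, fun v hv h0 => ?_⟩
  have he : bl B (XX e f τ ω (rc z0 + w • ic ζ)) (ic e) = τ := (h.XX_bl hB hx τ ω).2.2.1
  obtain ⟨h1, h2⟩ := h.cusp_root hB hX (by linarith) (by rw [he]; linarith) hv h0
  rw [wall_eq hB hz.1 hζ τ ω w h1 h2] at h0
  have h3 : (bl B (proj B E E' e f v) ζ : ℤ) * w + (bl B z0 (ic (proj B E E' e f v)) : ℝ) =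
      (-bl B v E' : ℤ) + (-bl B v f : ℤ) * τ := by
    push_cast
    linear_combination h0
  refine ⟨h1, h2, fun h4 => ?_, h3⟩
  rw [h4] at h3
  have hf : bl B v f = 0 := by
    have := congrArg Complex.im h3
    simp only [Int.cast_zero, zero_mul, zero_add, Complex.ofReal_im, Complex.add_im,
      Complex.intCast_im, Complex.mul_im, Complex.intCast_re, add_zero] at this
    have := (mul_eq_zero.1 this.symm).resolve_right hτ.ne'
    simpa
  have hp0 : proj B E E' e f v ≠ 0 := by
    intro h5
    have := h.proj_sq hB h1 h2
    simp_all
  refine hz.2 _ (h.proj_Lz hB v) hp0 (-bl B v E') ?_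
  rw [hf] at h3
  have := congrArg Complex.re h3
  simpa

omit hB in
lemma Gen.wall_unique {z0 : Fin n → ℝ} (hz : Gen B E E' e f z0) {ζ : Fin n → ℤ} {τ : ℂ}
    (hτ : 0 < τ.im) {r r' : Fin n → ℤ} (hr : Lz B E E' e f r) (hr' : Lz B E E' e f r')
    (h2 : bl B r r = -2) (h2' : bl B r' r' = -2) (ha : 0 < bl B r ζ) (ha' : 0 < bl B r' ζ) {w : ℂ}
    {p q p' q' : ℤ} (h : (bl B r ζ : ℤ) * w + (bl B z0 (ic r) : ℝ) = p + q * τ)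
    (h' : (bl B r' ζ : ℤ) * w + (bl B z0 (ic r') : ℝ) = p' + q' * τ) :
    r = r' ∧ p = p' ∧ q = q' := by
  have e1 : ((bl B z0 (ic (bl B r' ζ • r - bl B r ζ • r')) : ℝ) : ℂ) =
      (bl B r' ζ * p - bl B r ζ * p' : ℤ) + (bl B r' ζ * q - bl B r ζ * q' : ℤ) * τ := by
    simp only [ic_sub, ic_smul, bl_sub_right, bl_smul_right]
    push_cast
    grind
  have e2 := congrArg Complex.im e1
  simp only [Complex.ofReal_im, Complex.add_im,
      Complex.intCast_im, Complex.mul_im, Complex.intCast_re, zero_mul, add_zero, zero_add] at e2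
  have e3 : bl B r' ζ * q - bl B r ζ * q' = 0 := by
    exact_mod_cast (mul_eq_zero.1 e2.symm).resolve_right hτ.ne'
  rw [e3] at e1
  have e4 : bl B r' ζ • r - bl B r ζ • r' = 0 := by
    by_contra h0
    refine hz.2 _ ?_ h0 (bl B r' ζ * p - bl B r ζ * p') ?_
    · constructor <;> simp only [bl_sub_left, bl_smul_left, hr.E, hr.E', hr.e, hr.f, hr'.E,
        hr'.E', hr'.e, hr'.f] <;> ring
    · have := congrArg Complex.re e1
      simpa
  rw [sub_eq_zero] at e4
  have e5 := congrArg (fun x => bl B x x) e4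
  simp only [bl_smul_left, bl_smul_right, h2, h2'] at e5
  have e6 : bl B r' ζ = bl B r ζ := by nlinarith
  have e7 : r = r' := by
    rw [e6] at e4
    exact smul_right_injective _ ha.ne' e4
  subst e7
  have e8 : ((p - p' : ℤ) : ℂ) + (q - q' : ℤ) * τ = 0 := by
    push_cast; linear_combination h' - h
  obtain ⟨h5, h6⟩ := lattice_sep hτ (p := p - p') (q := q - q') (by
    rw [e8, norm_zero]; simpa)
  exact ⟨rfl, sub_eq_zero.1 h5, sub_eq_zero.1 h6⟩

lemma Datum.jac_ne_zero (h : Datum B D E E' e f) (hP : Rm B D k P)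
    {z0 : Fin n → ℝ} (hz : Gen B E E' e f z0) {ζ : Fin n → ℤ} (hζ : Lz B E E' e f ζ) {τ : ℂ}
    (hτ : 0 < τ.im) (w₀ : ℂ) :
    ∃ H : ℝ, ∀ ω : ℂ, H ≤ ω.im → ∀ w ∈ ball w₀ 1,
      (∀ r, Lz B E E' e f r → bl B r r = -2 → 0 < bl B r ζ → ∀ p q : ℤ,
        (bl B r ζ : ℤ) * w + ((bl B z0 (ic r) : ℝ) : ℂ) ≠ p + q * τ) →
      jac P B E E' e f τ z0 ζ w ω ≠ 0 := by
  obtain ⟨H, hH⟩ := h.toFr.walls hB hz hζ hτ w₀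
  refine ⟨H, fun ω hω w hw hr h0 => ?_⟩
  obtain ⟨hX, hX'⟩ := hH ω hω w hw
  obtain ⟨v, hv, hv0⟩ := hP.zeros _ ((h.pt_mem hB hX.1 hX.2.1).2 hX) h0
  have key : ∀ v : Fin n → ℤ, bl B v v = -2 →
      bl B (pt B E E' (XX e f τ ω (rc z0 + w • ic ζ))) (ic v) = 0 →
      ¬ 0 < bl B (proj B E E' e f v) ζ := by
    intro v hv hv0 hpos
    obtain ⟨h1, h2, -, h3⟩ := hX' v hv hv0
    exact hr _ (h.toFr.proj_Lz hB v) (by rw [h.toFr.proj_sq hB h1 h2, hv]) hpos _ _ h3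
  rcases lt_or_gt_of_ne (hX' v hv hv0).2.2.1 with h1 | h1
  · refine key (-v) (by simpa) (by simpa) ?_
    rw [proj_neg, bl_neg_left]; omega
  · exact key v hv hv0 h1

theorem Datum.jac_ord (h : Datum B D E E' e f) (hD : IsComponent B D)
    (hP : Rm B D k P) {c : ℕ} (hm : HasMult P B E E' e (f - e) c)
    {z0 : Fin n → ℝ} (hz : Gen B E E' e f z0) {ζ : Fin n → ℤ} (hζ : Lz B E E' e f ζ)
    (hdiv : ∀ r, Lz B E E' e f r → bl B r r = -2 → bl B r ζ ≠ 0 →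
      ∃ x, Lz B E E' e f x ∧ bl B r x = 1)
    (R : Finset (Fin n → ℤ)) (hR : ∀ r, r ∈ R ↔ Lz B E E' e f r ∧ bl B r r = -2)
    {τ : ℂ} (hτ : 0 < τ.im) (w : ℂ)
    [DecidablePred fun r : Fin n → ℤ => ∃ p q : ℤ,
        (bl B r ζ : ℤ) * w + ((bl B z0 (ic r) : ℝ) : ℂ) = p + q * τ] :
    ∃ H : ℝ, ∀ ω : ℂ, H ≤ ω.im → HasOrd (fun t => jac P B E E' e f τ z0 ζ (w + t) ω)
      (c * ((R.filter fun r => 0 < bl B r ζ).filter fun r => ∃ p q : ℤ,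
        (bl B r ζ : ℤ) * w + ((bl B z0 (ic r) : ℝ) : ℂ) = p + q * τ).card) := by
  obtain ⟨H, hH⟩ := h.toFr.walls hB hz hζ hτ w
  obtain ⟨H', hH'⟩ := h.jac_ne_zero hB hP hz hζ hτ w
  refine ⟨max H H', fun ω hω => ?_⟩
  have hw : w ∈ ball w 1 := mem_ball_self one_pos
  obtain ⟨hX, hX'⟩ := hH ω (le_of_max_le_left hω) w hw
  set X := XX e f τ ω (rc z0 + w • ic ζ) with hXdef
  have hcurve : ∀ t : ℂ, jac P B E E' e f τ z0 ζ (w + t) ω = P (pt B E E' (X + t • ic ζ)) := by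
    intro t
    rw [jac, hXdef]
    congr 2
    simp only [XX]; module
  have hKζ : Kp B E E' (ic ζ : Fin n → ℂ) := Kp.ic hζ.E hζ.E'
  set S := (R.filter fun r => 0 < bl B r ζ).filter fun r => ∃ p q : ℤ,
        (bl B r ζ : ℤ) * w + ((bl B z0 (ic r) : ℝ) : ℂ) = p + q * τ with hS
  rcases S.eq_empty_or_nonempty with hS0 | ⟨r, hrS⟩
  · rw [hS0, Finset.card_empty, mul_zero]
    have hne : ∀ r, Lz B E E' e f r → bl B r r = -2 → 0 < bl B r ζ → ∀ p q : ℤ,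
        (bl B r ζ : ℤ) * w + ((bl B z0 (ic r) : ℝ) : ℂ) ≠ p + q * τ := by
      intro r h1 h2 h3 p q h4
      have : r ∈ S := by
        rw [hS, Finset.mem_filter, Finset.mem_filter, hR]
        tauto
      rw [hS0] at this
      simpa
    refine hasOrd_zero_of_ne ?_ (by simpa using hH' ω (le_of_max_le_right hω) w hw hne)
    simp only [hcurve]
    exact (h.curve_diff hB hP.hol (γ := fun t : ℂ => X + t • ic ζ) (by simp)
      (fun t => Kp.add ⟨hX.1, hX.2.1⟩ (hKζ.smul t)) (by simpa)).continuousAt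
  · have hr := hrS
    rw [hS, Finset.mem_filter, Finset.mem_filter, hR] at hr
    obtain ⟨⟨⟨hrL, hr2⟩, hrζ⟩, p, q, hpq⟩ := hr
    have hcard : S.card = 1 := by
      rw [Finset.card_eq_one]
      refine ⟨r, Finset.eq_singleton_iff_unique_mem.2 ⟨hrS, fun r' hr' => ?_⟩⟩
      rw [hS, Finset.mem_filter, Finset.mem_filter, hR] at hr'
      obtain ⟨⟨⟨hrL', hr2'⟩, hrζ'⟩, p', q', hpq'⟩ := hr'
      exact (hz.wall_unique hτ hrL' hrL hr2' hr2 hrζ' hrζ hpq' hpq).1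
    rw [hcard, mul_one]
    simp only [hcurve]
    have G := h.toFr.gz hB
    have cr := fun v => hB.comm v r
    set v := r - p • E - q • e with hv
    have vE : bl B v E = 0 := by simp only [hv, bl_sub_left, bl_smul_left, G, hrL.E]; ring
    have ve : bl B v e = 0 := by simp only [hv, bl_sub_left, bl_smul_left, G, hrL.e]; ring
    have vE' : bl B v E' = -p := by simp only [hv, bl_sub_left, bl_smul_left, G, hrL.E']; ring
    have vf : bl B v f = -q := by simp only [hv, bl_sub_left, bl_smul_left, G, hrL.f]; ring
    have vv : bl B v v = -2 := by
      have : bl B v v = bl B v r - p * bl B v E - q * bl B v e := by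
        conv_lhs => arg 3; rw [hv]
        simp only [bl_sub_right, bl_smul_right]
      rw [this, vE, ve, hv]
      simp only [bl_sub_left, bl_smul_left, hr2, cr E, cr e, hrL.E, hrL.e]
      ring
    have vL : ∀ x, Lz B E E' e f x → bl B v x = bl B r x := by
      intro x hx
      simp only [hv, bl_sub_left, bl_smul_left, hB.comm E x, hB.comm e x,
        hx.E, hx.e]
      ring
    have hvr : proj B E E' e f v = r := by
      rw [proj, vE, ve, vE', vf, hv]; module
    have hv0 : bl B (pt B E E' X) (ic v) = 0 := by
      rw [hXdef, wall_eq hB hz.1 hζ τ ω w vE ve, hvr, vE', vf]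
      push_cast
      linear_combination hpq
    have key : ∀ v' : Fin n → ℤ, bl B v' v' = -2 → bl B (pt B E E' X) (ic v') = 0 →
        0 < bl B (proj B E E' e f v') ζ → v' = v := by
      intro v' h1 h2 h3
      obtain ⟨h4, h5, -, h6⟩ := hX' v' h1 h2
      obtain ⟨e1, e2, e3⟩ := hz.wall_unique hτ (h.toFr.proj_Lz hB v') hrL
        (by rw [h.toFr.proj_sq hB h4 h5, h1]) hr2 h3 hrζ h6 hpq
      rw [proj_add (E' := E') (f := f) h4 h5, hv, e1, ← e2, ← e3]
      module
    have hgd : Gd P B E E' e v X := by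
      refine ⟨hX, hv0, ?_⟩
      have hZ := (h.toFr.pt_cone hB hX.1 hX.2.1).2 hX.2.2.2
      have hl := (continuous_pt (B := B) (E := E) (E' := E')).continuousAt.eventually
        (roots_locally_finite hB hZ)
      filter_upwards [hl] with Y hY hYT hPY
      obtain ⟨v', hv', hv0'⟩ := hP.zeros _ ((h.pt_mem hB hYT.1 hYT.2.1).2 hYT) hPY
      have h1 := hY ((h.toFr.pt_cone hB hYT.1 hYT.2.1).2 hYT.2.2.2) v' hv' hv0'
      rcases lt_or_gt_of_ne (hX' v' hv' h1).2.2.1 with h2 | h2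
      · have := key (-v') (by simpa) (by simpa)
          (by rw [proj_neg, bl_neg_left]; omega)
        rw [← this, ic_neg, bl_neg_right, hv0', neg_zero]
      · rw [← key v' hv' h1 h2, hv0']
    obtain ⟨x, hx, hrx⟩ := hdiv r hrL hr2 hrζ.ne'
    refine (h.mult_div_one hB hD hP.toFm hm vv vE ve hx (by rw [vL x hx, hrx])) X hgd _ hKζ ?_
    rw [bl_ic, hB.comm, vL ζ hζ]
    exact_mod_cast hrζ.ne'

theorem Datum.jac_nz (h : Datum B D E E' e f) (hP : Rm B D k P)
    {z0 : Fin n → ℝ} (hz : Gen B E E' e f z0) {ζ : Fin n → ℤ} (hζ : Lz B E E' e f ζ)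
    (R : Finset (Fin n → ℤ)) (hR : ∀ r, r ∈ R ↔ Lz B E E' e f r ∧ bl B r r = -2)
    {τ : ℂ} (hτ : 0 < τ.im) (w : ℂ) :
    ∃ δ > 0, ∃ H : ℝ, ∀ w' ∈ ball w δ, w' ≠ w → ∀ ω : ℂ, H ≤ ω.im →
      jac P B E E' e f τ z0 ζ w' ω ≠ 0 := by
  obtain ⟨H, hH⟩ := h.jac_ne_zero hB hP hz hζ hτ w
  have h1 : ∀ᶠ w' in 𝓝[≠] w, ∀ r ∈ R.filter (fun r => 0 < bl B r ζ), ∀ p q : ℤ,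
      (bl B r ζ : ℤ) * w' + ((bl B z0 (ic r) : ℝ) : ℂ) ≠ p + q * τ := by
    rw [Filter.eventually_all_finset]
    intro r hr
    have hr0 : ((bl B r ζ : ℤ) : ℂ) ≠ 0 := by exact_mod_cast (Finset.mem_filter.1 hr).2.ne'
    have ht : Tendsto (fun w' : ℂ => ((bl B r ζ : ℤ) : ℂ) * w' + ((bl B z0 (ic r) : ℝ) : ℂ))
        (𝓝[≠] w) (𝓝[≠] (((bl B r ζ : ℤ) : ℂ) * w + ((bl B z0 (ic r) : ℝ) : ℂ))) := by
      refine tendsto_nhdsWithin_iff.2 ⟨?_, ?_⟩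
      · refine tendsto_nhdsWithin_of_tendsto_nhds (Continuous.tendsto ?_ w)
        fun_prop
      · filter_upwards [self_mem_nhdsWithin] with w' hw' heq
        grind
    exact ht.eventually (lattice_discrete hτ _)
  obtain ⟨δ, hδ, h2⟩ := Metric.mem_nhdsWithin_iff.1 h1
  refine ⟨min δ 1, lt_min hδ one_pos, H, fun w' hw' hne ω hω => ?_⟩
  refine hH ω hω w' (ball_subset_ball (min_le_right _ _) hw') fun r hr hr2 hrζ => ?_
  exact h2 ⟨ball_subset_ball (min_le_left _ _) hw', hne⟩ r
    (Finset.mem_filter.2 ⟨(hR r).2 ⟨hr, hr2⟩, hrζ⟩)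

lemma Fr.exists_roots (h : Fr B E E' e f) :
    ∃ R : Finset (Fin n → ℤ), ∀ r, r ∈ R ↔ Lz B E E' e f r ∧ bl B r r = -2 := by
  have hX := h.base hB
  have hZ := (h.pt_cone hB hX.1 hX.2.1).2 hX.2.2.2
  obtain ⟨S, hS, hS'⟩ := roots_finite hB hZ
  have hfin : {r | Lz B E E' e f r ∧ bl B r r = -2}.Finite := by
    refine hS.subset fun r hr => hS'.self_of_nhds hZ r hr.2 ?_
    rw [Fr.bl_pt hB hr.1.E, hr.1.E']
    simp only [XX, bl_add_left, bl_smul_left, bl_ic, hB.comm f r, hB.comm e r,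
      hr.1.e, hr.1.f, bl_zero_left]
    simp
  exact ⟨hfin.toFinset, fun r => by simp⟩

omit hB in
lemma cusp_jac_zero (τ : ℂ) (z0 : Fin n → ℝ) (ζ : Fin n → ℤ) :
    cusp (jac P B E E' e f τ z0 ζ) 0 =
      cusp (fun τ ω => P (pt B E E' (XX e f τ ω (rc z0)))) τ := by
  funext s
  simp only [cusp]
  congr 1
  funext ω
  rw [jac, zero_smul, add_zero]

omit hB in
lemma Gen.wall_zero {z0 : Fin n → ℝ} (hz : Gen B E E' e f z0) {τ : ℂ} (hτ : 0 < τ.im)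
    (a : ℤ) {r : Fin n → ℤ} (hr : Lz B E E' e f r) (h0 : r ≠ 0) (p q : ℤ) :
    (a : ℂ) * 0 + ((bl B z0 (ic r) : ℝ) : ℂ) ≠ p + q * τ := by
  intro h
  have h1 := congrArg Complex.im h
  simp only [Complex.ofReal_im, Complex.add_im, mul_zero,
    Complex.intCast_im, Complex.mul_im, Complex.intCast_re, zero_mul, add_zero, zero_add] at h1
  have h2 : q = 0 := by exact_mod_cast (mul_eq_zero.1 h1.symm).resolve_right hτ.ne'
  subst h2
  exact hz.2 r hr h0 p (by simpa using congrArg Complex.re h)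

omit hB in
lemma root_ne {r : Fin n → ℤ} (h : bl B r r = -2) : r ≠ 0 := by
  rintro rfl
  simp at h

theorem Datum.count (hD : IsComponent B D) (h : Datum B D E E' e f) (hP : Rm B D k P) {c : ℕ}
    (hm : HasMult P B E E' e (f - e) c) :
    ∃ C : ℕ, ∀ ζ, Lz B E E' e f ζ → ζ ≠ 0 →
      (∀ r, Lz B E E' e f r → bl B r r = -2 → bl B r ζ ≠ 0 →
        ∃ x, Lz B E E' e f x ∧ bl B r x = 1) →
      ∀ R : Finset (Fin n → ℤ), (∀ r, r ∈ R ↔ Lz B E E' e f r ∧ bl B r r = -2) →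
        2 * C * (-bl B ζ ζ) = c * ∑ r ∈ R, bl B r ζ ^ 2 := by
  classical
  obtain ⟨z0, hz⟩ := h.toFr.exists_gen hB
  have hI : 0 < I.im := by simp
  have hF := h.fam hB hD hP.toFm hz.1
  have hfreq : ∃ᶠ t in 𝓝 (0 : ℂ),
      cusp (fun τ ω => P (pt B E E' (XX e f τ ω (rc z0)))) I t ≠ 0 := by
    obtain ⟨ζ, h0, hζ⟩ := exists_Lz (E := E) (E' := E') (e := e) (f := f) hB
    obtain ⟨H, hH⟩ := h.jac_ne_zero hB hP hz hζ hI 0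
    have hev : ∀ᶠ ω in toCusp,
        cusp (fun τ ω => P (pt B E E' (XX e f τ ω (rc z0)))) I (ee ω) ≠ 0 := by
      refine eventually_toCusp.2 ⟨H, fun ω hω => ?_⟩
      rw [← cusp_jac_zero I z0 ζ, cusp_ee ((h.FJ hB hD hP.toFm hI hz.1 hζ h0).p2 0)]
      refine hH ω hω 0 (mem_ball_self one_pos) fun r hr hr2 _ p q => ?_
      exact hz.wall_zero hI _ hr (root_ne hr2) p q
    exact tendsto_ee.frequently hev.frequently
  have han : AnalyticAt ℂ (cusp (fun τ ω => P (pt B E E' (XX e f τ ω (rc z0)))) I) 0 := by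
    refine DifferentiableOn.analyticAt (s := ball 0 1) (fun t ht => ?_) (ball_mem_nhds 0 one_pos)
    exact (hF.ht (I, t) ⟨hI, by simp_all⟩).differentiableWithinAt
  obtain ⟨C, hC⟩ := exists_ord han hfreq
  refine ⟨C, fun ζ hζ h0 hdiv R hR => ?_⟩
  have key := (h.FJ hB hD hP.toFm hI hz.1 hζ h0).count (R.filter fun r => 0 < bl B r ζ)
    (fun r => bl B r ζ) (fun r => ((bl B z0 (ic r) : ℝ) : ℂ))
    (fun r hr => (Finset.mem_filter.1 hr).2.ne') c
    (fun w => h.jac_ord hB hD hP hm hz hζ hdiv R hR hI w)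
    (fun w => h.jac_nz hB hP hz hζ R hR hI w) (w₁ := 0)
    (fun r hr p q => by
      have := (hR r).1 (Finset.mem_filter.1 hr).1
      exact hz.wall_zero hI _ this.1 (root_ne this.2) p q)
    (C := C) (by rwa [cusp_jac_zero])
  have key' : (C : ℤ) * (-bl B ζ ζ) = c * ∑ r ∈ R.filter (fun r => 0 < bl B r ζ), bl B r ζ ^ 2 := by
    exact_mod_cast key
  have hneg : ∑ r ∈ R.filter (fun r => ¬ 0 < bl B r ζ), bl B r ζ ^ 2 =
      ∑ r ∈ R.filter (fun r => 0 < bl B r ζ), bl B r ζ ^ 2 := by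
    have hs : ∑ r ∈ R.filter (fun r => ¬ 0 < bl B r ζ), bl B r ζ ^ 2 =
        ∑ r ∈ R.filter (fun r => bl B r ζ < 0), bl B r ζ ^ 2 := by
      symm
      refine Finset.sum_subset (fun r hr => ?_) fun r hr hr' => ?_
      · rw [Finset.mem_filter] at hr ⊢
        exact ⟨hr.1, hr.2.not_gt⟩
      · rw [Finset.mem_filter] at hr hr'
        have : bl B r ζ = 0 := by
          by_contra h1
          exact hr' ⟨hr.1, lt_of_le_of_ne (not_lt.1 hr.2) h1⟩
        simpa
    rw [hs]
    have hR' : ∀ r ∈ R, -r ∈ R := by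
      intro r hr
      rw [hR] at hr ⊢
      refine ⟨by constructor <;> simp [hr.1.E, hr.1.E', hr.1.e, hr.1.f], by simp_all⟩
    refine Finset.sum_nbij' (fun r => -r) (fun r => -r) (fun r hr => ?_) (fun r hr => ?_)
      (fun r _ => neg_neg r) (fun r _ => neg_neg r) (fun r _ => by simp)
    · simp_all
    simp_all
  rw [← Finset.sum_filter_add_sum_filter_not R (fun r => 0 < bl B r ζ), hneg]
  linarith

theorem Datum.lead_ne_zero (hD : IsComponent B D) (h : Datum B D E E' e f) (hP : Rm B D k P)
    (hm : HasMult P B E E' e (f - e) 0) {ζ : Fin n → ℤ} (hζ : Lz B E E' e f ζ) (h0 : ζ ≠ 0)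
    (hdiv : ∀ r, Lz B E E' e f r → bl B r r = -2 → bl B r ζ ≠ 0 →
      ∃ x, Lz B E E' e f x ∧ bl B r x = 1) {τ : ℂ} (hτ : 0 < τ.im) :
    lead P B E E' e f τ 0 ≠ 0 := by
  classical
  obtain ⟨z0, hz⟩ := h.toFr.exists_gen hB
  obtain ⟨R, hR⟩ := h.toFr.exists_roots hB
  have := ((h.FJ hB hD hP.toFm hτ hz.1 hζ h0).const
    (fun w => by simpa using h.jac_ord hB hD hP hm hz hζ hdiv R hR hτ w)
    (fun w => h.jac_nz hB hP hz hζ R hR hτ w) 0 0).2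
  rwa [lead_jac, zero_smul, add_zero, h.lead_eq hB hD hP.toFm hτ hz.1] at this

omit hB in
lemma Gen.swap {z : Fin n → ℝ} (hz : Gen B E E' e f z) : Gen B E E' f e z :=
  ⟨hz.1.swap, fun u hu => hz.2 u hu.swap⟩

lemma Gen.no_wall (h : Fr B E E' e f) {z0 : Fin n → ℝ} (hz : Gen B E E' e f z0) {τ ω : ℂ}
    (hτ : 0 < τ.im) {u : Fin n → ℤ} (h1 : bl B u E = 0) (h2 : bl B u e = 0)
    (h0 : bl B (pt B E E' (XX e f τ ω (rc z0))) (ic u) = 0) : u = 0 := by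
  have hw := wall_eq hB hz.1 (ζ := 0) (by constructor <;> simp) τ ω 0 h1 h2
  rw [zero_smul, add_zero, h0, mul_zero, zero_add] at hw
  have hi := congrArg Complex.im hw
  simp only [Complex.zero_im, Complex.add_im, Complex.ofReal_im, Complex.intCast_im,
    Complex.mul_im, Complex.intCast_re, zero_mul, zero_add, add_zero] at hi
  have hf : bl B u f = 0 := by exact_mod_cast (mul_eq_zero.1 hi.symm).resolve_right hτ.ne'
  rw [hf] at hw
  have hr := congrArg Complex.re hw
  simp only [Complex.zero_re, Complex.add_re, Complex.ofReal_re, Complex.intCast_re,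
    Int.cast_zero, zero_mul, add_zero] at hr
  have hp : proj B E E' e f u = 0 := by
    by_contra hne
    exact hz.2 _ (h.proj_Lz hB u) hne (-bl B u E') (by push_cast; linarith)
  rw [hp] at hr
  have hE : bl B u E' = 0 := by
    simp only [ic_zero, bl_zero_right, zero_add] at hr
    exact_mod_cast hr.symm
  rw [proj_add (E' := E') (f := f) h1 h2, hp, hE, hf]
  simp

lemma Datum.mult_e_one (hD : IsComponent B D) (h : Datum B D E E' e f) (hP : Fm B D k P) {c : ℕ}
    (hm : HasMult P B E E' e (f - e) c) {v : Fin n → ℤ} (hv : bl B v v = -2)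
    (h1 : bl B v E = 0) (h2 : bl B v e = 1) : HasMult P B E E' e v c := by
  have G := h.gz hB
  have hy := h.toFr.proj_Lz hB v
  have hyd : proj B E E' e f v = v - bl B v E' • E - bl B v f • e - f := by
    simp only [proj, h1, h2]; module
  set y := proj B E E' e f v with hy'
  have y1 := hy.E
  have y2 := hy.E'
  have y3 := hy.e
  have y4 := hy.f
  set b := bl B v f with hb
  have vy : bl B v y = -2 - 2 * b := by
    conv_lhs => arg 3; rw [hyd]
    simp only [bl_sub_right, bl_smul_right, hv, h1, h2, ← hb]; ring
  have yy : bl B y y = 2 * (-1 - b) := by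
    conv_lhs => arg 2; rw [hyd]
    simp only [bl_sub_left, bl_smul_left, vy, hB.comm E y, hB.comm e y,
      hB.comm f y, y1, y3, y4]; ring
  set w := v - bl B v E' • E with hw
  have wE : bl B w E = 0 := by
    simp only [hw, bl_sub_left, bl_smul_left, G, h1]; ring
  have wE' : bl B w E' = 0 := by
    simp only [hw, bl_sub_left, bl_smul_left, G]; ring
  have we : bl B w e = 1 := by
    simp only [hw, bl_sub_left, bl_smul_left, G, h2]; ring
  have wy : bl B w y = -2 - 2 * b := by
    simp only [hw, bl_sub_left, bl_smul_left, hB.comm E y, y1, vy]; ring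
  have yn : bl B (-y) (-y) = 2 * (-1 - b) := by simpa
  obtain ⟨t1, -⟩ := h.transv hB hD (y := -y) (m := -1 - b) (by simpa)
    (by simpa) (by simpa) yn
  have hmu : HasMult P B E E' e w c := by
    refine hm.isom hB h hP t1 ?_ ?_ ?_
    · rw [acz_eich, bl_neg_right, hB.comm E y, y1, G.2.2.2.2.2.2.2.2.1]; simp
    · rw [acz_eich, bl_neg_right, hB.comm E' y, y2, G.2.2.2.2.2.2.2.2.2.2.2.2.1]; simp
    · rw [acz_eich, bl_neg_right, we, wy, hw, hyd]; module
  refine hmu.transl hB hD h hP (y := bl B v E' • e) (v' := v) ?_ ?_ wE ?_ wE'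
  · rw [bl_smul_left, G.2.2.2.2.2.2.2.2.2.1, mul_zero]
  · rw [bl_smul_left, G.2.2.2.2.2.2.2.2.2.2.2.2.2.1, mul_zero]
  · rw [bl_smul_left, hB.comm e w, we, hw]
    simp

lemma Datum.region_le (hD : IsComponent B D) (h : Datum B D E E' e f) (hP : Rm B D k P)
    (hm : HasMult P B E E' e (f - e) 0) {z0 : Fin n → ℝ} (hz : Gen B E E' e f z0) {τ ω : ℂ}
    (hτ : 2 ≤ τ.im) (hω : τ.im ≤ ω.im) : P (pt B E E' (XX e f τ ω (rc z0))) ≠ 0 := by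
  intro hP0
  have hτ0 : 0 < τ.im := by linarith
  have hω0 : 0 < ω.im := by linarith
  obtain ⟨hXE, hXE', hXe, hXf, hXX⟩ := h.toFr.XX_bl hB hz.1.rc τ ω
  have hZ := h.pt_mem_of_im hB hz.1 hτ0 hω0
  have hX := (h.pt_mem hB hXE hXE').1 hZ
  have hZc := (h.toFr.pt_cone hB hXE hXE').2 hX.2.2.2
  have hvimXX : bl B (vim (pt B E E' (XX e f τ ω (rc z0))))
      (vim (pt B E E' (XX e f τ ω (rc z0)))) = 2 * τ.im * ω.im := by
    rw [h.toFr.vim_pt_sq hB hXE]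
    have G := h.gr hB ℝ
    simp only [XX, vim_add, vim_smul, vim_rc, vre_ic, vim_ic, bl_add_left, bl_add_right,
      bl_smul_left, bl_smul_right, bl_zero_left, bl_zero_right, smul_zero, add_zero, G]
    ring
  have Ee : ∀ j : ℤ, bl B (e - j • E) (e - j • E) = 0 := fun j => by
    have G := h.gz hB
    simp only [bl_sub_left, bl_smul_left, bl_sub_right, bl_smul_right, G]; ring
  have roots : ∀ v, bl B v v = -2 → bl B (pt B E E' (XX e f τ ω (rc z0))) (ic v) = 0 →
      bl B v E = 0 ∧ (bl B v e = 1 ∨ bl B v e = -1) := by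
    intro v hv hv0
    have r1 := root_bound hB hZc hv hv0 (ic E)
    rw [show (rc (ic E : Fin n → ℝ) : Fin n → ℂ) = ic E by rfl,
      h.toFr.bl_pt_E hB hXE, hvimXX, bl_ic, bl_ic, h.EE] at r1
    have vE : bl B v E = 0 := by
      have : ((bl B v E : ℤ) : ℝ) ^ 2 < 1 := by
        refine r1.trans_lt ?_
        simp only [map_one, Int.cast_zero, sub_zero]
        rw [mul_one_div, div_lt_one (by positivity)]
        nlinarith
      have : bl B v E ^ 2 < 1 := by exact_mod_cast this
      simpa
    have r2 := root_bound hB hZc hv hv0 (ic (e - round τ.re • E))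
    rw [show (rc (ic (e - round τ.re • E) : Fin n → ℝ) : Fin n → ℂ) = ic (e - round τ.re • E) by
      rfl, hvimXX, bl_ic, bl_ic, Ee, bl_sub_right, bl_smul_right, vE, mul_zero,
      sub_zero, ic_sub, ic_smul, bl_sub_right, bl_smul_right, h.toFr.bl_pt_E hB hXE,
      h.toFr.bl_pt_e hB, hXe] at r2
    have hn : Complex.normSq (τ - ((round τ.re : ℤ) : ℂ) * 1) ≤ 1 / 4 + τ.im ^ 2 := by
      have := abs_le.1 (abs_sub_round τ.re)
      rw [Complex.normSq_apply]
      simp only [mul_one, Complex.sub_re, Complex.intCast_re, Complex.sub_im, Complex.intCast_im,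
        sub_zero]
      nlinarith
    have he : bl B v e ^ 2 < 2 := by
      have : ((bl B v e : ℤ) : ℝ) ^ 2 < 2 := by
        refine r2.trans_lt ?_
        simp only [Int.cast_zero, sub_zero]
        rw [mul_div_assoc', div_lt_iff₀ (by positivity)]
        nlinarith
      exact_mod_cast this
    have hne : bl B v e ≠ 0 := fun h0 => root_ne hv (hz.no_wall hB h.toFr hτ0 vE h0 hv0)
    refine ⟨vE, ?_⟩
    have l1 : -2 < bl B v e := by nlinarith
    have l2 : bl B v e < 2 := by nlinarith
    omega
  obtain ⟨v, hv, hv0, vE, ve⟩ : ∃ v, bl B v v = -2 ∧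
      bl B (pt B E E' (XX e f τ ω (rc z0))) (ic v) = 0 ∧ bl B v E = 0 ∧ bl B v e = 1 := by
    obtain ⟨v, hv, hv0⟩ := hP.zeros _ hZ hP0
    obtain ⟨h1, h2 | h2⟩ := roots v hv hv0
    · exact ⟨v, hv, hv0, h1, h2⟩
    · exact ⟨-v, by simpa, by simpa, by simpa, by simp [h2]⟩
  have key : ∀ v', bl B v' v' = -2 → bl B (pt B E E' (XX e f τ ω (rc z0))) (ic v') = 0 →
      v' = v ∨ v' = -v := by
    intro v' hv' hv0'
    obtain ⟨h1, h2 | h2⟩ := roots v' hv' hv0'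
    · left
      refine sub_eq_zero.1 (hz.no_wall hB h.toFr hτ0 (ω := ω) ?_ ?_ ?_)
      · simp_all
      · simp_all
      simp_all
    · right
      refine eq_neg_of_add_eq_zero_left (hz.no_wall hB h.toFr hτ0 (ω := ω) ?_ ?_ ?_)
      · simp_all
      · simp_all
      simp_all
  have hgd : Gd P B E E' e v (XX e f τ ω (rc z0)) := by
    refine ⟨hX, hv0, ?_⟩
    have hl := (continuous_pt (B := B) (E := E) (E' := E')).continuousAt.eventually
      (roots_locally_finite hB hZc)
    filter_upwards [hl] with Y hY hYT hPY
    obtain ⟨v', hv', hv0'⟩ := hP.zeros _ ((h.pt_mem hB hYT.1 hYT.2.1).2 hYT) hPY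
    rcases key v' hv' (hY ((h.toFr.pt_cone hB hYT.1 hYT.2.1).2 hYT.2.2.2) v' hv' hv0') with h1 | h1
    · simp_all
    simp_all
  have G := h.gz hB
  have hKe : Kp B E E' (ic e : Fin n → ℂ) :=
    Kp.ic G.2.2.2.2.2.2.2.2.2.1 G.2.2.2.2.2.2.2.2.2.2.2.2.2.1
  obtain ⟨l, hl, hlim⟩ := h.mult_e_one hB hD hP.toFm hm hv vE ve _ hgd _ hKe (by
    rw [bl_ic, hB.comm, ve]; simp)
  have hc := (h.curve_diff hB hP.hol (γ := fun t : ℂ => XX e f τ ω (rc z0) + t • ic e)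
    (by simp) (fun t => Kp.add ⟨hXE, hXE'⟩ (hKe.smul t)) (p := 0)
    (by simp_all)).continuousAt
  have h2 : Tendsto (fun t : ℂ => P (pt B E E' (XX e f τ ω (rc z0) + t • ic e))) (𝓝[≠] 0)
      (𝓝 (P (pt B E E' (XX e f τ ω (rc z0) + (0 : ℂ) • ic e)))) :=
    hc.tendsto.mono_left nhdsWithin_le_nhds
  rw [zero_smul, add_zero, hP0] at h2
  simp only [pow_zero, div_one] at hlim
  exact hl (tendsto_nhds_unique hlim h2)

lemma HasMult.swap (h : Fr B E E' e f) {m : ℕ} (hm : HasMult P B E E' e (f - e) m) :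
    HasMult P B E E' f (e - f) m := by
  rw [← neg_sub f e]
  rintro X ⟨h1, h2, h3⟩ ξ hξ hξv
  rw [← h.TT_swap_eq hB] at h1 h3
  simp only [ic_neg, bl_neg_right, neg_eq_zero] at h2 h3
  exact hm X ⟨h1, h2, h3⟩ ξ hξ (by simpa only [ic_neg, bl_neg_right, neg_ne_zero] using hξv)

lemma Datum.region (hD : IsComponent B D) (h : Datum B D E E' e f) (hP : Rm B D k P)
    (hm : HasMult P B E E' e (f - e) 0) {z0 : Fin n → ℝ} (hz : Gen B E E' e f z0) {τ ω : ℂ}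
    (hτ : 2 ≤ τ.im) (hω : 2 ≤ ω.im) : P (pt B E E' (XX e f τ ω (rc z0))) ≠ 0 := by
  rcases le_total τ.im ω.im with h1 | h1
  · exact h.region_le hB hD hP hm hz hτ h1
  · rw [XX_swap]
    exact (h.swap hB hD).region_le hB hD hP (hm.swap hB h.toFr) hz.swap hω h1

lemma Datum.cusp_XX (hD : IsComponent B D) (h : Datum B D E E' e f) (hP : Fm B D k P)
    {z0 : Fin n → ℝ} (hz : Pp B E E' e f z0) (τ ω : ℂ) :
    cusp (fun τ ω => P (pt B E E' (XX e f τ ω (rc z0)))) τ (ee ω) =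
      P (pt B E E' (XX e f τ ω (rc z0))) := by
  refine cusp_ee (F := fun τ ω => P (pt B E E' (XX e f τ ω (rc z0)))) (fun ω => ?_) ω
  have G := h.gz hB
  have := h.inv_transl hB hD hP (y := e) G.2.2.2.2.2.2.2.2.2.1 G.2.2.2.2.2.2.2.2.2.2.2.2.2.1
    (h.toFr.XX_bl hB hz.rc τ ω).1
  rw [← this]
  congr 2
  simp only [XX, add_smul, one_smul]
  abel

theorem Datum.mult_ne_zero (hD : IsComponent B D) (h : Datum B D E E' e f) (hP : Rm B D k P)
    (hk : k ≠ 0) {ζ : Fin n → ℤ} (hζ : Lz B E E' e f ζ) (h0 : ζ ≠ 0)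
    (hdiv : ∀ r, Lz B E E' e f r → bl B r r = -2 → bl B r ζ ≠ 0 →
      ∃ x, Lz B E E' e f x ∧ bl B r x = 1) : ¬ HasMult P B E E' e (f - e) 0 := by
  intro hm
  have h' := h.swap hB hD
  have hm' := hm.swap hB h.toFr
  obtain ⟨z0, hz⟩ := h.toFr.exists_gen hB
  have hF0 : ∀ τ : ℂ, 0 < τ.im → lead P B E E' e f τ 0 ≠ 0 := fun τ hτ =>
    h.lead_ne_zero hB hD hP hm hζ h0 hdiv hτ
  have hF0' : ∀ τ : ℂ, 0 < τ.im → lead P B E E' f e τ 0 ≠ 0 := fun τ hτ =>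
    h'.lead_ne_zero hB hD hP hm' hζ.swap h0 (fun r hr h2 h3 => by
      obtain ⟨x, hx, h4⟩ := hdiv r hr.swap h2 h3
      exact ⟨x, hx.swap, h4⟩) hτ
  set Φ := cusp (fun τ ω => P (pt B E E' (XX e f τ ω (rc z0)))) with hΦ
  set Ψ := cusp (fun τ ω => P (pt B E E' (XX f e τ ω (rc z0)))) with hΨ
  have hfΦ : Fam {p : ℂ × ℂ | 0 < p.1.im ∧ ‖p.2‖ < 1} Φ := h.fam hB hD hP.toFm hz.1
  have hfΨ : Fam {p : ℂ × ℂ | 0 < p.1.im ∧ ‖p.2‖ < 1} Ψ := h'.fam hB hD hP.toFm hz.1.swap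
  have hΦF : ∀ τ : ℂ, 0 < τ.im → Φ τ 0 = lead P B E E' e f τ 0 := fun τ hτ =>
    h.lead_eq hB hD hP.toFm hτ hz.1
  have hΨF : ∀ τ : ℂ, 0 < τ.im → Ψ τ 0 = lead P B E E' f e τ 0 := fun τ hτ =>
    h'.lead_eq hB hD hP.toFm hτ hz.1.swap
  have eΦ : ∀ τ ω, Φ τ (ee ω) = P (pt B E E' (XX e f τ ω (rc z0))) :=
    h.cusp_XX hB hD hP.toFm hz.1
  have eΨ : ∀ ω τ, Ψ ω (ee τ) = P (pt B E E' (XX e f τ ω (rc z0))) := fun ω τ => by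
    rw [hΨ, h'.cusp_XX hB hD hP.toFm hz.1.swap, XX_swap]
  set r : ℝ := Real.exp (-4 * Real.pi) with hr
  have hr0 : 0 < r := Real.exp_pos _
  have hr1 : r < 1 := Real.exp_lt_one_iff.2 (by linarith [Real.pi_pos])
  have hle : ∀ ω : ℂ, ‖ee ω‖ ≤ r ↔ 2 ≤ ω.im := fun ω => by
    rw [norm_ee, hr, Real.exp_le_exp]
    have := Real.pi_pos
    constructor
    · intro h; nlinarith
    · intro h; nlinarith
  have nz : ∀ G : ℂ → ℂ → ℂ, (∀ τ : ℂ, 0 < τ.im → G τ 0 ≠ 0) →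
      (∀ τ ω : ℂ, 2 ≤ τ.im → 2 ≤ ω.im → G τ (ee ω) ≠ 0) →
      ∀ τ : ℂ, 2 ≤ τ.im → ∀ s ∈ closedBall (0 : ℂ) r, G τ s ≠ 0 := by
    intro G g1 g2 τ hτ s hs
    by_cases hs0 : s = 0
    · rw [hs0]; exact g1 τ (by linarith)
    · obtain ⟨ω, rfl⟩ := exists_ee hs0
      exact g2 τ ω hτ ((hle ω).1 (by simpa using hs))
  have nΦ := nz Φ (fun τ hτ => by rw [hΦF τ hτ]; exact hF0 τ hτ) fun τ ω hτ hω => by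
    rw [eΦ]; exact h.region hB hD hP hm hz hτ hω
  have nΨ := nz Ψ (fun τ hτ => by rw [hΨF τ hτ]; exact hF0' τ hτ) fun τ ω hτ hω => by
    rw [eΨ]; exact h.region hB hD hP hm hz hω hτ
  set K : Set (ℂ × ℂ) := ((fun x : ℝ => (x : ℂ) + 2 * I) '' Icc 0 1) ×ˢ closedBall 0 r with hK
  have hKc : IsCompact K :=
    (isCompact_Icc.image (by fun_prop)).prod (isCompact_closedBall _ _)
  have him : ∀ p ∈ K, p.1.im = 2 := by
    rintro ⟨_, q⟩ ⟨⟨x, _, rfl⟩, _⟩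
    simp
  have hcont : ContinuousOn (fun p : ℂ × ℂ => Ψ p.1 p.2) K := fun p hp =>
    (hfΨ.cont (p := p) ⟨by rw [him p hp]; simp, by
      have := mem_closedBall_zero_iff.1 hp.2
      linarith⟩).continuousWithinAt
  have hne : K.Nonempty := ⟨(((0 : ℝ) : ℂ) + 2 * I, 0), ⟨0, by simp, rfl⟩, by simpa using hr0.le⟩
  obtain ⟨p0, hp0, hmin⟩ := hKc.exists_isMinOn hne hcont.norm
  obtain ⟨M, hM⟩ := hKc.exists_bound_of_continuousOn hcont
  set ε := ‖Ψ p0.1 p0.2‖ with hε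
  have hε0 : 0 < ε := norm_pos_iff.2 (nΨ p0.1 (him p0 hp0).ge p0.2 hp0.2)
  have hsph : ∀ τ : ℂ, 2 ≤ τ.im → ∀ s ∈ sphere (0 : ℂ) r, ∃ p ∈ K, Φ τ s = Ψ p.1 p.2 := by
    intro τ hτ s hs
    have hs' : ‖s‖ = r := by simpa using hs
    obtain ⟨ω, rfl⟩ := exists_ee (s := s) (by rintro rfl; simp at hs'; linarith)
    have hω : ω.im = 2 := by
      rw [norm_ee, hr, Real.exp_eq_exp] at hs'
      have := Real.pi_pos
      have h1 : Real.pi * (ω.im - 2) = 0 := by linarith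
      linarith [(mul_eq_zero.1 h1).resolve_left this.ne']
    refine ⟨(ω - (⌊ω.re⌋ : ℤ), ee τ), ⟨⟨Int.fract ω.re, ⟨Int.fract_nonneg _,
      (Int.fract_lt_one _).le⟩, ?_⟩, by simpa using (hle τ).2 hτ⟩, ?_⟩
    · apply Complex.ext
      · simp
      · simp [hω]
    · rw [eΨ, ← eΦ, sub_eq_add_neg, ee_add, ← Int.cast_neg, ee_int, mul_one]
  have hdiff : ∀ τ : ℂ, 2 ≤ τ.im → ∀ t ∈ closedBall (0 : ℂ) r, DifferentiableAt ℂ (Φ τ) t :=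
    fun τ hτ t ht => hfΦ.ht (τ, t) ⟨by linarith, by
      have := mem_closedBall_zero_iff.1 ht
      linarith⟩
  have up : ∀ τ : ℂ, 2 ≤ τ.im → ‖lead P B E E' e f τ 0‖ ≤ M := fun τ hτ => by
    rw [← hΦF τ (by linarith)]
    refine norm_le_of_sphere hr0 (hdiff τ hτ) (fun s hs => ?_) (mem_closedBall_self hr0.le)
    obtain ⟨p, hp, h1⟩ := hsph τ hτ s hs
    rw [h1]; tauto
  have down : ∀ τ : ℂ, 2 ≤ τ.im → ε ≤ ‖lead P B E E' e f τ 0‖ := fun τ hτ => by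
    rw [← hΦF τ (by linarith)]
    refine min_modulus hr0 hε0 (hdiff τ hτ) (nΦ τ hτ) fun s hs => ?_
    obtain ⟨p, hp, h1⟩ := hsph τ hτ s hs
    rw [h1]; tauto
  have hI : 0 < I.im := by simp
  have hhol := h.lead_hol hB hD hP.toFm
  rcases lt_or_gt_of_ne hk with hk | hk
  · exact hF0 I hI ((level_one hhol (fun τ hτ => h.lead_T hB hD hP.toFm hτ)
      (fun τ hτ => h.lead_S hB hD hP.toFm hτ) ⟨M, 2, up⟩).1 hk I hI)
  · refine inv_ne_zero (hF0 I hI) ((level_one (k := -k) (hhol.inv fun τ hτ => hF0 τ hτ)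
      (fun τ hτ => ?_) (fun τ hτ => ?_) ⟨ε⁻¹, 2, fun τ hτ => ?_⟩).1 (by omega) I hI)
    · simp only [Pi.inv_apply, h.lead_T hB hD hP.toFm hτ]
    · simp only [Pi.inv_apply, h.lead_S hB hD hP.toFm hτ, mul_inv, _root_.zpow_neg]
    · simp only [Pi.inv_apply, norm_inv]
      exact inv_anti₀ hε0 (down τ hτ)

end

lemma meyer {c : Fin 12 → ℤ} (h0 : 0 < c 0) (h1 : ∀ i, i ≠ 0 → c i < 0) :
    ∃ X : Fin 12 → ℤ, X ≠ 0 ∧ ∑ i, c i * X i ^ 2 = 0 := by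
  obtain ⟨x0, y0, x, y, hne, h⟩ := meyer_diagonal (h1 1 (by decide)) h0
    (a := ![c 2, c 3, c 4, c 5, c 6]) (b := ![c 7, c 8, c 9, c 10, c 11])
    (fun i => by fin_cases i <;> exact (h1 _ (by decide)).ne)
    (fun i => by fin_cases i <;> exact (h1 _ (by decide)).ne)
  refine ⟨![y0, x0, x 0, x 1, x 2, x 3, x 4, y 0, y 1, y 2, y 3, y 4], fun h0 => ?_, ?_⟩
  · have key : ∀ i, ![y0, x0, x 0, x 1, x 2, x 3, x 4, y 0, y 1, y 2, y 3, y 4] i = 0 :=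
      fun i => congrFun h0 i
    rcases hne with h | h | h | h
    · simp_all
    · simp_all
    · exact h (funext fun i => by fin_cases i <;> [exact key 2; exact key 3; exact key 4; exact key 5; exact key 6])
    · exact h (funext fun i => by fin_cases i <;> [exact key 7; exact key 8; exact key 9; exact key 10; exact key 11])
  · simp [Fin.sum_univ_succ] at h ⊢
    omega

section

variable (hB : Sig B)
include hB

lemma Sig.neg_int {p q r : Fin n → ℤ} (hp : 0 < bl B p p) (hq : 0 < bl B q q) (hpq : bl B p q = 0)
    (h1 : bl B r p = 0) (h2 : bl B r q = 0) (h0 : r ≠ 0) : bl B r r < 0 := by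
  have := hB.neg (ic p) (ic q) (ic r) (by simpa)
    (by simpa) (by simpa)
    (by simpa) (by simpa)
    (fun h => h0 (ic_injective (by simpa)))
  simpa

lemma exists_isotropic {l : ℕ} (hl : l ≤ 4) {g : Fin l → Fin n → ℤ} {p : Fin n → ℤ}
    (hp : 0 < bl B p p) (hg : ∀ i, bl B p (g i) = 0)
    (hneg : ∀ x, x ≠ 0 → (∀ i, bl B x (g i) = 0) → bl B x p = 0 → bl B x x < 0) :
    ∃ v, v ≠ 0 ∧ bl B v v = 0 ∧ ∀ i, bl B v (g i) = 0 := by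
  have key : ∀ m, m ≤ 11 → ∃ W : Fin (m + 1) → Fin n → ℤ, W 0 = p ∧ (∀ i, W i ≠ 0) ∧
      (∀ i j, bl B (W i) (g j) = 0) ∧ ∀ i j, i ≠ j → bl B (W i) (W j) = 0 := by
    intro m
    induction m with
    | zero =>
      refine fun _ => ⟨fun _ => p, rfl, fun _ h => ?_, fun _ => hg, fun i j hij =>
        absurd (by omega) hij⟩
      simp_all
    | succ m ih =>
      intro hm
      obtain ⟨W, h0, hne, hg, ho⟩ := ih (by omega)
      obtain ⟨ζ, hζ, h⟩ := exists_perp (B := B) (m := m + 1 + l) (by rw [hB.rk]; omega)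
        (Fin.append W g)
      have hW : ∀ i, bl B ζ (W i) = 0 := fun i => by simpa using h (Fin.castAdd l i)
      refine ⟨Fin.snoc (α := fun _ => Fin n → ℤ) W ζ, ?_, Fin.lastCases (by simpa)
        (by simpa), Fin.lastCases (fun j => ?_) (by simpa),
        Fin.lastCases (Fin.lastCases (fun h => absurd rfl h) fun j _ => ?_)
        fun i => Fin.lastCases (fun _ => ?_) fun j hij => ?_⟩
      · simpa
      · simpa using h (Fin.natAdd (m + 1) j)
      · simp_all
      · simpa [hB.comm _ ζ] using hW i
      simp_all
  obtain ⟨W, h0, hne, hg, ho⟩ := key 11 le_rfl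
  have hW : ∀ i, i ≠ 0 → bl B (W i) (W i) < 0 := fun i hi =>
    hneg _ (hne i) (hg i) (by rw [← h0]; exact ho i 0 hi)
  obtain ⟨X, hX, hs⟩ := meyer (c := fun i => bl B (W i) (W i)) (by simp_all) hW
  have hv : ∀ j, bl B (∑ i, X i • W i) (W j) = X j * bl B (W j) (W j) := fun j => by
    rw [bl_sum_left, Finset.sum_eq_single j, bl_smul_left]
    · intro i _ hij; rw [bl_smul_left, ho i j hij, mul_zero]
    simp
  refine ⟨∑ i, X i • W i, fun h => hX (funext fun j => ?_), ?_, fun j => ?_⟩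
  · have := hv j
    rw [h, bl_zero_left] at this
    refine (mul_eq_zero.1 this.symm).resolve_right ?_
    by_cases hj : j = 0
    · rw [hj, h0]; omega
    · exact (hW j hj).ne
  · rw [bl_sum_right, ← hs]
    exact Finset.sum_congr rfl fun i _ => by rw [bl_smul_right, hv]; ring
  · rw [bl_sum_left]
    exact Finset.sum_eq_zero fun i _ => by rw [bl_smul_left, hg, mul_zero]

lemma exists_positive_pair : ∃ p q : Fin n → ℤ, 0 < bl B p p ∧ 0 < bl B q q ∧ bl B p q = 0 := by
  obtain ⟨p, q, hp, hq, hpq⟩ := hB.pos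
  have hc : ∀ (g h : (Fin n → ℝ) × (Fin n → ℝ) → (Fin n → ℝ)), Continuous g → Continuous h →
      Continuous fun u => bl B (g u) (h u) := fun g h hg hh => by
    unfold bl; fun_prop
  let U : Set ((Fin n → ℝ) × (Fin n → ℝ)) := {u | 0 < bl B u.1 u.1} ∩
    {u | 0 < bl B u.1 u.1 * bl B u.2 u.2 - bl B u.1 u.2 ^ 2}
  have h1 := hc _ _ continuous_fst continuous_fst
  have h2 := hc _ _ continuous_snd continuous_snd
  have h3 := hc _ _ continuous_fst continuous_snd
  have hU : IsOpen U := (isOpen_lt continuous_const h1).inter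
    (isOpen_lt continuous_const ((h1.mul h2).sub (h3.pow 2)))
  have hd : DenseRange (fun x : Fin n → ℚ => fun i => (x i : ℝ)) :=
    DenseRange.piMap fun _ => Rat.denseRange_cast
  obtain ⟨⟨x, y⟩, hxy⟩ := (hd.prodMap hd).exists_mem_open hU
    ⟨(p, q), hp, by simp_all⟩
  obtain ⟨d, u, hd0, hu⟩ := exists_int_multiple x
  obtain ⟨d', v, hd0', hv⟩ := exists_int_multiple y
  have hu' : (ic u : Fin n → ℝ) = (d : ℝ) • fun i => (x i : ℝ) := by
    ext i; have := congrArg (Rat.cast : ℚ → ℝ) (congrFun hu i); simpa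
  have hv' : (ic v : Fin n → ℝ) = (d' : ℝ) • fun i => (y i : ℝ) := by
    ext i; have := congrArg (Rat.cast : ℚ → ℝ) (congrFun hv i); simpa
  obtain ⟨hx1, hx2⟩ := hxy
  simp only [Prod.map_apply] at hx1 hx2
  change 0 < bl B (fun i => (x i : ℝ)) (fun i => (x i : ℝ)) at hx1
  change 0 < bl B (fun i => (x i : ℝ)) (fun i => (x i : ℝ)) * bl B (fun i => (y i : ℝ)) (fun i => (y i : ℝ)) -
    bl B (fun i => (x i : ℝ)) (fun i => (y i : ℝ)) ^ 2 at hx2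
  have e1 : (0 : ℝ) < (bl B u u : ℤ) := by
    rw [← bl_ic, hu', bl_smul_left, bl_smul_right]; positivity
  have e2 : (0 : ℝ) < (bl B u u * bl B v v - bl B u v ^ 2 : ℤ) := by
    push_cast
    rw [← bl_ic, ← bl_ic, ← bl_ic, hu', hv']
    simp only [bl_smul_left, bl_smul_right]
    have : (0 : ℝ) < (d * d') ^ 2 := by positivity
    nlinarith [mul_pos this hx2]
  have e1' : 0 < bl B u u := by simp_all
  have e2' : 0 < bl B u u * bl B v v - bl B u v ^ 2 := by exact_mod_cast e2
  refine ⟨u, bl B u u • v - bl B u v • u, e1', ?_, ?_⟩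
  · simp only [bl_sub_left, bl_sub_right, bl_smul_left, bl_smul_right, hB.comm v u]
    nlinarith [mul_pos e1' e2']
  · simp only [bl_sub_right, bl_smul_right]; ring

lemma exists_primitive (hM : Maxl B) {v : Fin n → ℤ} (h0 : v ≠ 0) (hv : bl B v v = 0) :
    ∃ (d : ℤ) (w x : Fin n → ℤ), d ≠ 0 ∧ v = d • w ∧ bl B w x = 1 := by
  let L : (Fin n → ℤ) →ₗ[ℤ] ℤ :=
    { toFun := fun x => bl B v x
      map_add' := fun _ _ => bl_add_right ..
      map_smul' := fun _ _ => by simp only [bl_smul_right]; rfl }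
  obtain ⟨d, hd⟩ := (IsPrincipalIdealRing.principal (LinearMap.range L)).principal
  have hdvd : ∀ x, d ∣ bl B v x := fun x => by
    have : L x ∈ LinearMap.range L := ⟨x, rfl⟩
    rw [hd] at this
    exact Ideal.mem_span_singleton.1 this
  obtain ⟨x, hx⟩ : ∃ x, L x = d := by
    rw [← LinearMap.mem_range, hd]; simp
  have hd0 : d ≠ 0 := by
    rintro rfl
    exact h0 (bl_nondeg hB.det fun i => zero_dvd_iff.1 (hdvd _))
  have hdQ : (d : ℚ) ≠ 0 := by simpa
  obtain ⟨w, hw⟩ := hM ((d : ℚ)⁻¹ • ic v) (fun y => by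
    obtain ⟨m, hm⟩ := hdvd y
    simp_all)
    ⟨0, by simp_all⟩
  have hvw : v = d • w := ic_injective (R := ℚ) (by
    rw [ic_smul, ← hw, smul_smul, mul_inv_cancel₀ hdQ, one_smul])
  refine ⟨d, w, x, hd0, hvw, ?_⟩
  have : bl B v x = d := hx
  rw [hvw, bl_smul_left] at this
  simp_all

lemma Fr.of_isotropic (hM : Maxl B) (hE : bl B E E = 0) (h2 : bl B E' E' = 0)
    (h1 : bl B E E' = 1) {v : Fin n → ℤ} (hv0 : v ≠ 0) (hv : bl B v v = 0) (hvE : bl B v E = 0)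
    (hvE' : bl B v E' = 0) : ∃ (d : ℤ) (e f : Fin n → ℤ), d ≠ 0 ∧ v = d • e ∧ Fr B E E' e f := by
  obtain ⟨d, e, w, hd, rfl, hew⟩ := exists_primitive hB hM hv0 hv
  have h1' : bl B E' E = 1 := by rw [hB.comm, h1]
  have he : bl B e e = 0 := by simpa [-zsmul_eq_mul, bl_smul_left, bl_smul_right, hd] using hv
  have heE : bl B e E = 0 := by simpa [-zsmul_eq_mul, bl_smul_left, hd] using hvE
  have heE' : bl B e E' = 0 := by simpa [-zsmul_eq_mul, bl_smul_left, hd] using hvE'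
  set u := w - bl B w E' • E - bl B w E • E' with hu
  have u1 : bl B u E = 0 := by simp [-zsmul_eq_mul, bl_smul_left, hu, hE, h1']
  have u2 : bl B u E' = 0 := by simp [-zsmul_eq_mul, bl_smul_left, hu, h1, h2]
  have u3 : bl B e u = 1 := by simp [-zsmul_eq_mul, bl_smul_right, hu, heE, heE', hew]
  have u4 : bl B u e = 1 := by rw [hB.comm, u3]
  obtain ⟨m', hm'⟩ := hB.even u
  have hEe : bl B E e = 0 := by rw [hB.comm, heE]
  have hEe' : bl B E' e = 0 := by rw [hB.comm, heE']
  refine ⟨d, e, u - m' • e, hd, rfl, hE, h2, h1, he, ?_, ?_, hEe, ?_, hEe', ?_⟩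
  · simp only [bl_sub_left, bl_sub_right, bl_smul_left, bl_smul_right, he, u3, u4, hm']; ring
  · simp [-zsmul_eq_mul, bl_smul_right, he, u3]
  · simp [-zsmul_eq_mul, bl_smul_right, hEe, hB.comm E u, u1]
  · simp [-zsmul_eq_mul, bl_smul_right, hEe', hB.comm E' u, u2]

lemma exists_Fr_of (hM : Maxl B) {p q : Fin n → ℤ} (hp : 0 < bl B p p) (hq : 0 < bl B q q)
    (hpq : bl B p q = 0) {l : ℕ} (hl : l ≤ 2) {g : Fin l → Fin n → ℤ}
    (hgp : ∀ i, bl B (g i) p = 0) (hgq : ∀ i, bl B (g i) q = 0) :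
    ∃ E E' e f, Fr B E E' e f ∧ ∃ g' : Fin l → Fin n → ℤ, (∀ i, Lz B E E' e f (g' i)) ∧
      ∀ i j, bl B (g' i) (g' j) = bl B (g i) (g j) := by
  obtain ⟨v, hv0, hv, hvg⟩ := exists_isotropic hB (l := l + 1) (g := Fin.cons q g) (by omega) hp
    (Fin.cases hpq fun i => by simpa [hB.comm p] using hgp i)
    fun x h0 h1 h2 => hB.neg_int hp hq hpq h2 (h1 0) h0
  obtain ⟨d, E, x, hd, rfl, hEx⟩ := exists_primitive hB hM hv0 hv
  have hE : bl B E E = 0 := by simpa [-zsmul_eq_mul, bl_smul_left, bl_smul_right, hd] using hv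
  have hEq : bl B E q = 0 := by simpa [-zsmul_eq_mul, bl_smul_left, hd] using hvg 0
  have hEg : ∀ i, bl B E (g i) = 0 := fun i => by
    simpa [-zsmul_eq_mul, bl_smul_left, hd] using hvg i.succ
  have hxE : bl B x E = 1 := by rw [hB.comm, hEx]
  obtain ⟨m, hm⟩ := hB.even x
  set E' := x - m • E with hE'
  have h1 : bl B E E' = 1 := by simp [-zsmul_eq_mul, bl_smul_right, hE', hE, hEx]
  have h1' : bl B E' E = 1 := by rw [hB.comm, h1]
  have h2 : bl B E' E' = 0 := by
    simp only [hE', bl_sub_left, bl_sub_right, bl_smul_left, bl_smul_right, hE, hEx, hxE, hm]; ring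
  clear_value E'
  have hsub : ∀ y z, bl B E y = 0 → bl B E z = 0 →
      bl B (y - bl B y E' • E) (z - bl B z E' • E) = bl B y z := fun y z hy hz => by
    simp only [bl_sub_left, bl_sub_right, bl_smul_left, bl_smul_right, hE, hz, hB.comm y E,
      hy]; ring
  have hsE : ∀ y, bl B E y = 0 → bl B (y - bl B y E' • E) E = 0 := fun y hy => by
    simp only [bl_sub_left, bl_smul_left, hE, hB.comm y E, hy]; ring
  have hsE' : ∀ y, bl B (y - bl B y E' • E) E' = 0 := fun y => by
    simp only [bl_sub_left, bl_smul_left, h1]; ring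
  have r3 : 0 < bl B (q - bl B q E' • E) (q - bl B q E' • E) := by rwa [hsub q q hEq hEq]
  obtain ⟨v, hv0, hv, hvg⟩ := exists_isotropic hB (l := l + 2)
    (g := Fin.cons E (Fin.cons E' fun i => g i - bl B (g i) E' • E)) (by omega) r3
    (Fin.cases (hsE q hEq) (Fin.cases (hsE' q) fun i =>
      (hsub q (g i) hEq (hEg i)).trans ((hB.comm q _).trans (hgq i))))
    fun z h0 hz z3 => by
      have z1 : bl B z E = 0 := hz 0
      have z2 : bl B z E' = 0 := hz (Fin.succ 0)
      exact hB.neg_int (p := E + E') (by simp [hE, h1, h1', h2]) r3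
        (by rw [bl_add_left, hB.comm E, hB.comm E', hsE q hEq, hsE' q, add_zero])
        (by simp [z1, z2]) z3 h0
  have hvE : bl B v E = 0 := hvg 0
  have hvE' : bl B v E' = 0 := hvg (Fin.succ 0)
  obtain ⟨d', e, f, hd', rfl, h⟩ := Fr.of_isotropic hB hM hE h2 h1 hv0 hv hvE hvE'
  have hge : ∀ i, bl B e (g i - bl B (g i) E' • E) = 0 := fun i => by
    have : bl B (d' • e) (g i - bl B (g i) E' • E) = 0 := hvg i.succ.succ
    rw [bl_smul_left] at this
    exact (mul_eq_zero.1 this).resolve_left hd'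
  obtain ⟨-, -, -, -, g5, g6, g7, g8, g9, g10, g11, g12, g13, g14, g15, g16⟩ := h.gz hB
  generalize hy : (fun i => g i - bl B (g i) E' • E) = y at *
  have hy' : ∀ i, y i = g i - bl B (g i) E' • E := fun i => by tauto
  refine ⟨E, E', e, f, h, fun i => y i - bl B (y i) f • e, fun i => ⟨?_, ?_, ?_, ?_⟩, fun i j => ?_⟩
  · rw [bl_sub_left, bl_smul_left, g10, hy', hsE _ (hEg i)]; ring
  · rw [bl_sub_left, bl_smul_left, g14, hy', hsE']; ring
  · rw [bl_sub_left, bl_smul_left, g5, hy', hB.comm, hge]; ring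
  · rw [bl_sub_left, bl_smul_left, g7]; ring
  · rw [← hsub _ _ (hEg i) (hEg j), ← hy', ← hy']
    have e1 : bl B e (y j) = 0 := by rw [hy']; exact hge j
    have e2 : bl B (y i) e = 0 := by rw [hy', hB.comm]; exact hge i
    simp only [bl_sub_left, bl_sub_right, bl_smul_left, bl_smul_right, g5, e1, e2]; ring

lemma exists_Fr_root (hM : Maxl B) : ∃ E E' e f, Fr B E E' e f ∧ ∃ x y, Lz B E E' e f x ∧
    Lz B E E' e f y ∧ bl B x x = -2 ∧ bl B x y = 1 := by
  obtain ⟨p, q, hp, hq, hpq⟩ := exists_positive_pair hB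
  obtain ⟨E, E', e, f, h, -⟩ := exists_Fr_of hB hM hp hq hpq (l := 0) (g := Fin.elim0) (by omega)
    (fun i => i.elim0) fun i => i.elim0
  obtain ⟨g1, g2, g3, g4, g5, g6, g7, g8, g9, g10, g11, g12, g13, g14, g15, g16⟩ := h.gz hB
  have hs : ∀ x : Fin n → ℤ, (2 : ℤ) • x = x + x := fun x => by ring
  obtain ⟨E, E', e, f, h, g, hg, hh⟩ := exists_Fr_of hB hM (l := 2) (p := E + E')
    (q := e + e + f + f + E' - E) (g := ![e - f, f + E' - E]) (by simp [*]) (by simp [*])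
    (by simp [*]) le_rfl (fun i => by fin_cases i <;> simp [*]) (fun i => by fin_cases i <;> simp [*])
  exact ⟨E, E', e, f, h, g 0, g 1, hg 0, hg 1, by simp_all, by simp_all⟩

end

section Lz

variable {x y : Fin n → ℤ}

lemma Lz.zero : Lz B E E' e f 0 := by constructor <;> simp

lemma Lz.add (hx : Lz B E E' e f x) (hy : Lz B E E' e f y) : Lz B E E' e f (x + y) := by
  constructor <;> simp [hx.E, hx.E', hx.e, hx.f, hy.E, hy.E', hy.e, hy.f]

lemma Lz.neg (hx : Lz B E E' e f x) : Lz B E E' e f (-x) := by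
  constructor <;> simp [hx.E, hx.E', hx.e, hx.f]

lemma Lz.sub (hx : Lz B E E' e f x) (hy : Lz B E E' e f y) : Lz B E E' e f (x - y) := by
  rw [sub_eq_add_neg]; exact hx.add hy.neg

lemma Lz.smul (a : ℤ) (hx : Lz B E E' e f x) : Lz B E E' e f (a • x) := by
  constructor <;> simp [-zsmul_eq_mul, bl_smul_left, hx.E, hx.E', hx.e, hx.f]

lemma Lz.sum {ι : Type*} {s : Finset ι} {r : ι → Fin n → ℤ} (h : ∀ i ∈ s, Lz B E E' e f (r i)) :
    Lz B E E' e f (∑ i ∈ s, r i) :=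
  Finset.sum_induction _ _ (fun _ _ => Lz.add) Lz.zero h

lemma Lz.half (h : Lz B E E' e f (y + y)) : Lz B E E' e f y := by
  obtain ⟨h1, h2, h3, h4⟩ := h
  simp only [bl_add_left] at h1 h2 h3 h4
  constructor <;> omega

lemma Lz_neg_iff : Lz B E E' (-e) (-f) x ↔ Lz B E E' e f x :=
  ⟨fun h => ⟨h.E, h.E', by simpa using h.e, by simpa using h.f⟩,
    fun h => ⟨h.E, h.E', by simpa using h.e, by simpa using h.f⟩⟩

end Lz

/-- Roots of the definite part of a frame. -/
structure Root (B : Matrix (Fin n) (Fin n) ℤ) (E E' e f r : Fin n → ℤ) : Prop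
    extends Lz B E E' e f r where
  sq : bl B r r = -2

/-- Roots of divisor one. -/
def Dv (B : Matrix (Fin n) (Fin n) ℤ) (E E' e f r : Fin n → ℤ) : Prop :=
  ∃ x, Lz B E E' e f x ∧ bl B r x = 1

/-- The quadratic identities for the roots of all frames. -/
def Cnt (B : Matrix (Fin n) (Fin n) ℤ) : Prop :=
  ∀ E E' e f, Fr B E E' e f → ∃ C c : ℤ, 0 < c ∧ ∀ ζ, Lz B E E' e f ζ → ζ ≠ 0 →
    (∀ r, Root B E E' e f r → bl B r ζ ≠ 0 → Dv B E E' e f r) →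
    ∀ R : Finset (Fin n → ℤ), (∀ r, r ∈ R ↔ Root B E E' e f r) →
      2 * C * (-bl B ζ ζ) = c * ∑ r ∈ R, bl B r ζ ^ 2

section

variable (hB : Sig B)
include hB

lemma Fr.exists_half (hM : Maxl B) (h : Fr B E E' e f) {u : Fin n → ℤ} (hu : Lz B E E' e f u)
    (h2 : ∀ x, Lz B E E' e f x → (2 : ℤ) ∣ bl B u x) (h8 : (8 : ℤ) ∣ bl B u u) :
    ∃ y, Lz B E E' e f y ∧ y + y = u := by
  obtain ⟨c, hc⟩ := h8
  obtain ⟨w, hw⟩ := hM ((2 : ℚ)⁻¹ • ic u) (fun v => by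
    obtain ⟨m, hm⟩ := h2 _ (h.proj_Lz hB v)
    refine ⟨m, ?_⟩
    rw [bl_smul_left, bl_ic, hB.comm u, ← bl_proj hB hu, hB.comm, hm]
    simp) ⟨c, by
    rw [bl_smul_left, bl_smul_right, bl_ic, hc]; grind⟩
  have hw' : w + w = u := ic_injective (R := ℚ) (by
    rw [ic_add, ← hw, ← add_smul]; norm_num)
  exact ⟨w, Lz.half (hw' ▸ hu), hw'⟩

variable {r s : Fin n → ℤ}

lemma Fr.root_pair (h : Fr B E E' e f) (hr : Root B E E' e f r) (hs : Root B E E' e f s) :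
    r = s ∨ r = -s ∨ bl B r s = -1 ∨ bl B r s = 0 ∨ bl B r s = 1 := by
  by_cases h1 : r = s
  · grind
  by_cases h2 : r = -s
  · simp_all
  have a := h.Lz_neg hB (hr.sub hs.toLz) (sub_ne_zero.2 h1)
  have b := h.Lz_neg hB (hr.add hs.toLz) (fun h => h2 (eq_neg_of_add_eq_zero_left h))
  simp only [bl_sub_left, bl_sub_right, bl_add_left, bl_add_right, hr.sq, hs.sq,
    hB.comm s r] at a b
  omega

omit hB in
lemma Root.even_of_not (hr : Root B E E' e f r) (h : ¬ Dv B E E' e f r) {x : Fin n → ℤ}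
    (hx : Lz B E E' e f x) : (2 : ℤ) ∣ bl B r x := by
  by_contra h2
  obtain ⟨m, hm⟩ : Odd (bl B r x) := by grind
  refine h ⟨x + m • r, hx.add (hr.toLz.smul m), ?_⟩
  rw [bl_add_right, bl_smul_right, hr.sq, hm]; ring

lemma Fr.dv_of_dv (h : Fr B E E' e f) (hr : Root B E E' e f r) (hd : Dv B E E' e f r)
    (hs : Root B E E' e f s) (h0 : bl B s r ≠ 0) : Dv B E E' e f s := by
  rcases h.root_pair hB hs hr with rfl | rfl | h1 | h1 | h1
  · omega
  · obtain ⟨x, hx, hx1⟩ := hd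
    exact ⟨-x, hx.neg, by simpa⟩
  · exact ⟨-r, hr.neg, by simp [h1]⟩
  · omega
  · exact ⟨r, hr.toLz, h1⟩

lemma Fr.exists_avoid (hM : Maxl B) (h : Fr B E E' e f) : ∃ q : Fin 3 → Fin n → ℤ,
    ∀ ζ, (∀ i, bl B ζ (q i) = 0) → ∀ r, Root B E E' e f r → bl B r ζ ≠ 0 → Dv B E E' e f r := by
  by_contra! H
  have orth : ∀ {r s ζ}, Root B E E' e f r → Root B E E' e f s → ¬ Dv B E E' e f s →
      bl B ζ r = 0 → bl B s ζ ≠ 0 → bl B r s = 0 ∧ bl B s r = 0 := fun {r s ζ} hr hs hd h0 h1 => by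
    have := hs.even_of_not hd hr.toLz
    rw [hB.comm] at h1
    rw [hB.comm r s, and_self]
    rcases h.root_pair hB hs hr with rfl | rfl | h | h | h
    · omega
    · simp_all
    all_goals omega
  obtain ⟨-, -, r1, h1, -, d1⟩ := H ![0, 0, 0]
  obtain ⟨ζ2, p2, r2, h2, n2, d2⟩ := H ![r1, 0, 0]
  obtain ⟨ζ3, p3, r3, h3, n3, d3⟩ := H ![r1, r2, 0]
  obtain ⟨ζ4, p4, r4, h4, n4, d4⟩ := H ![r1, r2, r3]
  obtain ⟨e1, f1⟩ := orth (r := r1) h1 h2 d2 (p2 0) n2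
  obtain ⟨e2, f2⟩ := orth (r := r1) h1 h3 d3 (p3 0) n3
  obtain ⟨e3, f3⟩ := orth h2 h3 d3 (p3 1) n3
  obtain ⟨e4, f4⟩ := orth (r := r1) h1 h4 d4 (p4 0) n4
  obtain ⟨e5, f5⟩ := orth h2 h4 d4 (p4 1) n4
  obtain ⟨e6, f6⟩ := orth h3 h4 d4 (p4 2) n4
  obtain ⟨y, hy, hyy⟩ := h.exists_half hB hM (u := r1 + r2 + r3 + r4)
    (((h1.toLz.add h2.toLz).add h3.toLz).add h4.toLz) (fun x hx => by
      simp only [bl_add_left]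
      exact dvd_add (dvd_add (dvd_add (h1.even_of_not d1 hx) (h2.even_of_not d2 hx))
        (h3.even_of_not d3 hx)) (h4.even_of_not d4 hx))
    ⟨-1, by simp [*, h1.sq, h2.sq, h3.sq, h4.sq]⟩
  have key := congrArg (bl B r1) hyy
  simp only [bl_add_right, h1.sq, e1, e2, e4] at key
  exact d1 ⟨-y, hy.neg, by rw [bl_neg_right]; omega⟩

lemma Datum.cnt (hM : Maxl B) (hD : IsComponent B D) (hP : Rm B D k P) (hk : k ≠ 0)
    (h : Datum B D E E' e f) : ∃ C c : ℤ, 0 < c ∧ ∀ ζ, Lz B E E' e f ζ → ζ ≠ 0 →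
      (∀ r, Root B E E' e f r → bl B r ζ ≠ 0 → Dv B E E' e f r) →
      ∀ R : Finset (Fin n → ℤ), (∀ r, r ∈ R ↔ Root B E E' e f r) →
        2 * C * (-bl B ζ ζ) = c * ∑ r ∈ R, bl B r ζ ^ 2 := by
  obtain ⟨c, hc⟩ := h.exists_mult hB hP (v := f - e)
    (by rw [bl_sub_left, hB.comm, h.Ef, hB.comm, h.Ee, sub_zero])
  obtain ⟨C, hC⟩ := h.count hB hD hP hc
  refine ⟨C, c, ?_, fun ζ hζ h0 hd R hR => hC ζ hζ h0 (fun r hr hr2 => hd r ⟨hr, hr2⟩) R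
    fun r => (hR r).trans ⟨fun h => ⟨h.toLz, h.sq⟩, fun h => ⟨h.1, h.2⟩⟩⟩
  rcases c.eq_zero_or_pos with rfl | hc0
  · obtain ⟨q, hq⟩ := h.toFr.exists_avoid hB hM
    obtain ⟨ζ, h0, hζ⟩ := exists_perp (B := B) (by rw [hB.rk]; simp)
      ![E, E', e, f, q 0, q 1, q 2]
    exact absurd hc (h.mult_ne_zero hB hD hP hk ⟨hζ 0, hζ 1, hζ 2, hζ 3⟩ h0 fun r hr hr2 =>
      hq ζ (Fin.forall_fin_succ.2 ⟨hζ 4, Fin.forall_fin_succ.2 ⟨hζ 5, fun i => by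
        rw [Fin.eq_zero i]; exact hζ 6⟩⟩) r ⟨hr, hr2⟩)
  omega

lemma Rm.cnt (hM : Maxl B) (hD : IsComponent B D) (hP : Rm B D k P) (hk : k ≠ 0) : Cnt B := by
  intro E E' e f h
  rcases h.datum hB hD with h | h
  · exact h.cnt hB hM hD hP hk
  · have := h.cnt hB hM hD hP hk
    have hr : ∀ r, Root B E E' (-e) (-f) r ↔ Root B E E' e f r := fun r =>
      ⟨fun h => ⟨Lz_neg_iff.1 h.toLz, h.sq⟩, fun h => ⟨Lz_neg_iff.2 h.toLz, h.sq⟩⟩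
    simpa only [Dv, Lz_neg_iff, hr] using this

lemma Fr.exists_root (hG : Cnt B) (h : Fr B E E' e f) (hr : Root B E E' e f r)
    (hd : Dv B E E' e f r) {ζ : Fin n → ℤ} (hζ : Lz B E E' e f ζ) (h0 : ζ ≠ 0) :
    ∃ s, Root B E E' e f s ∧ bl B s ζ ≠ 0 := by
  by_contra! H
  obtain ⟨C, c, hc, hC⟩ := hG E E' e f h
  obtain ⟨R, hR⟩ := h.exists_roots hB
  have hR' : ∀ r, r ∈ R ↔ Root B E E' e f r := fun r =>
    (hR r).trans ⟨fun h => ⟨h.1, h.2⟩, fun h => ⟨h.toLz, h.sq⟩⟩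
  have h1 := hC ζ hζ h0 (fun s hs hs0 => absurd (H s hs) hs0) R hR'
  rw [Finset.sum_eq_zero fun s hs => by rw [H s ((hR' s).1 hs)]; rfl, mul_zero] at h1
  have hC0 : C = 0 := by
    have := h.Lz_neg hB hζ h0
    rcases mul_eq_zero.1 h1 with h | h <;> omega
  have h2 := hC r hr.toLz (root_ne hr.sq) (fun s => h.dv_of_dv hB hr hd) R hR'
  have h3 := Finset.single_le_sum (fun s _ => sq_nonneg (bl B s r)) ((hR' r).2 hr)
  simp only [hr.sq] at h3
  rw [hC0] at h2
  nlinarith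

end

end

section

variable {n : ℕ} {B : Matrix (Fin n) (Fin n) ℤ} {E E' e f : Fin n → ℤ} {k : ℕ} {r : ℕ → Fin n → ℤ}

/-- A frame with `k` pairwise orthogonal roots and a root of divisor one. -/
structure Cf (B : Matrix (Fin n) (Fin n) ℤ) (E E' e f : Fin n → ℤ) (k : ℕ)
    (r : ℕ → Fin n → ℤ) : Prop extends Fr B E E' e f where
  lz : ∀ i < k, Lz B E E' e f (r i)
  gram : ∀ i < k, ∀ j < k, bl B (r i) (r j) = if i = j then -2 else 0
  dv : ∃ s, Root B E E' e f s ∧ Dv B E E' e f s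

/-- Half the sum of the roots in `S` belongs to the lattice. -/
def Tet (B : Matrix (Fin n) (Fin n) ℤ) (E E' e f : Fin n → ℤ) (r : ℕ → Fin n → ℤ)
    (S : Finset ℕ) : Prop :=
  ∃ h, Lz B E E' e f h ∧ h + h = ∑ i ∈ S, r i

lemma Cf.root (h : Cf B E E' e f k r) {i : ℕ} (hi : i < k) : Root B E E' e f (r i) :=
  ⟨h.lz i hi, by rw [h.gram i hi i hi, if_pos rfl]⟩

lemma Cf.bl_sum (h : Cf B E E' e f k r) {i : ℕ} (hi : i < k) {T : Finset ℕ}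
    (hT : T ⊆ Finset.range k) (a : ℕ → ℤ) :
    bl B (r i) (∑ j ∈ T, a j • r j) = if i ∈ T then -2 * a i else 0 := by
  rw [bl_sum_right, Finset.sum_congr rfl fun j hj => by
    rw [bl_smul_right, h.gram i hi j (Finset.mem_range.1 (hT hj)), mul_ite, mul_zero],
    Finset.sum_ite_eq, mul_comm]

lemma Cf.sum_sum (h : Cf B E E' e f k r) {S T : Finset ℕ} (hS : S ⊆ Finset.range k)
    (hT : T ⊆ Finset.range k) : bl B (∑ i ∈ S, r i) (∑ j ∈ T, r j) = -2 * (S ∩ T).card := by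
  have := fun i hi => h.bl_sum (i := i) hi hT 1
  simp only [Pi.one_apply, one_smul] at this
  rw [bl_sum_left, Finset.sum_congr rfl fun i hi => this i (Finset.mem_range.1 (hS hi)),
    Finset.sum_ite_mem, Finset.sum_const, nsmul_eq_mul]
  ring

section

variable (hB : Sig B)
include hB

lemma Fr.neighbor (hM : Maxl B) (h : Fr B E E' e f) {l : Fin n → ℤ} (hl : Lz B E E' e f l)
    (h8 : bl B l l = -8) : ∃ e' f', Fr B E E' e' f' ∧ ∃ t : (Fin n → ℤ) → Fin n → ℤ,
      (∀ x y, Lz B E E' e f x → Lz B E E' e f y → (2 : ℤ) ∣ bl B x l → (2 : ℤ) ∣ bl B y l →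
        Lz B E E' e' f' (t x) ∧ bl B (t x) (t y) = bl B x y ∧ t (x + y) = t x + t y) ∧ t 0 = 0 ∧
      ∃ g, Lz B E E' e' f' g ∧ g + g = t l := by
  obtain ⟨-, -, -, -, g5, g6, g7, g8, g9, g10, g11, g12, g13, g14, g15, g16⟩ := h.gz hB
  have el : bl B e l = 0 := by rw [hB.comm, hl.e]
  have fl : bl B f l = 0 := by rw [hB.comm, hl.f]
  set v := f + f + e + e - l with hv
  obtain ⟨d, w, f', hd, hw, h'⟩ := Fr.of_isotropic (v := v) hB hM h.EE h.E'E' h.EE'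
    (fun h0 => by
      have := congrArg (bl B e) h0
      simp [hv, g5, g7, el] at this)
    (by simp [hv, g5, g6, g7, g8, el, fl, hl.e, hl.f, h8]) (by simp [hv, g10, g12, hl.E])
    (by simp [hv, g14, g16, hl.E'])
  obtain ⟨-, -, -, -, w5, w6, w7, w8, w9, w10, w11, w12, w13, w14, w15, w16⟩ := h'.gz hB
  have hz : ∀ z, bl B z v = 0 → bl B z w = 0 := fun z h0 => by
    rw [hw, bl_smul_right] at h0
    simp_all
  have lzp : ∀ z, bl B z E = 0 → bl B z E' = 0 → bl B z v = 0 →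
      Lz B E E' w f' (z - bl B z f' • w) := fun z h1 h2 h3 => by
    constructor <;> simp only [bl_sub_left, bl_smul_left, h1, h2, hz z h3, w5, w7, w10, w14] <;>
      ring
  have hA : ∀ x y, Lz B E E' e f x → Lz B E E' e f y → ∀ a b : ℤ,
      bl B (x + a • e) (y + b • e) = bl B x y := fun x y hx hy a b => by
    simp only [bl_add_left, bl_add_right, bl_smul_left, bl_smul_right, hx.e, g5,
      hB.comm e y, hy.e]; ring
  have hAv : ∀ x, Lz B E E' e f x → (2 : ℤ) ∣ bl B x l → bl B (x + (bl B x l / 2) • e) v = 0 :=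
    fun x hx h2 => by
      simp only [hv, bl_add_left, bl_add_right, bl_smul_left, bl_sub_right, hx.e, hx.f, g5, g7, el]
      omega
  have hI : ∀ x y, bl B x w = 0 → bl B y w = 0 →
      bl B (x - bl B x f' • w) (y - bl B y f' • w) = bl B x y := fun x y hx hy => by
    simp only [bl_sub_left, bl_sub_right, bl_smul_left, bl_smul_right, hx, w5,
      hB.comm w y, hy]; ring
  refine ⟨w, f', h', fun x => (x + (bl B x l / 2) • e) - bl B (x + (bl B x l / 2) • e) f' • w,
    fun x y hx hy x2 y2 => ⟨lzp _ ?_ ?_ (hAv x hx x2), ?_, ?_⟩, by simp,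
    (f - e) - bl B (f - e) f' • w, lzp _ ?_ ?_ ?_, ?_⟩
  · rw [bl_add_left, bl_smul_left, hx.E, g10]; ring
  · rw [bl_add_left, bl_smul_left, hx.E', g14]; ring
  · exact (hI _ _ (hz _ (hAv x hx x2)) (hz _ (hAv y hy y2))).trans (hA x y hx hy _ _)
  · have : x + y + (bl B (x + y) l / 2) • e = (x + (bl B x l / 2) • e) + (y + (bl B y l / 2) • e) := by
      rw [bl_add_left, Int.add_ediv_of_dvd_left x2, add_smul]; abel
    simp only [this]
    rw [bl_add_left, add_smul]; abel
  · rw [bl_sub_left, g10, g12, sub_zero]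
  · rw [bl_sub_left, g14, g16, sub_zero]
  · simp [hv, g5, g6, g7, g8, el, fl]
  · have h4 : l + (bl B l l / 2) • e = (f - e) + (f - e) - d • w := by
      rw [← hw, hv, h8]
      ring
    have h5 : bl B (f - e + (f - e) - d • w) f' = bl B (f - e) f' + bl B (f - e) f' - d := by
      rw [bl_sub_left, bl_add_left, bl_smul_left, w7, mul_one]
    simp only [h4, h5, sub_smul, add_smul]
    abel

lemma Cf.step (hM : Maxl B) (h : Cf B E E' e f k r) {S : Finset ℕ} (hS : S ⊆ Finset.range k)
    (hc : S.card = 4) : ∃ e' f' r', Cf B E E' e' f' k r' ∧ Tet B E E' e' f' r' S ∧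
      ∀ T ⊆ Finset.range k, Even (S ∩ T).card → Tet B E E' e f r T → Tet B E E' e' f' r' T := by
  have hL : Lz B E E' e f (∑ i ∈ S, r i) := Lz.sum fun i hi => h.lz i (Finset.mem_range.1 (hS hi))
  obtain ⟨e', f', h', t, ht, ht0, g, hg, hgg⟩ := h.toFr.neighbor hB hM hL
    (by rw [h.sum_sum hS hS, Finset.inter_self, hc]; rfl)
  have hr2 : ∀ i < k, (2 : ℤ) ∣ bl B (r i) (∑ i ∈ S, r i) := fun i hi => by
    have := h.bl_sum hi hS 1
    simp only [Pi.one_apply, one_smul] at this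
    omega
  have hsum : ∀ T ⊆ Finset.range k, (2 : ℤ) ∣ bl B (∑ i ∈ T, r i) (∑ i ∈ S, r i) ∧
      t (∑ i ∈ T, r i) = ∑ i ∈ T, t (r i) := fun T hT => by
    induction T using Finset.induction_on with
    | empty => simpa
    | insert a T ha ih =>
      obtain ⟨i1, i2⟩ := ih ((Finset.subset_insert a T).trans hT)
      have hak : a < k := Finset.mem_range.1 (hT (Finset.mem_insert_self a T))
      rw [Finset.sum_insert ha, Finset.sum_insert ha, ← i2, bl_add_left]
      exact ⟨dvd_add (hr2 a hak) i1, (ht _ _ (h.lz a hak) (Lz.sum fun i hi => h.lz i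
        (Finset.mem_range.1 (hT (Finset.mem_insert_of_mem hi)))) (hr2 a hak) i1).2.2⟩
  obtain ⟨a, ha⟩ : S.Nonempty := Finset.card_pos.1 (by omega)
  have hak := Finset.mem_range.1 (hS ha)
  have hlz : ∀ i < k, Lz B E E' e' f' (t (r i)) := fun i hi =>
    (ht _ _ (h.lz i hi) (h.lz i hi) (hr2 i hi) (hr2 i hi)).1
  have hgr : ∀ i < k, ∀ j < k, bl B (t (r i)) (t (r j)) = if i = j then -2 else 0 :=
    fun i hi j hj => by
      rw [(ht _ _ (h.lz i hi) (h.lz j hj) (hr2 i hi) (hr2 j hj)).2.1, h.gram i hi j hj]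
  refine ⟨e', f', fun i => t (r i), ⟨h', hlz, hgr, t (r a), ⟨hlz a hak, by simp_all⟩,
    -g, hg.neg, ?_⟩, ⟨g, hg, by simp_all⟩, ?_⟩
  · have h1 := (ht _ _ (h.lz a hak) hL (hr2 a hak) (hsum S hS).1).2.1
    have h2 := h.bl_sum hak hS 1
    simp only [Pi.one_apply, one_smul, if_pos ha, mul_one] at h2
    rw [h2, ← hgg, bl_add_right] at h1
    rw [bl_neg_right]; omega
  · rintro T hT ⟨c, hc⟩ ⟨y, hy, hyy⟩
    have h1 := h.sum_sum hT hS
    rw [← hyy, bl_add_left, Finset.inter_comm, hc] at h1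
    have y2 : (2 : ℤ) ∣ bl B y (∑ i ∈ S, r i) := by omega
    have := ht y y hy hy y2 y2
    exact ⟨t y, this.1, by simp_all⟩

end

/-- Half a combination of the roots belongs to the lattice. -/
def Half (B : Matrix (Fin n) (Fin n) ℤ) (E E' e f : Fin n → ℤ) (k : ℕ) (r : ℕ → Fin n → ℤ)
    (c : ℕ → ℤ) : Prop :=
  ∃ y, Lz B E E' e f y ∧ y + y = ∑ i ∈ Finset.range k, c i • r i

lemma Cf.half_even (h : Cf B E E' e f k r) {c : ℕ → ℤ} (hc : ∀ i < k, (2 : ℤ) ∣ c i) :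
    Half B E E' e f k r c := by
  refine ⟨∑ i ∈ Finset.range k, (c i / 2) • r i,
    Lz.sum fun i hi => (h.lz i (Finset.mem_range.1 hi)).smul _, ?_⟩
  rw [← Finset.sum_add_distrib]
  refine Finset.sum_congr rfl fun i hi => ?_
  rw [← add_smul]
  congr 1
  grind

lemma Tet.half {S : Finset ℕ} (hS : S ⊆ Finset.range k) (hT : Tet B E E' e f r S) (m : ℤ)
    {c : ℕ → ℤ} (h : Half B E E' e f k r fun i => c i - if i ∈ S then m else 0) :
    Half B E E' e f k r c := by
  obtain ⟨y, hy, hyy⟩ := h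
  obtain ⟨z, hz, hzz⟩ := hT
  refine ⟨y + m • z, hy.add (hz.smul m), ?_⟩
  have e1 : y + m • z + (y + m • z) = y + y + m • (z + z) := by rw [smul_add]; abel
  rw [e1, hyy, hzz, Finset.smul_sum, ← Finset.inter_eq_right.2 hS, ← Finset.sum_ite_mem,
    ← Finset.sum_add_distrib]
  refine Finset.sum_congr rfl fun i _ => ?_
  by_cases hi : i ∈ S <;>
    simp only [Finset.inter_eq_right.2 hS, hi, if_true, if_false, sub_smul, sub_add_cancel,
      sub_zero, add_zero]

lemma Tet.even {S : Finset ℕ} (hT : Tet B E E' e f r S) (s : Fin n → ℤ) :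
    (2 : ℤ) ∣ ∑ i ∈ S, bl B s (r i) := by
  obtain ⟨z, hz, hzz⟩ := hT
  rw [← bl_sum_right, ← hzz, bl_add_right]
  omega

lemma Tet.congr {S : Finset ℕ} (hT : Tet B E E' e f r S) {r' : ℕ → Fin n → ℤ}
    (h : ∀ i ∈ S, r' i = r i) : Tet B E E' e f r' S := by
  obtain ⟨z, hz, hzz⟩ := hT
  exact ⟨z, hz, hzz.trans (Finset.sum_congr rfl fun i hi => (h i hi).symm)⟩

section

variable (hB : Sig B)
include hB

omit hB in
lemma Cf.dbl_perp (h : Cf B E E' e f k r) (s : Fin n → ℤ) {j : ℕ} (hj : j < k) :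
    bl B (r j) (s + s + ∑ i ∈ Finset.range k, bl B s (r i) • r i) =
      2 * bl B (r j) s - 2 * bl B s (r j) := by
  rw [bl_add_right, bl_add_right, h.bl_sum hj subset_rfl, if_pos (Finset.mem_range.2 hj)]; ring

lemma Cf.dbl_sq (h : Cf B E E' e f k r) {s : Fin n → ℤ} (hs : Root B E E' e f s) :
    bl B (s + s + ∑ i ∈ Finset.range k, bl B s (r i) • r i)
      (s + s + ∑ i ∈ Finset.range k, bl B s (r i) • r i) =
      -8 + 2 * ∑ i ∈ Finset.range k, bl B s (r i) ^ 2 := by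
  have h1 : bl B s (∑ i ∈ Finset.range k, bl B s (r i) • r i) =
      ∑ i ∈ Finset.range k, bl B s (r i) ^ 2 := by
    rw [bl_sum_right]
    exact Finset.sum_congr rfl fun i _ => by rw [bl_smul_right, sq]
  have h2 : bl B (∑ i ∈ Finset.range k, bl B s (r i) • r i)
      (s + s + ∑ i ∈ Finset.range k, bl B s (r i) • r i) = 0 := by
    rw [bl_sum_left]
    exact Finset.sum_eq_zero fun j hj => by
      rw [bl_smul_left, h.dbl_perp s (Finset.mem_range.1 hj), hB.comm, sub_self, mul_zero]
  rw [bl_add_left, h2]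
  simp only [bl_add_left, bl_add_right, h1, hs.sq]; ring

lemma Cf.weight (h : Cf B E E' e f k r)
    (hno : ∀ s, Root B E E' e f s → ∃ i < k, bl B s (r i) ≠ 0) {s : Fin n → ℤ}
    (hs : Root B E E' e f s) : ∑ i ∈ Finset.range k, bl B s (r i) ^ 2 ≤ 4 ∧
      ∑ i ∈ Finset.range k, bl B s (r i) ^ 2 ≠ 3 := by
  have hL : Lz B E E' e f (s + s + ∑ i ∈ Finset.range k, bl B s (r i) • r i) :=
    (hs.toLz.add hs.toLz).add (Lz.sum fun i hi => (h.lz i (Finset.mem_range.1 hi)).smul _)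
  have h1 := h.dbl_sq hB hs
  constructor
  · rcases eq_or_ne (s + s + ∑ i ∈ Finset.range k, bl B s (r i) • r i) 0 with h0 | h0
    · rw [h0, bl_zero_left] at h1; omega
    · have := h.toFr.Lz_neg hB hL h0; omega
  · intro h3
    obtain ⟨i, hi, h0⟩ := hno _ ⟨hL, by omega⟩
    rw [hB.comm, h.dbl_perp s hi, hB.comm, sub_self] at h0
    omega

lemma Cf.proj_eq (h : Cf B E E' e f k r)
    (hno : ∀ s, Root B E E' e f s → ∃ i < k, bl B s (r i) ≠ 0) {s t ζ : Fin n → ℤ}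
    (hs : Root B E E' e f s) (ht : Root B E E' e f t)
    (hst : Half B E E' e f k r fun i => bl B s (r i) - bl B t (r i))
    (hζ : ∀ i < k, bl B ζ (r i) = 0) (h0 : bl B ζ t = 0) : bl B ζ s = 0 := by
  obtain ⟨y, hy, hyy⟩ := hst
  have hS := h.dbl_sq hB hs
  have hT := h.dbl_sq hB ht
  have pS := fun j hj => h.dbl_perp s (j := j) hj
  have pT := fun j hj => h.dbl_perp t (j := j) hj
  have lT : Lz B E E' e f (∑ i ∈ Finset.range k, bl B t (r i) • r i) :=
    Lz.sum fun i hi => (h.lz i (Finset.mem_range.1 hi)).smul _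
  have zS : ∀ x : Fin n → ℤ, bl B ζ (x + x + ∑ i ∈ Finset.range k, bl B x (r i) • r i) =
      2 * bl B ζ x := fun x => by
    rw [bl_add_right, bl_sum_right, Finset.sum_eq_zero fun i hi => by
      rw [bl_smul_right, hζ i (Finset.mem_range.1 hi), mul_zero], bl_add_right]; ring
  have zs := zS s
  have zt := zS t
  set w := s - t + y with hw
  set w' := s + t + y + ∑ i ∈ Finset.range k, bl B t (r i) • r i with hw'
  have e1 : s + s + ∑ i ∈ Finset.range k, bl B s (r i) • r i = w + w' := by
    have : ∑ i ∈ Finset.range k, bl B s (r i) • r i =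
        y + y + ∑ i ∈ Finset.range k, bl B t (r i) • r i := by
      rw [hyy, ← Finset.sum_add_distrib]
      simp only [← add_smul, sub_add_cancel]
    rw [this, hw, hw']; abel
  have e2 : t + t + ∑ i ∈ Finset.range k, bl B t (r i) • r i = w' - w := by ring
  have lw : Lz B E E' e f w := (hs.toLz.sub ht.toLz).add hy
  have lw' : Lz B E E' e f w' := ((hs.toLz.add ht.toLz).add hy).add lT
  clear_value w w'
  simp only [e1, e2] at hS hT pS pT zs zt
  have perp : ∀ j < k, bl B (r j) w = 0 ∧ bl B (r j) w' = 0 := fun j hj => by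
    have a := pS j hj
    have b := pT j hj
    rw [hB.comm _ s, sub_self, bl_add_right] at a
    rw [hB.comm _ t, sub_self, bl_sub_right] at b
    omega
  have low : ∀ x, Lz B E E' e f x → (∀ j < k, bl B (r j) x = 0) → x ≠ 0 → bl B x x ≤ -4 :=
    fun x hx hp hx0 => by
      have a := h.toFr.Lz_neg hB hx hx0
      obtain ⟨m, hm⟩ := hB.even x
      have b : bl B x x ≠ -2 := fun h2 => by
        obtain ⟨i, hi, h0⟩ := hno x ⟨hx, h2⟩
        exact h0 (by rw [hB.comm, hp i hi])
      omega
  rcases eq_or_ne w 0 with rfl | w0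
  · simp only [zero_add, sub_zero] at zs zt; omega
  rcases eq_or_ne w' 0 with rfl | w0'
  · simp only [add_zero, zero_sub, bl_neg_right] at zs zt; omega
  have a := low w lw (fun j hj => (perp j hj).1) w0
  have b := low w' lw' (fun j hj => (perp j hj).2) w0'
  simp only [bl_add_left, bl_add_right, bl_sub_left, bl_sub_right] at hS hT
  obtain ⟨i, hi, hi0⟩ := hno s hs
  have c := Finset.single_le_sum (f := fun i => bl B s (r i) ^ 2) (fun i _ => sq_nonneg _)
    (Finset.mem_range.2 hi)
  have d : 0 ≤ ∑ i ∈ Finset.range k, bl B t (r i) ^ 2 := Finset.sum_nonneg fun i _ => sq_nonneg _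
  have : 0 < bl B s (r i) ^ 2 := by positivity
  omega

lemma Cf.exists_root (hG : Cnt B) (h : Cf B E E' e f k r) {α : Type*} [Fintype α]
    (hk : k + Fintype.card α ≤ 11) (key : (Fin n → ℤ) → α)
    (hkey : (∀ s, Root B E E' e f s → ∃ i < k, bl B s (r i) ≠ 0) →
      ∀ s t, Root B E E' e f s → Root B E E' e f t → key s = key t →
        Half B E E' e f k r fun i => bl B s (r i) - bl B t (r i)) :
    ∃ s, Root B E E' e f s ∧ ∀ i < k, bl B s (r i) = 0 := by
  by_contra! hno
  classical
  have hrep : ∀ a : α, ∃ t, (∃ s, Root B E E' e f s ∧ key s = a) → Root B E E' e f t ∧ key t = a :=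
    fun a => by
      by_cases H : ∃ s, Root B E E' e f s ∧ key s = a
      · grind
      simp_all
  choose t ht using hrep
  let v : Fin 4 ⊕ Fin k ⊕ α → Fin n → ℤ := Sum.elim ![E, E', e, f] (Sum.elim (fun i => r i) t)
  have hcard : Fintype.card (Fin 4 ⊕ Fin k ⊕ α) < n := by
    simp only [Fintype.card_sum, Fintype.card_fin, hB.rk]; omega
  obtain ⟨ζ, h0, hζ⟩ := exists_perp (B := B) hcard (v ∘ (Fintype.equivFin _).symm)
  have hζ' : ∀ x, bl B ζ (v x) = 0 := fun x => by simpa using hζ (Fintype.equivFin _ x)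
  have hL : Lz B E E' e f ζ :=
    ⟨hζ' (.inl 0), hζ' (.inl 1), hζ' (.inl 2), hζ' (.inl 3)⟩
  obtain ⟨s1, hs1, hd1⟩ := h.dv
  obtain ⟨s, hs, hs0⟩ := h.toFr.exists_root hB hG hs1 hd1 hL h0
  obtain ⟨ht1, ht2⟩ := ht (key s) ⟨s, hs, rfl⟩
  rw [hB.comm] at hs0
  exact hs0 (h.proj_eq hB hno hs ht1 (hkey hno s _ hs ht1 ht2.symm)
    (fun i hi => hζ' (.inr (.inl ⟨i, hi⟩))) (hζ' (.inr (.inr (key s)))))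

lemma Cf.snoc (h : Cf B E E' e f k r) {s : Fin n → ℤ} (hs : Root B E E' e f s)
    (h0 : ∀ i < k, bl B s (r i) = 0) : Cf B E E' e f (k + 1) (Function.update r k s) := by
  have key : ∀ i < k + 1, i = k ∨ i < k := fun i hi => by omega
  refine ⟨h.toFr, fun i hi => ?_, fun i hi j hj => ?_, h.dv⟩
  · rcases key i hi with rfl | hi
    · simpa using hs.toLz
    · rw [Function.update_of_ne hi.ne]; exact h.lz i hi
  · rcases key i hi with rfl | hi <;> rcases key j hj with rfl | hj
    · simp [hs.sq]
    · grind
    · rw [Function.update_self, Function.update_of_ne hi.ne, hB.comm, h0 i hi,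
        if_neg hi.ne]
    · rw [Function.update_of_ne hi.ne, Function.update_of_ne hj.ne]
      exact h.gram i hi j hj

lemma Cf.extend (hG : Cnt B) (h : Cf B E E' e f k r) {α : Type*} [Fintype α]
    (hk : k + Fintype.card α ≤ 11) (key : (Fin n → ℤ) → α)
    (hkey : (∀ s, Root B E E' e f s → ∃ i < k, bl B s (r i) ≠ 0) →
      ∀ s t, Root B E E' e f s → Root B E E' e f t → key s = key t →
        Half B E E' e f k r fun i => bl B s (r i) - bl B t (r i)) :
    ∃ r', Cf B E E' e f (k + 1) r' ∧
      ∀ T ⊆ Finset.range k, Tet B E E' e f r T → Tet B E E' e f r' T := by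
  obtain ⟨s, hs, h0⟩ := h.exists_root hB hG hk key hkey
  exact ⟨_, h.snoc hB hs h0, fun T hT h => h.congr fun i hi =>
    Function.update_of_ne (Finset.mem_range.1 (hT hi)).ne _ _⟩

lemma Cf.extend_small (hG : Cnt B) (h : Cf B E E' e f k r) (hk : k ≤ 3) :
    ∃ r', Cf B E E' e f (k + 1) r' := by
  obtain ⟨r', h', -⟩ := h.extend hB hG (α := Fin 3 → ZMod 2) (by simpa)
    (fun s i => (bl B s (r i) : ℤ)) fun _ s t _ _ hst => h.half_even fun i hi =>
      (ZMod.intCast_eq_intCast_iff_dvd_sub _ _ 2).1 (congrFun hst ⟨i, by omega⟩).symm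
  grind

lemma exists_Cf (hM : Maxl B) (hG : Cnt B) : ∃ E E' e f r, Cf B E E' e f 8 r ∧
    Tet B E E' e f r {0, 1, 2, 3} ∧ Tet B E E' e f r {0, 1, 4, 5} ∧
    Tet B E E' e f r {0, 2, 4, 6} ∧ Tet B E E' e f r {0, 1, 6, 7} := by
  have z2 : ∀ {a b : ℤ}, (a : ZMod 2) = b → (2 : ℤ) ∣ b - a :=
    (ZMod.intCast_eq_intCast_iff_dvd_sub _ _ 2).1
  obtain ⟨E, E', e, f, h, x, y, hx, hy, hxx, hxy⟩ := exists_Fr_root hB hM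
  have h : Cf B E E' e f 0 0 := ⟨h, by simp, by simp, x, ⟨hx, hxx⟩, y, hy, hxy⟩
  obtain ⟨r, h⟩ := h.extend_small hB hG (by omega)
  obtain ⟨r, h⟩ := h.extend_small hB hG (by omega)
  obtain ⟨r, h⟩ := h.extend_small hB hG (by omega)
  obtain ⟨r, h⟩ := h.extend_small hB hG (by omega)
  obtain ⟨e, f, r, h, t1, -⟩ := h.step hB hM (S := {0, 1, 2, 3}) (by decide) rfl
  obtain ⟨r, h, ht⟩ := h.extend hB hG (α := ZMod 2 × ZMod 2) (by simp)
    (fun s => ((bl B s (r 0) + bl B s (r 1) : ℤ), (bl B s (r 0) + bl B s (r 2) : ℤ)))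
    fun _ s t _ _ hst => by
      obtain ⟨k1, k2⟩ := Prod.mk.injEq .. ▸ hst
      have := z2 k1
      have := z2 k2
      have a := t1.even s
      have b := t1.even t
      simp at a b
      refine t1.half (by decide) (bl B s (r 0) - bl B t (r 0)) (h.half_even fun i hi => ?_)
      interval_cases i <;> simp <;> omega
  replace t1 := ht _ (by decide) t1
  obtain ⟨r, h, ht⟩ := h.extend hB hG (α := Option (ZMod 2 × ZMod 2)) (by simp)
    (fun s => if (2 : ℤ) ∣ bl B s (r 4) then
      some ((bl B s (r 0) + bl B s (r 1) : ℤ), (bl B s (r 0) + bl B s (r 2) : ℤ)) else none)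
    fun hno s t hs ht hst => by
      have ev : ∀ s, Root B E E' e f s → ¬ (2 : ℤ) ∣ bl B s (r 4) → (2 : ℤ) ∣ bl B s (r 0) ∧
          (2 : ℤ) ∣ bl B s (r 1) ∧ (2 : ℤ) ∣ bl B s (r 2) ∧ (2 : ℤ) ∣ bl B s (r 3) :=
        fun s hs h4 => by
          have sq : ∀ a : ℤ, 0 ≤ a ^ 2 ∧ (2 : ℤ) ∣ a ^ 2 - a := fun a => ⟨sq_nonneg a, by
            simp_all⟩
          have a := t1.even s
          have w := h.weight hB hno hs
          simp [Finset.sum_range_succ] at a w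
          have := sq (bl B s (r 0))
          have := sq (bl B s (r 1))
          have := sq (bl B s (r 2))
          have := sq (bl B s (r 3))
          have := sq (bl B s (r 4))
          omega
      by_cases s4 : (2 : ℤ) ∣ bl B s (r 4) <;> by_cases t4 : (2 : ℤ) ∣ bl B t (r 4) <;>
        simp only [s4, t4, if_true, if_false, reduceCtorEq, Option.some.injEq] at hst
      · obtain ⟨k1, k2⟩ := Prod.mk.injEq .. ▸ hst
        have := z2 k1
        have := z2 k2
        have a := t1.even s
        have b := t1.even t
        simp at a b
        refine t1.half (by decide) (bl B s (r 0) - bl B t (r 0)) (h.half_even fun i hi => ?_)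
        interval_cases i <;> simp <;> omega
      · have a := ev s hs s4
        have b := ev t ht t4
        exact h.half_even fun i hi => by interval_cases i <;> omega
  replace t1 := ht _ (by decide) t1
  obtain ⟨e, f, r, h, t2, ht⟩ := h.step hB hM (S := {0, 1, 4, 5}) (by decide) rfl
  replace t1 := ht _ (by decide) (by decide) t1
  obtain ⟨r, h, ht⟩ := h.extend hB hG (α := ZMod 2 × ZMod 2) (by simp)
    (fun s => ((bl B s (r 0) + bl B s (r 1) : ℤ),
      (bl B s (r 0) + bl B s (r 2) + bl B s (r 4) : ℤ)))
    fun _ s t _ _ hst => by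
      obtain ⟨k1, k2⟩ := Prod.mk.injEq .. ▸ hst
      have := z2 k1
      have := z2 k2
      have a := t1.even s
      have b := t1.even t
      have c := t2.even s
      have d := t2.even t
      simp at a b c d
      refine t1.half (by decide) (bl B s (r 3) - bl B t (r 3)) <|
        t2.half (by decide) (bl B s (r 5) - bl B t (r 5)) (h.half_even fun i hi => ?_)
      interval_cases i <;> simp <;> omega
  replace t1 := ht _ (by decide) t1
  replace t2 := ht _ (by decide) t2
  obtain ⟨e, f, r, h, t3, ht⟩ := h.step hB hM (S := {0, 2, 4, 6}) (by decide) rfl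
  replace t1 := ht _ (by decide) (by decide) t1
  replace t2 := ht _ (by decide) (by decide) t2
  obtain ⟨r, h, ht⟩ := h.extend hB hG (α := ZMod 2) (by simp)
    (fun s => (bl B s (r 0) + bl B s (r 1) + bl B s (r 2) + bl B s (r 3) + bl B s (r 4) +
      bl B s (r 5) + bl B s (r 6) : ℤ))
    fun _ s t _ _ hst => by
      have := z2 hst
      have a := t1.even s
      have b := t1.even t
      have c := t2.even s
      have d := t2.even t
      have i := t3.even s
      have j := t3.even t
      simp at a b c d i j
      refine t1.half (by decide) (bl B s (r 3) - bl B t (r 3)) <|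
        t2.half (by decide) (bl B s (r 5) - bl B t (r 5)) <|
        t3.half (by decide) (bl B s (r 6) - bl B t (r 6)) (h.half_even fun i hi => ?_)
      interval_cases i <;> simp <;> omega
  replace t1 := ht _ (by decide) t1
  replace t2 := ht _ (by decide) t2
  replace t3 := ht _ (by decide) t3
  obtain ⟨e, f, r, h, t4, ht⟩ := h.step hB hM (S := {0, 1, 6, 7}) (by decide) rfl
  exact ⟨E, E', e, f, r, h, ht _ (by decide) (by decide) t1, ht _ (by decide) (by decide) t2,
    ht _ (by decide) (by decide) t3, t4⟩

lemma Cf.mul_eq_zero (h : Cf B E E' e f k r) {s x : Fin n → ℤ} (hs : Root B E E' e f s)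
    (hh : Half B E E' e f k r fun i => bl B s (r i)) (h0 : ∃ i < k, bl B s (r i) ≠ 0)
    (hx : ∀ i < k, bl B x (r i) = 0) : bl B s x = 0 := by
  obtain ⟨y, hy, hyy⟩ := hh
  obtain ⟨i, hi, hi0⟩ := h0
  have h1 := h.dbl_sq hB hs
  have c := Finset.single_le_sum (f := fun i => bl B s (r i) ^ 2) (fun i _ => sq_nonneg _)
    (Finset.mem_range.2 hi)
  have : 0 < bl B s (r i) ^ 2 := by positivity
  have hxy : bl B x (y + y) = 0 := by
    rw [hyy, bl_sum_right]
    exact Finset.sum_eq_zero fun i hi => by rw [bl_smul_right, hx i (Finset.mem_range.1 hi), mul_zero]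
  rw [← hyy, show s + s + (y + y) = (s + y) + (s + y) by abel] at h1
  have hsy : s + y = 0 := by
    by_contra h0
    have := h.toFr.Lz_neg hB (hs.toLz.add hy) h0
    obtain ⟨m, hm⟩ := hB.even (s + y)
    generalize s + y = q at *
    simp only [bl_add_left, bl_add_right] at h1
    omega
  rw [bl_add_right] at hxy
  rw [eq_neg_of_add_eq_zero_left hsy, bl_neg_left, hB.comm]
  omega

omit hB in
lemma Cf.tet_root (h : Cf B E E' e f k r) {S : Finset ℕ} (hS : S ⊆ Finset.range k)
    (hc : S.card = 4) {z : Fin n → ℤ} (hz : Lz B E E' e f z) (hzz : z + z = ∑ i ∈ S, r i)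
    {A : Finset ℕ} (hA : A ⊆ S) : Root B E E' e f (z - ∑ i ∈ A, r i) ∧ ∀ i < k,
      bl B (r i) (z - ∑ i ∈ A, r i) = if i ∈ S then if i ∈ A then 1 else -1 else 0 := by
  have hAk := hA.trans hS
  refine ⟨⟨hz.sub (Lz.sum fun i hi => h.lz i (Finset.mem_range.1 (hAk hi))), ?_⟩, fun i hi => ?_⟩
  · have h1 := h.sum_sum hS hS
    have h2 := h.sum_sum hS hAk
    have h3 := h.sum_sum hAk hS
    have h4 := h.sum_sum hAk hAk
    simp only [Finset.inter_self, Finset.inter_eq_right.2 hA, Finset.inter_eq_left.2 hA, hc,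
      ← hzz, bl_add_left, bl_add_right] at h1 h2 h3 h4
    push_cast at h1
    simp only [bl_sub_left, bl_sub_right]
    omega
  · have h1 := h.bl_sum hi hS 1
    have h2 := h.bl_sum hi hAk 1
    simp only [Pi.one_apply, one_smul, ← hzz, bl_add_right, mul_one] at h1 h2
    rw [bl_sub_right]
    by_cases iA : i ∈ A
    · simp only [iA, hA iA, if_true] at h1 h2 ⊢; omega
    · by_cases iS : i ∈ S <;> (simp_all; try omega)

omit hB in
lemma Cf.exists_tet_roots (h : Cf B E E' e f k r) {S : Finset ℕ} (hS : S ⊆ Finset.range k)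
    (hc : S.card = 4) (hT : Tet B E E' e f r S) : ∃ U : Finset (Fin n → ℤ), U.card = 16 ∧
      ∀ s ∈ U, Root B E E' e f s ∧ ∀ i < k, bl B (r i) s ^ 2 = if i ∈ S then 1 else 0 := by
  classical
  obtain ⟨z, hz, hzz⟩ := hT
  refine ⟨S.powerset.image fun A => z - ∑ i ∈ A, r i, ?_, fun s hs => ?_⟩
  · rw [Finset.card_image_of_injOn, Finset.card_powerset, hc]
    · rfl
    · intro A hA A' hA' h0
      have hA := Finset.mem_powerset.1 (Finset.mem_coe.1 hA)
      have hA' := Finset.mem_powerset.1 (Finset.mem_coe.1 hA')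
      have key : ∀ i ∈ S, i ∈ A ↔ i ∈ A' := fun i hi => by
        have hik := Finset.mem_range.1 (hS hi)
        have a := (h.tet_root hS hc hz hzz hA).2 i hik
        have b := (h.tet_root hS hc hz hzz hA').2 i hik
        simp only at h0
        rw [h0, b] at a
        by_cases iA : i ∈ A <;> simp_all
      ext i
      exact ⟨fun hi => (key i (hA hi)).1 hi, fun hi => (key i (hA' hi)).2 hi⟩
  · obtain ⟨A, hA, rfl⟩ := Finset.mem_image.1 hs
    obtain ⟨h1, h2⟩ := h.tet_root hS hc hz hzz (Finset.mem_powerset.1 hA)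
    simp_all

lemma Cf.exists_key (h : Cf B E E' e f 8 r) : ∃ d ≤ 4, ∃ key : (Fin n → ℤ) → Fin d → ZMod 2,
    ∀ s t, Lz B E E' e f s → Lz B E E' e f t → (∀ i < 8, bl B s (r i) = 0) →
      (∀ i < 8, bl B t (r i) = 0) → key s = key t → ∃ y, s = t + (y + y) := by
  obtain ⟨g1, g2, g3, g4, g5, g6, g7, g8, g9, g10, g11, g12, g13, g14, g15, g16⟩ := h.toFr.gz hB
  let v : Fin 4 ⊕ Fin 8 → Fin n → ℤ := Sum.elim ![E, E', e, f] fun i => r i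
  let u : Fin 4 ⊕ Fin 8 → Fin n → ℤ := Sum.elim ![E', E, f, e] fun i => r i
  let M : Submodule ℤ (Fin n → ℤ) :=
    { carrier := {x | ∀ i, bl B x (u i) = 0}
      add_mem' := fun {a b} ha hb i => by rw [bl_add_left, ha i, hb i, add_zero]
      zero_mem' := fun i => bl_zero_left ..
      smul_mem' := fun c x hx i => by rw [bl_smul_left, hx i, mul_zero] }
  have hM : ∀ s, Lz B E E' e f s → (∀ i < 8, bl B s (r i) = 0) → s ∈ M := fun s hs hr =>
    Sum.forall.2 ⟨fun i => by fin_cases i <;> [exact hs.E'; exact hs.E; exact hs.f; exact hs.e],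
      fun i => hr i i.2⟩
  have huv : ∀ i j, i ≠ j → bl B (v i) (u j) = 0 := by
    rintro (i | i) (j | j) hij
    · fin_cases i <;> fin_cases j <;> simp [v, u, *] at hij ⊢
    · have := h.lz j j.2
      change bl B (![E, E', e, f] i) (r j) = 0
      rw [hB.comm]
      fin_cases i <;> [exact this.E; exact this.E'; exact this.e; exact this.f]
    · have := h.lz i i.2
      fin_cases j <;> [exact this.E'; exact this.E; exact this.f; exact this.e]
    · exact (h.gram i i.2 j j.2).trans (if_neg fun h => hij (by rw [Fin.ext h]))
  have huv' : ∀ i, bl B (v i) (u i) ≠ 0 := by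
    rintro (i | i)
    · fin_cases i <;> positivity
    · exact (h.gram i i.2 i i.2).trans_ne (by simp)
  have hd : Module.finrank ℤ M ≤ 4 := by
    have hinj : Function.Injective (M.subtype.coprod (Fintype.linearCombination ℤ v)) := by
      rw [← LinearMap.ker_eq_bot, LinearMap.ker_eq_bot']
      rintro ⟨x, c⟩ h0
      have h0 : (x : Fin n → ℤ) + ∑ i, c i • v i = 0 := h0
      have hc : c = 0 := funext fun j => by
        have h1 := congrArg (fun z => bl B z (u j)) h0
        simp only [bl_add_left, x.2 j, bl_sum_left, bl_zero_left, zero_add] at h1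
        rw [Finset.sum_eq_single j (fun i _ hi => by rw [bl_smul_left, huv i j hi, mul_zero])
          (by simp), bl_smul_left] at h1
        exact (_root_.mul_eq_zero.1 h1).resolve_right (huv' j)
      simp_all
    have := LinearMap.finrank_le_finrank_of_injective hinj
    simp [hB.rk] at this
    omega
  classical
  let b := Module.finBasis ℤ M
  refine ⟨_, hd, fun s i => if hs : s ∈ M then ((b.repr ⟨s, hs⟩ i : ℤ) : ZMod 2) else 0,
    fun s t hs ht hs' ht' hst => ?_⟩
  have hsM := hM s hs hs'
  have htM := hM t ht ht'
  have h2 : ∀ i, (2 : ℤ) ∣ b.repr ⟨s, hsM⟩ i - b.repr ⟨t, htM⟩ i := fun i =>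
    (ZMod.intCast_eq_intCast_iff_dvd_sub _ _ 2).1
      (by have := congrFun hst i; simp_all)
  choose m hm using h2
  refine ⟨(∑ i, m i • b i : M), ?_⟩
  have : (⟨s, hsM⟩ : M) = ⟨t, htM⟩ + ((∑ i, m i • b i) + ∑ i, m i • b i) := by
    rw [← sub_eq_iff_eq_add', ← b.sum_repr (_ - _), ← Finset.sum_add_distrib]
    refine Finset.sum_congr rfl fun i _ => ?_
    rw [map_sub, Finsupp.sub_apply, hm, ← add_smul, two_mul]
  exact congrArg Subtype.val this

lemma Cf.sum_le (h : Cf B E E' e f 8 r) {t : Fin n → ℤ} (ht : Root B E E' e f t)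
    (hp : ∀ s, Root B E E' e f s → bl B s t ≠ 0 → ∀ i < 8, bl B s (r i) = 0)
    {R : Finset (Fin n → ℤ)} (hR : ∀ r, r ∈ R ↔ Root B E E' e f r) :
    ∑ s ∈ R, bl B s t ^ 2 ≤ 38 := by
  classical
  obtain ⟨d, hd, key, hkey⟩ := h.exists_key hB
  have hQ : ∀ s ∈ R.filter fun s => bl B s t ≠ 0,
      Root B E E' e f s ∧ ∀ i < 8, bl B s (r i) = 0 := fun s hs => by
    obtain ⟨h1, h2⟩ := Finset.mem_filter.1 hs
    exact ⟨(hR s).1 h1, hp s ((hR s).1 h1) h2⟩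
  have hcard : (R.filter fun s => bl B s t ≠ 0).card ≤ 32 := by
    refine (Finset.card_le_mul_card_image (f := key) _ 2 fun a ha => ?_).trans ?_
    · obtain ⟨s, hs, rfl⟩ := Finset.mem_image.1 ha
      refine (Finset.card_le_card fun x hx => ?_).trans (Finset.card_le_two (a := s) (b := -s))
      obtain ⟨hx, hxs⟩ := Finset.mem_filter.1 hx
      obtain ⟨y, hy⟩ := hkey x s (hQ x hx).1.toLz (hQ s hs).1.toLz (hQ x hx).2 (hQ s hs).2 hxs
      rw [Finset.mem_insert, Finset.mem_singleton]
      obtain ⟨m, hm⟩ := hB.even y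
      have h1 := (hQ x hx).1.sq
      have h2 := (hQ s hs).1.sq
      have h3 : bl B x s = _ := congrArg (bl B · s) hy
      rcases h.toFr.root_pair hB (hQ x hx).1 (hQ s hs).1 with h | h | h
      · exact .inl h
      · exact .inr h
      · rw [hy] at h1
        simp only [bl_add_left, bl_add_right, hB.comm s y] at h1 h3
        omega
    · have h1 : ((R.filter fun s => bl B s t ≠ 0).image key).card ≤ 2 ^ d :=
        (Finset.card_le_univ _).trans (by simp)
      have h2 : 2 ^ d ≤ 2 ^ 4 := Nat.pow_le_pow_right (by norm_num) hd
      omega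
  rw [← Finset.sum_filter_of_ne (p := fun s => bl B s t ≠ 0) fun s _ h0 h1 => h0 (by rw [h1]; rfl)]
  have hle : ∀ s ∈ R.filter fun s => bl B s t ≠ 0,
      bl B s t ^ 2 ≤ 1 + if s ∈ ({t, -t} : Finset _) then 3 else 0 := fun s hs => by
    rcases h.toFr.root_pair hB (hQ s hs).1 ht with rfl | rfl | h | h | h
    · simp [ht.sq]
    · simp [ht.sq]
    all_goals rw [h]; split_ifs <;> norm_num
  refine (Finset.sum_le_sum hle).trans ?_
  rw [Finset.sum_add_distrib, Finset.sum_const, ← Finset.sum_filter, Finset.sum_const]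
  have : ((R.filter fun s => bl B s t ≠ 0).filter fun s => s ∈ ({t, -t} : Finset _)).card ≤ 2 :=
    (Finset.card_le_card fun x hx => (Finset.mem_filter.1 hx).2).trans Finset.card_le_two
  simp only [nsmul_eq_mul]
  omega

lemma Cf.le_sum (h : Cf B E E' e f 8 r) (t1 : Tet B E E' e f r {0, 1, 2, 3})
    (t2 : Tet B E E' e f r {0, 1, 4, 5})
    {R : Finset (Fin n → ℤ)} (hR : ∀ r, r ∈ R ↔ Root B E E' e f r) :
    40 ≤ ∑ s ∈ R, bl B s (r 0) ^ 2 := by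
  classical
  obtain ⟨U, hU, hU'⟩ := h.exists_tet_roots (by decide) rfl t1
  obtain ⟨V, hV, hV'⟩ := h.exists_tet_roots (by decide) rfl t2
  have g0 := h.root (i := 0) (by simp)
  have hUV : Disjoint U V := Finset.disjoint_left.2 fun s h1 h2 => by
    have a := (hU' s h1).2 2 (by simp)
    grind
  have one : ∀ s ∈ U ∪ V, bl B s (r 0) ^ 2 = 1 := fun s hs => by
    rw [hB.comm]
    grind
  have four : ∀ s ∈ ({r 0, -r 0} : Finset _), bl B s (r 0) ^ 2 = 4 := fun s hs => by
    rcases Finset.mem_insert.1 hs with rfl | hs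
    · rw [g0.sq]; rfl
    · rw [Finset.mem_singleton.1 hs, bl_neg_left, g0.sq]; rfl
  have hne : r 0 ≠ -r 0 := fun h0 => by
    have := congrArg (bl B (r 0)) h0
    rw [bl_neg_right, g0.sq] at this
    omega
  have hW : Disjoint (U ∪ V) {r 0, -r 0} := Finset.disjoint_left.2 fun s h1 h2 => by
    have := (one s h1).symm.trans (four s h2)
    omega
  refine le_trans (le_of_eq ?_) (Finset.sum_le_sum_of_subset_of_nonneg
    (s := (U ∪ V) ∪ {r 0, -r 0}) (fun s hs => (hR s).2 ?_) fun _ _ _ => sq_nonneg _)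
  · rw [Finset.sum_union hW, Finset.sum_congr rfl one, Finset.sum_congr rfl four,
      Finset.sum_const, Finset.sum_const, Finset.card_union_of_disjoint hUV, hU, hV,
      Finset.card_pair hne]
    rfl
  · simp only [Finset.mem_union, Finset.mem_insert, Finset.mem_singleton] at hs
    rcases hs with (hs | hs) | rfl | rfl
    · exact (hU' s hs).1
    · exact (hV' s hs).1
    · omega
    · exact ⟨g0.toLz.neg, by simpa using g0.sq⟩

theorem not_cnt (hM : Maxl B) : ¬ Cnt B := by
  intro hG
  obtain ⟨E, E', e, f, r, h, t1, t2, t3, t4⟩ := exists_Cf hB hM hG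
  obtain ⟨R, hR⟩ := h.toFr.exists_roots hB
  replace hR : ∀ r, r ∈ R ↔ Root B E E' e f r := fun r =>
    (hR r).trans ⟨fun h => ⟨h.1, h.2⟩, fun h => ⟨h.toLz, h.sq⟩⟩
  have zero : ∀ s x, Root B E E' e f s → (∀ i < 8, bl B x (r i) = 0) → bl B s x ≠ 0 →
      ∀ i < 8, bl B s (r i) = 0 := fun s x hs hx h0 => by
    by_contra! h1
    refine h0 (h.mul_eq_zero hB hs ?_ h1 hx)
    have a := t1.even s
    have b := t2.even s
    have c := t3.even s
    have d := t4.even s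
    simp at a b c d
    refine t1.half (by decide) (bl B s (r 3)) (t2.half (by decide) (bl B s (r 5))
      (t3.half (by decide) (bl B s (r 2) - bl B s (r 3)) (t4.half (by decide) (bl B s (r 7))
        (h.half_even fun i hi => ?_))))
    interval_cases i <;> simp <;> omega
  obtain ⟨q, hq⟩ := h.toFr.exists_avoid hB hM
  let v : Fin 4 ⊕ Fin 8 ⊕ Fin 3 → Fin n → ℤ :=
    Sum.elim ![E, E', e, f] (Sum.elim (fun i => r i) q)
  obtain ⟨ζ, h0, hζ⟩ := exists_perp (B := B) (m := Fintype.card (Fin 4 ⊕ Fin 8 ⊕ Fin 3))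
    (by simp [hB.rk]) (v ∘ (Fintype.equivFin _).symm)
  have hζ' : ∀ x, bl B ζ (v x) = 0 := fun x => by simpa using hζ (Fintype.equivFin _ x)
  obtain ⟨s1, hs1, hd1⟩ := h.dv
  obtain ⟨s, hs, hs0⟩ := h.toFr.exists_root hB hG hs1 hd1
    (ζ := ζ) ⟨hζ' (.inl 0), hζ' (.inl 1), hζ' (.inl 2), hζ' (.inl 3)⟩ h0
  have hd := hq ζ (fun i => hζ' (.inr (.inr i))) s hs hs0
  have hsr := zero s ζ hs (fun i hi => hζ' (.inr (.inl ⟨i, hi⟩))) hs0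
  have hle := h.sum_le hB hs (fun x hx => zero x s hx hsr) hR
  have hge := h.le_sum hB t1 t2 hR
  obtain ⟨C, c, hc, hC⟩ := hG E E' e f h.toFr
  have g0 := h.root (i := 0) (by simp)
  have hd0 : Dv B E E' e f (r 0) := by
    obtain ⟨z, hz, hzz⟩ := t1
    have := h.bl_sum (i := 0) (by simp) (T := {0, 1, 2, 3}) (by decide) 1
    simp only [Pi.one_apply, one_smul, ← hzz, bl_add_right] at this
    refine ⟨-z, hz.neg, ?_⟩
    rw [bl_neg_right]
    simp at this
    omega
  have i1 := hC s hs.toLz (root_ne hs.sq) (fun x => h.toFr.dv_of_dv hB hs hd) R hR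
  have i2 := hC (r 0) g0.toLz (root_ne g0.sq) (fun x => h.toFr.dv_of_dv hB g0 hd0) R hR
  rw [hs.sq] at i1
  rw [g0.sq] at i2
  nlinarith

end

end

/-- There is no 2-reflective even lattice of signature (2,14). -/
theorem no_two_reflective_signature_2_14 {N : ℕ} (B : Matrix (Fin N) (Fin N) ℤ)
    (hB : IsEvenLatticeOfSignature B 2 14) : ¬ Is2Reflective B := by
  intro h
  obtain ⟨B', D, k, Q, hB', hM, hD, hQ, hf, hne⟩ := exists_MF (sig_of_isEven hB) h
  obtain ⟨E, E', e, f, hF, -⟩ := exists_Fr_root hB' hM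
  have hk : k ≠ 0 := by
    rcases hF.datum hB' hD with h | h
    · exact h.weight_ne_zero hB' hD hQ hf hne
    · exact h.weight_ne_zero hB' hD hQ hf hne
  obtain ⟨m, P, hm, hP, hinv⟩ := hQ.norm hB' hD hf
  exact not_cnt hB' hM (Rm.cnt hB' hM hD ⟨⟨hP.supp, hP.hol, hP.hom, hinv⟩, hP.zeros⟩
    (mul_ne_zero (Nat.cast_ne_zero.2 hm) hk))

end Refl
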